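/- Let c be a rational number with c ∉ {−5, −5/2, −155/72, −2, −5/4, 0, 19/16}. If c ∈ Im η and c ∉ Im ρ, then the fourth dynatomic polynomial Φ_{4,c} factors in ℚ[x] as a product of two irreducible polynomials of degrees 8 and 4, and its Galois group G_c is isomorphic to the group ℋ. -/

import Mathlib

open Polynomial

/-- The fourth dynatomic polynomial of `x^2 + c`. -/
noncomputable def Phi4 {K : Type*} [Field K] (c : K) : K[X] :=
  X ^ 12 + C (6 * c) * X ^ 10 + X ^ 9 + C (15 * c ^ 2 + 3 * c) * X ^ 8 +
    C (4 * c) * X ^ 7 + C (20 * c ^ 3 + 12 * c ^ 2 + 1) * X ^ 6 +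
    C (6 * c ^ 2 + 2 * c) * X ^ 5 +
    C (15 * c ^ 4 + 18 * c ^ 3 + 3 * c ^ 2 + 4 * c) * X ^ 4 +
    C (4 * c ^ 3 + 4 * c ^ 2 + 1) * X ^ 3 +
    C (6 * c ^ 5 + 12 * c ^ 4 + 6 * c ^ 3 + 5 * c ^ 2 + c) * X ^ 2 +
    C (c ^ 4 + 2 * c ^ 3 + c ^ 2 + 2 * c) * X +
    C (c ^ 6 + 3 * c ^ 5 + 3 * c ^ 4 + 3 * c ^ 3 + 2 * c ^ 2 + 1)

/-- The group ℋ ⊆ S₁₂, generated by (1,10,4,9,3,12,2,11), (1,9,3,11)(2,10,4,12)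
and (1,11,4,10,3,9,2,12)(5,8,7,6) (here written on {0,…,11}). -/
def Hgroup : Subgroup (Equiv.Perm (Fin 12)) :=
  Subgroup.closure
    {([0, 9, 3, 8, 2, 11, 1, 10] : List (Fin 12)).formPerm,
     ([0, 8, 2, 10] : List (Fin 12)).formPerm * ([1, 9, 3, 11] : List (Fin 12)).formPerm,
     ([0, 10, 3, 9, 2, 8, 1, 11] : List (Fin 12)).formPerm *
       ([4, 7, 6, 5] : List (Fin 12)).formPerm}


/-- reduction of binary quadratic forms -/
lemma qform_red (D : ℤ) (hD : D = -3 ∨ D = 5 ∨ D = -15) :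
    ∀ (n : ℕ) (b t c : ℤ), b ≠ 0 → b.natAbs ≤ n → (2*t+1)^2 - 4*b*c = D →
      ∃ X Y : ℤ, (b*X^2+(2*t+1)*X*Y+c*Y^2).natAbs = 1 ∨
        (D = -15 ∧ (b*X^2+(2*t+1)*X*Y+c*Y^2).natAbs = 2) := by
  intro n
  induction n with
  | zero => intro b t c hb hn; omega
  | succ n ih =>
    intro b t c hb hn h
    -- reduce t mod b
    obtain ⟨s, k, hs, hk⟩ : ∃ s k : ℤ, t = s + b * k ∧ |2*s+1| ≤ |b| := by
      have h1 := Int.emod_nonneg t hb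
      have h2 := Int.emod_lt_abs t hb
      have h3 := Int.emod_add_mul_ediv t b
      by_cases h4 : 2 * (t % b) + 1 ≤ |b|
      · exact ⟨t % b, t / b, by linarith, by rw [abs_of_nonneg (by linarith)]; exact h4⟩
      · rcases lt_or_gt_of_ne hb with hb' | hb'
        · refine ⟨t % b + b, t / b - 1, by linarith, ?_⟩
          rw [abs_of_neg hb'] at *
          rw [abs_le]; constructor <;> linarith
        · refine ⟨t % b - b, t / b + 1, by linarith, ?_⟩
          rw [abs_of_pos hb'] at *
          rw [abs_le]; constructor <;> linarith
    subst hs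
    set c' := c - (2*s+1)*k - b*k^2 with hc'
    have h' : (2*s+1)^2 - 4*b*c' = D := by rw [hc', ← h]; ring
    have key : ∀ X Y : ℤ, b*(X - k*Y)^2 + (2*(s+b*k)+1)*(X-k*Y)*Y+c*Y^2
        = b*X^2+(2*s+1)*X*Y+c'*Y^2 := by intro X Y; rw [hc']; ring
    by_cases hlt : c'.natAbs < b.natAbs
    · have hc0 : c' ≠ 0 := by
        rintro h0
        rw [h0] at h'
        rcases hD with rfl | rfl | rfl
        · nlinarith
        · have : (2*s+1) < 3 := by nlinarith
          have : -3 < (2*s+1)  := by nlinarith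
          have : s = -1 ∨ s = 0 := by omega
          rcases this with rfl | rfl <;> norm_num at h'
        · nlinarith
      obtain ⟨X, Y, hXY⟩ := ih c' (-s-1) b hc0 (by omega) (by rw [← h']; ring)
      refine ⟨-Y - k * X, X, ?_⟩
      have e : b*(-Y - k*X)^2 + (2*(s+b*k)+1)*(-Y-k*X)*X+c*X^2 = c'*X^2+(2*(-s-1)+1)*X*Y+b*Y^2 := by
        rw [key]; ring
      rw [e]; exact hXY
    · refine ⟨1, 0, ?_⟩
      have e : b*1^2 + (2*(s+b*k)+1)*1*0+c*0^2 = b := by ring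
      rw [e]
      have h5 : |b| ≤ |c'| := by rw [Int.abs_eq_natAbs, Int.abs_eq_natAbs]; omega
      have h6 : (2*s+1)^2 ≤ b^2 := sq_le_sq.mpr hk
      have h7 : b^2 ≤ |b*c'| := by rw [abs_mul, ← sq_abs]; nlinarith [abs_nonneg b]
      have hb2 : |b| ≤ 2 := by
        by_contra hcon
        push Not at hcon
        have : 9 ≤ b^2 := by rw [← sq_abs]; nlinarith
        rcases abs_cases (b*c') with ⟨h8,_⟩ | ⟨h8,_⟩ <;> rcases hD with rfl | rfl | rfl <;> nlinarith
      by_cases hb1 : b.natAbs = 1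
      · left; exact hb1
      · right
        have hb3 : b.natAbs = 2 := by rw [Int.abs_eq_natAbs] at hb2; omega
        refine ⟨?_, hb3⟩
        have : b^2 = 4 := by rw [← sq_abs, Int.abs_eq_natAbs, hb3]; norm_num
        rcases abs_cases (b*c') with ⟨h8,_⟩ | ⟨h8,_⟩ <;> rcases hD with rfl | rfl | rfl <;> nlinarith

open scoped QuadraticAlgebra

abbrev QO (a : ℤ) := QuadraticAlgebra ℤ a 1

lemma cube_core (a : ℤ) (hD : 1+4*a = -3 ∨ 1+4*a = 5 ∨ 1+4*a = -15) (p q b : ℤ) (hb : b ≠ 0)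
    (hN : p^2+p*q-a*q^2 = b^3) (hc : IsCoprime q b) :
    ∃ g k : QO a, g^3 = ⟨p, q⟩ * k ∧ ((k.norm).natAbs = 1 ∨ (1+4*a = -15 ∧ k.norm.natAbs = 8)) := by
  obtain ⟨s, w, hs⟩ := hc
  -- s q + w b = 1
  set t := p * s with ht
  obtain ⟨c, hcc⟩ : b ∣ t^2+t-a := by
    have : t^2+t-a = s^2 * b^3 + (t-a * (1+s*q))*(1 - s*q) := by rw [← hN, ht]; ring
    rw [this, ← hs]
    exact ⟨s^2*b^2 + (t-a * (s*q+w*b+s*q))*w, by ring⟩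
  obtain ⟨X, Y, hXY⟩ := qform_red (1+4*a) hD _ b t c hb le_rfl (by linear_combination (4)*hcc)
  set f := b*X^2+(2*t+1)*X*Y+c*Y^2 with hf
  set g : QO a := ⟨b*X+t*Y, Y⟩ with hg
  set d : QO a := ⟨p, q⟩ with hd
  have hNg : g.norm = b * f := by
    rw [QuadraticAlgebra.norm_def, hf, hg]; simp only; linear_combination Y^2*hcc
  have hNd : d.norm = b^3 := by
    rw [QuadraticAlgebra.norm_def, hd]; simp only; linear_combination hN
  have hdd : d * star d = ((b^3 : ℤ) : QO a) := by
    rw [← hNd]; simp [QuadraticAlgebra.ext_iff, QuadraticAlgebra.norm_def, hd]; constructor <;> ring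
  have hdb : d ∣ ((b^3 : ℤ) : QO a) := ⟨star d, hdd.symm⟩
  -- q g = Y d + b z
  have hqg : (q : QO a) * g = (Y : QO a) * d + (b : QO a) * ((q*X - w*p*Y : ℤ) : QO a) := by
    simp [QuadraticAlgebra.ext_iff, hg, hd]
    constructor
    · rw [ht]; linear_combination p*Y*hs
    · ring
  have h1 : d ∣ (q : QO a)^3 * g^3 := by
    rw [← mul_pow, hqg]
    set z : QO a := ((q*X - w*p*Y : ℤ) : QO a)
    have : ((Y : QO a) * d + b * z)^3 = d * (Y^3*d^2 + 3 * Y^2*d*b*z+3*Y*b^2*z^2) + (b^3) * z^3 := by ring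
    rw [this]
    apply dvd_add (Dvd.intro _ rfl)
    push_cast at hdb
    exact Dvd.dvd.mul_right hdb _
  have h2 : d ∣ (b : QO a)^3 * g^3 := by push_cast at hdb; exact Dvd.dvd.mul_right hdb _
  have hcop : IsCoprime ((q : QO a)^3) ((b : QO a)^3) := by
    apply IsCoprime.pow
    exact ⟨s, w, by exact_mod_cast congrArg (fun z : ℤ => (z : QO a)) hs⟩
  have h3 : d ∣ g^3 := by
    obtain ⟨u, v, huv⟩ := hcop
    have : g^3 = u * (q^3 * g^3) + v * (b^3*g^3) := by linear_combination (-g^3) * huv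
    rw [this]
    exact dvd_add (h1.mul_left _) (h2.mul_left _)
  obtain ⟨k, hk⟩ := h3
  refine ⟨g, k, hk, ?_⟩
  have hn : k.norm = f^3 := by
    have := congrArg QuadraticAlgebra.norm hk
    rw [map_pow, map_mul, hNg, hNd] at this
    have hb3 : b^3 ≠ 0 := pow_ne_zero _ hb
    apply mul_left_cancel₀ hb3
    rw [← this]; ring
  rw [hn, Int.natAbs_pow]
  rcases hXY with h | ⟨h, h'⟩
  · left; rw [h]
  · right; rw [h']; exact ⟨h, rfl⟩

lemma QO_cube (a x y : ℤ) : (⟨x, y⟩ : QO a)^3 =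
    ⟨x^3+3*a*x*y^2+a*y^3, 3*x^2*y+3*x*y^2+(a+1)*y^3⟩ := by
  simp [QuadraticAlgebra.ext_iff, pow_succ]; constructor <;> ring

lemma QO_mul_star (a : ℤ) (k : QO a) : k * star k = ((k.norm : ℤ) : QO a) := by
  simp [QuadraticAlgebra.ext_iff, QuadraticAlgebra.norm_def]; constructor <;> ring

/-- δ is a unit times a cube -/
lemma cube_unit (a : ℤ) (hD : 1+4*a = -3 ∨ 1+4*a = 5 ∨ 1+4*a = -15) (p q b : ℤ) (hb : b ≠ 0)
    (hN : p^2+p*q-a*q^2 = b^3) (hc : IsCoprime q b) :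
    ∃ g k : QO a, ⟨p, q⟩ = k * g^3 ∧ k.norm.natAbs = 1 := by
  obtain ⟨g, k, hgk, hk⟩ := cube_core a hD p q b hb hN hc
  have hk1 : k.norm.natAbs = 1 := by
    rcases hk with h | ⟨h, h'⟩
    · exact h
    · exfalso
      have ha : a = -4 := by omega
      subst ha
      have h0 : 0 ≤ k.norm := by
        rw [QuadraticAlgebra.norm_def]; nlinarith [sq_nonneg (2*k.re+k.im), sq_nonneg k.im]
      have h8 : k.norm = 8 := by omega
      rw [QuadraticAlgebra.norm_def] at h8
      have h9 : (2*k.re+k.im)^2 + 15 * k.im^2 = 32 := by linarith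
      have h10 : k.im < 2 := by nlinarith
      have h11 : -2 < k.im := by nlinarith
      have h12 : 2*k.re+k.im < 6 := by nlinarith
      have h13 : -6 < 2*k.re+k.im := by nlinarith
      generalize 2*k.re+k.im = u at *
      generalize k.im = v at *
      interval_cases v <;> interval_cases u <;> omega
  have hs := QO_mul_star a k
  refine ⟨g, (k.norm : QO a) * star k, ?_, ?_⟩
  · rw [hgk]
    rcases Int.natAbs_eq k.norm with h | h <;> rw [hk1] at h <;> rw [h] at hs ⊢ <;> push_cast at hs ⊢
    · linear_combination (-⟨p, q⟩) * hs
    · linear_combination (⟨p, q⟩) * hs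
  · rw [map_mul, QuadraticAlgebra.norm_intCast, QuadraticAlgebra.norm_star, Int.natAbs_mul, Int.natAbs_pow, Int.cast_id, hk1]

lemma cube15 (P Q b : ℤ) (hb : b ≠ 0) (h : P^2+15*Q^2 = 4*b^3) (hc : IsCoprime Q b) :
    ∃ A B : ℤ, 4*P = A^3-45*A*B^2 ∧ 4*Q = 3*A^2*B-15*B^3 ∧ A^2+15*B^2 = 4*b ∧ 2 ∣ A - B := by
  obtain ⟨p, hp⟩ : ∃ p, P = 2*p+Q := by
    have h2 : (P - Q) % 2 = 0 := by
      have : (P^2+15*Q^2) % 2 = 0 := by rw [h]; omega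
      rcases Int.emod_two_eq_zero_or_one P with h1 | h1 <;> rcases Int.emod_two_eq_zero_or_one Q with h2 | h2 <;>
        simp [pow_two, Int.add_emod, Int.mul_emod, Int.sub_emod, h1, h2] at this ⊢
    exact ⟨(P-Q)/2, by omega⟩
  subst hp
  obtain ⟨g, k, hgk, hk⟩ := cube_unit (-4) (by norm_num) p Q b hb (by linarith) hc
  have h0 : k = 1 ∨ k = -1 := by
    have h0 : 0 ≤ k.norm := by
        rw [QuadraticAlgebra.norm_def]; nlinarith [sq_nonneg (2*k.re+k.im), sq_nonneg k.im]
    have h8 : k.norm = 1 := by omega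
    rw [QuadraticAlgebra.norm_def] at h8
    have h10 : k.im = 0 := by
      have h10 : k.im < 1 := by nlinarith [sq_nonneg (2*k.re+k.im)]
      have h11 : -1 < k.im := by nlinarith [sq_nonneg (2*k.re+k.im)]
      omega
    rw [h10] at h8
    have : k.re = 1 ∨ k.re = -1 := by
      rw [← mul_self_eq_one_iff]; linarith
    rcases this with h | h
    · left; ext <;> simp [h, h10]
    · right; ext <;> simp [h, h10]
  obtain ⟨g, hg⟩ : ∃ g : QO (-4), ⟨p, Q⟩ = g^3 := by
    rcases h0 with rfl | rfl
    · exact ⟨g, by rw [hgk]; ring⟩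
    · exact ⟨-g, by rw [hgk]; ring⟩
  obtain ⟨x, y⟩ := g
  have hn := congrArg QuadraticAlgebra.norm hg
  rw [QO_cube, QuadraticAlgebra.mk.injEq] at hg
  rw [map_pow, QuadraticAlgebra.norm_def, QuadraticAlgebra.norm_def] at hn
  simp only at hn
  have hn2 : (x^2+x*y+4*y^2)^3 = b^3 := by linarith
  have hn3 : x^2+x*y+4*y^2 = b := by
    have : Odd 3 := by decide
    exact this.strictMono_pow.injective hn2
  refine ⟨2*x+y, y, ?_, ?_, by rw [← hn3]; ring, ⟨x, by ring⟩⟩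
  · rw [hg.1, hg.2]; ring
  · rw [hg.2]; ring

lemma unit5 : ∀ (n : ℕ) (x y : ℤ), x.natAbs + y.natAbs ≤ n → (x^2+x*y-y^2).natAbs = 1 →
    ∃ (j : ℕ) (e : QO 1), j < 3 ∧ (⟨x, y⟩ : QO 1) = (⟨0,1⟩ : QO 1)^j * e^3 := by
  have hneg : ∀ (x y : ℤ), (∃ (j : ℕ) (e : QO 1), j < 3 ∧ (⟨x, y⟩ : QO 1) = (⟨0,1⟩ : QO 1)^j * e^3) →
     (∃ (j : ℕ) (e : QO 1), j < 3 ∧ (⟨-x, -y⟩ : QO 1) = (⟨0,1⟩ : QO 1)^j * e^3) := by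
    rintro x y ⟨j, e, hj, h⟩
    refine ⟨j, -e, hj, ?_⟩
    have : (⟨-x, -y⟩ : QO 1) = -⟨x,y⟩ := by ext <;> simp
    rw [this, h]; ring
  have hinv : (⟨0,1⟩ : QO 1) * ⟨-1,1⟩ = 1 := by ext <;> simp
  have hup : ∀ (x y : ℤ), (∃ (j : ℕ) (e : QO 1), j < 3 ∧ (⟨y-x, x⟩ : QO 1) = (⟨0,1⟩ : QO 1)^j * e^3) →
     (∃ (j : ℕ) (e : QO 1), j < 3 ∧ (⟨x, y⟩ : QO 1) = (⟨0,1⟩ : QO 1)^j * e^3) := by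
    rintro x y ⟨j, e, hj, h⟩
    have h1 : (⟨x, y⟩ : QO 1) = ⟨0,1⟩ * ⟨y-x, x⟩ := by ext <;> simp
    by_cases hj2 : j = 2
    · subst hj2
      exact ⟨0, ⟨0,1⟩ * e, by norm_num, by rw [h1, h]; ring⟩
    · exact ⟨j+1, e, by omega, by rw [h1, h]; ring⟩
  have hdn : ∀ (x y : ℤ), (∃ (j : ℕ) (e : QO 1), j < 3 ∧ (⟨y, x+y⟩ : QO 1) = (⟨0,1⟩ : QO 1)^j * e^3) →
     (∃ (j : ℕ) (e : QO 1), j < 3 ∧ (⟨x, y⟩ : QO 1) = (⟨0,1⟩ : QO 1)^j * e^3) := by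
    rintro x y ⟨j, e, hj, h⟩
    have h1 : (⟨x, y⟩ : QO 1) = ⟨-1,1⟩ * ⟨y, x+y⟩ := by ext <;> simp
    rcases j with _ | j
    · refine ⟨2, ⟨-1,1⟩ * e, by norm_num, ?_⟩
      rw [h1, h]
      linear_combination (-⟨-1,1⟩ * e^3 * (⟨0,1⟩ * ⟨-1,1⟩ + 1)) * hinv
    · refine ⟨j, e, by omega, ?_⟩
      rw [h1, h]
      linear_combination (⟨0,1⟩^j * e^3) * hinv
  intro n
  induction n with
  | zero => intro x y h h1; have : x = 0 := by omega
            have : y = 0 := by omega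
            subst x y; simp at h1
  | succ n ih =>
    intro x y h h1
    -- wlog y ≥ 0 after sign
    have main : ∀ x y : ℤ, 0 ≤ y → x.natAbs + y.natAbs ≤ n + 1 → (x^2+x*y-y^2).natAbs = 1 →
       ∃ (j : ℕ) (e : QO 1), j < 3 ∧ (⟨x, y⟩ : QO 1) = (⟨0,1⟩ : QO 1)^j * e^3 := by
      intro x y hy h h1
      have h2 : x^2+x*y-y^2 = 1 ∨ x^2+x*y-y^2 = -1 := by omega
      rcases hy.eq_or_lt with rfl | hy
      · have : x = 1 ∨ x = -1 := by
          have : x^2 = 1 := by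
            rcases h2 with h2 | h2 <;> nlinarith
          exact mul_self_eq_one_iff.mp (by linarith)
        rcases this with rfl | rfl
        · exact ⟨0, 1, by norm_num, by ext <;> simp⟩
        · exact ⟨0, -1, by norm_num, by ext <;> simp [pow_succ]⟩
      · rcases lt_trichotomy x 0 with hx | rfl | hx
        · -- x < 0 < y
          apply hdn
          have h3 : y ≤ -x := by
            by_contra hcon
            rcases h2 with h2 | h2 <;> nlinarith
          apply ih
          · omega
          · have : y^2+y*(x+y)-(x+y)^2 = -(x^2+x*y-y^2) := by ring
            rw [this]; omega
        · have : y = 1 := by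
            rcases h2 with h2 | h2 <;> nlinarith
          subst this
          exact ⟨1, 1, by norm_num, by simp⟩
        · apply hup
          have h3 : x ≤ y := by
            by_contra hcon
            rcases h2 with h2 | h2 <;> nlinarith
          apply ih
          · omega
          · have : (y-x)^2+(y-x)*x-x^2 = -(x^2+x*y-y^2) := by ring
            rw [this]; omega
    rcases le_total 0 y with hy | hy
    · exact main x y hy h h1
    · have := hneg _ _ (main (-x) (-y) (by omega) (by omega) (by rw [← h1]; ring_nf))
      simpa using this

lemma cube5 (p q b : ℤ) (hb : b ≠ 0) (h : p^2-5*q^2 = b^3) (hc : IsCoprime (2*q) b) :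
    ∃ A B : ℤ, 8*p = A^3+15*A*B^2 ∧ 8*q = 3*A^2*B+5*B^3 ∧ A^2-5*B^2 = 4*b ∧ 2 ∣ A - B := by
  obtain ⟨g, k, hgk, hk⟩ := cube_unit 1 (by norm_num) (p-q) (2*q) b hb (by linarith) hc
  obtain ⟨kx, ky⟩ := k
  have hk' : (kx^2+kx*ky-ky^2).natAbs = 1 := by
    rw [QuadraticAlgebra.norm_def] at hk; rw [← hk]; ring_nf
  obtain ⟨j, e, hj, hje⟩ := unit5 _ kx ky le_rfl hk'
  obtain ⟨x, y, hxy⟩ : ∃ x y, e * g = (⟨x, y⟩ : QO 1) := ⟨_, _, rfl⟩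
  have h1 : (⟨p-q, 2*q⟩ : QO 1) = ⟨0,1⟩^j * ⟨x, y⟩^3 := by
    rw [← hxy, hgk, hje]; ring
  have hodd : (p - q) % 2 = 1 := by
    have hb2 : b % 2 = 1 := by
      have := hc.of_mul_left_left
      have := Int.isCoprime_iff_gcd_eq_one.mp this
      by_contra hcon
      have h3 : (2:ℤ) ∣ b := by omega
      have : (2:ℤ) ∣ Int.gcd 2 b := Int.dvd_coe_gcd (dvd_refl _) h3
      omega
    have h3 : (p^2-5*q^2) % 2 = 1 := by rw [h]; simp [pow_succ, Int.mul_emod, hb2]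
    rcases Int.emod_two_eq_zero_or_one p with h1 | h1 <;> rcases Int.emod_two_eq_zero_or_one q with h2 | h2 <;>
        simp [pow_two, Int.mul_emod, Int.sub_emod, h1, h2] at h3 ⊢
  have hev : (3*x^2*y+3*x*y^2+(1+1)*y^3) % 2 = 0 := by
    rcases Int.emod_two_eq_zero_or_one x with h1 | h1 <;> rcases Int.emod_two_eq_zero_or_one y with h2 | h2 <;>
        simp [pow_succ, Int.mul_emod, Int.add_emod, h1, h2]
  have hj0 : (⟨p-q, 2*q⟩ : QO 1) =  ⟨x, y⟩^3 := by
    rw [QO_cube] at h1 ⊢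
    generalize hR : x^3+3*1*x*y^2+1*y^3 = R at *
    generalize hI : 3*x^2*y+3*x*y^2+(1+1)*y^3 = I at *
    interval_cases j
    · simpa using h1
    · simp [QuadraticAlgebra.ext_iff] at h1; omega
    · simp [QuadraticAlgebra.ext_iff, pow_succ] at h1; omega
  have hn := congrArg QuadraticAlgebra.norm hj0
  rw [QO_cube, QuadraticAlgebra.mk.injEq] at hj0
  rw [map_pow, QuadraticAlgebra.norm_def, QuadraticAlgebra.norm_def] at hn
  simp only at hn
  have hn2 : (x^2+x*y-y^2)^3 = b^3 := by linarith
  have hn3 : x^2+x*y-y^2 = b := by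
    have : Odd 3 := by decide
    exact this.strictMono_pow.injective hn2
  refine ⟨2*x+y, y, ?_, ?_, by rw [← hn3]; ring, ⟨x, by ring⟩⟩
  · linear_combination 8*hj0.1 + 4 * hj0.2
  · linear_combination 4 * hj0.2

lemma unit3 (x y : ℤ) (h : (x^2+x*y+y^2).natAbs = 1) :
    ∃ (j : ℕ) (e : QO (-1)), j < 3 ∧ (⟨x, y⟩ : QO (-1)) = (⟨0,1⟩ : QO (-1))^j * e^3 := by
  have h1 : x^2+x*y+y^2 = 1 := by
    have : 0 ≤ x^2+x*y+y^2 := by nlinarith [sq_nonneg (x+y)]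
    omega
  have : x < 2 := by nlinarith [sq_nonneg (x+2*y)]
  have : -2 < x := by nlinarith [sq_nonneg (x+2*y)]
  have : y < 2 := by nlinarith [sq_nonneg (y+2*x)]
  have : -2 < y := by nlinarith [sq_nonneg (y+2*x)]
  have h6 : (x = 1 ∧ y = 0) ∨ (x = -1 ∧ y = 0) ∨ (x = 0 ∧ y = 1) ∨ (x = 0 ∧ y = -1) ∨ (x = -1 ∧ y = 1) ∨ (x = 1 ∧ y = -1) := by
    interval_cases x <;> interval_cases y <;> simp_all
  rcases h6 with ⟨rfl, rfl⟩ | ⟨rfl, rfl⟩ | ⟨rfl, rfl⟩ | ⟨rfl, rfl⟩ | ⟨rfl, rfl⟩ | ⟨rfl, rfl⟩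
  · exact ⟨0, 1, by norm_num, by ext <;> simp⟩
  · exact ⟨0, -1, by norm_num, by ext <;> simp [pow_succ]⟩
  · exact ⟨1, 1, by norm_num, by ext <;> simp [pow_succ]⟩
  · exact ⟨1, -1, by norm_num, by ext <;> simp [pow_succ]⟩
  · exact ⟨2, 1, by norm_num, by ext <;> simp [pow_succ]⟩
  · exact ⟨2, -1, by norm_num, by ext <;> simp [pow_succ]⟩

lemma cube3 (p q b : ℤ) (hb : b ≠ 0) (h : p^2+3*q^2 = b^3) (hc : IsCoprime (2*q) b) :
    ∃ P Q : ℤ, p = P^3-9*P*Q^2 ∧ q = 3*P^2*Q-3*Q^3 ∧ P^2+3*Q^2 = b := by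
  obtain ⟨g, k, hgk, hk⟩ := cube_unit (-1) (by norm_num) (p-q) (2*q) b hb (by linarith) hc
  obtain ⟨kx, ky⟩ := k
  have hk' : (kx^2+kx*ky+ky^2).natAbs = 1 := by
    rw [QuadraticAlgebra.norm_def] at hk; rw [← hk]; ring_nf
  obtain ⟨j, e, hj, hje⟩ := unit3 kx ky hk'
  obtain ⟨x, y, hxy⟩ : ∃ x y, e * g = (⟨x, y⟩ : QO (-1)) := ⟨_, _, rfl⟩
  have h1 : (⟨p-q, 2*q⟩ : QO (-1)) = ⟨0,1⟩^j * ⟨x, y⟩^3 := by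
    rw [← hxy, hgk, hje]; ring
  have hodd : (p - q) % 2 = 1 := by
    have hb2 : b % 2 = 1 := by
      have := hc.of_mul_left_left
      have := Int.isCoprime_iff_gcd_eq_one.mp this
      by_contra hcon
      have h3 : (2:ℤ) ∣ b := by omega
      have : (2:ℤ) ∣ Int.gcd 2 b := Int.dvd_coe_gcd (dvd_refl _) h3
      omega
    have h3 : (p^2+3*q^2) % 2 = 1 := by rw [h]; simp [pow_succ, Int.mul_emod, hb2]
    rcases Int.emod_two_eq_zero_or_one p with h1 | h1 <;> rcases Int.emod_two_eq_zero_or_one q with h2 | h2 <;>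
        simp [pow_two, Int.add_emod, Int.mul_emod, Int.sub_emod, h1, h2] at h3 ⊢
  have hev : (3*x^2*y+3*x*y^2+(-1+1)*y^3) % 2 = 0 := by
    rcases Int.emod_two_eq_zero_or_one x with h1 | h1 <;> rcases Int.emod_two_eq_zero_or_one y with h2 | h2 <;>
        simp [pow_succ, Int.mul_emod, Int.add_emod, h1, h2]
  have hj0 : (⟨p-q, 2*q⟩ : QO (-1)) =  ⟨x, y⟩^3 := by
    rw [QO_cube] at h1 ⊢
    generalize hR : x^3+3*(-1)*x*y^2+(-1)*y^3 = R at *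
    generalize hI : 3*x^2*y+3*x*y^2+(-1+1)*y^3 = I at *
    interval_cases j
    · simpa using h1
    · simp [QuadraticAlgebra.ext_iff] at h1; omega
    · simp [QuadraticAlgebra.ext_iff, pow_succ] at h1; omega
  -- make y even
  obtain ⟨x, y, hj1, hy⟩ : ∃ x y : ℤ, (⟨p-q, 2*q⟩ : QO (-1)) =  ⟨x, 2*y⟩^3 ∧ True := by
    rcases Int.emod_two_eq_zero_or_one y with h2 | h2
    · exact ⟨x, y/2, by rw [show 2*(y/2) = y by omega]; exact hj0, trivial⟩
    · rcases Int.emod_two_eq_zero_or_one x with h3 | h3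
      · refine ⟨-x-y, x/2, ?_, trivial⟩
        rw [show 2*(x/2) = x by omega, hj0, QO_cube, QO_cube]
        ext
        · simp only; ring
        · simp only; ring
      · refine ⟨y, (-x-y)/2, ?_, trivial⟩
        rw [show 2*((-x-y)/2) = -x-y by omega, hj0, QO_cube, QO_cube]
        ext
        · simp only; ring
        · simp only; ring
  have hn := congrArg QuadraticAlgebra.norm hj1
  rw [QO_cube, QuadraticAlgebra.mk.injEq] at hj1
  rw [map_pow, QuadraticAlgebra.norm_def, QuadraticAlgebra.norm_def] at hn
  simp only at hn
  have hn2 : (x^2+2*x*y+4*y^2)^3 = b^3 := by linarith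
  have hn3 : x^2+2*x*y+4*y^2 = b := by
    have : Odd 3 := by decide
    exact this.strictMono_pow.injective hn2
  refine ⟨x+y, y, ?_, ?_, by rw [← hn3]; ring⟩
  · linarith [hj1.1, hj1.2]
  · linarith [hj1.1, hj1.2]

lemma cop_pr {a b : ℤ} (h : ∀ p : ℤ, Prime p → p ∣ a → p ∣ b → False) : IsCoprime a b := by
  apply isCoprime_of_prime_dvd
  · rintro ⟨rfl, rfl⟩
    exact h 2 Int.prime_two (dvd_zero _) (dvd_zero _)
  · intro z hz h1 h2; exact h z hz h1 h2

lemma dvd_eq' {p a b : ℤ} (h : p ∣ a) (e : a = b) : p ∣ b := e ▸ h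
lemma cop_eq' {p a b : ℤ} (h : IsCoprime p a) (e : a = b) : IsCoprime p b := e ▸ h

lemma pr_cop {a b p : ℤ} (h : IsCoprime a b) (hp : Prime p) (h1 : p ∣ a) (h2 : p ∣ b) : False :=
  hp.not_isUnit (h.isUnit_of_dvd' h1 h2)

lemma pr_dvd {p q a : ℤ} (hp : Prime p) (hq : Prime q) (h : p ∣ q) (h2 : p ∣ a) : q ∣ a :=
  ((hp.dvd_prime_iff_associated hq).mp h).dvd'.trans h2

lemma int_sq_odd {a : ℤ} (h : a % 2 = 1) : a^2 % 8 = 1 := by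
  obtain ⟨k, rfl⟩ : ∃ k, a = 2*k+1 := ⟨a/2, by omega⟩
  have : k*(k+1) % 2 = 0 := by
    rcases Int.emod_two_eq_zero_or_one k with h | h <;> simp [Int.mul_emod, Int.add_emod, h]
  have h2 : (2*k+1)^2 = 4*(k*(k+1))+1 := by ring
  omega

lemma par_sq (a : ℤ) : a^2 % 2 = a % 2 := by
  rcases Int.emod_two_eq_zero_or_one a with h | h <;> simp [pow_two, Int.mul_emod, h]

lemma par_cube (a : ℤ) : a^3 % 2 = a % 2 := by
  rcases Int.emod_two_eq_zero_or_one a with h | h <;> simp [pow_succ, Int.mul_emod, h]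

/-- common part of the descent for `x³+y³=4z³` -/
lemma cub_step (P Q a : ℤ) (hc : IsCoprime P Q) (hodd : (P - Q) % 2 = 1) (h2 : P % 2 = 0)
    (h : P * ((P - Q) * (P + Q)) = 2 * a^3) :
    ∃ x y z : ℤ, x^3 = P - Q ∧ y^3 = P + Q ∧ P = 2 * z^3 ∧ IsCoprime x y ∧ z ∣ a := by
  obtain ⟨P', rfl⟩ : ∃ k, P = 2*k := ⟨P/2, by omega⟩
  have h3 : P' * ((2*P'-Q)*(2*P'+Q)) = a^3 := by linarith
  have c1 : IsCoprime (2*P'-Q) (2*P'+Q) := by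
    apply cop_pr
    intro p hp h1 h2
    have h5 : p ∣ 2*(2*P') := dvd_eq' (dvd_add h1 h2) (by ring)
    have h6 : p ∣ 2*Q := dvd_eq' (dvd_sub h2 h1) (by ring)
    rcases hp.dvd_or_dvd h6 with h7 | h7
    · have := pr_dvd hp Int.prime_two h7 h1; omega
    · rcases hp.dvd_or_dvd h5 with h8 | h8
      · have := pr_dvd hp Int.prime_two h8 h1; omega
      · exact pr_cop hc hp h8 h7
  have c2 : IsCoprime P' ((2*P'-Q)*(2*P'+Q)) := by
    have c3 : IsCoprime P' Q := hc.of_mul_left_right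
    apply IsCoprime.mul_right
    · have := (c3.neg_right).add_mul_left_right 2
      exact cop_eq' this (by ring)
    · have := c3.add_mul_left_right 2
      exact cop_eq' this (by ring)
  obtain ⟨⟨z, hz⟩, ⟨w, hw⟩⟩ := Int.eq_pow_of_mul_eq_pow_odd c2 (by decide) h3
  obtain ⟨⟨x, hx⟩, ⟨y, hy⟩⟩ := Int.eq_pow_of_mul_eq_pow_odd c1 (by decide) hw
  refine ⟨x, y, z, hx.symm, hy.symm, by rw [hz], ?_, ?_⟩
  · rw [hx, hy] at c1
    exact (IsCoprime.pow_iff (by norm_num) (by norm_num)).mp c1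
  · have : z^3 ∣ a^3 := ⟨(2*P'-Q)*(2*P'+Q), by rw [← hz]; exact h3.symm⟩
    exact (Int.pow_dvd_pow_iff (by norm_num)).mp this

lemma cub4 : ∀ (n : ℕ) (x y z : ℤ), z.natAbs ≤ n → IsCoprime x y → x^3+y^3 = 4*z^3 → z = 0 := by
  intro n
  induction n using Nat.strong_induction_on with
  | _ n ih =>
  intro x y z hn hc h
  by_contra hz
  have hpx := par_cube x
  have hpy := par_cube y
  have hxy : x % 2 = 1 ∧ y % 2 = 1 := by
    by_contra hcon
    have h1 : x % 2 = 0 ∧ y % 2 = 0 := by omega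
    exact pr_cop hc Int.prime_two (by omega) (by omega)
  obtain ⟨p, q, rfl, rfl⟩ : ∃ p q : ℤ, x = p + q ∧ y = p - q :=
    ⟨(x+y)/2, (x-y)/2, by omega, by omega⟩
  have hpq : IsCoprime p q := by
    apply cop_pr
    intro r hr h1 h2
    exact pr_cop hc hr (dvd_add h1 h2) (dvd_sub h1 h2)
  have h1 : p * (p^2+3*q^2) = 2*z^3 := by linarith
  have hop : (p+q) % 2 = 1 := hxy.1
  have hodd : (p^2+3*q^2) % 2 = 1 := by have := par_sq p; have := par_sq q; omega
  have hp2 : p % 2 = 0 := by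
    have : (p * (p^2+3*q^2)) % 2 = 0 := by rw [h1]; omega
    rw [Int.mul_emod, hodd] at this; omega
  have hp0 : p ≠ 0 := by rintro rfl; apply hz; have : z^3 = 0 := by linarith
                         exact pow_eq_zero_iff (by norm_num) |>.mp this
  have hp4 : 4 ≤ p^2 := by
    obtain ⟨k, rfl⟩ : ∃ k, p = 2*k := ⟨p/2, by omega⟩
    have : 1 ≤ k^2 := by
      have : k ≠ 0 := by rintro rfl; simp at hp0
      have := sq_pos_of_ne_zero this
      omega
    nlinarith
  -- finish
  have fin : ∀ a b x' y' z' : ℤ, (a * b).natAbs ≤ z.natAbs → z' ≠ 0 → a ≠ 0 → 2 ≤ b.natAbs → z' ∣ a → IsCoprime x' y' →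
      x'^3+y'^3 = 4*z'^3 → False := by
    intro a b x' y' z' hle h0 ha hb hd hc' he
    have h3 := Nat.le_of_dvd (by omega) (Int.natAbs_dvd_natAbs.mpr hd)
    rw [Int.natAbs_mul] at hle
    have h4 : 0 < a.natAbs := by omega
    have : z'.natAbs < z.natAbs := by nlinarith
    exact h0 (ih z'.natAbs (by omega) x' y' z' le_rfl hc' he)
  have hbig : ∀ b : ℤ, 4 ≤ b^3 → 2 ≤ b.natAbs := by
    intro b hb
    by_contra hcon
    have : b = 0 ∨ b = 1 ∨ b = -1 := by omega
    rcases this with rfl | rfl | rfl <;> norm_num at hb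
  by_cases h3 : (3:ℤ) ∣ p
  · obtain ⟨p1, rfl⟩ := h3
    have hq3 : ¬ (3:ℤ) ∣ q := fun h => pr_cop hpq Int.prime_three (Dvd.intro _ rfl) h
    have h4 : 9 * (p1 * (q^2+3*p1^2)) = 2*z^3 := by linarith
    obtain ⟨z1, rfl⟩ : (3:ℤ) ∣ z := by
      have : (3:ℤ) ∣ z^3 := by omega
      exact Int.prime_three.dvd_of_dvd_pow this
    have h5 : p1 * (q^2+3*p1^2) = 6*z1^3 := by linarith
    have hodd2 : (q^2+3*p1^2) % 2 = 1 := by have := par_sq p1; have := par_sq q; omega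
    have hm3 : ¬ (3:ℤ) ∣ (q^2+3*p1^2) := by
      intro h
      have : (3:ℤ) ∣ q^2 := by omega
      exact hq3 (Int.prime_three.dvd_of_dvd_pow this)
    obtain ⟨p2, rfl⟩ : (6:ℤ) ∣ p1 := by
      have : (3:ℤ) ∣ p1 := by
        have : (3:ℤ) ∣ p1 * (q^2+3*p1^2) := by rw [h5]; exact ⟨2*z1^3, by ring⟩
        exact (Int.prime_three.dvd_or_dvd this).resolve_right hm3
      omega
    have h6 : p2 * (q^2+3*(6*p2)^2) = z1^3 := by linarith
    have c1 : IsCoprime p2 q := hpq.of_mul_left_right.of_mul_left_right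
    have c2 : IsCoprime p2 (q^2+3*(6*p2)^2) := by
      have := (c1.pow_right (n := 2)).add_mul_left_right (108*p2)
      exact cop_eq' this (by ring)
    obtain ⟨⟨a, ha⟩, ⟨b, hb⟩⟩ := Int.eq_pow_of_mul_eq_pow_odd c2 (by decide) h6
    have hb0 : b ≠ 0 := by rintro rfl; nlinarith
    have c3 : IsCoprime (2*(6*p2)) b := by
      rw [← IsCoprime.pow_right_iff (m := 3) (by norm_num), ← hb]
      apply cop_pr
      intro r hr h1 h2
      rcases hr.dvd_or_dvd h1 with h7 | h7
      · have := pr_dvd hr Int.prime_two h7 h2; omega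
      · have h8 : r ∣ q^2 := by
          have := dvd_sub h2 (Dvd.dvd.mul_left (dvd_pow h7 (two_ne_zero)) 3)
          exact dvd_eq' this (by ring)
        exact pr_cop hpq hr (Dvd.dvd.mul_left h7 _) (hr.dvd_of_dvd_pow h8)
    obtain ⟨P, Q, hP, hQ, hPQ⟩ := cube3 q (6*p2) b hb0 hb c3
    have hbodd : b % 2 = 1 := by have := par_cube b; rw [← hb] at this; omega
    have hPQodd : (Q - P) % 2 = 1 := by have := par_sq P; have := par_sq Q; omega
    have c4 : IsCoprime Q P := by
      apply cop_pr
      intro r hr h1 h2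
      refine pr_cop (hpq.of_mul_left_right) hr (?_ : r ∣ 6 * p2) (?_ : r ∣ q)
      · rw [hQ]; exact dvd_sub (Dvd.dvd.mul_left h1 _) (Dvd.dvd.mul_left (dvd_pow h1 (by norm_num)) _)
      · rw [hP]; exact dvd_sub (dvd_pow h2 (by norm_num)) (Dvd.dvd.mul_left (dvd_pow h1 (by norm_num)) _)
    have h7 : Q * ((Q - P)*(Q+P)) = 2 * (-a)^3 := by rw [show (-a)^3 = -a^3 by ring, ← ha]; linarith
    have hQ2 : Q % 2 = 0 := by
      have h8 : (Q * ((Q - P)*(Q+P))) % 2 = 0 := by rw [h7]; omega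
      have h9 : (Q + P) % 2 = 1 := by omega
      simpa [Int.mul_emod, hPQodd, h9] using h8
    obtain ⟨x', y', z', hx, hy, hzz, hcop, hdv⟩ := cub_step Q P (-a) c4 hPQodd hQ2 h7
    have ha0 : a ≠ 0 := by rintro rfl; apply hp0; rw [ha]; ring
    refine fin a b x' y' z' ?_ ?_ ha0 ?_ ((dvd_neg).mp hdv) hcop ?_
    · have : (a*b)^3 = z1^3 := by rw [mul_pow, ← ha, ← hb]; exact h6
      have := (show Odd 3 by decide).strictMono_pow.injective this
      rw [this]; omega
    · rintro rfl
      rw [hzz] at h7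
      have : a^3 = 0 := by linarith
      exact ha0 (pow_eq_zero_iff (by norm_num) |>.mp this)
    · apply hbig; rw [← hb]
      have : 0 < p2^2 := sq_pos_of_ne_zero (by rintro rfl; simp at hp0)
      nlinarith [sq_nonneg q]
    · rw [hx, hy]; linarith
  · have hp3 := h3
    obtain ⟨p1, rfl⟩ : (2:ℤ) ∣ p := by omega
    have h6 : p1 * ((2*p1)^2+3*q^2) = z^3 := by linarith
    have c1 : IsCoprime p1 q := hpq.of_mul_left_right
    have c2 : IsCoprime p1 ((2*p1)^2+3*q^2) := by
      have h3' : IsCoprime p1 3 := by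
        refine ((Prime.coprime_iff_not_dvd Int.prime_three).mpr ?_).symm
        intro h; exact h3 (Dvd.dvd.mul_left h _)
      have := (h3'.mul_right (c1.pow_right (n := 2))).add_mul_left_right (4*p1)
      exact cop_eq' this (by ring)
    obtain ⟨⟨a, ha⟩, ⟨b, hb⟩⟩ := Int.eq_pow_of_mul_eq_pow_odd c2 (by decide) h6
    have hb0 : b ≠ 0 := by rintro rfl; nlinarith
    have c3 : IsCoprime (2*q) b := by
      rw [← IsCoprime.pow_right_iff (m := 3) (by norm_num), ← hb]
      apply cop_pr
      intro r hr h1 h2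
      rcases hr.dvd_or_dvd h1 with h7 | h7
      · have := pr_dvd hr Int.prime_two h7 h2; omega
      · have h8 : r ∣ (2*p1)^2 := by
          have := dvd_sub h2 (Dvd.dvd.mul_left (dvd_pow h7 (two_ne_zero)) 3)
          exact dvd_eq' this (by ring)
        exact pr_cop hpq hr (hr.dvd_of_dvd_pow h8) h7
    obtain ⟨P, Q, hP, hQ, hPQ⟩ := cube3 (2*p1) q b hb0 hb c3
    have hbodd : b % 2 = 1 := by have := par_cube b; rw [← hb] at this; omega
    have hPQodd : (P - 3*Q) % 2 = 1 := by have := par_sq P; have := par_sq Q; omega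
    have c4 : IsCoprime P (3*Q) := by
      apply cop_pr
      intro r hr h1 h2
      rcases hr.dvd_or_dvd h2 with h7 | h7
      · apply hp3
        apply pr_dvd hr Int.prime_three h7
        rw [hP]; exact dvd_sub (dvd_pow h1 (by norm_num)) (Dvd.dvd.mul_right (Dvd.dvd.mul_left h1 _) _)
      refine pr_cop hpq hr ?_ (?_ : r ∣ q)
      · rw [hP]; exact dvd_sub (dvd_pow h1 (by norm_num)) (Dvd.dvd.mul_right (Dvd.dvd.mul_left h1 _) _)
      · rw [hQ]; exact dvd_sub (Dvd.dvd.mul_left h7 _) (Dvd.dvd.mul_left (dvd_pow h7 (by norm_num)) _)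
    have h7 : P * ((P - 3*Q)*(P+3*Q)) = 2 * a^3 := by rw [← ha]; linarith
    have hQ2 : P % 2 = 0 := by
      have h8 : (P * ((P - 3*Q)*(P+3*Q))) % 2 = 0 := by rw [h7]; omega
      have h9 : (P + 3*Q) % 2 = 1 := by omega
      simpa [Int.mul_emod, hPQodd, h9] using h8
    obtain ⟨x', y', z', hx, hy, hzz, hcop, hdv⟩ := cub_step P (3*Q) a c4 hPQodd hQ2 h7
    have ha0 : a ≠ 0 := by rintro rfl; apply hp0; rw [ha]; ring
    refine fin a b x' y' z' ?_ ?_ ha0 ?_ hdv hcop ?_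
    · have : (a*b)^3 = z^3 := by rw [mul_pow, ← ha, ← hb]; exact h6
      have := (show Odd 3 by decide).strictMono_pow.injective this
      rw [this]
    · rintro rfl
      rw [hzz] at h7
      have : a^3 = 0 := by linarith
      exact ha0 (pow_eq_zero_iff (by norm_num) |>.mp this)
    · apply hbig; rw [← hb]; nlinarith
    · rw [hx, hy]; linarith

lemma pow4_of_mul {a b e : ℤ} (ha : 0 ≤ a) (hc : IsCoprime a b) (h : a * b = e^4) : ∃ u, a = u^4 := by
  obtain ⟨d, hd⟩ := exists_associated_pow_of_mul_eq_pow (hc.isUnit_of_dvd' (gcd_dvd_left _ _) (gcd_dvd_right _ _)) h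
  rcases Int.associated_iff.mp hd with h1 | h1
  · exact ⟨d, h1.symm⟩
  · have : d^4 = 0 := by have : 0 ≤ d^4 := by positivity
                         linarith
    exact ⟨0, by rw [this] at h1; linarith⟩

lemma pow4_mul_prime {a b e p : ℤ} (hp : Prime p) (hp0 : 0 < p) (ha : 0 ≤ a) (hb : 0 ≤ b) (hc : IsCoprime a b)
    (h : a * b = p * e^4) :
    ∃ u v, (a = u^4 ∧ b = p*v^4 ∨ a = p * u^4 ∧ b = v^4) := by
  have h1 : p ∣ a * b := ⟨_, h⟩
  rcases hp.dvd_or_dvd h1 with ⟨k, rfl⟩ | ⟨k, rfl⟩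
  · have h2 : k * b = e^4 := by
      apply mul_left_cancel₀ hp.ne_zero; linarith
    have hk : 0 ≤ k := by nlinarith
    obtain ⟨u, rfl⟩ := pow4_of_mul hk hc.of_mul_left_right h2
    obtain ⟨v, rfl⟩ := pow4_of_mul hb hc.of_mul_left_right.symm (by rw [mul_comm]; exact h2)
    exact ⟨u, v, Or.inr ⟨rfl, rfl⟩⟩
  · have h2 : k * a = e^4 := by
      apply mul_left_cancel₀ hp.ne_zero; linarith
    have hk : 0 ≤ k := by nlinarith
    obtain ⟨u, rfl⟩ := pow4_of_mul hk hc.symm.of_mul_left_right h2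
    obtain ⟨v, rfl⟩ := pow4_of_mul ha hc.of_mul_right_right (by rw [mul_comm]; exact h2)
    exact ⟨v, u, Or.inl ⟨rfl, rfl⟩⟩

lemma sq_eq_of_pow4 {a b : ℤ} (h : a^4 = b^4) : a^2 = b^2 := by
  have h1 : (a^2-b^2)*(a^2+b^2) = 0 := by linarith
  rcases mul_eq_zero.mp h1 with h2 | h2
  · linarith
  · nlinarith [sq_nonneg a, sq_nonneg b]

lemma prime5 : Prime (5:ℤ) := by norm_num

set_option maxHeartbeats 1000000 in
lemma quart : ∀ (n : ℕ) (M e N : ℤ), e.natAbs ≤ n → IsCoprime M e → M^4+M^2*e^2-e^4 = N^2 →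
    e = 0 ∨ (e^2 = 1 ∧ M^2 = 1) := by
  intro n
  induction n using Nat.strong_induction_on with
  | _ n ih =>
  intro M e N hn hc h
  by_cases he0 : e = 0
  · exact Or.inl he0
  right
  -- WLOG M > 0
  wlog hM : 0 < M generalizing M
  · have hM0 : M ≠ 0 := by
      rintro rfl
      have : 0 < e^4 := by positivity
      nlinarith [sq_nonneg N]
    have := this (-M) hc.neg_left (by rw [← h]; ring) (by omega)
    simpa using this
  have hModd : M % 2 = 1 := by
    by_contra hcon
    have heodd : e % 2 = 1 := by
      by_contra h2
      exact pr_cop hc Int.prime_two (by omega) (by omega)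
    obtain ⟨k, rfl⟩ : ∃ k, M = 2*k := ⟨M/2, by omega⟩
    have h1 := int_sq_odd heodd
    have h2 : (2*k)^4+(2*k)^2*e^2-e^4 = 4*(4*k^4+k^2*e^2) - (e^2)^2 := by ring
    have h4 : (e^2) % 2 = 1 := by omega
    have h3 := int_sq_odd h4
    have h5 : N^2 % 4 = 3 := by rw [← h, h2]; omega
    rcases Int.emod_two_eq_zero_or_one N with h6 | h6
    · have h7 := par_sq N; omega
    · have := int_sq_odd h6; omega
  -- final descent
  have step : ∀ u v g f : ℤ, v^4 = g^4*f^4 → u^2 = f^4+f^2*g^2-g^4 → IsCoprime f g → v ≠ 0 → v.natAbs * u.natAbs ≤ e.natAbs →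
      u^2 = 1 ∧ v^2 = 1 := by
    intro u v g f hv hu hfg hv0 hle
    have hv2 : v^2 = (g*f)^2 := sq_eq_of_pow4 (by rw [hv]; ring)
    have hva : v.natAbs = g.natAbs * f.natAbs := by
      rw [← Int.natAbs_mul]; exact Int.natAbs_eq_iff_sq_eq.mpr hv2
    have hg0 : g ≠ 0 := by rintro rfl; simp at hva; exact hv0 hva
    have hf0 : f ≠ 0 := by rintro rfl; simp at hva; exact hv0 hva
    have hu0 : u ≠ 0 := by
      rintro rfl
      have hh : (2*f^2+g^2)^2 = 5 * (g^2)^2 := by linarith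
      have h5 : (5:ℤ) ∣ 2*f^2+g^2 := prime5.dvd_of_dvd_pow ⟨_, hh⟩
      obtain ⟨w, hw⟩ := h5
      rw [hw] at hh
      have h6 : (5:ℤ) ∣ g := prime5.dvd_of_dvd_pow (prime5.dvd_of_dvd_pow (⟨w^2, by linarith⟩ : (5:ℤ) ∣ (g^2)^2))
      have h7 : (5:ℤ) ∣ 2*f^2 := by
        have := dvd_sub (⟨w, hw⟩ : (5:ℤ) ∣ 2*f^2+g^2) (dvd_pow h6 two_ne_zero)
        exact dvd_eq' this (by ring)
      rcases prime5.dvd_or_dvd h7 with h8 | h8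
      · norm_num at h8
      · exact pr_cop hfg prime5 (prime5.dvd_of_dvd_pow h8) h6
    have e1 : 1 ≤ f.natAbs := by omega
    have e2 : 1 ≤ u.natAbs := by omega
    have e3 : 1 ≤ g.natAbs := by omega
    have hle2 : g.natAbs * (f.natAbs * u.natAbs) ≤ e.natAbs := by rw [← mul_assoc, ← hva]; exact hle
    have hfin : g^2 = 1 ∧ f^2 = 1 := by
      by_cases hlt : g.natAbs < e.natAbs
      · rcases ih g.natAbs (by omega) f g u le_rfl hfg hu.symm with h0 | h0
        · exact absurd h0 hg0
        · exact h0
      · have h1 : f.natAbs * u.natAbs = 1 := by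
          have : 1 ≤ f.natAbs * u.natAbs := Nat.mul_pos e1 e2
          by_contra hcon
          have : 2 ≤ f.natAbs * u.natAbs := by omega
          nlinarith
        have hf1 : f.natAbs = 1 := Nat.eq_one_of_mul_eq_one_right h1
        have hu1 : u.natAbs = 1 := Nat.eq_one_of_mul_eq_one_left h1
        have hf2 : f^2 = 1 := by rw [← Int.natAbs_sq, hf1]; rfl
        have hu2 : u^2 = 1 := by rw [← Int.natAbs_sq, hu1]; rfl
        refine ⟨?_, hf2⟩
        have : g^2*(g^2-1) = 0 := by
          have : f^4 = 1 := by rw [show f^4 = (f^2)^2 by ring, hf2]; rfl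
          rw [this, hf2, hu2] at hu; linarith
        rcases mul_eq_zero.mp this with h | h
        · exact absurd (pow_eq_zero_iff two_ne_zero |>.mp h) hg0
        · linarith
    constructor
    · rw [hu, show f^4 = (f^2)^2 by ring, show g^4 = (g^2)^2 by ring, hfin.1, hfin.2]; norm_num
    · rw [hv2, mul_pow, hfin.1, hfin.2]; norm_num
  have step2 : ∀ u v x y : ℤ, IsCoprime x y → x*y = v^4 → 0 ≤ x → 0 ≤ y → y - x = u^2-v^2 → v ≠ 0 →
      v.natAbs * u.natAbs ≤ e.natAbs → u^2 = 1 ∧ v^2 = 1 := by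
    intro u v x y hxy hv hx hy hd hv0 hle
    obtain ⟨g, rfl⟩ := pow4_of_mul hx hxy hv
    obtain ⟨f, rfl⟩ := pow4_of_mul hy hxy.symm (by rw [mul_comm]; exact hv)
    have hv2 : v^2 = (g*f)^2 := sq_eq_of_pow4 (by rw [← hv]; ring)
    have hfg : IsCoprime f g := ((IsCoprime.pow_iff (by norm_num) (by norm_num)).mp hxy).symm
    exact step u v g f hv.symm (by linarith) hfg hv0 hle
  have split : ∀ F G e' : ℤ, IsCoprime F G → F * G = 5 * e'^4 → 0 < F + G → e' ≠ 0 →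
      ∃ u v : ℤ, u^4+5*v^4 = F+G ∧ e'^2 = u^2*v^2 ∧ e'.natAbs = v.natAbs * u.natAbs := by
    intro F G e' hFG hp hs h0
    have hpos : 0 < F * G := by rw [hp]; positivity
    have hF : 0 ≤ F := by by_contra hneg; push Not at hneg; nlinarith
    have hG : 0 ≤ G := by by_contra hneg; push Not at hneg; nlinarith
    obtain ⟨u, v, h1⟩ := pow4_mul_prime prime5 (by norm_num) hF hG hFG hp
    rcases h1 with ⟨rfl, rfl⟩ | ⟨rfl, rfl⟩
    · have h2 : e'^2 = (v*u)^2 := sq_eq_of_pow4 (by linarith)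
      exact ⟨u, v, rfl, by rw [h2]; ring, by rw [← Int.natAbs_mul]; exact Int.natAbs_eq_iff_sq_eq.mpr h2⟩
    · have h2 : e'^2 = (u*v)^2 := sq_eq_of_pow4 (by linarith)
      exact ⟨v, u, by ring, by rw [h2]; ring, by rw [← Int.natAbs_mul]; exact Int.natAbs_eq_iff_sq_eq.mpr h2⟩
  -- a prime dividing both factors is 2
  have hNpar : N % 2 = 1 ∨ e % 2 = 0 := by
    by_contra hcon
    push Not at hcon
    have h1 : e % 2 = 1 := by omega
    have h2 : N % 2 = 0 := by omega
    have := int_sq_odd hModd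
    have := int_sq_odd h1
    have h3 : M^4+M^2*e^2-e^4 = (M^2)^2+M^2*e^2-(e^2)^2 := by ring
    rw [h3] at h
    have h4 := par_sq N
    have := par_sq (M^2); have := par_sq (e^2)
    have h5 : M^2*e^2 % 2 = 1 := by rw [Int.mul_emod]; simp [show M^2 % 2 = 1 by omega, show e^2 % 2 = 1 by omega]
    omega
  have hgcd : ∀ F G e' : ℤ, F * G = 5 * e'^4 → e' ∣ e → (∀ p, Prime p → p ∣ F + G → p ∣ e' → (2:ℤ) ∣ p ∨ p ∣ M) →
      ¬ ((2:ℤ) ∣ F ∧ (2:ℤ) ∣ G) → IsCoprime F G := by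
    intro F G e' hp hd hm h2
    apply cop_pr
    intro p hpr h3 h4
    have h5 : p^2 ∣ 5 * e'^4 := by rw [← hp, pow_two]; exact mul_dvd_mul h3 h4
    have h6 : p ∣ e' := by
      rcases hpr.dvd_or_dvd ((Dvd.intro_left p (by ring)).trans h5 : p ∣ 5*e'^4) with h6 | h6
      · have h7 := (hpr.dvd_prime_iff_associated prime5).mp h6
        have h8 : (5:ℤ)^2 ∣ 5 * e'^4 := (h7.pow_pow (n := 2)).dvd'.trans h5
        obtain ⟨w, hw⟩ := h8
        have h9 : (5:ℤ) ∣ e'^4 := ⟨w, by linarith⟩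
        exact h7.dvd.trans (prime5.dvd_of_dvd_pow h9)
      · exact hpr.dvd_of_dvd_pow h6
    rcases hm p hpr (dvd_add h3 h4) h6 with h7 | h7
    · exact h2 ⟨h7.trans h3, h7.trans h4⟩
    · exact pr_cop hc hpr h7 (h6.trans hd)
  have two_or : ∀ p : ℤ, Prime p → p ∣ 2 → (2:ℤ) ∣ p := fun p hp h => ((hp.dvd_prime_iff_associated Int.prime_two).mp h).dvd'
  by_cases hepar : e % 2 = 1
  · have hNodd : N % 2 = 1 := by omega
    have hprod : (2*M^2+e^2-2*N)*(2*M^2+e^2+2*N) = 5*e^4 := by rw [← sub_eq_zero] at h ⊢; linear_combination 4 * h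
    have hc1 : IsCoprime (2*M^2+e^2-2*N) (2*M^2+e^2+2*N) := by
      apply hgcd _ _ e hprod (dvd_refl _)
      · intro p hp h1 h2
        have h3 : p ∣ 2 * (2 * M^2) := by
          have := dvd_sub h1 (Dvd.dvd.mul_left (dvd_pow h2 two_ne_zero) 2)
          exact dvd_eq' this (by ring)
        rcases hp.dvd_or_dvd h3 with h4 | h4
        · exact Or.inl (two_or p hp h4)
        rcases hp.dvd_or_dvd h4 with h4 | h4
        · exact Or.inl (two_or p hp h4)
        · exact Or.inr (hp.dvd_of_dvd_pow h4)
      · have := int_sq_odd hepar; omega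
    obtain ⟨u, v, h1, h2, h3⟩ := split _ _ e hc1 hprod (by nlinarith [sq_nonneg e]) he0
    have hodd : u % 2 = 1 ∧ v % 2 = 1 := by
      have hm : (u^2*v^2) % 2 = 1 := by rw [← h2]; have := int_sq_odd hepar; omega
      have := par_sq u; have := par_sq v
      rcases Int.emod_two_eq_zero_or_one u with h5 | h5 <;> rcases Int.emod_two_eq_zero_or_one v with h6 | h6 <;>
        rw [Int.mul_emod] at hm <;> simp_all
    have hu8 := int_sq_odd hodd.1
    have hv8 := int_sq_odd hodd.2
    obtain ⟨k, hk⟩ : ∃ k, u^2-v^2 = 8*k := ⟨(u^2-v^2)/8, by omega⟩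
    have hM2 : M^2 = (4*k)^2+v^4 := by
      have : 4*M^2 = (u^2-v^2)^2+4*v^4 := by linear_combination -h1 - 2*h2
      rw [hk] at this; linarith
    have hv0 : v ≠ 0 := by rintro rfl; omega
    have hvpos : 0 < v^4 := by positivity
    have hMk := abs_lt_of_sq_lt_sq' (show (4*k)^2 < M^2 by linarith) hM.le
    have hc2 : IsCoprime (M-4*k) (M+4*k) := by
      apply cop_pr
      intro p hp h4 h5
      have h6 : p ∣ 2*M := dvd_eq' (dvd_add h4 h5) (by ring)
      have h7 : p ∣ v^4 := dvd_eq' (Dvd.dvd.mul_right h4 (M+4*k)) (by linarith)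
      rcases hp.dvd_or_dvd h6 with h8 | h8
      · have := (two_or p hp h8).trans h4; omega
      · refine pr_cop hc hp h8 (hp.dvd_of_dvd_pow (n := 2) ?_)
        rw [h2]; exact Dvd.dvd.mul_left (dvd_pow (hp.dvd_of_dvd_pow h7) two_ne_zero) _
    have hfin := step2 u v (M-4*k) (M+4*k) hc2 (by linarith) (by linarith) (by linarith) (by linarith) hv0 h3.ge
    refine ⟨by rw [h2, hfin.1, hfin.2]; norm_num, ?_⟩
    have hk0 : k = 0 := by rw [hfin.1, hfin.2] at hk; omega
    rw [hM2, hk0, show v^4 = (v^2)^2 by ring, hfin.2]; norm_num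
  · exfalso
    obtain ⟨e1, rfl⟩ : ∃ k, e = 2*k := ⟨e/2, by omega⟩
    have he1 : e1 ≠ 0 := by rintro rfl; simp at he0
    have hM8 := int_sq_odd hModd
    have hNodd : N % 2 = 1 := by
      have h3 : M^4+M^2*(2*e1)^2-(2*e1)^4 = (M^2)^2+2*(2*(M^2*e1^2) - 8*e1^4) := by ring
      rw [h3] at h
      have := par_sq N; have := par_sq (M^2); omega
    obtain ⟨N1, hN1⟩ : ∃ k, M^2 - N = 2*k := ⟨(M^2-N)/2, by omega⟩
    have hprod : (N1+e1^2)*(M^2-N1+e1^2) = 5*e1^4 := by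
      have : N = M^2-2*N1 := by linarith
      rw [this] at h
      linarith
    have hc1 : IsCoprime (N1+e1^2) (M^2-N1+e1^2) := by
      apply hgcd _ _ e1 hprod (Dvd.intro_left _ rfl)
      · intro p hp h1 h2
        have h3 : p ∣ M^2 := by
          have := dvd_sub h1 (Dvd.dvd.mul_left (dvd_pow h2 two_ne_zero) 2)
          exact dvd_eq' this (by ring)
        exact Or.inr (hp.dvd_of_dvd_pow h3)
      · omega
    obtain ⟨u, v, h1, h2, h3⟩ := split _ _ e1 hc1 hprod (by nlinarith [sq_nonneg e1]) he1
    have hM2 : M^2 = (u^2-v^2)^2+4*v^4 := by linear_combination -h1 - 2*h2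
    have hpar : (u^2-v^2) % 2 = 1 := by
      have := par_sq (u^2-v^2); omega
    obtain ⟨w, hw⟩ : ∃ w, M - (u^2-v^2) = 2*w := ⟨(M - (u^2-v^2))/2, by omega⟩
    have hv0 : v ≠ 0 := by rintro rfl; rw [Int.natAbs_zero, zero_mul] at h3; omega
    have hvpos : 0 < v^4 := by positivity
    have hMk := abs_lt_of_sq_lt_sq' (show (u^2-v^2)^2 < M^2 by linarith) hM.le
    have hww : w * (w + (u^2-v^2)) = v^4 := by
      have hM' : M = 2*w+(u^2-v^2) := by linarith
      rw [hM'] at hM2; linarith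
    have hc2 : IsCoprime w (w + (u^2-v^2)) := by
      apply cop_pr
      intro p hp h4 h5
      have h6 : p ∣ M := dvd_eq' (dvd_add h4 h5) (by linarith)
      have h7 : p ∣ v^4 := dvd_eq' (Dvd.dvd.mul_right h4 (w + (u^2-v^2))) hww
      refine pr_cop hc hp h6 (Dvd.dvd.mul_left (hp.dvd_of_dvd_pow (n := 2) ?_) 2)
      rw [h2]; exact Dvd.dvd.mul_left (dvd_pow (hp.dvd_of_dvd_pow h7) two_ne_zero) _
    have hfin := step2 u v w (w + (u^2-v^2)) hc2 hww (by linarith) (by linarith) (by ring) hv0 (by rw [← h3]; omega)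
    rw [hfin.1, hfin.2] at hpar
    norm_num at hpar

lemma two_or' {p : ℤ} (hp : Prime p) (h : p ∣ 2) : (2:ℤ) ∣ p :=
  ((hp.dvd_prime_iff_associated Int.prime_two).mp h).dvd'

/-- coprime factors of a square -/
lemma sq_split {a b Y : ℤ} (hc : IsCoprime a b) (ha : a ≠ 0) (h : a * b = Y^2) :
    ∃ s q : ℤ, (a = s^2 ∧ b = q^2) ∨ (a = -s^2 ∧ b = -q^2) := by
  obtain ⟨s, hs⟩ := Int.sq_of_isCoprime hc h
  have h0 : s ≠ 0 := by rintro rfl; simp at hs; exact ha hs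
  have key : ∀ c, s^2*c = Y^2 → ∃ q, c = q^2 := by
    intro c hc
    have h1 : s ∣ Y := by rw [← Int.pow_dvd_pow_iff (n := 2) (by norm_num)]; exact ⟨c, hc.symm⟩
    obtain ⟨q, rfl⟩ := h1
    exact ⟨q, mul_left_cancel₀ (pow_ne_zero 2 h0) (by rw [hc]; ring)⟩
  rcases hs with hs | hs
  · obtain ⟨q, hq⟩ := key b (by rw [← hs]; exact h)
    exact ⟨s, q, Or.inl ⟨hs, hq⟩⟩
  · obtain ⟨q, hq⟩ := key (-b) (by rw [← h, hs]; ring)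
    exact ⟨s, q, Or.inr ⟨hs, by linarith⟩⟩

lemma d_case1 (s q n : ℤ) (hn : n ≠ 0) (hs : s % 2 = 1) (hc : IsCoprime s n) (h : s^6-16*n^3 = q^2) : False := by
  have hq : q % 2 = 1 := by
    have := par_sq q; have := par_sq (s^3); have := par_cube s
    have : s^6 = (s^3)^2 := by ring
    omega
  have hs3 := par_cube s
  obtain ⟨w, hw⟩ : ∃ w, s^3 - q = 2*w := ⟨(s^3-q)/2, by omega⟩
  have hprod : w * (s^3 - w) = 4*n^3 := by
    have : q = s^3-2*w := by linarith
    rw [this] at h; linarith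
  have hcw : IsCoprime w (s^3-w) := by
    apply cop_pr
    intro p hp h1 h2
    have h3 : p ∣ s^3 := dvd_eq' (dvd_add h1 h2) (by ring)
    have h4 : p ∣ 4*n^3 := by rw [← hprod]; exact Dvd.dvd.mul_right h1 _
    have h5 := hp.dvd_of_dvd_pow h3
    rcases hp.dvd_or_dvd h4 with h6 | h6
    · have h7 : p ∣ 2 := hp.dvd_of_dvd_pow (n := 2) (by norm_num; exact h6)
      have := (two_or' hp h7).trans h5
      omega
    · exact pr_cop hc hp h5 (hp.dvd_of_dvd_pow h6)
  have fin : ∀ w w', IsCoprime w w' → w * w' = 4*n^3 → w + w' = s^3 → w % 2 = 0 → False := by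
    intro w w' hc' hp hsum hpar
    have hw' : w' % 2 = 1 := by omega
    obtain ⟨k, rfl⟩ : ∃ k, w = 4*k := by
      have h1 : IsCoprime (4:ℤ) w' := by
        have : IsCoprime (2:ℤ) w' := (Prime.coprime_iff_not_dvd Int.prime_two).mpr (by omega)
        have := this.pow_left (m := 2)
        norm_num at this; exact this
      obtain ⟨k, hk⟩ := h1.dvd_of_dvd_mul_right ⟨_, hp⟩
      exact ⟨k, hk⟩
    have h1 : k * w' = n^3 := by linarith
    obtain ⟨⟨u, hu⟩, ⟨v, hv⟩⟩ := Int.eq_pow_of_mul_eq_pow_odd hc'.of_mul_left_right (by decide) h1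
    have hsv : IsCoprime s (-v) := by
      apply IsCoprime.neg_right
      apply cop_pr
      intro p hp h2 h3
      refine pr_cop hc hp h2 (hp.dvd_of_dvd_pow (n := 3) ?_)
      rw [← h1, hv]; exact Dvd.dvd.mul_left (dvd_pow h3 (by norm_num)) _
    have := cub4 _ s (-v) u le_rfl hsv (by rw [show (-v)^3 = -v^3 by ring, ← hv, ← hu]; linarith)
    subst this
    apply hn
    have : n^3 = 0 := by rw [← h1, hu]; ring
    exact pow_eq_zero_iff (by norm_num) |>.mp this
  rcases Int.emod_two_eq_zero_or_one w with h1 | h1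
  · exact fin w (s^3-w) hcw hprod (by ring) h1
  · exact fin (s^3-w) w hcw.symm (by rw [mul_comm]; exact hprod) (by ring) (by omega)

lemma d_case2 (s q n : ℤ) (hs : s ≠ 0) (hn : n % 2 = 1) (hc : IsCoprime s n) (h : 4*s^6-n^3 = q^2) : False := by
  have hq : q % 2 = 1 := by
    have := par_sq q; have := par_cube n
    omega
  have hprod : (2*s^3-q)*(2*s^3+q) = n^3 := by linarith
  have hcw : IsCoprime (2*s^3-q) (2*s^3+q) := by
    apply cop_pr
    intro p hp h1 h2
    have h3 : p ∣ 4*s^3 := dvd_eq' (dvd_add h1 h2) (by ring)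
    have h4 : p ∣ n^3 := by rw [← hprod]; exact Dvd.dvd.mul_right h1 _
    have h5 := hp.dvd_of_dvd_pow h4
    rcases hp.dvd_or_dvd h3 with h6 | h6
    · have h7 : p ∣ 2 := hp.dvd_of_dvd_pow (n := 2) (by norm_num; exact h6)
      have := (two_or' hp h7).trans h5
      omega
    · exact pr_cop hc hp (hp.dvd_of_dvd_pow h6) h5
  obtain ⟨⟨u, hu⟩, ⟨v, hv⟩⟩ := Int.eq_pow_of_mul_eq_pow_odd hcw (by decide) hprod
  rw [hu, hv, IsCoprime.pow_iff (by norm_num) (by norm_num)] at hcw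
  exact hs (cub4 _ u v s le_rfl hcw (by linarith))

lemma d_not_sq (m n Y : ℤ) (hm : m ≠ 0) (hn : n ≠ 0) (hc : IsCoprime m n) (h : m^4-16*m*n^3 = Y^2) : False := by
  rcases Int.emod_two_eq_zero_or_one m with hpar | hpar
  · have hnodd : n % 2 = 1 := by
      by_contra hcon
      exact pr_cop hc Int.prime_two (by omega) (by omega)
    have hn2 : IsCoprime n 2 := ((Prime.coprime_iff_not_dvd Int.prime_two).mpr (by omega)).symm
    obtain ⟨m1, rfl⟩ : ∃ k, m = 2*k := ⟨m/2, by omega⟩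
    have hm1 : m1 ≠ 0 := by rintro rfl; simp at hm
    obtain ⟨Y1, rfl⟩ : ∃ k, Y = 4*k := by
      have : (4:ℤ)^2 ∣ Y^2 := ⟨m1^4-2*m1*n^3, by rw [← h]; ring⟩
      rw [Int.pow_dvd_pow_iff (by norm_num)] at this
      exact this
    have h1 : m1*(m1^3-2*n^3) = Y1^2 := by linarith
    have c1 : IsCoprime m1 n := hc.of_mul_left_right
    rcases Int.emod_two_eq_zero_or_one m1 with hpar | hpar
    · obtain ⟨m2, rfl⟩ : ∃ k, m1 = 2*k := ⟨m1/2, by omega⟩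
      have hm2 : m2 ≠ 0 := by rintro rfl; simp at hm1
      obtain ⟨Y2, rfl⟩ : ∃ k, Y1 = 2*k := by
        have : (2:ℤ)^2 ∣ Y1^2 := ⟨4*m2^4-m2*n^3, by rw [← h1]; ring⟩
        rw [Int.pow_dvd_pow_iff (by norm_num)] at this
        exact this
      have h2 : m2*(4*m2^3-n^3) = Y2^2 := by linarith
      have c2 : IsCoprime m2 n := c1.of_mul_left_right
      have c3 : IsCoprime m2 (4*m2^3-n^3) :=
        cop_eq' ((c2.pow_right (n := 3)).neg_right.add_mul_left_right (4*m2^2)) (by ring)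
      obtain ⟨s, q, ⟨hs, hq⟩ | ⟨hs, hq⟩⟩ := sq_split c3 hm2 h2
      · refine d_case2 s q n (by rintro rfl; simp at hs; exact hm2 hs) hnodd ?_ (by rw [← hq, hs]; ring)
        rw [hs, IsCoprime.pow_left_iff (by norm_num)] at c2; exact c2
      · refine d_case2 s q (-n) (by rintro rfl; simp at hs; exact hm2 hs) (by omega) ?_ ?_
        · rw [hs, IsCoprime.neg_left_iff, IsCoprime.pow_left_iff (by norm_num)] at c2; exact c2.neg_right
        · rw [hs] at hq; linarith
    · have c3 : IsCoprime m1 (m1^3-2*n^3) := by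
        have h2 : IsCoprime m1 2 := ((Prime.coprime_iff_not_dvd Int.prime_two).mpr (by omega)).symm
        exact cop_eq' ((h2.mul_right (c1.pow_right (n := 3))).neg_right.add_mul_left_right (m1^2)) (by ring)
      have fin : ∀ s q n : ℤ, s % 2 = 1 → n % 2 = 1 → s^6-2*n^3 = q^2 → False := by
        intro s q n hs hn h
        have h1 := par_cube s
        have h2 := par_cube n
        have h3 := int_sq_odd (show s^3 % 2 = 1 by omega)
        have h6 : s^6 = (s^3)^2 := by ring
        have h4 : q % 2 = 1 := by have := par_sq q; omega
        have := int_sq_odd h4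
        omega
      obtain ⟨s, q, ⟨hs, hq⟩ | ⟨hs, hq⟩⟩ := sq_split c3 hm1 h1
      · exact fin s q n (by have := par_sq s; omega) hnodd (by rw [← hq, hs]; ring)
      · exact fin s q (-n) (by have := par_sq s; omega) (by omega) (by rw [hs] at hq; linarith)
  · have h1 : m*(m^3-16*n^3) = Y^2 := by linarith
    have c3 : IsCoprime m (m^3-16*n^3) := by
      have h2 : IsCoprime m 2 := ((Prime.coprime_iff_not_dvd Int.prime_two).mpr (by omega)).symm
      exact cop_eq' (((h2.pow_right (n := 4)).mul_right (hc.pow_right (n := 3))).neg_right.add_mul_left_right (m^2)) (by ring)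
    obtain ⟨s, q, ⟨hs, hq⟩ | ⟨hs, hq⟩⟩ := sq_split c3 hm h1
    · refine d_case1 s q n hn (by have := par_sq s; omega) ?_ (by rw [← hq, hs]; ring)
      rw [hs, IsCoprime.pow_left_iff (by norm_num)] at hc; exact hc
    · refine d_case1 s q (-n) (by omega) (by have := par_sq s; omega) ?_ (by rw [hs] at hq; linarith)
      rw [hs, IsCoprime.neg_left_iff, IsCoprime.pow_left_iff (by norm_num)] at hc; exact hc.neg_right

lemma b_not_sq (m n Y : ℤ) (hm : m ≠ 0) (hn : n ≠ 0) (hc : IsCoprime m n) (hmn : m ≠ n)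
    (h : m^4+4*n^2*(m-n)^2 = Y^2) : False := by
  wlog hY : 0 < Y generalizing Y
  · have h0 : Y ≠ 0 := by
      rintro rfl
      have : 0 < m^4 := by positivity
      nlinarith [mul_nonneg (sq_nonneg n) (sq_nonneg (m-n))]
    exact this (-Y) (by rw [h]; ring) (by omega)
  rcases Int.emod_two_eq_zero_or_one m with hpar | hpar
  · have hnodd : n % 2 = 1 := by
      by_contra hcon
      exact pr_cop hc Int.prime_two (by omega) (by omega)
    obtain ⟨m1, rfl⟩ : ∃ k, m = 2*k := ⟨m/2, by omega⟩
    have hm1 : m1 ≠ 0 := by rintro rfl; simp at hm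
    obtain ⟨Y1, rfl⟩ : ∃ k, Y = 2*k := by
      have : (2:ℤ)^2 ∣ Y^2 := ⟨4*m1^4+n^2*(2*m1-n)^2, by rw [← h]; ring⟩
      rw [Int.pow_dvd_pow_iff (by norm_num)] at this
      exact this
    have h1 : 4*m1^4+(n*(2*m1-n))^2 = Y1^2 := by linarith
    have hNodd : (n*(2*m1-n)) % 2 = 1 := by
      rw [Int.mul_emod, hnodd, show (2*m1-n) % 2 = 1 by omega]; rfl
    set N := n*(2*m1-n) with hN
    have hY1 : Y1 % 2 = 1 := by have := par_sq Y1; have := par_sq N; omega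
    obtain ⟨w, hw⟩ : ∃ w, Y1 - N = 2*w := ⟨(Y1-N)/2, by omega⟩
    have hprod : w * (w+N) = m1^4 := by
      have : Y1 = 2*w+N := by linarith
      rw [this] at h1; linarith
    have hcw : IsCoprime w (w+N) := by
      apply cop_pr
      intro p hp h2 h3
      have h4 : p ∣ N := dvd_eq' (dvd_sub h3 h2) (by ring)
      have h5 : p ∣ m1 := hp.dvd_of_dvd_pow (n := 4) (by rw [← hprod]; exact Dvd.dvd.mul_right h2 _)
      have h6 : p ∣ n^2 := dvd_eq' (dvd_sub (Dvd.dvd.mul_left h5 (2*n)) h4) (by rw [hN]; ring)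
      exact pr_cop hc hp (Dvd.dvd.mul_left h5 _) (hp.dvd_of_dvd_pow h6)
    have hpos : 0 < m1^4 := by positivity
    have hlt := abs_lt_of_sq_lt_sq' (show N^2 < Y1^2 by linarith) (by linarith)
    obtain ⟨g, hg⟩ := pow4_of_mul (by linarith) hcw hprod
    obtain ⟨f, hf⟩ := pow4_of_mul (by linarith) hcw.symm (by rw [mul_comm]; exact hprod)
    have hfg : IsCoprime g f := by
      rw [hg, show g^4+N = f^4 by rw [← hf, hg]] at hcw
      exact (IsCoprime.pow_iff (by norm_num) (by norm_num)).mp hcw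
    have hm2 : m1^2 = (g*f)^2 := sq_eq_of_pow4 (by rw [← hprod, hf, hg]; ring)
    have hq : g^4+g^2*f^2-f^4 = (n-m1)^2 := by
      have : g^2*f^2 = m1^2 := by rw [hm2]; ring
      rw [this, ← hg, ← hf, hN]; ring
    rcases quart _ g f _ le_rfl hfg hq with rfl | ⟨hf2, hg2⟩
    · simp at hm2; exact hm1 hm2
    · have : N = 0 := by
        have h3 : f^4 = (f^2)^2 := by ring
        have h4 : g^4 = (g^2)^2 := by ring
        rw [hf2] at h3; rw [hg2] at h4; linarith
      omega
  · have hY2 : Y % 2 = 1 := by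
      have h3 : m^4+4*n^2*(m-n)^2 = (m^2)^2 + 2*(2*n^2*(m-n)^2) := by ring
      have := par_sq Y; have := par_sq (m^2); have := par_sq m; omega
    have hm8 := int_sq_odd hpar
    obtain ⟨w, hw⟩ : ∃ w, Y - m^2 = 2*w := ⟨(Y-m^2)/2, by omega⟩
    have hprod : w * (w+m^2) = (n*(m-n))^2 := by
      have : Y = 2*w+m^2 := by linarith
      rw [this] at h; linarith
    have hcw : IsCoprime w (w+m^2) := by
      apply cop_pr
      intro p hp h2 h3
      have h4 : p ∣ m := hp.dvd_of_dvd_pow (n := 2) (dvd_eq' (dvd_sub h3 h2) (by ring))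
      have h5 : p ∣ n*(m-n) := hp.dvd_of_dvd_pow (n := 2) (by rw [← hprod]; exact Dvd.dvd.mul_right h2 _)
      have h6 : p ∣ n^2 := dvd_eq' (dvd_sub (Dvd.dvd.mul_left h4 n) h5) (by ring)
      exact pr_cop hc hp h4 (hp.dvd_of_dvd_pow h6)
    have hnz : 0 < (n*(m-n))^2 := by
      have : m - n ≠ 0 := sub_ne_zero.mpr hmn
      positivity
    have hm2 : 0 < m^2 := by positivity
    have hw0 : w ≠ 0 := by rintro rfl; linarith
    have hlt := abs_lt_of_sq_lt_sq' (show (m^2)^2 < Y^2 by linarith) (by linarith)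
    obtain ⟨p, q, ⟨hp, hq⟩ | ⟨hp, hq⟩⟩ := sq_split hcw hw0 hprod
    swap
    · nlinarith [sq_nonneg p]
    wlog hq0 : 0 ≤ q generalizing q
    · exact this (-q) (by rw [hq]; ring) (by omega)
    have hpq : IsCoprime p q := by
      rw [hq, hp, IsCoprime.pow_iff (by norm_num) (by norm_num)] at hcw; exact hcw
    have h1 : (q-p)*(q+p) = m^2 := by rw [hp] at hq; linarith
    have hqp : p^2 < q^2 := by linarith
    have hlt2 := abs_lt_of_sq_lt_sq' hqp hq0
    have hodd : (q-p) % 2 = 1 := by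
      have h2 : ((q-p)*(q+p)) % 2 = 1 := by rw [h1]; omega
      rcases Int.emod_two_eq_zero_or_one (q-p) with h3 | h3
      · rw [Int.mul_emod, h3] at h2; simp at h2
      · exact h3
    have c2 : IsCoprime (q-p) (q+p) := by
      apply cop_pr
      intro r hr h2 h3
      have h4 : r ∣ 2*q := dvd_eq' (dvd_add h2 h3) (by ring)
      have h5 : r ∣ 2*p := dvd_eq' (dvd_sub h3 h2) (by ring)
      rcases hr.dvd_or_dvd h4 with h6 | h6
      · have := (two_or' hr h6).trans h2; omega
      rcases hr.dvd_or_dvd h5 with h7 | h7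
      · have := (two_or' hr h7).trans h2; omega
      exact pr_cop hpq hr h7 h6
    obtain ⟨t, s, ⟨ht, hs⟩ | ⟨ht, hs⟩⟩ := sq_split c2 (by omega) h1
    swap
    · nlinarith [sq_nonneg t]
    have hts : IsCoprime t s := by
      rw [ht, hs, IsCoprime.pow_iff (by norm_num) (by norm_num)] at c2; exact c2
    have hm3 : m^2 = t^2*s^2 := by rw [← h1, ht, hs]
    have h4 : 4 * (p*q) = s^4-t^4 := by
      rw [show s^4 = (s^2)^2 by ring, show t^4 = (t^2)^2 by ring, ← hs, ← ht]; ring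
    have h5 : (p*q)^2 = (n*(m-n))^2 := by rw [mul_pow, ← hp, ← hq]; exact hprod
    have fin : ∀ t s, IsCoprime t s → m^2 = t^2*s^2 → t^4+t^2*s^2-s^4=(2*n-m)^2 → False := by
      intro t s hts hm3 h6
      rcases quart _ t s _ le_rfl hts h6 with rfl | ⟨hf2, hg2⟩
      · nlinarith
      · have h7 : (2*n-m)^2 = 1 := by
          rw [← h6, show t^4 = (t^2)^2 by ring, show s^4 = (s^2)^2 by ring, hf2, hg2]; norm_num
        have h8 : m^2 = 1 := by rw [hm3, hf2, hg2]; norm_num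
        have : n*(m-n) = 0 := by linarith
        rw [this] at hnz; norm_num at hnz
    rcases sq_eq_sq_iff_eq_or_eq_neg.mp h5 with h6 | h6
    · exact fin t s hts hm3 (by rw [← hm3]; linarith)
    · exact fin s t hts.symm (by rw [hm3]; ring) (by rw [mul_comm, ← hm3]; linarith)

lemma sqf_dvd {s N : ℕ} (hs : Squarefree s) (hN : N ≠ 0) (h : ∀ p : ℕ, p.Prime → p ∣ s → p ∣ N) : s ∣ N := by
  rw [← Nat.prod_primeFactors_of_squarefree hs]
  refine dvd_trans (Finset.prod_dvd_prod_of_subset _ N.primeFactors _ ?_) (Nat.prod_primeFactors_dvd N)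
  intro p hp
  rw [Nat.mem_primeFactors] at hp ⊢
  exact ⟨hp.1, h p hp.1 hp.2.1, hN⟩

lemma sqcls (N : ℕ) {X Y Z : ℤ} (hN : N ≠ 0) (hX : 0 < X) (hY : 0 < Y) (h : X * Y = Z^2)
    (hp : ∀ p : ℕ, p.Prime → (p:ℤ) ∣ X → (p:ℤ) ∣ Y → p ∣ N) :
    ∃ s : ℕ, s ∣ N ∧ ∃ α β : ℤ, X = s * α^2 ∧ Y = s * β^2 := by
  obtain ⟨x, y, hc, h1, h2⟩ : ∃ x y : ℤ, IsCoprime x y ∧ X = (Int.gcd X Y) * x ∧ Y = (Int.gcd X Y) * y := by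
    obtain ⟨x, hx⟩ := Int.gcd_dvd_left X Y
    obtain ⟨y, hy⟩ := Int.gcd_dvd_right X Y
    refine ⟨x, y, ?_, hx, hy⟩
    have hg : (Int.gcd X Y : ℤ) ≠ 0 := by intro h0; rw [h0] at hx; simp at hx; omega
    have := Int.gcd_eq_gcd_ab X Y
    refine ⟨Int.gcdA X Y, Int.gcdB X Y, ?_⟩
    apply mul_left_cancel₀ hg
    rw [mul_one]
    calc (Int.gcd X Y : ℤ) * (X.gcdA Y * x + X.gcdB Y * y) = (Int.gcd X Y * x) * X.gcdA Y + (Int.gcd X Y * y) * X.gcdB Y := by ring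
      _ = _ := by rw [← hx, ← hy, ← this]
  set g := Int.gcd X Y with hg
  have hg0 : (g:ℤ) ≠ 0 := by intro h0; rw [h0] at h1; simp at h1; omega
  have hgp : 0 < (g:ℤ) := by positivity
  have hx : 0 < x := by rw [h1] at hX; exact (mul_pos_iff_of_pos_left hgp).1 hX
  have hgZ : (g:ℤ) ∣ Z := by
    rw [← Int.pow_dvd_pow_iff (n := 2) (by norm_num)]
    exact ⟨x*y, by rw [← h]; nth_rewrite 1 [h1]; nth_rewrite 1 [h2]; ring⟩
  obtain ⟨w, hw⟩ := hgZ
  have hxy : x * y = w^2 := by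
    apply mul_left_cancel₀ (pow_ne_zero 2 hg0)
    calc (g:ℤ)^2*(x*y) = (g*x)*(g*y) := by ring
      _ = Z^2 := by rw [← h1, ← h2, h]
      _ = _ := by rw [hw]; ring
  obtain ⟨a, b, hab⟩ := sq_split hc hx.ne' hxy
  obtain ⟨ha, hb⟩ : x = a^2 ∧ y = b^2 := by
    rcases hab with hab | hab
    · exact hab
    · nlinarith [sq_nonneg a, hab.1]
  obtain ⟨s, t, hst, hs⟩ := Nat.sq_mul_squarefree g
  have hgs : (g:ℤ) = s * t^2 := by rw [← hst]; push_cast; ring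
  refine ⟨s, ?_, t*a, t*b, by rw [h1, hgs, ha]; ring, by rw [h2, hgs, hb]; ring⟩
  apply sqf_dvd hs hN
  intro p hpp hps
  have hpg : (p:ℤ) ∣ g := by rw [hgs]; exact Dvd.dvd.mul_right (by exact_mod_cast hps) _
  exact hp p hpp (hpg.trans (Int.gcd_dvd_left X Y)) (hpg.trans (Int.gcd_dvd_right X Y))

lemma AB_pr {p : ℤ} (hp : Prime p) {m n : ℤ} (hc : IsCoprime m n) (h1 : p ∣ m^2+4*n^2)
    (h2 : p ∣ m^4+4*n^2*(m-n)^2) : p ∣ 34 := by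
  have hn : ¬ p ∣ n := fun h => pr_cop hc hp (hp.dvd_of_dvd_pow (n := 2)
    (dvd_eq' (dvd_sub h1 (Dvd.dvd.mul_left h (4*n))) (by ring))) h
  have h3 : p ∣ 2^2*(n^3*(n-2*m)) := dvd_eq' (dvd_sub h2 (Dvd.dvd.mul_right h1 (m^2))) (by ring)
  rcases hp.dvd_or_dvd h3 with h | h
  · exact (hp.dvd_of_dvd_pow h).trans (by norm_num)
  rcases hp.dvd_or_dvd h with h | h
  · exact absurd (hp.dvd_of_dvd_pow h) hn
  have h4 : p ∣ 17*m^2 := dvd_eq' (dvd_sub h1 (Dvd.dvd.mul_right h (4*n+8*m))) (by ring)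
  rcases hp.dvd_or_dvd h4 with h5 | h5
  · exact h5.trans (by norm_num)
  · have h6 := hp.dvd_of_dvd_pow h5
    exact absurd (dvd_eq' (dvd_add h (Dvd.dvd.mul_left h6 2)) (by ring)) hn

lemma AD_pr {p : ℤ} (hp : Prime p) {m n : ℤ} (hc : IsCoprime m n) (h1 : p ∣ m^2+4*n^2)
    (h2 : p ∣ m^4-16*m*n^3) : p ∣ 10 := by
  have hn : ¬ p ∣ n := fun h => pr_cop hc hp (hp.dvd_of_dvd_pow (n := 2)
    (dvd_eq' (dvd_sub h1 (Dvd.dvd.mul_left h (4*n))) (by ring))) h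
  have h3 : p ∣ 2^4*(n^3*(n-m)) := dvd_eq' (dvd_sub h2 (Dvd.dvd.mul_right h1 (m^2-4*n^2))) (by ring)
  rcases hp.dvd_or_dvd h3 with h | h
  · exact (hp.dvd_of_dvd_pow h).trans (by norm_num)
  rcases hp.dvd_or_dvd h with h | h
  · exact absurd (hp.dvd_of_dvd_pow h) hn
  have h4 : p ∣ 5*n^2 := dvd_eq' (dvd_add h1 (Dvd.dvd.mul_right h (m+n))) (by ring)
  rcases hp.dvd_or_dvd h4 with h5 | h5
  · exact h5.trans (by norm_num)
  · exact absurd (hp.dvd_of_dvd_pow h5) hn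

lemma BD_pr {p : ℤ} (hp : Prime p) {m n : ℤ} (hc : IsCoprime m n) (h1 : p ∣ m^4+4*n^2*(m-n)^2)
    (h2 : p ∣ m^4-16*m*n^3) : p ∣ 34 := by
  have hn : ¬ p ∣ n := fun h => pr_cop hc hp (hp.dvd_of_dvd_pow (n := 4)
    (dvd_eq' (dvd_add h2 (Dvd.dvd.mul_left h (16*m*n^2))) (by ring))) h
  have h3 : p ∣ 2^2*(n^2*(m+n)^2) := dvd_eq' (dvd_sub h1 h2) (by ring)
  rcases hp.dvd_or_dvd h3 with h | h
  · exact (hp.dvd_of_dvd_pow h).trans (by norm_num)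
  rcases hp.dvd_or_dvd h with h | h
  · exact absurd (hp.dvd_of_dvd_pow h) hn
  replace h := hp.dvd_of_dvd_pow h
  have h4 : p ∣ 17*n^4 := dvd_eq' (dvd_sub h2 (Dvd.dvd.mul_right h (m^3-m^2*n+m*n^2-17*n^3))) (by ring)
  rcases hp.dvd_or_dvd h4 with h5 | h5
  · exact h5.trans (by norm_num)
  · exact absurd (hp.dvd_of_dvd_pow h5) hn

lemma cop_odd {m n : ℤ} (hc : IsCoprime m n) (hm : m % 2 = 0) : n % 2 = 1 := by
  by_contra h
  exact pr_cop hc Int.prime_two (Int.dvd_of_emod_eq_zero hm) (Int.dvd_of_emod_eq_zero (by omega))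

lemma par_mul (a b : ℤ) : a*b % 2 = (a % 2) * (b % 2) := by
  rcases Int.emod_two_eq_zero_or_one a with h | h <;> rcases Int.emod_two_eq_zero_or_one b with h' | h' <;>
    simp [Int.mul_emod, h, h']

lemma odd_mul_even {t b : ℤ} (ht : t % 2 = 1) (h : t*b % 2 = 0) : b % 2 = 0 := by
  rw [par_mul, ht, one_mul] at h; exact h

lemma B_even {m n t β : ℤ} (hc : IsCoprime m n) (ht : t % 2 = 1) (h : m^4+4*n^2*(m-n)^2 = 2*t*β^2) : False := by
  have hm : m % 2 = 0 := by
    have h1 := par_sq (m^2); have h2 := par_sq m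
    have : m^4 = (m^2)^2 := by ring
    have h3 : 4*n^2*(m-n)^2 = 4*(n^2*(m-n)^2) := by ring
    have h4 : 2*t*β^2 = 2*(t*β^2) := by ring
    omega
  have hn := cop_odd hc hm
  obtain ⟨k, rfl⟩ : ∃ k, m = 2*k := ⟨m/2, by omega⟩
  have h1 : t*β^2 = 2*(4*k^4+(n*(2*k-n))^2) := by linarith
  have h2 := odd_mul_even ht (by omega : t*β^2 % 2 = 0)
  rw [par_sq] at h2
  obtain ⟨b, rfl⟩ : ∃ b, β = 2*b := ⟨β/2, by omega⟩
  have h3 : 2*(t*b^2) = 4*k^4+(n*(2*k-n))^2 := by linarith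
  have h4 := par_sq (n*(2*k-n))
  have h5 := par_mul n (2*k-n)
  have h6 : (2*k-n) % 2 = 1 := by omega
  rw [hn, h6] at h5
  omega

lemma AD_even {m n t k α β : ℤ} (hc : IsCoprime m n) (ht : t % 2 = 1) (hk : k % 2 = 1)
    (h : m^2+4*n^2 = 2*t*α^2) (h' : k*(m^4-16*m*n^3) = 2*t*β^2) : False := by
  have hm : m % 2 = 0 := by
    have h2 := par_sq m
    have h4 : 2*t*α^2 = 2*(t*α^2) := by ring
    omega
  have hn := cop_odd hc hm
  obtain ⟨l, rfl⟩ : ∃ l, m = 2*l := ⟨m/2, by omega⟩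
  have h1 : t*α^2 = 2*(l^2+n^2) := by linarith
  have h2 := odd_mul_even ht (by omega : t*α^2 % 2 = 0)
  rw [par_sq] at h2
  obtain ⟨b, rfl⟩ : ∃ b, α = 2*b := ⟨α/2, by omega⟩
  have h3 : 2*(t*b^2) = l^2+n^2 := by linarith
  have hl : l % 2 = 1 := by have := par_sq l; have := par_sq n; omega
  have h4 : t*β^2 = 2*(4*(k*(l*(l^3-2*n^3)))) := by linarith
  have h5 := odd_mul_even ht (by omega : t*β^2 % 2 = 0)
  rw [par_sq] at h5
  obtain ⟨c, rfl⟩ : ∃ b, β = 2*b := ⟨β/2, by omega⟩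
  have h6 : t*c^2 = 2*(k*(l*(l^3-2*n^3))) := by linarith
  have h7 := odd_mul_even ht (by omega : t*c^2 % 2 = 0)
  rw [par_sq] at h7
  obtain ⟨d, rfl⟩ : ∃ b, c = 2*b := ⟨c/2, by omega⟩
  have h8 : 2*(t*d^2) = (k*(l*(l^3-2*n^3))) := by linarith
  have h9 : (l^3-2*n^3) % 2 = 1 := by have := par_cube l; omega
  have h10 := par_mul k (l*(l^3-2*n^3))
  rw [par_mul l, h9, hl, hk] at h10
  omega

lemma B_pos {m n : ℤ} (hm : m ≠ 0) : 0 < m^4+4*n^2*(m-n)^2 := by positivity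
lemma A_pos {m n : ℤ} (hm : m ≠ 0) : 0 < m^2+4*n^2 := by positivity

lemma pos_of_sq {X Y Z : ℤ} (hX : 0 < X) (hY : Y ≠ 0) (h : X*Y = Z^2) : 0 < Y := by
  rcases lt_or_gt_of_ne hY with h1 | h1
  · nlinarith [sq_nonneg Z, mul_pos hX (neg_pos.2 h1)]
  · exact h1

lemma div34 {s : ℕ} (h : s ∣ 34) : s = 1 ∨ s = 17 ∨ ∃ t : ℤ, t % 2 = 1 ∧ (s:ℤ) = 2*t := by
  have h1 : s ≤ 34 := Nat.le_of_dvd (by norm_num) h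
  interval_cases s <;> first | (exfalso; revert h; decide) | (left; rfl) | (right; left; rfl) | skip
  · right; right; exact ⟨1, by norm_num⟩
  · right; right; exact ⟨17, by norm_num⟩

lemma intpr {p : ℕ} (hp : p.Prime) : Prime (p:ℤ) := Nat.prime_iff_prime_int.mp hp

/-- `ab` a square -/
lemma ab_red {m n Y : ℤ} (hm : m ≠ 0) (hn : n ≠ 0) (hc : IsCoprime m n) (hmn : m ≠ n)
    (h : (m^2+4*n^2)*(m^4+4*n^2*(m-n)^2) = Y^2) :
    ∃ α β : ℤ, m^2+4*n^2 = 17*α^2 ∧ m^4+4*n^2*(m-n)^2 = 17*β^2 := by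
  obtain ⟨s, hs, α, β, h1, h2⟩ := sqcls 34 (by norm_num) (A_pos hm) (B_pos hm) h
    (fun p hp h1 h2 => by exact_mod_cast AB_pr (intpr hp) hc h1 h2)
  rcases div34 hs with rfl | rfl | ⟨t, ht, hst⟩
  · exact (b_not_sq m n β hm hn hc hmn (by rw [h2]; push_cast; ring)).elim
  · exact ⟨α, β, by exact_mod_cast h1, by exact_mod_cast h2⟩
  · rw [hst] at h2; exact (B_even hc ht h2).elim

lemma D_ne {m n : ℤ} (hm : m ≠ 0) (hn : n ≠ 0) (hc : IsCoprime m n) : m^4-16*m*n^3 ≠ 0 :=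
  fun h => d_not_sq m n 0 hm hn hc (by rw [h]; norm_num)

lemma bd_red {m n Y : ℤ} (hm : m ≠ 0) (hn : n ≠ 0) (hc : IsCoprime m n) (hmn : m ≠ n)
    (h : (m^4+4*n^2*(m-n)^2)*(m^4-16*m*n^3) = Y^2) :
    ∃ α β : ℤ, m^4-16*m*n^3 = 17*α^2 ∧ m^4+4*n^2*(m-n)^2 = 17*β^2 := by
  obtain ⟨s, hs, α, β, h1, h2⟩ := sqcls 34 (by norm_num) (B_pos hm) (pos_of_sq (B_pos hm) (D_ne hm hn hc) h) h
    (fun p hp h1 h2 => by exact_mod_cast BD_pr (intpr hp) hc h1 h2)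
  rcases div34 hs with rfl | rfl | ⟨t, ht, hst⟩
  · exact (b_not_sq m n α hm hn hc hmn (by rw [h1]; push_cast; ring)).elim
  · exact ⟨β, α, by exact_mod_cast h2, by exact_mod_cast h1⟩
  · rw [hst] at h1; exact (B_even hc ht h1).elim

lemma div170 {s : ℕ} (h : s ∣ 170) : s = 1 ∨ s = 17 ∨ (5 ∣ s) ∨ ∃ t : ℤ, t % 2 = 1 ∧ (s:ℤ) = 2*t := by
  have h1 : s ≤ 170 := Nat.le_of_dvd (by norm_num) h
  have h2 : s ∈ Nat.divisors 170 := by simp [h]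
  rw [show Nat.divisors 170 = {1,2,5,10,17,34,85,170} by decide] at h2
  simp only [Finset.mem_insert, Finset.mem_singleton] at h2
  rcases h2 with rfl | rfl | rfl | rfl | rfl | rfl | rfl | rfl
  · simp
  · right; right; right; exact ⟨1, by norm_num⟩
  · right; right; left; norm_num
  · right; right; left; norm_num
  · simp
  · right; right; right; exact ⟨17, by norm_num⟩
  · right; right; left; norm_num
  · right; right; left; norm_num

lemma abd_red {m n Y : ℤ} (hm : m ≠ 0) (hn : n ≠ 0) (hc : IsCoprime m n) (hmn : m ≠ n)
    (hA : ∀ α, m^2+4*n^2 ≠ α^2)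
    (h : (m^2+4*n^2)*(m^4+4*n^2*(m-n)^2)*(m^4-16*m*n^3) = Y^2) : False := by
  have hAB : 0 < (m^2+4*n^2)*(m^4+4*n^2*(m-n)^2) := mul_pos (A_pos hm) (B_pos hm)
  have hD := pos_of_sq hAB (D_ne hm hn hc) h
  obtain ⟨s, hs, α, β, h1, h2⟩ := sqcls (X := m^4+4*n^2*(m-n)^2) (Y := (m^2+4*n^2)*(m^4-16*m*n^3)) (Z := Y)
    34 (by norm_num) (B_pos hm) (mul_pos (A_pos hm) hD) (by rw [← h]; ring)
    (fun p hp h1 h2 => by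
      rcases (intpr hp).dvd_or_dvd h2 with h3 | h3
      · exact_mod_cast AB_pr (intpr hp) hc h3 h1
      · exact_mod_cast BD_pr (intpr hp) hc h1 h3)
  rcases div34 hs with rfl | rfl | ⟨t, ht, hst⟩
  · exact (b_not_sq m n α hm hn hc hmn (by rw [h1]; push_cast; ring)).elim
  swap
  · rw [hst] at h1; exact (B_even hc ht h1).elim
  push_cast at h1 h2
  obtain ⟨u, hu, γ, δ, h3, h4⟩ := sqcls (X := m^2+4*n^2) (Y := 17*(m^4-16*m*n^3)) (Z := 17*β)
    170 (by norm_num) (A_pos hm) (by linarith) (by linear_combination 17*h2)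
    (fun p hp h1 h2 => by
      rcases (intpr hp).dvd_or_dvd h2 with h3 | h3
      · exact_mod_cast h3.trans (by norm_num : (17:ℤ) ∣ 170)
      · exact_mod_cast (AD_pr (intpr hp) hc h1 h3).trans (by norm_num : (10:ℤ) ∣ 170))
  rcases div170 hu with rfl | rfl | h5 | ⟨t, ht, hst⟩
  · exact hA γ (by rw [h3]; push_cast; ring)
  · exact d_not_sq m n δ hm hn hc (by push_cast at h4; linarith)
  · have h6 : (5:ℤ) ∣ m^2+4*n^2 := by rw [h3]; exact Dvd.dvd.mul_right (by exact_mod_cast h5) _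
    have h7 : (5:ℤ) ∣ 17*(m^4-16*m*n^3) := by rw [h4]; exact Dvd.dvd.mul_right (by exact_mod_cast h5) _
    have hn5 : ¬ (5:ℤ) ∣ n := fun h => pr_cop hc prime5 (prime5.dvd_of_dvd_pow (n := 2)
      (dvd_eq' (dvd_sub h6 (Dvd.dvd.mul_left h (4*n))) (by ring))) h
    have key : ∀ x y z : ZMod 5, x^2+4*y^2 = 0 → 17*(x^4-16*x*y^3) = 0 → x^4+4*y^2*(x-y)^2=17*z^2 → y = 0 := by
      decide
    apply hn5
    apply (ZMod.intCast_zmod_eq_zero_iff_dvd n 5).1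
    have e1 := (ZMod.intCast_zmod_eq_zero_iff_dvd (m^2+4*n^2) 5).2 h6
    have e2 := (ZMod.intCast_zmod_eq_zero_iff_dvd (17*(m^4-16*m*n^3)) 5).2 h7
    have e3 := congrArg (Int.cast : ℤ → ZMod 5) h1
    push_cast at e1 e2 e3
    exact key _ _ _ e1 e2 e3
  · rw [hst] at h3 h4
    exact AD_even hc ht (by norm_num) h3 h4

lemma div10 {s : ℕ} (h : s ∣ 10) : s = 1 ∨ s = 5 ∨ ∃ t : ℤ, t % 2 = 1 ∧ (s:ℤ) = 2*t := by
  have h1 : s ≤ 10 := Nat.le_of_dvd (by norm_num) h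
  interval_cases s <;> first | (exfalso; revert h; decide) | (left; rfl) | (right; left; rfl) | skip
  · right; right; exact ⟨1, by norm_num⟩
  · right; right; exact ⟨5, by norm_num⟩

/-- coprime factors of five times a square, the first prime to 5 -/
lemma split5 {a b Y : ℤ} (hc : IsCoprime a b) (ha : a ≠ 0) (h5 : ¬ (5:ℤ) ∣ a) (h : a*b = 5*Y^2) :
    ∃ s q : ℤ, (a = s^2 ∧ b = 5*q^2) ∨ (a = -s^2 ∧ b = -(5*q^2)) := by
  have hb : (5:ℤ) ∣ b := (prime5.dvd_or_dvd (⟨Y^2, h⟩ : (5:ℤ) ∣ a*b)).resolve_left h5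
  obtain ⟨b', rfl⟩ := hb
  obtain ⟨s, q, hsq⟩ := sq_split (Y := Y) (IsCoprime.of_mul_right_right hc) ha (by linarith)
  refine ⟨s, q, ?_⟩
  rcases hsq with ⟨h1, h2⟩ | ⟨h1, h2⟩
  · left; exact ⟨h1, by rw [h2]⟩
  · right; exact ⟨h1, by rw [h2]; ring⟩

lemma ad_red {m n Y : ℤ} (hm : m ≠ 0) (hn : n ≠ 0) (hc : IsCoprime m n)
    (h : (m^2+4*n^2)*(m^4-16*m*n^3) = Y^2) :
    ∃ s k p q : ℤ, IsCoprime s k ∧ s ≠ 0 ∧ k % 2 = 1 ∧ m * k = 4*s^2*n ∧ 4*s^4+k^2 = 5*p^2 ∧ 4*s^6-k^3 = 5*q^2 := by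
  obtain ⟨s, hs, α, β, h1, h2⟩ := sqcls 10 (by norm_num) (A_pos hm) (pos_of_sq (A_pos hm) (D_ne hm hn hc) h) h
    (fun p hp h1 h2 => by exact_mod_cast AD_pr (intpr hp) hc h1 h2)
  rcases div10 hs with rfl | rfl | ⟨t, ht, hst⟩
  · exact (d_not_sq m n β hm hn hc (by rw [h2]; push_cast; ring)).elim
  swap
  · rw [hst] at h1 h2; exact (AD_even hc ht (k := 1) (by norm_num) h1 (by rw [one_mul]; exact h2)).elim
  push_cast at h1 h2
  have hm5 : ¬ (5:ℤ) ∣ m := by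
    intro h5
    have h6 : (5:ℤ) ∣ 4*n^2 := dvd_eq' (dvd_sub (Dvd.intro _ h1.symm) (Dvd.dvd.mul_left h5 m)) (by ring)
    have h7 : (5:ℤ) ∣ n := by
      rcases prime5.dvd_or_dvd h6 with h7 | h7
      · norm_num at h7
      · exact prime5.dvd_of_dvd_pow h7
    exact pr_cop hc prime5 h5 h7
  rcases Int.emod_two_eq_zero_or_one m with hpar | hpar
  swap
  · exfalso
    obtain ⟨s, q, hsq⟩ := split5 (a := m) (b := m^3-16*n^3) (Y := β) (by
      apply cop_pr
      intro p hp h3 h4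
      have h5 : p ∣ 2^4*n^3 := dvd_eq' (dvd_sub (Dvd.dvd.mul_right h3 (m^2)) h4) (by ring)
      rcases hp.dvd_or_dvd h5 with h6 | h6
      · have := (two_or' hp (hp.dvd_of_dvd_pow h6)).trans h3; omega
      · exact pr_cop hc hp h3 (hp.dvd_of_dvd_pow h6)) hm hm5 (by rw [← h2]; ring)
    have hs : s % 2 = 1 := by have := par_sq s; omega
    have hs8 := int_sq_odd hs
    have hm8 := int_sq_odd hpar
    have e1 : m^3 = m*m^2 := by ring
    rcases hsq with ⟨h3, h4⟩ | ⟨h3, h4⟩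
    · have hq : q % 2 = 1 := by have := par_cube m; have := par_sq q; omega
      have hq8 := int_sq_odd hq
      have : m^3 % 8 = 1 := by rw [e1, Int.mul_emod, hm8, h3, hs8]; norm_num
      omega
    · have hq : q % 2 = 1 := by have := par_cube m; have := par_sq q; omega
      have hq8 := int_sq_odd hq
      have : m^3 % 8 = 7 := by rw [e1, Int.mul_emod, hm8, h3, Int.neg_emod]; omega
      omega
  have hn2 := cop_odd hc hpar
  obtain ⟨l, rfl⟩ : ∃ l, m = 2*l := ⟨m/2, by omega⟩
  have hα : α % 2 = 0 := by
    have h3 := par_sq α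
    have : (2*l)^2 = 4*l^2 := by ring
    omega
  obtain ⟨a, rfl⟩ : ∃ a, α = 2*a := ⟨α/2, by omega⟩
  have h3 : l^2+n^2 = 5*a^2 := by linarith
  have hn8 := int_sq_odd hn2
  have hl : l % 2 = 0 := by
    by_contra hcon
    have := int_sq_odd (a := l) (by omega)
    have := par_sq a
    rcases Int.emod_two_eq_zero_or_one a with h | h
    · obtain ⟨a, rfl⟩ : ∃ b, a = 2*b := ⟨a/2, by omega⟩
      have : (2*a)^2 = 4*a^2 := by ring
      omega
    · omega
  obtain ⟨m, rfl⟩ : ∃ a, l = 2*a := ⟨l/2, by omega⟩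
  have hβ : β % 2 = 0 := by
    have h3 := par_sq β
    have : (2*(2*m))^4 = 2*(128*m^4) := by ring
    have : 16*(2*(2*m))*n^3 = 2*(32*m*n^3) := by ring
    omega
  obtain ⟨β, rfl⟩ : ∃ a, β = 2*a := ⟨β/2, by omega⟩
  have h4 : 5*β^2 = 2*(32*m^4-8*m*n^3) := by linarith
  have hβ : β % 2 = 0 := by have h3 := par_sq β; omega
  obtain ⟨β, rfl⟩ : ∃ a, β = 2*a := ⟨β/2, by omega⟩
  have h4 : 5*β^2 = 2*(8*m^4-2*m*n^3) := by linarith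
  have hβ : β % 2 = 0 := by have h3 := par_sq β; omega
  obtain ⟨β, rfl⟩ : ∃ a, β = 2*a := ⟨β/2, by omega⟩
  have h4 : m*(4*m^3-n^3) = 5*β^2 := by linarith
  have hc' : IsCoprime m n := IsCoprime.of_mul_left_right (IsCoprime.of_mul_left_right hc)
  obtain ⟨s, q, hsq⟩ := split5 (a := m) (b := 4*m^3-n^3) (Y := β) (by
      apply cop_pr
      intro p hp h3 h4
      have h5 : p ∣ n^3 := dvd_eq' (dvd_sub (Dvd.dvd.mul_right h3 (4*m^2)) h4) (by ring)
      exact pr_cop hc' hp h3 (hp.dvd_of_dvd_pow h5)) (by rintro rfl; simp at hm)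
      (fun h => hm5 (Dvd.dvd.mul_left (Dvd.dvd.mul_left h 2) 2)) h4
  rcases hsq with ⟨h5, h6⟩ | ⟨h5, h6⟩
  · refine ⟨s, n, a, q, ?_, ?_, hn2, by rw [h5]; ring, by rw [← h3, h5]; ring, by rw [← h6, h5]; ring⟩
    · rw [h5] at hc'; exact (IsCoprime.pow_left_iff (by norm_num)).1 hc'
    · rintro rfl; rw [h5] at hm; simp at hm
  · refine ⟨s, -n, a, q, ?_, ?_, by omega, by rw [h5]; ring, by rw [← h3, h5]; ring, ?_⟩
    · rw [h5] at hc'; exact ((IsCoprime.pow_left_iff (by norm_num : 0 < 2)).1 ((IsCoprime.neg_left_iff _ _).1 hc')).neg_right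
    · rintro rfl; rw [h5] at hm; simp at hm
    · rw [h5] at h6; linarith

/-! ### curves `y² = x³ + a x² + b x + c` and coordinates of points -/

/-- the curve `y² = x³ + a x² + b x + c` -/
def EC (F : Type) [Field F] (a b c : ℤ) : WeierstrassCurve.Affine F :=
  { a₁ := 0, a₂ := a, a₃ := 0, a₄ := b, a₆ := c }

set_option linter.unusedSectionVars false
set_option linter.unusedVariables false

section EC
open WeierstrassCurve.Affine
variable {F : Type} [Field F] [DecidableEq F] {a b c : ℤ}

/-- `P` is the affine point `(x, y)` -/
def At (P : (EC F a b c).Point) (x y : F) : Prop := ∃ h, P = Point.some x y h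

/-- nonvanishing of the discriminant in the field `F` -/
def EDisc (F : Type) [Field F] (a b c : ℤ) : Prop :=
  ((16 * (-4*a^3*c + a^2*b^2 + 18*a*b*c - 4*b^3 - 27*c^2) : ℤ) : F) ≠ 0

lemma EC_disc (h : EDisc F a b c) : (EC F a b c).Δ ≠ 0 := by
  intro h0; apply h
  rw [← h0]
  simp only [EC, WeierstrassCurve.Δ, WeierstrassCurve.b₂, WeierstrassCurve.b₄, WeierstrassCurve.b₆, WeierstrassCurve.b₈]
  push_cast; ring

lemma EC_eqn (x y : F) : (EC F a b c).Equation x y ↔ y^2 = x^3+a*x^2+b*x+c := by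
  rw [equation_iff]; simp [EC]

lemma at_or_zero (P : (EC F a b c).Point) : P = 0 ∨ ∃ x y, At P x y := by
  cases P with
  | zero => left; rfl
  | some x y h => right; exact ⟨x, y, h, rfl⟩

lemma At.eqn {P : (EC F a b c).Point} {x y : F} (h : At P x y) : y^2 = x^3+a*x^2+b*x+c := by
  obtain ⟨h, -⟩ := h; exact (EC_eqn x y).1 h.1

lemma At.uniq {P : (EC F a b c).Point} {x y x' y' : F} (h : At P x y) (h' : At P x' y') : x = x' ∧ y = y' := by
  obtain ⟨h, rfl⟩ := h
  obtain ⟨h', e⟩ := h'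
  injection e with e1 e2
  exact ⟨e1, e2⟩

lemma At.ne_zero {P : (EC F a b c).Point} {x y : F} (h : At P x y) : P ≠ 0 := by
  obtain ⟨h, rfl⟩ := h; exact Point.some_ne_zero h

lemma At.eq {P Q : (EC F a b c).Point} {x y : F} (h : At P x y) (h' : At Q x y) : P = Q := by
  obtain ⟨h, rfl⟩ := h
  obtain ⟨h', rfl⟩ := h'
  rfl

lemma At.congr {P : (EC F a b c).Point} {x y x' y' : F} (h : At P x y) (hx : x = x') (hy : y = y') : At P x' y' := by
  subst hx; subst hy; exact h

lemma At.mk (hd : EDisc F a b c) {x y : F} (h : y^2 = x^3+a*x^2+b*x+c) : ∃ P : (EC F a b c).Point, At P x y :=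
  ⟨Point.some x y ((equation_iff_nonsingular_of_Δ_ne_zero (EC_disc hd)).1 ((EC_eqn x y).2 h)), _, rfl⟩

lemma At.neg {P : (EC F a b c).Point} {x y : F} (h : At P x y) : At (-P) x (-y) := by
  obtain ⟨h, rfl⟩ := h
  rw [Point.neg_some]
  have : (EC F a b c).negY x y = -y := by simp [WeierstrassCurve.Affine.negY, EC]
  refine ⟨this ▸ (nonsingular_neg ..).2 h, ?_⟩
  congr 1

lemma At.add_neg {P Q : (EC F a b c).Point} {x y : F} (h : At P x y) (h' : At Q x (-y)) : P + Q = 0 := by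
  rw [h'.eq h.neg, add_neg_cancel]

lemma At.add {P Q : (EC F a b c).Point} {x₁ y₁ x₂ y₂ l : F} (h : At P x₁ y₁) (h' : At Q x₂ y₂)
    (hn : ¬(x₁ = x₂ ∧ y₁ = -y₂)) (h1 : l*(x₁-x₂) = y₁-y₂)
    (h2 : l*(y₁+y₂) = x₁^2+x₁*x₂+x₂^2+a*(x₁+x₂)+b) :
    At (P+Q) (l^2-a-x₁-x₂) (l*(x₁-(l^2-a-x₁-x₂))-y₁) := by
  obtain ⟨h, rfl⟩ := h
  obtain ⟨h', rfl⟩ := h'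
  have hs : (EC F a b c).slope x₁ x₂ y₁ y₂ = l := by
    by_cases hx : x₁ = x₂
    · subst hx
      have hy : y₁ ≠ -y₂ := fun e => hn ⟨rfl, e⟩
      have hyy : y₁ = y₂ := by
        have := h1; rw [sub_self, mul_zero] at this; exact (sub_eq_zero.1 this.symm)
      subst hyy
      have h0 : y₁+y₁ ≠ 0 := fun e => hy (eq_neg_of_add_eq_zero_left e)
      rw [slope_of_Y_ne rfl (by simpa [WeierstrassCurve.Affine.negY, EC] using hy)]
      simp only [WeierstrassCurve.Affine.negY, EC]
      rw [div_eq_iff (by simpa using h0)]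
      linear_combination -h2
    · rw [slope_of_X_ne hx, div_eq_iff (sub_ne_zero.2 hx), h1]
  have hn' : ¬(x₁ = x₂ ∧ y₁ = (EC F a b c).negY x₂ y₂) := by
    simpa [WeierstrassCurve.Affine.negY, EC] using hn
  rw [Point.add_some hn', At]
  have e1 : (EC F a b c).addX x₁ x₂ ((EC F a b c).slope x₁ x₂ y₁ y₂) = l^2-a-x₁-x₂ := by
    rw [hs]; simp [WeierstrassCurve.Affine.addX, EC]
  have e2 : (EC F a b c).addY x₁ x₂ y₁ ((EC F a b c).slope x₁ x₂ y₁ y₂) = l*(x₁-(l^2-a-x₁-x₂))-y₁ := by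
    rw [hs]; simp [WeierstrassCurve.Affine.addX, WeierstrassCurve.Affine.addY, WeierstrassCurve.Affine.negAddY, WeierstrassCurve.Affine.negY, EC]; ring
  have := nonsingular_add h h' hn'
  refine ⟨by rw [← e1, ← e2] at *; exact this, ?_⟩
  congr 1

lemma At.add_ne {P Q : (EC F a b c).Point} {x₁ y₁ x₂ y₂ l : F} (h : At P x₁ y₁) (h' : At Q x₂ y₂)
    (hn : x₁ ≠ x₂) (h1 : l*(x₁-x₂) = y₁-y₂) :
    At (P+Q) (l^2-a-x₁-x₂) (l*(x₁-(l^2-a-x₁-x₂))-y₁) := by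
  refine h.add h' (fun e => hn e.1) h1 ?_
  apply mul_left_cancel₀ (sub_ne_zero.2 hn)
  linear_combination (y₁+y₂)*h1 + h.eqn - h'.eqn

lemma At.dbl {P : (EC F a b c).Point} {x y l : F} (h : At P x y) (hn : 2*y ≠ 0) (h1 : l*(2*y) = 3*x^2+2*a*x+b) :
    At (P+P) (l^2-a-2*x) (l*(x-(l^2-a-2*x))-y) := by
  refine (h.add h (l := l) (fun e => hn (by linear_combination e.2)) (by ring) (by linear_combination h1)).congr (by ring) (by ring)

end EC

/-! ### reduction modulo `p` -/

section red
variable {p : ℕ} [Fact p.Prime]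

/-- `q` is integral at `p` -/
def PI (p : ℕ) (q : ℚ) : Prop := (q.den : ZMod p) ≠ 0

lemma PI_of_dvd {q r s : ℚ} (hq : PI p q) (hr : PI p r) (h : s.den ∣ q.den * r.den) : PI p s := by
  obtain ⟨k, hk⟩ := h
  intro h0
  have := congrArg (Nat.cast : ℕ → ZMod p) hk
  push_cast at this
  rw [h0, zero_mul] at this
  exact mul_ne_zero hq hr this

lemma PI.add {q r : ℚ} (hq : PI p q) (hr : PI p r) : PI p (q+r) := PI_of_dvd hq hr (Rat.add_den_dvd q r)
lemma PI.mul {q r : ℚ} (hq : PI p q) (hr : PI p r) : PI p (q*r) := PI_of_dvd hq hr (Rat.mul_den_dvd q r)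
lemma PI.neg {q : ℚ} (hq : PI p q) : PI p (-q) := by rw [PI, Rat.neg_den]; exact hq
lemma PI.sub {q r : ℚ} (hq : PI p q) (hr : PI p r) : PI p (q-r) := by rw [sub_eq_add_neg]; exact hq.add hr.neg
lemma PI_int (n : ℤ) : PI p (n:ℚ) := by simp [PI]
lemma PI_nat (n : ℕ) : PI p (n:ℚ) := by simp [PI]
lemma PI_ofNat (n : ℕ) [n.AtLeastTwo] : PI p (OfNat.ofNat n : ℚ) := PI_nat n
lemma PI_one : PI p (1:ℚ) := by simp [PI]
lemma PI_zero : PI p (0:ℚ) := by simp [PI]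
lemma PI.pow {q : ℚ} (hq : PI p q) (n : ℕ) : PI p (q^n) := by
  induction n with
  | zero => simpa using PI_one
  | succ n ih => rw [pow_succ]; exact ih.mul hq

lemma PI.cadd {q r : ℚ} (hq : PI p q) (hr : PI p r) : ((q+r:ℚ):ZMod p) = q + r := Rat.cast_add_of_ne_zero hq hr
lemma PI.csub {q r : ℚ} (hq : PI p q) (hr : PI p r) : ((q-r:ℚ):ZMod p) = q - r := Rat.cast_sub_of_ne_zero hq hr
lemma PI.cmul {q r : ℚ} (hq : PI p q) (hr : PI p r) : ((q*r:ℚ):ZMod p) = q * r := Rat.cast_mul_of_ne_zero hq hr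
lemma PI.cneg {q : ℚ} : ((-q:ℚ):ZMod p) = -q := Rat.cast_neg _
lemma PI.cpow {q : ℚ} (hq : PI p q) (n : ℕ) : ((q^n:ℚ):ZMod p) = q^n := by
  induction n with
  | zero => simp
  | succ n ih => rw [pow_succ, (hq.pow n).cmul hq, ih, pow_succ]

lemma PI_inv_of_not {q : ℚ} (h : ¬ PI p q) : q ≠ 0 ∧ PI p q⁻¹ ∧ ((q⁻¹:ℚ):ZMod p) = 0 := by
  have hd : (q.den : ZMod p) = 0 := by by_contra h'; exact h h'
  have h0 : q ≠ 0 := by rintro rfl; exact h PI_zero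
  have hn : (q.num : ZMod p) ≠ 0 := by
    intro hn
    rw [ZMod.intCast_zmod_eq_zero_iff_dvd] at hn
    rw [ZMod.natCast_eq_zero_iff] at hd
    have := Nat.dvd_gcd (Int.natCast_dvd.1 hn) hd
    rw [q.reduced] at this
    exact (Fact.out : p.Prime).one_lt.ne' (Nat.dvd_one.1 this)
  have e : q⁻¹ = (q.den : ℤ) / (q.num : ℤ) := by
    conv_lhs => rw [← Rat.num_div_den q]
    rw [inv_div]; push_cast; rfl
  have h1 : PI p q⁻¹ := by
    have : ((q⁻¹).den : ℤ) ∣ q.num := by rw [e, ← Rat.divInt_eq_div]; exact Rat.den_dvd _ _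
    obtain ⟨k, hk⟩ := this
    intro h2
    apply hn
    rw [hk]; push_cast; rw [h2, zero_mul]
  refine ⟨h0, h1, ?_⟩
  have h2 : q⁻¹ * (q.num:ℚ) = (q.den : ℚ) := by rw [e]; push_cast; rw [div_mul_cancel₀]; exact_mod_cast Rat.num_ne_zero.2 h0
  have h3 := congrArg (Rat.cast : ℚ → ZMod p) h2
  rw [h1.cmul (PI_int _), Rat.cast_natCast, hd, Rat.cast_intCast] at h3
  exact (mul_eq_zero.1 h3).resolve_right hn

lemma PI.inv {q : ℚ} (hq : PI p q) (h : (q:ZMod p) ≠ 0) : PI p q⁻¹ := by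
  by_contra h'
  obtain ⟨h0, h1, h2⟩ := PI_inv_of_not h'
  rw [inv_inv] at h2; exact h h2

lemma PI.cinv {q : ℚ} (hq : PI p q) (h : (q:ZMod p) ≠ 0) : ((q⁻¹:ℚ):ZMod p) = (q:ZMod p)⁻¹ := by
  have h0 : q ≠ 0 := by rintro rfl; simp at h
  have := (hq.inv h).cmul hq
  rw [inv_mul_cancel₀ h0, Rat.cast_one] at this
  exact eq_inv_of_mul_eq_one_left this.symm

lemma PI_of_pow {q : ℚ} {n : ℕ} (hn : n ≠ 0) (h : PI p (q^n)) : PI p q := by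
  by_contra h'
  obtain ⟨h0, h1, h2⟩ := PI_inv_of_not h'
  have h3 := h.cmul (h1.pow n)
  rw [← mul_pow, mul_inv_cancel₀ h0, one_pow, h1.cpow, h2, zero_pow hn, mul_zero, Rat.cast_one] at h3
  exact one_ne_zero h3

/-- a quotient with nonvanishing residue numerator and vanishing denominator is not integral -/
lemma not_PI_of {l d e : ℚ} (hd : PI p d) (h : l*d = e) (hd0 : (d:ZMod p) = 0) (he0 : (e:ZMod p) ≠ 0) : ¬ PI p l := by
  intro hl
  apply he0
  rw [← h, hl.cmul hd, hd0, mul_zero]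

lemma PI_of_mul {l d e : ℚ} (hd : PI p d) (he : PI p e) (h : l*d = e) (hd0 : (d:ZMod p) ≠ 0) : PI p l ∧ (l:ZMod p)*d = e := by
  have h0 : d ≠ 0 := by rintro rfl; simp at hd0
  have : l = e * d⁻¹ := by rw [← h, mul_inv_cancel_right₀ h0]
  have hl : PI p l := by rw [this]; exact he.mul (hd.inv hd0)
  exact ⟨hl, by rw [← hl.cmul hd, h]⟩


section
open WeierstrassCurve.Affine
variable {a b c : ℤ}

lemma At.nonsing {F : Type} [Field F] [DecidableEq F] {P : (EC F a b c).Point} {x y : F} (h : At P x y) (h0 : y = 0) :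
    3*x^2+2*a*x+b ≠ 0 := by
  obtain ⟨h, -⟩ := h
  rw [nonsingular_iff] at h
  rcases h.2 with h1 | h1
  · intro h2; apply h1; simp [EC, h2]
  · exfalso; apply h1; simp [EC, h0]

lemma exists_slope {F : Type} [Field F] [DecidableEq F] {P Q : (EC F a b c).Point} {x₁ y₁ x₂ y₂ : F}
    (h2 : (2:F) ≠ 0) (h : At P x₁ y₁) (h' : At Q x₂ y₂)
    (hn : ¬(x₁ = x₂ ∧ y₁ = -y₂)) : ∃ l, l*(x₁-x₂) = y₁-y₂ ∧ l*(y₁+y₂) = x₁^2+x₁*x₂+x₂^2+a*(x₁+x₂)+b := by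
  by_cases hx : x₁ = x₂
  · subst hx
    have e : (y₁-y₂)*(y₁+y₂) = 0 := by linear_combination h.eqn - h'.eqn
    have hs : y₁+y₂ ≠ 0 := fun e => hn ⟨rfl, eq_neg_of_add_eq_zero_left e⟩
    have e2 := (mul_eq_zero.1 e).resolve_right hs
    refine ⟨(x₁^2+x₁*x₁+x₁^2+a*(x₁+x₁)+b)/(y₁+y₂), by rw [e2]; ring, div_mul_cancel₀ _ hs⟩
  · have hd := sub_ne_zero.2 hx
    refine ⟨(y₁-y₂)/(x₁-x₂), div_mul_cancel₀ _ hd, ?_⟩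
    rw [div_mul_eq_mul_div, div_eq_iff hd]
    linear_combination h.eqn - h'.eqn

/-- the reduction relation -/
def Red (p : ℕ) [Fact p.Prime] (P : (EC ℚ a b c).Point) (P' : (EC (ZMod p) a b c).Point) : Prop :=
  (P = 0 ∧ P' = 0) ∨ (∃ x y, At P x y ∧ ¬ PI p x ∧ P' = 0) ∨
    (∃ x y, At P x y ∧ PI p x ∧ PI p y ∧ At P' (x:ZMod p) (y:ZMod p))

lemma At.PIy {P : (EC ℚ a b c).Point} {x y : ℚ} (h : At P x y) (hx : PI p x) : PI p y := by
  apply PI_of_pow (n := 2) (by norm_num)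
  rw [h.eqn]
  exact (((hx.pow 3).add ((PI_int a).mul (hx.pow 2))).add ((PI_int b).mul hx)).add (PI_int c)

lemma At.cast_eqn {P : (EC ℚ a b c).Point} {x y : ℚ} (h : At P x y) (hx : PI p x) :
    (y:ZMod p)^2 = (x:ZMod p)^3+a*x^2+b*x+c := by
  have hy := h.PIy hx
  have := congrArg (Rat.cast : ℚ → ZMod p) h.eqn
  rw [hy.cpow, (((hx.pow 3).add ((PI_int a).mul (hx.pow 2))).add ((PI_int b).mul hx)).cadd (PI_int c),
    ((hx.pow 3).add ((PI_int a).mul (hx.pow 2))).cadd ((PI_int b).mul hx), (hx.pow 3).cadd ((PI_int a).mul (hx.pow 2)),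
    (PI_int a).cmul (hx.pow 2), (PI_int b).cmul hx, hx.cpow, hx.cpow] at this
  simpa using this

lemma red_exists (hd : EDisc (ZMod p) a b c) (P : (EC ℚ a b c).Point) : ∃ P', Red p P P' := by
  rcases at_or_zero P with h | ⟨x, y, h⟩
  · exact ⟨0, Or.inl ⟨h, rfl⟩⟩
  by_cases hx : PI p x
  · obtain ⟨P', h'⟩ := At.mk hd (h.cast_eqn hx)
    exact ⟨P', Or.inr (Or.inr ⟨x, y, h, hx, h.PIy hx, h'⟩)⟩
  · exact ⟨0, Or.inr (Or.inl ⟨x, y, h, hx, rfl⟩)⟩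

lemma red_unique {P : (EC ℚ a b c).Point} {P' P'' : (EC (ZMod p) a b c).Point} (h : Red p P P') (h' : Red p P P'') :
    P' = P'' := by
  rcases h with ⟨rfl, rfl⟩ | ⟨x, y, h, hx, rfl⟩ | ⟨x, y, h, hx, hy, h1⟩ <;>
  rcases h' with ⟨h0, rfl⟩ | ⟨x', y', h', hx', rfl⟩ | ⟨x', y', h', hx', hy', h2⟩
  · rfl
  · rfl
  · exact absurd rfl h'.ne_zero
  · rfl
  · rfl
  · rw [(h.uniq h').1] at hx; exact absurd hx' hx
  · exact absurd h0 h.ne_zero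
  · rw [(h.uniq h').1] at hx; exact absurd hx hx'
  · obtain ⟨rfl, rfl⟩ := h.uniq h'
    exact h1.eq h2

lemma Red.neg {P : (EC ℚ a b c).Point} {P' : (EC (ZMod p) a b c).Point} (h : Red p P P') : Red p (-P) (-P') := by
  rcases h with ⟨rfl, rfl⟩ | ⟨x, y, h, hx, rfl⟩ | ⟨x, y, h, hx, hy, h1⟩
  · left; simp
  · right; left; exact ⟨x, -y, h.neg, hx, by simp⟩
  · right; right; exact ⟨x, -y, h.neg, hx, hy.neg, h1.neg.congr rfl (PI.cneg).symm⟩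

lemma red_add_int (h2 : (2:ZMod p) ≠ 0) {P Q : (EC ℚ a b c).Point} {P' Q' : (EC (ZMod p) a b c).Point}
    {x₁ y₁ x₂ y₂ : ℚ} (hP : At P x₁ y₁) (hQ : At Q x₂ y₂) (hx₁ : PI p x₁) (hx₂ : PI p x₂)
    (hP' : At P' (x₁:ZMod p) (y₁:ZMod p)) (hQ' : At Q' (x₂:ZMod p) (y₂:ZMod p)) :
    (¬((x₁:ZMod p) = x₂ ∧ (y₁:ZMod p) = -y₂) → ∃ x y, At (P+Q) x y ∧ PI p x ∧ PI p y ∧ At (P'+Q') (x:ZMod p) (y:ZMod p)) ∧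
    (((x₁:ZMod p) = x₂ ∧ (y₁:ZMod p) = -y₂) → P' + Q' = 0 ∧ (P + Q = 0 ∨ ∃ x y, At (P+Q) x y ∧ ¬ PI p x)) := by
  have hy₁ := hP.PIy hx₁
  have hy₂ := hQ.PIy hx₂
  have d1 := hx₁.sub hx₂
  have d2 := hy₁.add hy₂
  have e1 := hy₁.sub hy₂
  have i1 := (hx₁.pow 2).add (hx₁.mul hx₂)
  have i2 := i1.add (hx₂.pow 2)
  have i3 := (PI_int (p := p) a).mul (hx₁.add hx₂)
  have e2 := (i2.add i3).add (PI_int b)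
  have c2 : ((x₁^2+x₁*x₂+x₂^2+a*(x₁+x₂)+b:ℚ):ZMod p) = (x₁:ZMod p)^2+x₁*x₂+x₂^2+a*(x₁+x₂)+b := by
    rw [(i2.add i3).cadd (PI_int b), i2.cadd i3, i1.cadd (hx₂.pow 2), (hx₁.pow 2).cadd (hx₁.mul hx₂),
      (PI_int (p := p) a).cmul (hx₁.add hx₂), hx₁.cadd hx₂, hx₁.cmul hx₂, hx₁.cpow, hx₂.cpow, Rat.cast_intCast, Rat.cast_intCast]
  constructor
  · intro hn
    have hn0 : ¬(x₁ = x₂ ∧ y₁ = -y₂) := by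
      rintro ⟨rfl, rfl⟩; exact hn ⟨rfl, PI.cneg⟩
    obtain ⟨l, l1, l2⟩ := exists_slope (by norm_num) hP hQ hn0
    have hl : PI p l := by
      by_cases h : (x₁:ZMod p) = x₂
      · refine (PI_of_mul d2 e2 l2 ?_).1
        rw [hy₁.cadd hy₂]; intro h0; exact hn ⟨h, eq_neg_of_add_eq_zero_left h0⟩
      · refine (PI_of_mul d1 e1 l1 ?_).1
        rw [hx₁.csub hx₂]; exact sub_ne_zero.2 h
    have m1 : (l:ZMod p)*(x₁-x₂) = y₁-y₂ := by rw [← hx₁.csub hx₂, ← hl.cmul d1, l1, hy₁.csub hy₂]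
    have m2 : (l:ZMod p)*(y₁+y₂) = (x₁:ZMod p)^2+x₁*x₂+x₂^2+a*(x₁+x₂)+b := by
      rw [← hy₁.cadd hy₂, ← hl.cmul d2, l2, c2]
    have k1 := (hl.pow 2).sub (PI_int a)
    have k2 := k1.sub hx₁
    have k3 := k2.sub hx₂
    have k4 := (hl.mul (hx₁.sub k3)).sub hy₁
    refine ⟨_, _, hP.add hQ hn0 l1 l2, k3, k4, (hP'.add hQ' hn m1 m2).congr ?_ ?_⟩
    · rw [k2.csub hx₂, k1.csub hx₁, (hl.pow 2).csub (PI_int a), hl.cpow, Rat.cast_intCast]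
    · rw [(hl.mul (hx₁.sub k3)).csub hy₁, hl.cmul (hx₁.sub k3), hx₁.csub k3,
        k2.csub hx₂, k1.csub hx₁, (hl.pow 2).csub (PI_int a), hl.cpow, Rat.cast_intCast]
  · rintro ⟨hX, hY⟩
    refine ⟨hP'.add_neg (hQ'.congr hX.symm (by rw [hY]; ring)), ?_⟩
    by_cases hn0 : x₁ = x₂ ∧ y₁ = -y₂
    · left; exact hP.add_neg (hQ.congr hn0.1.symm (by rw [hn0.2]; ring))
    right
    obtain ⟨l, l1, l2⟩ := exists_slope (by norm_num) hP hQ hn0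
    refine ⟨_, _, hP.add hQ hn0 l1 l2, ?_⟩
    have hl : ¬ PI p l := by
      by_cases h0 : (y₁:ZMod p) = 0
      · refine not_PI_of d2 l2 (by rw [hy₁.cadd hy₂, hY]; ring) ?_
        rw [c2]
        have := hP'.nonsing h0
        rw [← hX]; intro h; apply this; rw [← h]; ring
      · refine not_PI_of d1 l1 (by rw [hx₁.csub hx₂, hX]; ring) ?_
        rw [hy₁.csub hy₂]
        intro h
        apply h0
        apply mul_left_cancel₀ h2
        linear_combination h + hY
    intro h
    apply hl
    apply PI_of_pow (n := 2) (by norm_num)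
    have := ((h.add hx₂).add hx₁).add (PI_int (p := p) a)
    convert this using 1; ring

lemma red_add_E1 {P Q : (EC ℚ a b c).Point} {x₁ y₁ x₂ y₂ : ℚ} (hP : At P x₁ y₁) (hQ : At Q x₂ y₂)
    (hx₁ : PI p x₁) (hx₂ : ¬ PI p x₂) : ∃ x y, At (P+Q) x y ∧ PI p x := by
  have hx : x₁ ≠ x₂ := by rintro rfl; exact hx₂ hx₁
  obtain ⟨h0, hs, hs0⟩ := PI_inv_of_not hx₂
  have hs1 : x₂ * x₂⁻¹ = 1 := mul_inv_cancel₀ h0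
  generalize x₂⁻¹ = s at *
  have ht2 : (y₂*s^2)^2 = s+a*s^2+b*s^3+c*s^4 := by
    have := hQ.eqn
    calc (y₂*s^2)^2 = (x₂*s)^3*s+a*(x₂*s)^2*s^2+b*(x₂*s)*s^3+c*s^4 := by rw [mul_pow, this]; ring
      _ = _ := by rw [hs1]; ring
  have ht : PI p (y₂*s^2) := by
    apply PI_of_pow (n := 2) (by norm_num)
    rw [ht2]
    exact ((hs.add ((PI_int a).mul (hs.pow 2))).add ((PI_int b).mul (hs.pow 3))).add ((PI_int c).mul (hs.pow 4))
  have hl : ((y₁-y₂)/(x₁-x₂))*(x₁-x₂) = y₁-y₂ := div_mul_cancel₀ _ (sub_ne_zero.2 hx)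
  generalize ((y₁-y₂)/(x₁-x₂)) = l at *
  refine ⟨_, _, hP.add_ne hQ hx hl, ?_⟩
  have hy₁ := hP.PIy hx₁
  have i1 := PI_one.sub (hx₁.mul hs)
  have key : (l^2-a-x₁-x₂)*(1-x₁*s)^2 = (x₁+b*s)*(1+x₁*s)+2*a*x₁*s+2*c*s^2-2*y₁*(y₂*s^2) := by
    have e1 : (x₁-x₂)*s = -(1-x₁*s) := by rw [sub_mul, hs1]; ring
    have e2 : l*(1-x₁*s) = -(y₁-y₂)*s := by rw [← hl]; linear_combination l*e1
    have e3 : l^2*(1-x₁*s)^2 = (y₁-y₂)^2*s^2 := by rw [← mul_pow, e2]; ring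
    have := hP.eqn
    have := hQ.eqn
    linear_combination e3 + s^2*hP.eqn + s^2*hQ.eqn + (2*x₁-x₁^2*s+s*b+a*(x₂*s+1)+x₂*(x₂*s+1))*hs1
  refine (PI_of_mul (i1.pow 2) ?_ key ?_).1
  · exact ((((hx₁.add ((PI_int b).mul hs)).mul (PI_one.add (hx₁.mul hs))).add (((PI_ofNat 2).mul (PI_int a)).mul hx₁ |>.mul hs)).add
      (((PI_ofNat 2).mul (PI_int c)).mul (hs.pow 2))).sub (((PI_ofNat 2).mul hy₁).mul ht)
  · rw [i1.cpow, PI_one.csub (hx₁.mul hs), hx₁.cmul hs, hs0]; simp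


lemma EDisc.two (hd : EDisc (ZMod p) a b c) : (2:ZMod p) ≠ 0 := by
  intro h; apply hd; push_cast
  rw [show (16:ZMod p) = 2*8 by norm_num, h]; ring

lemma red_add (hd : EDisc (ZMod p) a b c) {P Q : (EC ℚ a b c).Point} {P' Q' : (EC (ZMod p) a b c).Point}
    (hP : Red p P P') (hQ : Red p Q Q') : Red p (P+Q) (P'+Q') := by
  have h2 := hd.two
  -- integral + nonintegral
  have D : ∀ {P Q : (EC ℚ a b c).Point} {P' : (EC (ZMod p) a b c).Point} {x₁ y₁ x₂ y₂ : ℚ}, At P x₁ y₁ → At Q x₂ y₂ →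
      PI p x₁ → ¬ PI p x₂ → At P' (x₁:ZMod p) (y₁:ZMod p) → Red p (P+Q) P' := by
    intro P Q P' x₁ y₁ x₂ y₂ hP hQ hx₁ hx₂ hP'
    obtain ⟨x, y, hR, hx⟩ := red_add_E1 hP hQ hx₁ hx₂
    obtain ⟨R', hR'⟩ := At.mk hd (hR.cast_eqn hx)
    have := red_add_int h2 hR hP.neg hx hx₁ hR' (hP'.neg.congr rfl PI.cneg.symm)
    by_cases h : (x:ZMod p) = x₁ ∧ (y:ZMod p) = -((-y₁:ℚ):ZMod p)
    · rw [PI.cneg, neg_neg] at h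
      right; right
      exact ⟨x, y, hR, hx, hR.PIy hx, hP'.congr h.1.symm h.2.symm⟩
    · obtain ⟨x', y', h1, h3, -⟩ := this.1 h
      have : P + Q + -P = Q := by abel
      rw [this] at h1
      rw [(h1.uniq hQ).1] at h3
      exact absurd h3 hx₂
  have D' : ∀ {P Q : (EC ℚ a b c).Point} {x₁ y₁ x₂ y₂ : ℚ}, At P x₁ y₁ → At Q x₂ y₂ →
      ¬ PI p x₁ → ¬ PI p x₂ → Red p (P+Q) 0 := by
    intro P Q x₁ y₁ x₂ y₂ hP hQ hx₁ hx₂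
    rcases at_or_zero (P+Q) with h | ⟨x, y, h⟩
    · left; exact ⟨h, rfl⟩
    by_cases hx : PI p x
    · obtain ⟨x', y', h1, h3⟩ := red_add_E1 h hQ.neg hx hx₂
      have : P + Q + -Q = P := by abel
      rw [this] at h1
      rw [(h1.uniq hP).1] at h3
      exact absurd h3 hx₁
    · right; left; exact ⟨x, y, h, hx, rfl⟩
  rcases hP with ⟨rfl, rfl⟩ | ⟨x₁, y₁, hP, hx₁, rfl⟩ | ⟨x₁, y₁, hP, hx₁, hy₁, hP'⟩
  · rw [zero_add, zero_add]; exact hQ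
  · rcases hQ with ⟨rfl, rfl⟩ | ⟨x₂, y₂, hQ, hx₂, rfl⟩ | ⟨x₂, y₂, hQ, hx₂, hy₂, hQ'⟩
    · rw [add_zero, add_zero]; right; left; exact ⟨_, _, hP, hx₁, rfl⟩
    · rw [add_zero]; exact D' hP hQ hx₁ hx₂
    · rw [zero_add, add_comm]; exact D hQ hP hx₂ hx₁ hQ'
  · rcases hQ with ⟨rfl, rfl⟩ | ⟨x₂, y₂, hQ, hx₂, rfl⟩ | ⟨x₂, y₂, hQ, hx₂, hy₂, hQ'⟩
    · rw [add_zero, add_zero]; right; right; exact ⟨_, _, hP, hx₁, hy₁, hP'⟩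
    · rw [add_zero]; exact D hP hQ hx₁ hx₂ hP'
    · have := red_add_int h2 hP hQ hx₁ hx₂ hP' hQ'
      by_cases h : (x₁:ZMod p) = x₂ ∧ (y₁:ZMod p) = -y₂
      · obtain ⟨h1, h3⟩ := this.2 h
        rw [h1]
        rcases h3 with h3 | ⟨x, y, h3, h4⟩
        · left; exact ⟨h3, rfl⟩
        · right; left; exact ⟨x, y, h3, h4, rfl⟩
      · right; right; exact this.1 h

/-- the reduction homomorphism -/
noncomputable def redHom (hd : EDisc (ZMod p) a b c) : (EC ℚ a b c).Point →+ (EC (ZMod p) a b c).Point :=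
  AddMonoidHom.mk' (fun P => (red_exists hd P).choose) (fun P Q =>
    red_unique (red_exists hd (P+Q)).choose_spec (red_add hd (red_exists hd P).choose_spec (red_exists hd Q).choose_spec))

lemma redHom_spec (hd : EDisc (ZMod p) a b c) (P : (EC ℚ a b c).Point) : Red p P (redHom hd P) :=
  (red_exists hd P).choose_spec

lemma redHom_at (hd : EDisc (ZMod p) a b c) {P : (EC ℚ a b c).Point} {x y : ℚ} (h : At P x y) (hx : PI p x) :
    PI p y ∧ At (redHom hd P) (x:ZMod p) (y:ZMod p) := by
  refine ⟨h.PIy hx, ?_⟩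
  obtain ⟨P', h'⟩ := At.mk hd (h.cast_eqn hx)
  rw [red_unique (redHom_spec hd P) (Or.inr (Or.inr ⟨x, y, h, hx, h.PIy hx, h'⟩))]
  exact h'

lemma redHom_at' (hd : EDisc (ZMod p) a b c) {P : (EC ℚ a b c).Point} {x y : ℚ} {X Y : ZMod p} (h : At P x y)
    (h' : At (redHom hd P) X Y) : PI p x ∧ PI p y ∧ (x:ZMod p) = X ∧ (y:ZMod p) = Y := by
  rcases redHom_spec hd P with ⟨h1, h2⟩ | ⟨_, _, h1, h2, h3⟩ | ⟨x', y', h1, h2, h3, h4⟩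
  · exact absurd h2 h'.ne_zero
  · exact absurd h3 h'.ne_zero
  · obtain ⟨rfl, rfl⟩ := h.uniq h1
    exact ⟨h2, h3, h4.uniq h'⟩

lemma redHom_zero' (hd : EDisc (ZMod p) a b c) {P : (EC ℚ a b c).Point} {x y : ℚ} (h : At P x y) :
    redHom hd P = 0 ↔ ¬ PI p x := by
  constructor
  · intro h0 hx
    exact (redHom_at hd h hx).2.ne_zero h0
  · intro hx
    exact red_unique (redHom_spec hd P) (Or.inr (Or.inl ⟨x, y, h, hx, rfl⟩))

end

end red

set_option linter.unusedSectionVars false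
set_option linter.unusedVariables false

lemma rat_sq_int {q : ℚ} {k : ℤ} (h : q^2 = k) : ∃ n : ℤ, q = n := by
  have h1 : q.den = 1 := by
    have h2 : (q^2).den = 1 := by rw [h]; simp
    rw [Rat.den_pow] at h2
    exact (Nat.pow_eq_one.1 h2).resolve_right (by norm_num)
  exact ⟨q.num, ((Rat.den_eq_one_iff q).1 h1).symm⟩

lemma pt_form {a b c : ℤ} {P : (EC ℚ a b c).Point} {x y : ℚ} (h : At P x y) :
    ∃ m e n : ℤ, 0 < e ∧ IsCoprime m e ∧ x = m/e^2 ∧ y = n/e^3 ∧ n^2 = m^3+a*m^2*e^2+b*m*e^4+c*e^6 ∧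
      x.num = m ∧ (x.den:ℤ) = e^2 := by
  have hE := h.eqn
  have hq0 : (x.den:ℚ) ≠ 0 := by exact_mod_cast x.den_ne_zero
  have hx : x * x.den = x.num := Rat.mul_den_eq_num x
  have hcop : IsCoprime x.num (x.den:ℤ) := by
    rw [Int.isCoprime_iff_gcd_eq_one]; exact x.reduced
  obtain ⟨K, hK⟩ : ∃ K : ℤ, K = x.num^3+a*x.num^2*x.den+b*x.num*x.den^2+c*x.den^3 := ⟨_, rfl⟩
  have h1 : (y*x.den^2)^2 = ((K*x.den:ℤ):ℚ) := by
    rw [hK]; push_cast; rw [← hx, mul_pow, hE]; ring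
  obtain ⟨n1, hn1⟩ := rat_sq_int h1
  have h2 : n1^2 = (x.den:ℤ)*K := by
    rw [hn1] at h1; have : n1^2 = K*x.den := by exact_mod_cast h1
    rw [this]; ring
  have hKc : IsCoprime (x.den:ℤ) K := by
    apply cop_pr
    intro p hp h3 h4
    rw [hK] at h4
    have : p ∣ x.num^3 := dvd_eq' (dvd_sub h4 (Dvd.dvd.mul_left h3 (a*x.num^2+b*x.num*x.den+c*x.den^2))) (by ring)
    exact pr_cop hcop hp (hp.dvd_of_dvd_pow this) h3
  have hdp : (0:ℤ) < x.den := by exact_mod_cast x.den_pos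
  obtain ⟨e, n, hen⟩ := sq_split hKc hdp.ne' h2.symm
  obtain ⟨he, hn⟩ : (x.den:ℤ) = e^2 ∧ K = n^2 := by
    rcases hen with hen | hen
    · exact hen
    · nlinarith [sq_nonneg e, hen.1]
  have he0 : e ≠ 0 := by rintro rfl; simp at he
  have hn1' : n1 = e*n ∨ n1 = -(e*n) := by
    apply sq_eq_sq_iff_eq_or_eq_neg.1; rw [h2, he, hn]; ring
  have heq : (x.den:ℚ) = e^2 := by exact_mod_cast he
  have he0' : (e:ℚ) ≠ 0 := by exact_mod_cast he0
  have hyy : y*e^4 = n1 := by rw [← hn1, heq]; ring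
  have key : ∃ n' : ℤ, y = n'/|(e:ℚ)|^3 ∧ n'^2 = K := by
    have : ∃ n' : ℤ, y = n'/(e:ℚ)^3 ∧ n'^2 = K := by
      rcases hn1' with h3 | h3
      · refine ⟨n, ?_, hn.symm⟩
        rw [h3] at hyy; push_cast at hyy; field_simp
        apply mul_left_cancel₀ he0'; linear_combination hyy
      · refine ⟨-n, ?_, by rw [hn]; ring⟩
        rw [h3] at hyy; push_cast at hyy; field_simp
        apply mul_left_cancel₀ he0'; push_cast; linear_combination hyy
    obtain ⟨n', h3, h4⟩ := this
    rcases abs_choice (e:ℚ) with h5 | h5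
    · exact ⟨n', by rw [h5]; exact h3, h4⟩
    · refine ⟨-n', ?_, by rw [← h4]; ring⟩
      rw [h5, h3]; push_cast; field_simp
  obtain ⟨n', h3, h4⟩ := key
  refine ⟨x.num, |e|, n', abs_pos.2 he0, ?_, ?_, ?_, ?_, rfl, by rw [sq_abs]; exact he⟩
  · rw [he] at hcop
    have := (IsCoprime.pow_right_iff (by norm_num : 0 < 2)).1 hcop
    rcases abs_choice e with h5 | h5 <;> rw [h5]
    · exact this
    · exact this.neg_right
  · push_cast; rw [sq_abs, ← heq, Rat.num_div_den]
  · push_cast; exact h3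
  · have e1 : |e|^2 = x.den := by rw [sq_abs, he]
    rw [h4, hK, show |e|^4 = (|e|^2)^2 by ring, show |e|^6 = (|e|^2)^3 by ring, e1]

lemma num_le {x : ℚ} {a b : ℤ} (hb : b ≠ 0) (ha : a ≠ 0) (h : x = a/b) : |x.num| ≤ |a| ∧ (x.den:ℤ) ≤ |b| := by
  have h1 : x = Rat.divInt a b := by rw [h, Rat.divInt_eq_div]
  constructor
  · apply Int.le_of_dvd (abs_pos.2 ha)
    rw [abs_dvd_abs, h1]; exact Rat.num_dvd _ hb
  · apply Int.le_of_dvd (abs_pos.2 hb)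
    rw [dvd_abs, h1]; exact Rat.den_dvd _ _

set_option linter.unusedSectionVars false
set_option linter.unusedVariables false

/-! ### the curve `y² = x (x² + 17 x - 289)` -/

lemma prime17 : Prime (17:ℤ) := by norm_num

lemma dvd17_zmod (a : ℤ) : (17:ℤ) ∣ a ↔ ((a:ℤ):ZMod 17) = 0 := by
  rw [ZMod.intCast_zmod_eq_zero_iff_dvd]; norm_num

/-- splitting `a * b = 289 v⁴` -/
lemma split289 {a b w : ℤ} (hc : IsCoprime a b) (h : a*b = 289*w) :
    (∃ b', b = 289*b' ∧ a*b' = w) ∨ (∃ a', a = 289*a' ∧ a'*b = w) := by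
  have h17 : (17:ℤ) ∣ a*b := ⟨17*w, by rw [h]; ring⟩
  have key : ∀ a b : ℤ, IsCoprime a b → a*b = 289*w → (17:ℤ) ∣ b → ∃ b', b = 289*b' ∧ a*b' = w := by
    intro a b hc h hb
    have hna : ¬ (17:ℤ) ∣ a := fun ha => pr_cop hc prime17 ha hb
    have hcop : IsCoprime (289:ℤ) a := by
      have : IsCoprime (17:ℤ) a := (prime17.coprime_iff_not_dvd).2 hna
      have := this.pow_left (m := 2); norm_num at this; exact this
    obtain ⟨b', hb'⟩ := hcop.dvd_of_dvd_mul_left (show (289:ℤ) ∣ a*b from ⟨w, h⟩)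
    refine ⟨b', hb', ?_⟩
    rw [hb'] at h; linarith
  rcases prime17.dvd_or_dvd h17 with ha | hb
  · right
    obtain ⟨a', h1, h2⟩ := key b a hc.symm (by rw [mul_comm]; exact h) ha
    exact ⟨a', h1, by rw [mul_comm]; exact h2⟩
  · left; exact key a b hc h hb

lemma pow4_split {a b w : ℤ} (ha : 0 ≤ a) (hb : 0 ≤ b) (hc : IsCoprime a b) (h : a*b = w^4) : ∃ g h, a = g^4 ∧ b = h^4 := by
  obtain ⟨g, hg⟩ := pow4_of_mul ha hc h
  obtain ⟨k, hk⟩ := pow4_of_mul hb hc.symm (by rw [mul_comm]; exact h)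
  exact ⟨g, k, hg, hk⟩

lemma halve_core {U V f S : ℤ} (hU : 0 < U) (hV : 0 < V) (hc : IsCoprime U V) (hS : 0 < S) (h17 : ¬ (17:ℤ) ∣ S)
    (h1 : U*V = 1445*f^4) (h2 : U+V = S^2+34*f^2) :
    ∃ σ g h u : ℤ, (σ = 1 ∨ σ = -1) ∧ u^2 = σ*(g^4-289*h^4)+17*g^2*h^2 ∧ g^4+289*h^4 = S ∧ g^2*h^2*u^2 = f^2 := by
  have key : ∀ U V : ℤ, 0 < U → 0 < V → IsCoprime U V → U+V = S^2+34*f^2 → (∃ V', V = 289*V' ∧ U*V' = 5*f^4) → 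
    ∃ σ g h u : ℤ, (σ = 1 ∨ σ = -1) ∧ u^2 = σ*(g^4-289*h^4)+17*g^2*h^2 ∧ g^4+289*h^4 = S ∧ g^2*h^2*u^2 = f^2 := by
    rintro U V hU hV hc h2 ⟨V', rfl, h3⟩
    have hV' : 0 < V' := by linarith
    have hc' : IsCoprime U V' := hc.of_mul_right_right
    obtain ⟨u, v, huv⟩ := pow4_mul_prime prime5 (by norm_num) hU.le hV'.le hc' h3
    rcases huv with ⟨rfl, rfl⟩ | ⟨rfl, rfl⟩
    · have huv : u^2*v^2 = f^2 := by
        have : (u^2*v^2)^2 = (f^2)^2 := by linarith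
        exact (sq_eq_sq₀ (by positivity) (by positivity)).1 this
      have hprod : (S-(u^2-17*v^2))*(S+(u^2-17*v^2)) = 4*(289*v^4) := by
        rw [← huv] at h2; linear_combination -h2
      have hpar : (2:ℤ) ∣ S-(u^2-17*v^2) := by
        have : (2:ℤ) ∣ (S-(u^2-17*v^2))*(S+(u^2-17*v^2)) := ⟨2*(289*v^4), by rw [hprod]; ring⟩
        rcases Int.prime_two.dvd_or_dvd this with h | h
        · exact h
        · exact dvd_eq' (dvd_sub h (Dvd.intro (u^2-17*v^2) rfl)) (by ring)
      obtain ⟨a, ha⟩ := hpar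
      obtain ⟨b, hb⟩ : ∃ b, b = a+(u^2-17*v^2) := ⟨_, rfl⟩
      have hSa : S = a+b := by rw [hb]; linarith
      have hab : a*b = 289*v^4 := by
        have e2 : S+(u^2-17*v^2) = 2*b := by rw [hSa, hb]; ring
        rw [ha, e2] at hprod; linarith
      have hv0 : v ≠ 0 := by rintro rfl; simp at hV'
      have hab0 : 0 < a*b := by rw [hab]; positivity
      have ha0 : 0 < a ∧ 0 < b := by
        rcases mul_pos_iff.1 hab0 with h | h
        · exact h
        · exfalso; linarith
      have hcab : IsCoprime a b := by
        apply cop_pr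
        intro p hp h3 h4
        have h5 : p ∣ 289*v^4 := by rw [← hab]; exact h3.mul_right _
        have h6 : p ∣ u^2-17*v^2 := dvd_eq' (dvd_sub h4 h3) (by rw [hb]; ring)
        rcases hp.dvd_or_dvd h5 with h7 | h7
        · have h8 : p ∣ 17 := hp.dvd_of_dvd_pow (show p ∣ (17:ℤ)^2 by norm_num; exact h7)
          have h9 : Associated p 17 := hp.associated_of_dvd prime17 h8
          exact h17 (h9.symm.dvd.trans (by rw [hSa]; exact dvd_add h3 h4))
        · have h8 := hp.dvd_of_dvd_pow h7
          have h9 : p ∣ u^2 := dvd_eq' (dvd_add h6 (h8.mul_left (17*v))) (by ring)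
          have h10 := hp.dvd_of_dvd_pow h9
          exact pr_cop hc hp (h10.trans (dvd_pow_self _ (by norm_num))) (((h8.trans (dvd_pow_self v (by norm_num : 4 ≠ 0))).mul_left 5).mul_left 289)
      have fin : ∀ g h : ℤ, (g^4*h^4 = v^4) → g^2*h^2 = v^2 := by
        intro g h e
        have : (g^2*h^2)^2 = (v^2)^2 := by linarith
        exact (sq_eq_sq₀ (by positivity) (by positivity)).1 this
      rcases split289 hcab hab with ⟨b', e1, e2⟩ | ⟨a', e1, e2⟩
      · obtain ⟨g, h, rfl, rfl⟩ := pow4_split ha0.1.le (by linarith) (by rw [e1] at hcab; exact hcab.of_mul_right_right) e2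
        have e3 := fin g h e2
        refine ⟨-1, g, h, u, Or.inr rfl, ?_, ?_, ?_⟩
        · rw [e1] at hb; linear_combination -hb-17*e3
        · rw [hSa, e1]
        · rw [e3, ← huv]; ring
      · obtain ⟨h, g, rfl, rfl⟩ := pow4_split (by linarith) ha0.2.le (by rw [e1] at hcab; exact hcab.of_mul_left_right) e2
        have e3 := fin g h (by rw [← e2]; ring)
        refine ⟨1, g, h, u, Or.inl rfl, ?_, ?_, ?_⟩
        · rw [e1] at hb; linear_combination -hb-17*e3
        · rw [hSa, e1]; ring
        · rw [e3, ← huv]; ring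
    · exfalso
      apply h17
      rw [dvd17_zmod]
      have h4 : ((5*u^4+289*v^4 : ℤ) : ZMod 17) = ((S^2+34*f^2:ℤ):ZMod 17) := by rw [h2]
      push_cast at h4
      have a1 : (289:ZMod 17) = 0 := by decide
      have a2 : (34:ZMod 17) = 0 := by decide
      rw [a1, a2, zero_mul, zero_mul, add_zero, add_zero] at h4
      generalize ((u:ℤ):ZMod 17) = u at h4
      generalize ((S:ℤ):ZMod 17) = S at h4 ⊢
      revert u S; decide +kernel
  have h3 : U*V = 289*(5*f^4) := by rw [h1]; ring
  rcases split289 hc h3 with h | ⟨a', e1, e2⟩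
  · exact key U V hU hV hc h2 h
  · exact key V U hV hU hc.symm (by rw [add_comm]; exact h2) ⟨a', e1, by rw [mul_comm]; exact e2⟩

lemma halve {s e N : ℤ} (hs : 0 < s) (he : 0 < e) (hc : IsCoprime s e) (h17 : ¬ (17:ℤ) ∣ s)
    (h : N^2 = s^4+17*s^2*e^2-289*e^4) :
    ∃ σ g h u : ℤ, (σ = 1 ∨ σ = -1) ∧ u^2 = σ*(g^4-289*h^4)+17*g^2*h^2 ∧ g^4+289*h^4 ≤ 2*s ∧
      (g^4+289*h^4)^2*e^2 = 4*g^2*h^2*u^2*s^2 ∧ g ≠ 0 ∧ h ≠ 0 ∧ u ≠ 0 := by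
  have h5 : ∀ p f U V S: ℤ, Prime p → p ∣ U → p ∣ V → U*V = 1445*f^4 → U+V = S^2+34*f^2 → ¬ (17:ℤ) ∣ S → p ∣ S ∧ p ∣ f := by
    intro p f U V S hp h1 h2 h3 h4 h17
    have hsum : p ∣ S^2+34*f^2 := by rw [← h4]; exact dvd_add h1 h2
    have hf : p ∣ f := by
      have h5 : p ∣ 1445*f^4 := by rw [← h3]; exact h1.mul_right _
      rcases hp.dvd_or_dvd h5 with h6 | h6
      · have h7 : p ∣ 17^2*5 := by norm_num; exact h6
        rcases hp.dvd_or_dvd h7 with h8 | h8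
        · have h9 : Associated p 17 := hp.associated_of_dvd prime17 (hp.dvd_of_dvd_pow h8)
          exfalso; apply h17
          have : (17:ℤ) ∣ S^2 := dvd_eq' (dvd_sub (h9.symm.dvd.trans hsum) (Dvd.intro (2*f^2) rfl)) (by ring)
          exact prime17.dvd_of_dvd_pow this
        · have h9 : Associated p 5 := hp.associated_of_dvd prime5 h8
          have h10 : (5*5:ℤ) ∣ 1445*f^4 := by rw [← h3]; exact mul_dvd_mul (h9.symm.dvd.trans h1) (h9.symm.dvd.trans h2)
          have h11 : (5:ℤ) ∣ 289*f^4 := by omega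
          rcases prime5.dvd_or_dvd h11 with h12 | h12
          · norm_num at h12
          · exact h9.dvd.trans (prime5.dvd_of_dvd_pow h12)
      · exact hp.dvd_of_dvd_pow h6
    refine ⟨?_, hf⟩
    have : p ∣ S^2 := dvd_eq' (dvd_sub hsum (hf.mul_left (34*f))) (by ring)
    exact hp.dvd_of_dvd_pow this
  have fin : ∀ f U V S : ℤ, U*V = 1445*f^4 → U+V = S^2+34*f^2 → 0 < S → ¬ (17:ℤ) ∣ S → f ≠ 0 → IsCoprime U V → 
     ∃ σ g h u : ℤ, (σ = 1 ∨ σ = -1) ∧ u^2 = σ*(g^4-289*h^4)+17*g^2*h^2 ∧ g^4+289*h^4 = S ∧ g^2*h^2*u^2 = f^2 := by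
    intro f U V S h1 h2 hS h17 hf hc
    have hp : 0 < U*V := by rw [h1]; positivity
    have hs : 0 < U+V := by rw [h2]; positivity
    have : 0 < U ∧ 0 < V := by
      rcases mul_pos_iff.1 hp with h | h
      · exact h
      · linarith [h.1, h.2]
    exact halve_core this.1 this.2 hc hS h17 h1 h2
  have fin2 : ∀ f S : ℤ, f ≠ 0 → S ≤ 2*s → S^2*e^2 = 4*f^2*s^2 → (∃ σ g h u : ℤ, (σ = 1 ∨ σ = -1) ∧ u^2 = σ*(g^4-289*h^4)+17*g^2*h^2 ∧ g^4+289*h^4 = S ∧ g^2*h^2*u^2 = f^2) →  ∃ σ g h u : ℤ, (σ = 1 ∨ σ = -1) ∧ u^2 = σ*(g^4-289*h^4)+17*g^2*h^2 ∧ g^4+289*h^4 ≤ 2*s ∧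
      (g^4+289*h^4)^2*e^2 = 4*g^2*h^2*u^2*s^2 ∧ g ≠ 0 ∧ h ≠ 0 ∧ u ≠ 0 := by
    rintro f S hf h1 h2 ⟨σ, g, h, u, a1, a2, a3, a4⟩
    refine ⟨σ, g, h, u, a1, a2, by rw [a3]; exact h1, by rw [a3, h2, ← a4]; ring, ?_, ?_, ?_⟩
    · rintro rfl; apply hf; simpa using a4.symm
    · rintro rfl; apply hf; simpa using a4.symm
    · rintro rfl; apply hf; simpa using a4.symm
  rcases Int.even_or_odd' e with ⟨f, rfl | rfl⟩
  · -- even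
    have hsodd : s % 2 = 1 := by
      rcases Int.emod_two_eq_zero_or_one s with h0 | h0
      · exact absurd (pr_cop hc Int.prime_two (Int.dvd_of_emod_eq_zero h0) (Dvd.intro f rfl)) id
      · exact h0
    have hN : N % 2 = 1 := by
      have : N^2 % 2 = 1 := by
        have h1 := int_sq_odd hsodd
        have h2 : N^2 = (s^2)^2 + 2*(34*s^2*f^2-2312*f^4) := by rw [h]; ring
        have h3 := int_sq_odd (a := s^2) (by omega)
        omega
      rcases Int.emod_two_eq_zero_or_one N with h0 | h0
      · obtain ⟨k, rfl⟩ := Int.dvd_of_emod_eq_zero h0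
        have : (2*k)^2 = 2*(2*k^2) := by ring
        omega
      · exact h0
    have hs2 := int_sq_odd hsodd
    obtain ⟨k, hk⟩ : (2:ℤ) ∣ s^2 - N := by omega
    obtain ⟨U, hU⟩ : ∃ U, U = k+17*f^2 := ⟨_, rfl⟩
    obtain ⟨V, hV⟩ : ∃ V, V = s^2-k+17*f^2 := ⟨_, rfl⟩
    have hf : f ≠ 0 := by rintro rfl; simp at he
    have h17' := h17
    have e1 : U*V = 1445*f^4 := by
      have hN' : N = s^2-2*k := by linarith
      rw [hN'] at h; rw [hU, hV]
      have : 4*((k + 17 * f ^ 2) * (s ^ 2 - k + 17 * f ^ 2) - 1445 * f ^ 4) = 0 := by linear_combination -h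
      linarith
    have e2 : U+V = s^2+34*f^2 := by rw [hU, hV]; ring
    refine fin2 f s hf (by linarith) (by ring) (fin f U V s e1 e2 hs h17 hf ?_)
    apply cop_pr
    intro p hp h1 h2
    obtain ⟨a1, a2⟩ := h5 p f U V s hp h1 h2 e1 e2 h17
    exact pr_cop hc hp a1 (a2.mul_left 2)
  · obtain ⟨E, hE⟩ : ∃ E, E = 2*f+1 := ⟨_, rfl⟩
    rw [← hE] at he hc h fin2 ⊢
    have hEo : E % 2 = 1 := by omega
    obtain ⟨U, hU⟩ : ∃ U, U = 2*s^2+17*E^2-2*N := ⟨_, rfl⟩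
    obtain ⟨V, hV⟩ : ∃ V, V = 2*s^2+17*E^2+2*N := ⟨_, rfl⟩
    have h17' : ¬ (17:ℤ) ∣ 2*s := by
      intro h0; rcases prime17.dvd_or_dvd h0 with h1 | h1
      · norm_num at h1
      · exact h17 h1
    have e1 : U*V = 1445*E^4 := by rw [hU, hV]; linear_combination -4*h
    have e2 : U+V = (2*s)^2+34*E^2 := by rw [hU, hV]; ring
    refine fin2 E (2*s) he.ne' le_rfl (by ring) (fin E U V (2*s) e1 e2 (by linarith) h17' he.ne' ?_)
    apply cop_pr
    intro p hp h1 h2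
    obtain ⟨a1, a2⟩ := h5 p E U V (2*s) hp h1 h2 e1 e2 h17'
    rcases hp.dvd_or_dvd a1 with h3 | h3
    · have h4 : Associated p 2 := hp.associated_of_dvd Int.prime_two h3
      have := h4.symm.dvd.trans a2; omega
    · exact pr_cop hc hp h3 a2

set_option linter.unusedSectionVars false
set_option linter.unusedVariables false

abbrev E17 := EC ℚ 17 (-289) 0

lemma E17_disc : EDisc ℚ 17 (-289) 0 := by unfold EDisc; norm_num

/-- same `x`-coordinate means equal up to sign -/
lemma At.eq_or_neg {a b c : ℤ} {P Q : (EC ℚ a b c).Point} {x y y' : ℚ} (h : At P x y) (h' : At Q x y') : P = Q ∨ P = -Q := by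
  have h1 := h.eqn
  have h2 := h'.eqn
  have : y^2 = y'^2 := by rw [h1, h2]
  rcases sq_eq_sq_iff_eq_or_eq_neg.1 this with h3 | h3
  · left; subst h3; exact h.eq h'
  · right; subst h3; exact h.eq h'.neg

lemma halve_pt {N : E17.Point} {s e q : ℤ} {y : ℚ} (hN : At N (s^2/e^2) y) (hs : 0 < s) (he : 0 < e) (hc : IsCoprime s e)
    (h17 : ¬ (17:ℤ) ∣ s) (h : q^2 = s^4+17*s^2*e^2-289*e^4) :
    ∃ R : E17.Point, ∃ σ g h : ℤ, ∃ y' : ℚ, At R (((σ*g^2:ℤ):ℚ)/((h^2:ℤ):ℚ)) y' ∧ (σ = 1 ∨ σ = -1) ∧ (N = R+R ∨ N = -(R+R)) ∧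
      g^4+289*h^4 ≤ 2*s ∧ g ≠ 0 ∧ h ≠ 0 := by
  obtain ⟨σ, g, k, u, hσ, h1, h2, h3, hg, hk, hu⟩ := halve hs he hc h17 h
  have hg' : (g:ℚ) ≠ 0 := by exact_mod_cast hg
  have hk' : (k:ℚ) ≠ 0 := by exact_mod_cast hk
  have hu' : (u:ℚ) ≠ 0 := by exact_mod_cast hu
  have he' : (e:ℚ) ≠ 0 := by exact_mod_cast he.ne'
  have h1' : (u:ℚ)^2 = σ*(g^4-289*k^4)+17*g^2*k^2 := by exact_mod_cast h1
  have h3' : ((g:ℚ)^4+289*k^4)^2*e^2 = 4*g^2*k^2*u^2*s^2 := by exact_mod_cast h3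
  have hσ' : (σ:ℚ)^2 = 1 := by rcases hσ with rfl | rfl <;> norm_num
  have hσ3 : (σ:ℚ)^3 = σ := by rw [pow_succ, hσ', one_mul]
  have hσ4 : (σ:ℚ)^4 = 1 := by rw [show (σ:ℚ)^4 = (σ^2)^2 by ring, hσ', one_pow]
  obtain ⟨R, hR⟩ := At.mk E17_disc (x := (σ*g^2/k^2 : ℚ)) (y := (g*u/k^3:ℚ)) (by
    push_cast; field_simp; rw [h1']; linear_combination (-17*g^4*k^2-g^6*σ)*hσ')
  refine ⟨R, σ, g, k, _, hR.congr (by push_cast; rfl) rfl, hσ, ?_, h2, hg, hk⟩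
  have hy : 2*((g:ℚ)*u/k^3) ≠ 0 := by positivity
  have hd := hR.dbl hy (l := (3*(σ*g^2/k^2 : ℚ)^2+2*((17:ℤ):ℚ)*(σ*g^2/k^2 : ℚ)+((-289:ℤ):ℚ))/(2*((g:ℚ)*u/k^3))) (div_mul_cancel₀ _ hy)
  refine At.eq_or_neg hN (hd.congr ?_ rfl)
  push_cast
  have : (s:ℚ)^2/e^2 = ((g:ℚ)^4+289*k^4)^2/(4*g^2*k^2*u^2) := by
    field_simp; linear_combination -h3'
  rw [this]
  field_simp
  rw [h1']
  ring_nf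
  simp only [hσ', hσ3, hσ4]
  ring

lemma fin17 : ∀ s < 25, ∀ e < 25, (0 < s ∧ 0 < e ∧ Nat.gcd s e = 1 ∧
    (Nat.sqrt (289*e^4+17*s^2*e^2-s^4))^2 = 289*e^4+17*s^2*e^2-s^4 ∧ s^4 ≤ 289*e^4+17*s^2*e^2) → s = 3 ∧ e = 1 := by
  decide +kernel

lemma fin17' {s e q : ℤ} (hs : 0 < s) (he : 0 < e) (hs' : s < 25) (he' : e < 25) (hc : IsCoprime s e)
    (h : q^2 = 289*e^4+17*s^2*e^2-s^4) : s = 3 ∧ e = 1 := by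
  lift s to ℕ using hs.le
  lift e to ℕ using he.le
  have hle : s^4 ≤ 289*e^4+17*s^2*e^2 := by
    have : (s:ℤ)^4 ≤ 289*e^4+17*s^2*e^2 := by nlinarith [sq_nonneg q]
    exact_mod_cast this
  have hq : q.natAbs^2 = 289*e^4+17*s^2*e^2-s^4 := by
    zify [hle]; rw [sq_abs]; exact h
  have := fin17 s (by omega) e (by omega) ⟨by omega, by omega, Nat.isCoprime_iff_coprime.1 hc, by
    rw [← hq, pow_two q.natAbs, Nat.sqrt_eq, pow_two], hle⟩
  omega

/-- `E17(ℚ)` is generated by `P` and `T` -/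
theorem mw17 {P T : E17.Point} (hP : At P (-9) (-57)) (hT : At T 0 0) (N : E17.Point) :
    N ∈ AddSubgroup.closure {P, T} := by
  generalize hG : AddSubgroup.closure {P, T} = G
  have hPG : P ∈ G := by rw [← hG]; exact AddSubgroup.subset_closure (by simp)
  have hTG : T ∈ G := by rw [← hG]; exact AddSubgroup.subset_closure (by simp)
  have main : ∀ B : ℕ, ∀ N : E17.Point, ∀ x y : ℚ, At N x y → |x.num| ≤ B → (x.den:ℤ) ≤ B → N ∈ G := by
    intro B
    induction B using Nat.strong_induction_on with
    | _ B ih =>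
    -- halving step
    have half : ∀ (N : E17.Point) (s e q : ℤ) (y : ℚ), At N (s^2/e^2) y → 0 < s → 0 < e → IsCoprime s e → ¬ (17:ℤ) ∣ s →
        q^2 = s^4+17*s^2*e^2-289*e^4 → (s ≤ 298*B ∧ 596 < B ∨ s^2 ≤ B ) → N ∈ G := by
      intro N s e q y hN hs he hc h17 h hB
      obtain ⟨R, σ, g, k, y', hR, hσ, hNR, hgk, hg, hk⟩ := halve_pt hN hs he hc h17 h
      have hk2 : 0 < k^2 := by positivity
      have hg2 : 0 < g^2 := by positivity
      have hlt : g^2 < B ∧ k^2 < B := by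
        have e1 : g^4 = (g^2)^2 := by ring
        have e2 : k^4 = (k^2)^2 := by ring
        rw [e1, e2] at hgk
        rcases hB with ⟨h1, h2⟩ | h1
        · have h2' : (596:ℤ) < B := by exact_mod_cast h2
          constructor <;> by_contra hcon <;> push Not at hcon <;> nlinarith
        · constructor <;> by_contra hcon <;> push Not at hcon <;> nlinarith
      have hlt' : max (g^2) (k^2) < B := max_lt hlt.1 hlt.2
      obtain ⟨B', hB'⟩ : ∃ B' : ℕ, (B':ℤ) = max (g^2) (k^2) := ⟨(max (g^2) (k^2)).toNat, by
        rw [Int.toNat_of_nonneg]; exact le_max_of_le_left hg2.le⟩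
      have hσ0 : σ*g^2 ≠ 0 := by rcases hσ with rfl | rfl <;> simp [hg]
      obtain ⟨n1, n2⟩ := num_le (x := (((σ*g^2:ℤ):ℚ)/((k^2:ℤ):ℚ))) hk2.ne' hσ0 rfl
      have hab : |σ*g^2| = g^2 := by rcases hσ with rfl | rfl <;> simp
      rw [hab] at n1
      rw [abs_of_pos hk2] at n2
      have hRG := ih B' (by zify; rw [hB']; exact hlt') R _ y' hR (by rw [hB']; exact n1.trans (le_max_left _ _)) (by rw [hB']; exact n2.trans (le_max_right _ _))
      rcases hNR with h0 | h0
      · rw [h0]; exact G.add_mem hRG hRG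
      · rw [h0]; exact G.neg_mem (G.add_mem hRG hRG)
    have sqc : ∀ m e n : ℤ, IsCoprime m e → m ≠ 0 → ¬ (17:ℤ) ∣ m → n^2 = m^3+17*m^2*e^2-289*m*e^4 →
        ∃ s q : ℤ, 0 < s ∧ ((m = s^2 ∧ q^2 = s^4+17*s^2*e^2-289*e^4) ∨ (m = -s^2 ∧ q^2 = 289*e^4+17*s^2*e^2-s^4 ∧ n = s*q)) := by
      intro m e n hme hm0 h17 hn
      have hcop : IsCoprime m (m^2+17*m*e^2-289*e^4) := by
        apply cop_pr
        intro p hp h1 h2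
        have h3 : p ∣ 17^2*e^4 := dvd_eq' (dvd_sub (h1.mul_left (m+17*e^2)) h2) (by ring)
        rcases hp.dvd_or_dvd h3 with h4 | h4
        · have h5 := hp.associated_of_dvd prime17 (hp.dvd_of_dvd_pow h4)
          exact h17 (h5.symm.dvd.trans h1)
        · exact pr_cop hme hp h1 (hp.dvd_of_dvd_pow h4)
      obtain ⟨s, q, hsq⟩ := sq_split hcop hm0 (show m*(m^2+17*m*e^2-289*e^4) = n^2 by rw [hn]; ring)
      have hs0 : s ≠ 0 := by rintro rfl; simp at hsq; tauto
      have hss : |s|^2 = s^2 := sq_abs s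
      have hss4 : |s|^4 = s^4 := by rw [show |s|^4 = (|s|^2)^2 by ring, hss]; ring
      rcases hsq with ⟨h1, h2⟩ | ⟨h1, h2⟩
      · refine ⟨|s|, q, abs_pos.2 hs0, Or.inl ⟨by rw [hss, h1], ?_⟩⟩
        rw [hss, hss4, ← h2, h1]; ring
      · have hq : q^2 = 289*e^4+17*s^2*e^2-s^4 := by rw [h1] at h2; linear_combination h2
        have hn2 : n^2 = (|s| * q)^2 := by rw [hn, mul_pow, hss, h1, hq]; ring
        rcases sq_eq_sq_iff_eq_or_eq_neg.1 hn2 with h3 | h3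
        · refine ⟨|s|, q, abs_pos.2 hs0, Or.inr ⟨by rw [hss, h1], by rw [hss, hss4, hq], h3⟩⟩
        · refine ⟨|s|, -q, abs_pos.2 hs0, Or.inr ⟨by rw [hss, h1], by rw [hss, hss4, neg_sq, hq], by rw [h3]; ring⟩⟩
    -- 17 does not divide the numerator
    have core : ∀ (N : E17.Point) (x y : ℚ), At N x y → |x.num| ≤ B → (x.den:ℤ) ≤ B → ¬ (17:ℤ) ∣ x.num → N ∈ G := by
      intro N x y hN hB1 hB2 h17
      obtain ⟨m, e, n, he, hme, hx, hy, hn, hxm, hxe⟩ := pt_form hN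
      rw [hxm] at hB1 h17
      rw [hxe] at hB2
      have hm0 : m ≠ 0 := by rintro rfl; simp at h17
      have he' : (e:ℚ) ≠ 0 := by exact_mod_cast he.ne'
      obtain ⟨s, q, hs, hsq⟩ := sqc m e n hme hm0 h17 (by rw [hn]; ring)
      have hs' : (s:ℚ) ≠ 0 := by exact_mod_cast hs.ne'
      rcases hsq with ⟨rfl, hq⟩ | ⟨rfl, hq, rfl⟩
      · have hse : IsCoprime s e := (IsCoprime.pow_left_iff (by norm_num : 0 < 2)).1 hme
        refine half N s e q y (hN.congr (by rw [hx]; push_cast; rfl) rfl) hs he hse (fun h0 => h17 (h0.trans (dvd_pow_self _ (by norm_num)))) hq (Or.inr ?_)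
        rwa [abs_of_pos (by positivity)] at hB1
      · have hse : IsCoprime s e := (IsCoprime.pow_left_iff (by norm_num : 0 < 2)).1 ((IsCoprime.neg_left_iff _ _).1 hme)
        have h17s : ¬ (17:ℤ) ∣ s := fun h0 => h17 (by rw [dvd_neg]; exact h0.trans (dvd_pow_self _ (by norm_num)))
        rw [abs_neg, abs_of_pos (by positivity)] at hB1
        have hq' : (q:ℚ)^2 = 289*e^4+17*s^2*e^2-s^4 := by exact_mod_cast hq
        by_cases hs9 : s^2 = 9*e^2
        · have h9 : x = -9 := by
            rw [hx]; push_cast; rw [show (s:ℚ)^2 = 9*e^2 by exact_mod_cast hs9]; field_simp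
          rcases At.eq_or_neg (hN.congr h9 rfl) hP with h0 | h0
          · rw [h0]; exact hPG
          · rw [h0]; exact G.neg_mem hPG
        rcases Nat.lt_or_ge 596 B with hBB | hBB
        · have hs9' : (s:ℚ)^2-9*e^2 ≠ 0 := by rw [sub_ne_zero]; exact_mod_cast hs9
          obtain ⟨D, hD⟩ : ∃ D : ℚ, (s:ℚ)^2-9*e^2 = D := ⟨_, rfl⟩
          have hD0 : D ≠ 0 := by rw [← hD]; exact hs9'
          have hxne : x - (-9) ≠ 0 := by
            rw [hx]; push_cast
            intro h0; apply hs9'; field_simp at h0; linear_combination -h0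
          have hA := hN.add_ne hP (sub_ne_zero.1 hxne) (l := (y-(-57))/(x-(-9))) (div_mul_cancel₀ _ hxne)
          obtain ⟨q3, hq3⟩ : ∃ q3 : ℚ, q3 = (3*q+19*s*e)/(s^2-9*e^2) := ⟨_, rfl⟩
          have hx3 : ((y-(-57))/(x-(-9)))^2-((17:ℤ):ℚ)-x-(-9) = q3^2 := by
            have e1 : (y-(-57))/(x-(-9)) = -((s*q+57*e^3)/(e*(s^2-9*e^2))) := by
              rw [div_eq_iff hxne, hy, hx]; push_cast; rw [hD]; field_simp; rw [← hD]; ring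
            rw [e1, hq3, hx]; push_cast; rw [hD]; field_simp; rw [← hD]
            linear_combination (s^2-9*e^2)*hq'
          have hA' := hA.congr hx3 rfl
          generalize (y-(-57))/(x-(-9))*(x-(((y-(-57))/(x-(-9)))^2-((17:ℤ):ℚ)-x-(-9)))-y = y3 at hA'
          have hNP : N + P ∈ G := by
            obtain ⟨m3, e3, n3, he3, hme3, hx3', hy3', hn3, hxm3, hxe3⟩ := pt_form hA'
            have he3' : (e3:ℚ) ≠ 0 := by exact_mod_cast he3.ne'
            have hm3 : 0 ≤ m3 := by
              rw [← hxm3]; exact Rat.num_nonneg.2 (sq_nonneg _)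
            by_cases hm30 : m3 = 0
            · have e4 : q3^2 = 0 := by rw [hx3', hm30]; simp
              have hA2 := hA'.congr e4 rfl
              have := hA2.eqn
              have e5 : y3 = 0 := by have : y3^2 = 0 := by rw [this]; simp
                                     exact pow_eq_zero_iff (by norm_num) |>.1 this
              rw [e5] at hA2
              rw [hA2.eq hT]; exact hTG
            · -- m3 = (q3 e3)^2
              obtain ⟨s3', hs3'⟩ := rat_sq_int (q := q3*e3) (k := m3) (by rw [mul_pow, hx3']; field_simp)
              have hm3s : m3 = s3'^2 := by
                have : (q3*e3)^2 = m3 := by rw [mul_pow, hx3']; field_simp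
                rw [hs3'] at this; exact_mod_cast this.symm
              have hrel : s3'*(3*q-19*s*e) = -(e3*(9*s^2+289*e^2)) := by
                have : (s3':ℚ)*(3*q-19*s*e) = -(e3*(9*s^2+289*e^2)) := by
                  rw [← hs3', hq3, hD]; field_simp; rw [← hD]; linear_combination 9*hq'
                exact_mod_cast this
              have hcop3 : IsCoprime s3' e3 := by
                rw [hm3s] at hme3; exact (IsCoprime.pow_left_iff (by norm_num : 0 < 2)).1 hme3
              have hdv : s3' ∣ 9*s^2+289*e^2 := hcop3.dvd_of_dvd_mul_left (by
                rw [← dvd_neg, ← hrel]; exact Dvd.intro _ rfl)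
              have h173 : ¬ (17:ℤ) ∣ s3' := by
                intro h0
                have h1 := h0.trans hdv
                have h2 : (17:ℤ) ∣ s^2 := by omega
                exact h17s (prime17.dvd_of_dvd_pow h2)
              have hs30 : s3' ≠ 0 := by rintro rfl; simp at h173
              have hss : |s3'|^2 = s3'^2 := sq_abs s3'
              obtain ⟨s4, q4, hs4, hsq4⟩ := sqc m3 e3 n3 hme3 hm30 (by rw [hm3s]; exact fun h0 => h173 (prime17.dvd_of_dvd_pow h0)) (by rw [hn3]; ring)
              have hq4 : m3 = s4^2 ∧ q4^2 = s4^4+17*s4^2*e3^2-289*e3^4 := by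
                rcases hsq4 with h0 | h0
                · exact h0
                · exfalso; have := h0.1; have : 0 < s4^2 := by positivity
                  linarith
              have hs43 : s4 = |s3'| := by
                apply (sq_eq_sq₀ hs4.le (abs_nonneg _)).1; rw [hss, ← hm3s, hq4.1]
              have hle : s4 ≤ 9*s^2+289*e^2 := by
                rw [hs43]; exact Int.le_of_dvd (by positivity) ((abs_dvd _ _).2 hdv)
              refine half (N+P) s4 e3 q4 y3 (hA'.congr (by rw [hx3', hq4.1]; push_cast; rfl) rfl) hs4 he3 ?_ ?_ hq4.2 (Or.inl ⟨by linarith, hBB⟩)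
              · rw [hq4.1] at hme3; exact (IsCoprime.pow_left_iff (by norm_num : 0 < 2)).1 hme3
              · rw [hs43, dvd_abs]; exact h173
          have := G.sub_mem hNP hPG
          rwa [add_sub_cancel_right] at this
        · exfalso
          have hBB' : (B:ℤ) ≤ 596 := by exact_mod_cast hBB
          obtain ⟨h1, h2⟩ := fin17' hs he (by nlinarith) (by nlinarith) hse hq
          rw [h1, h2] at hs9; norm_num at hs9
    intro N x y hN hB1 hB2
    by_cases h17 : (17:ℤ) ∣ x.num
    · obtain ⟨m, e, n, he, hme, hx, hy, hn, hxm, hxe⟩ := pt_form hN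
      rw [hxm] at hB1 h17
      rw [hxe] at hB2
      by_cases hm0 : m = 0
      · have hx0 : x = 0 := by rw [hx, hm0]; simp
        have hN0 := hN.congr hx0 rfl
        have hy0 : y = 0 := by
          have h1 := hN0.eqn
          have : y^2 = 0 := by rw [h1]; simp
          exact pow_eq_zero_iff (by norm_num) |>.1 this
        rw [hy0] at hN0
        rw [hN0.eq hT]; exact hTG
      · obtain ⟨m1, rfl⟩ := h17
        have h17e : ¬ (17:ℤ) ∣ e := fun h0 => pr_cop hme prime17 (Dvd.intro _ rfl) h0
        have hn17 : (17:ℤ) ∣ n := prime17.dvd_of_dvd_pow (n := 2) (by rw [hn]; exact ⟨289*m1^3+289*m1^2*e^2-289*m1*e^4, by ring⟩)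
        obtain ⟨n1, rfl⟩ := hn17
        have hn1 : n1^2 = 17*(m1*(m1^2+m1*e^2-e^4)) := by
          have : 289*n1^2 = 289*(17*(m1*(m1^2+m1*e^2-e^4))) := by linear_combination hn
          linarith
        have hn17 : (17:ℤ) ∣ n1 := prime17.dvd_of_dvd_pow (n := 2) (by rw [hn1]; exact Dvd.intro _ rfl)
        obtain ⟨n2, rfl⟩ := hn17
        have h3 : (17:ℤ) ∣ m1*(m1^2+m1*e^2-e^4) := ⟨n2^2, by linarith⟩
        have h4 : (17:ℤ) ∣ m1 := by
          rcases prime17.dvd_or_dvd h3 with h5 | h5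
          · exact h5
          · exfalso; apply h17e
            rw [dvd17_zmod] at h5 ⊢
            push_cast at h5
            generalize ((m1:ℤ):ZMod 17) = u at h5
            generalize ((e:ℤ):ZMod 17) = S at h5 ⊢
            revert u S; decide +kernel
        obtain ⟨m2, rfl⟩ := h4
        have hm2 : m2 ≠ 0 := by rintro rfl; simp at hm0
        have hm2' : (m2:ℚ) ≠ 0 := by exact_mod_cast hm2
        have he' : (e:ℚ) ≠ 0 := by exact_mod_cast he.ne'
        have hx0 : x ≠ 0 := by rw [hx]; push_cast; positivity
        have hA := hN.add_ne hT hx0 (l := y/x) (by rw [sub_zero, sub_zero]; field_simp)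
        have hE := hN.eqn
        have hxT : (y/x)^2-((17:ℤ):ℚ)-x-0 = ((-e^2:ℤ):ℚ)/((m2:ℤ):ℚ) := by
          have : (y/x)^2-((17:ℤ):ℚ)-x-0 = -289/x := by
            rw [div_pow, hE]; push_cast; field_simp; ring
          rw [this, hx]; push_cast; field_simp; norm_num
        have hA' := hA.congr hxT rfl
        obtain ⟨n1, n2⟩ := num_le (x := ((-e^2:ℤ):ℚ)/((m2:ℤ):ℚ)) hm2 (by simp [he.ne']) rfl
        have hfin := core (N+T) _ _ hA' (n1.trans (by rw [abs_neg, abs_of_pos (by positivity)]; exact hB2)) (n2.trans (by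
          refine le_trans ?_ hB1
          rw [abs_mul, abs_mul]
          have := abs_nonneg m2
          norm_num; linarith)) (by
          intro h0
          have h1 : (((-e^2:ℤ):ℚ)/((m2:ℤ):ℚ)).num ∣ -e^2 := by
            have := Rat.num_dvd (-e^2) hm2; rwa [Rat.divInt_eq_div] at this
          have h2 := h0.trans h1
          rw [dvd_neg] at h2
          exact h17e (prime17.dvd_of_dvd_pow h2))
        have := G.sub_mem hfin hTG
        rwa [add_sub_cancel_right] at this
    · exact core N x y hN hB1 hB2 h17
  rcases at_or_zero N with rfl | ⟨x, y, h⟩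
  · exact G.zero_mem
  · exact main (max x.num.natAbs x.den) N x y h (by
      rw [Int.abs_eq_natAbs]; exact_mod_cast le_max_left _ _) (by exact_mod_cast le_max_right _ _)

set_option linter.unusedSectionVars false
set_option linter.unusedVariables false

instance fact13 : Fact (Nat.Prime 13) := ⟨by norm_num⟩
instance fact17 : Fact (Nat.Prime 17) := ⟨by norm_num⟩
instance fact59 : Fact (Nat.Prime 59) := ⟨by norm_num⟩
instance fact101 : Fact (Nat.Prime 101) := ⟨by norm_num⟩
instance fact127 : Fact (Nat.Prime 127) := ⟨by norm_num⟩
instance fact179 : Fact (Nat.Prime 179) := ⟨by norm_num⟩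
instance fact5 : Fact (Nat.Prime 5) := ⟨by norm_num⟩

lemma At.add_eq {F : Type} [Field F] [DecidableEq F] {a b c : ℤ} {P Q : (EC F a b c).Point} {x₁ y₁ x₂ y₂ : F} (l x₃ y₃ : F)
    (h : At P x₁ y₁) (h' : At Q x₂ y₂)
    (hh : x₁ ≠ x₂ ∧ l*(x₁-x₂) = y₁-y₂ ∧ l^2-a-x₁-x₂ = x₃ ∧ l*(x₁-x₃)-y₁ = y₃) : At (P+Q) x₃ y₃ := by
  obtain ⟨h1, h2, h3, h4⟩ := hh
  exact (h.add_ne h' h1 h2).congr h3 (by rw [h3, h4])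

lemma At.dbl_eq {F : Type} [Field F] [DecidableEq F] {a b c : ℤ} {P : (EC F a b c).Point} {x y : F} (l x₃ y₃ : F)
    (h : At P x y)
    (hh : 2*y ≠ 0 ∧ l*(2*y) = 3*x^2+2*a*x+b ∧ l^2-a-2*x = x₃ ∧ l*(x-x₃)-y = y₃) : At (P+P) x₃ y₃ := by
  obtain ⟨h1, h2, h3, h4⟩ := hh
  exact (h.dbl h1 h2).congr h3 (by rw [h3, h4])

lemma int_two_pow (k : ℤ) (hk : k ≠ 0) : ∃ (j : ℕ) (q : ℤ), k = 2^j*q ∧ q % 2 = 1 := by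
  obtain ⟨n, hn⟩ : ∃ n, n = k.natAbs := ⟨_, rfl⟩
  induction n using Nat.strong_induction_on generalizing k with
  | _ n ih =>
    rcases Int.emod_two_eq_zero_or_one k with h | h
    · obtain ⟨l, rfl⟩ := Int.dvd_of_emod_eq_zero h
      obtain ⟨j, q, h1, h2⟩ := ih l.natAbs (by omega) l (by omega) rfl
      exact ⟨j+1, q, by rw [h1]; ring, h2⟩
    · exact ⟨0, k, by ring, h⟩

lemma odd_zsmul_two_torsion {A : Type*} [AddCommGroup A] {T : A} (hT : T + T = 0) {q : ℤ} (hq : q % 2 = 1) : q • T = T := by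
  obtain ⟨k, rfl⟩ : ∃ k, q = 2*k+1 := ⟨q/2, by omega⟩
  rw [add_zsmul, mul_comm, mul_zsmul, two_zsmul, hT, zsmul_zero, zero_add, one_zsmul]

/-- the doubling sequence of `P` -/
lemma seq17 {P : E17.Point} (hP : At P (-9) (-57)) (j : ℕ) : ∃ m e n M : ℤ, At ((2^j:ℤ) • P) (m/e^2) (n/e^3) ∧ 0 < e ∧ IsCoprime m e ∧
    n^2 = m^3+17*m^2*e^2-289*m*e^4 ∧ m % 2 = 1 ∧ e % 2 = 1 ∧ ¬ (17:ℤ) ∣ m ∧ (1 ≤ j → (∃ s, m = s^2) ∧ ((5:ℤ) ∣ m ∨ (5:ℤ) ∣ e)) ∧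
    2*M = m^2+289*e^4 ∧ M % 4 = 1 := by
  have hM : ∀ m e : ℤ, m % 2 = 1 → e % 2 = 1 → ∃ M : ℤ, 2*M = m^2+289*e^4 ∧ M % 4 = 1 := by
    intro m e h1 h2
    have a1 := int_sq_odd h1
    have a2 := int_sq_odd h2
    have a3 := int_sq_odd (a := e^2) (by omega)
    have a4 : e^4 = (e^2)^2 := by ring
    rw [a4]
    exact ⟨(m^2+289*(e^2)^2)/2, by omega, by omega⟩
  induction j with
  | zero =>
    refine ⟨-9, 1, -57, 185, ?_, by norm_num, isCoprime_one_right, by norm_num, by norm_num, by norm_num, by norm_num, by norm_num, by norm_num, by norm_num⟩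
    rw [pow_zero, one_zsmul]; exact hP.congr (by norm_num) (by norm_num)
  | succ j ih =>
    obtain ⟨m, e, n, M, hR, he, hme, hn, hm2, he2, h17, h5, hM1, hM2⟩ := ih
    have he' : (e:ℚ) ≠ 0 := by exact_mod_cast he.ne'
    have hn2 : n % 2 = 1 := by
      rcases Int.emod_two_eq_zero_or_one n with h | h
      · exfalso
        have a1 := int_sq_odd hm2
        have a2 := int_sq_odd he2
        have a3 := int_sq_odd (a := e^2) (by omega)
        obtain ⟨l, rfl⟩ := Int.dvd_of_emod_eq_zero h
        obtain ⟨u, rfl⟩ : ∃ u, m = 2*u+1 := ⟨m/2, by omega⟩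
        obtain ⟨v, rfl⟩ : ∃ v, e = 2*v+1 := ⟨e/2, by omega⟩
        have := congrArg (Int.cast : ℤ → ZMod 2) hn
        push_cast at this
        have t : (2:ZMod 2) = 0 := by decide
        rw [t] at this; simp at this
        revert this; decide
      · exact h
    have hn0 : n ≠ 0 := by rintro rfl; simp at hn2
    have hn' : (n:ℚ) ≠ 0 := by exact_mod_cast hn0
    have hnq : (n:ℚ)^2 = m^3+17*m^2*e^2-289*m*e^4 := by exact_mod_cast hn
    have hMq : 2*(M:ℚ) = m^2+289*e^4 := by exact_mod_cast hM1
    have hd := hR.dbl (l := (3*(m/e^2:ℚ)^2+2*((17:ℤ):ℚ)*(m/e^2:ℚ)+((-289:ℤ):ℚ))/(2*((n:ℚ)/e^3))) (by positivity) (div_mul_cancel₀ _ (by positivity))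
    have hx : ((3*(m/e^2:ℚ)^2+2*((17:ℤ):ℚ)*(m/e^2:ℚ)+((-289:ℤ):ℚ))/(2*((n:ℚ)/e^3)))^2-((17:ℤ):ℚ)-2*(m/e^2:ℚ) = (M/(n*e))^2 := by
      have : (M:ℚ) = (m^2+289*e^4)/2 := by linarith
      rw [this]; push_cast; field_simp
      rw [hnq]; ring
    have hS : (2^j:ℤ) • P + (2^j:ℤ) • P = (2^(j+1):ℤ) • P := by rw [← add_zsmul]; congr 1; ring
    rw [hS] at hd
    obtain ⟨m', e', n', he0, hme', hx', hy', hn3, -, -⟩ := pt_form (hd.congr hx rfl)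
    have he0' : (e':ℚ) ≠ 0 := by exact_mod_cast he0.ne'
    have hrel : m'*(n*e)^2 = M^2*e'^2 := by
      have : (m':ℚ)*(n*e)^2 = M^2*e'^2 := by
        field_simp at hx'; linear_combination -hx'
      exact_mod_cast this
    have hcop2 : IsCoprime (m') (e'^2) := hme'.pow_right
    have hm'd : m' ∣ M^2 := hcop2.dvd_of_dvd_mul_right (by rw [← hrel]; exact Dvd.intro _ rfl)
    have he'd : e'^2 ∣ (n*e)^2 := hcop2.symm.dvd_of_dvd_mul_left (by rw [hrel]; exact Dvd.intro_left _ rfl)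
    have he'd1 : e' ∣ n*e := (Int.pow_dvd_pow_iff (by norm_num)).1 he'd
    have hm'2 : m' % 2 = 1 := by
      rcases Int.emod_two_eq_zero_or_one m' with h | h
      · exfalso
        have := Int.prime_two.dvd_of_dvd_pow ((Int.dvd_of_emod_eq_zero h).trans hm'd)
        omega
      · exact h
    have he'2 : e' % 2 = 1 := by
      rcases Int.emod_two_eq_zero_or_one e' with h | h
      · exfalso
        rcases Int.prime_two.dvd_or_dvd ((Int.dvd_of_emod_eq_zero h).trans he'd1) with h0 | h0 <;> omega
      · exact h
    have h17M : ¬ (17:ℤ) ∣ M := by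
      intro h0
      have : (17:ℤ) ∣ m^2 := by omega
      exact h17 (prime17.dvd_of_dvd_pow this)
    have hsq : ∃ s, m' = s^2 := by
      have e1 : (M/(n*e)*e' : ℚ)^2 = m' := by rw [mul_pow, hx']; field_simp
      obtain ⟨s, hs⟩ := rat_sq_int e1
      rw [hs] at e1
      exact ⟨s, by exact_mod_cast e1.symm⟩
    have h5' : (5:ℤ) ∣ m' ∨ (5:ℤ) ∣ e' := by
      rcases Nat.eq_zero_or_pos j with rfl | hj
      · rw [pow_zero, one_zsmul] at hR
        obtain ⟨a1, a2⟩ := hP.uniq hR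
        have a3 : m = -9*e^2 := by
          have : (m:ℚ) = -9*e^2 := by field_simp at a1; linarith
          exact_mod_cast this
        have a4 : e = 1 := by
          have a5 : e ∣ m := by rw [a3]; exact ⟨-9*e, by ring⟩
          have := (hme.symm.isUnit_of_dvd' (dvd_refl e) a5)
          rcases Int.isUnit_iff.1 this with h | h
          · exact h
          · omega
        subst a4
        have a5 : M = 185 := by rw [a3] at hM1; omega
        have a6 : n^2 = 3249 := by rw [hn, a3]; norm_num
        left
        have a7 : (5:ℤ) ∣ m'*3249 := ⟨37*185*e'^2, by rw [a5] at hrel; rw [← a6]; linear_combination hrel⟩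
        omega
      · obtain ⟨-, h6⟩ := h5 hj
        have hM5 : ¬ (5:ℤ) ∣ M := by
          intro h0
          have h7 : (5:ℤ) ∣ m^2+289*e^4 := by rw [← hM1]; exact h0.mul_left 2
          rcases h6 with h6 | h6
          · have : (5:ℤ) ∣ 289*e^4 := dvd_eq' (dvd_sub h7 (h6.mul_left m)) (by ring)
            rcases prime5.dvd_or_dvd this with h8 | h8
            · norm_num at h8
            · exact pr_cop hme prime5 h6 (prime5.dvd_of_dvd_pow h8)
          · have : (5:ℤ) ∣ m^2 := dvd_eq' (dvd_sub h7 (h6.mul_left (289*e^3))) (by ring)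
            exact pr_cop hme prime5 (prime5.dvd_of_dvd_pow this) h6
        have h8 : (5:ℤ) ∣ n*e := by
          rcases h6 with h6 | h6
          · have : (5:ℤ) ∣ n^2 := by rw [hn]; exact dvd_eq' (h6.mul_left (m^2+17*m*e^2-289*e^4)) (by ring)
            exact (prime5.dvd_of_dvd_pow this).mul_right _
          · exact h6.mul_left _
        right
        have h9 : (5:ℤ) ∣ M^2*e'^2 := by rw [← hrel]; exact (h8.trans (dvd_pow_self _ (by norm_num))).mul_left _
        rcases prime5.dvd_or_dvd h9 with h10 | h10
        · exact absurd (prime5.dvd_of_dvd_pow h10) hM5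
        · exact prime5.dvd_of_dvd_pow h10
    obtain ⟨M', hM1', hM2'⟩ := hM m' e' hm'2 he'2
    exact ⟨m', e', n', M', (hd.congr hx rfl).congr hx' hy', he0, hme', by rw [hn3]; ring, hm'2, he'2,
      fun h0 => h17M (prime17.dvd_of_dvd_pow (h0.trans hm'd)), fun _ => ⟨hsq, h5'⟩, hM1', hM2'⟩

/-- `2 R ≡ T` modulo prime divisors of `M` -/
lemma red_two {p : ℕ} [Fact p.Prime] (hd : EDisc (ZMod p) 17 (-289) 0) {R T : E17.Point} {m e n M : ℤ}
    (hR : At R (m/e^2) (n/e^3)) (hT : At T 0 0) (hme : IsCoprime m e) 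
    (hM : 2*M = m^2+289*e^4) (hpM : (M : ZMod p) = 0) : redHom hd R + redHom hd R = redHom hd T := by
  have h2 : (2:ZMod p) ≠ 0 := hd.two
  have hbad : ((16*289^2*1445:ℤ):ZMod p) ≠ 0 := by
    unfold EDisc at hd; intro h0; apply hd; rw [← h0]; norm_num
  have hM' : (m:ZMod p)^2+289*(e:ZMod p)^4 = 0 := by
    have := congrArg (Int.cast : ℤ → ZMod p) hM
    push_cast at this; rw [← this, hpM, mul_zero]
  have he : (e:ZMod p) ≠ 0 := by
    intro h0
    rw [h0] at hM'
    have h1 : (m:ZMod p) = 0 := by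
      have : (m:ZMod p)^2 = 0 := by rw [← hM']; ring
      exact pow_eq_zero_iff (by norm_num) |>.1 this
    obtain ⟨u, v, huv⟩ := hme
    have := congrArg (Int.cast : ℤ → ZMod p) huv
    push_cast at this; rw [h0, h1] at this; simp at this
  have hec : ((((e:ℚ)^2):ℚ):ZMod p) = (e:ZMod p)^2 := by
    rw [(PI_int e).cpow]; simp
  have hPI : PI p ((m:ℚ)/e^2) ∧ ((((m:ℚ)/e^2):ℚ):ZMod p) * (e:ZMod p)^2 = m := by
    have he0 : (e:ℚ) ≠ 0 := by intro h0; apply he; have : e = 0 := by exact_mod_cast h0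
                               rw [this]; simp
    have := PI_of_mul (p := p) (l := (m:ℚ)/e^2) (d := (e:ℚ)^2) (e := m) ((PI_int e).pow 2) (PI_int m) (by field_simp) (by rw [hec]; exact pow_ne_zero _ he)
    rw [hec] at this
    simpa using this
  obtain ⟨-, hA⟩ := redHom_at hd hR hPI.1
  have hTT : At (redHom hd T) 0 0 := by
    obtain ⟨-, h⟩ := redHom_at hd hT PI_zero
    exact h.congr (by simp) (by simp)
  generalize ((((n:ℚ)/e^3):ℚ):ZMod p) = y at hA
  have hx := hPI.2
  generalize ((((m:ℚ)/e^2):ℚ):ZMod p) = x at hA hx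
  have hx2 : x^2 = -289 := by
    rw [← hx] at hM'
    apply mul_right_cancel₀ (pow_ne_zero 4 he)
    linear_combination hM'
  have hE := hA.eqn
  push_cast at hE
  have hy : y ≠ 0 := by
    intro h0
    rw [h0] at hE
    apply hbad
    push_cast
    have e1 : x*(17*x-578) = 0 := by linear_combination -hE-(x)*hx2
    rcases mul_eq_zero.1 e1 with h1 | h1
    · rw [h1] at hx2; linear_combination (16*289*1445:ZMod p)*hx2
    · have e3 : (17:ZMod p)^2*x^2 = 578^2 := by linear_combination (17*x+578)*h1
      rw [hx2] at e3
      linear_combination (-(16*289):ZMod p)*e3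
  have h2y : 2*y ≠ 0 := mul_ne_zero h2 hy
  obtain ⟨l, hl⟩ : ∃ l : ZMod p, l*(2*y) = 3*x^2+2*((17:ℤ):ZMod p)*x+((-289:ℤ):ZMod p) := ⟨_, div_mul_cancel₀ _ h2y⟩
  have hdb := hA.dbl h2y hl
  push_cast at hl
  have hX : l^2-((17:ℤ):ZMod p)-2*x = 0 := by
    push_cast
    apply mul_left_cancel₀ (pow_ne_zero 2 h2y)
    have : (2*y)^2*(l^2-17-2*x) = (x^2+289)^2 := by
      linear_combination (l*(2*y)+(3*x^2+34*x-289))*hl - (4*17+8*x)*hE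
    rw [this, hx2]; ring
  have hdb2 := hdb.congr hX rfl
  generalize l*(x-(l^2-((17:ℤ):ZMod p)-2*x))-y = y2 at hdb2
  have hy2 : y2 = 0 := by
    have := hdb2.eqn
    have : y2^2 = 0 := by rw [this]; simp
    exact pow_eq_zero_iff (by norm_num) |>.1 this
  rw [hy2] at hdb2
  exact hdb2.eq hTT

set_option linter.unusedSectionVars false
set_option linter.unusedVariables false
open NumberTheorySymbols

/-- from a rational solution of `17 v² = r⁴ + 4 (r-1)²` to points on the curve -/
lemma pt17 {P : E17.Point} (hP : At P (-9) (-57)) {r v : ℚ} (h : 17*v^2 = r^4+4*(r-1)^2) (hr : r ≠ -1) :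
    ∃ N N' : E17.Point, N + N' = P ∧ (∃ z y, At N z y ∧ (5*z+102-y)*(r+1) = 17*(z+9) ∧ -(z^2-17*z-1156)*(r+1) = 17*(5*z+102+y)) ∧
      (∃ z y, At N' z y ∧ (5*z+102-y)*(r+1) = 17*(z+9) ∧ -(z^2-17*z-1156)*(r+1) = 17*(5*z+102+y)) := by
  have hr1 : r+1 ≠ 0 := fun h0 => hr (by linarith)
  have hv : v ≠ 0 := by
    rintro rfl
    have h1 : r^4+4*(r-1)^2 = 0 := by rw [← h]; ring
    have h2 : r = 0 := by
      have : r^4 = 0 := by nlinarith [sq_nonneg (r^2), sq_nonneg (r-1)]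
      exact pow_eq_zero_iff (by norm_num) |>.1 this
    rw [h2] at h1; norm_num at h1
  obtain ⟨w, hw⟩ : ∃ w, w = (r+1)⁻¹ := ⟨_, rfl⟩
  have hw1 : w*(r+1) = 1 := by rw [hw]; exact inv_mul_cancel₀ hr1
  have hwr : w ≠ 0 := by rw [hw]; exact inv_ne_zero hr1
  have hrw : r = 1/w-1 := by rw [hw]; field_simp; ring
  have key : ∀ v : ℚ, 17*v^2 = r^4+4*(r-1)^2 → ∃ N : E17.Point, ∃ z y, z = 17*(r^2-8*r+8-17*v)*w^2/2 ∧ y = 5*z+102-17*(z+9)*w ∧ At N z y ∧ (5*z+102-y)*(r+1) = 17*(z+9) ∧ -(z^2-17*z-1156)*(r+1) = 17*(5*z+102+y) := by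
    intro v h
    obtain ⟨z, hz⟩ : ∃ z, z = 17*(r^2-8*r+8-17*v)*w^2/2 := ⟨_, rfl⟩
    obtain ⟨y, hy⟩ : ∃ y, y = 5*z+102-17*(z+9)*w := ⟨_, rfl⟩
    have hq : z^2 - 17*(1-10*w+17*w^2)*z - 289*(2-3*w)^2 = 0 := by
      have hv' : v = (17*(r^2-8*r+8)-2*z/w^2)/289 := by rw [hz]; field_simp; ring
      rw [hv', hrw] at h
      field_simp at h
      have h3 : 68*(z^2 - 17*(1-10*w+17*w^2)*z - 289*(2-3*w)^2) = 0 := by linear_combination h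
      linarith
    have hE : y^2 = z^3+((17:ℤ):ℚ)*z^2+((-289:ℤ):ℚ)*z+((0:ℤ):ℚ) := by
      push_cast; rw [hy]; linear_combination -(z+9)*hq
    obtain ⟨N, hN⟩ := At.mk E17_disc hE
    refine ⟨N, z, y, hz, hy, hN, ?_, ?_⟩
    · rw [hy]; linear_combination 17*(z+9)*hw1
    · rw [hy]
      have h9 : -(z^2-17*z-1156) = 17*w*(10*z+204-17*(z+9)*w) := by linear_combination -hq
      rw [h9]; linear_combination 17*(10*z+204-17*(z+9)*w)*hw1
  obtain ⟨N, z, y, hz, hy, hN, c1, c2⟩ := key v h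
  obtain ⟨N', z', y', hz', hy', hN', c1', c2'⟩ := key (-v) (by rw [neg_sq]; exact h)
  refine ⟨N, N', ?_, ⟨z, y, hN, c1, c2⟩, ⟨z', y', hN', c1', c2'⟩⟩
  have hne : z ≠ z' := by
    intro h0
    rw [hz, hz'] at h0
    have : 289*v*w^2 = 0 := by linear_combination -h0
    have := mul_ne_zero (mul_ne_zero (by norm_num : (289:ℚ) ≠ 0) hv) (pow_ne_zero 2 hwr)
    contradiction
  refine At.eq (hN.add_eq (5-17*w) (-9) (-57) hN' ⟨hne, by rw [hy, hy']; ring, ?_, ?_⟩) hP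
  · rw [hz, hz', hrw]; push_cast; field_simp; ring
  · rw [hy]; ring

/-- reduction of a square condition -/
lemma sq_red {p : ℕ} [Fact p.Prime] {f q : ℚ} (hf : PI p f) (h : f = q^2) : IsSquare ((f:ℚ):ZMod p) := by
  have hq : PI p q := PI_of_pow (n := 2) (by norm_num) (by rw [← h]; exact hf)
  rw [h, hq.cpow]; exact ⟨_, pow_two _⟩

/-- a polynomial expression with integer coefficients is compatible with reduction -/
lemma PI_F6 {p : ℕ} [Fact p.Prime] {z y : ℚ} (hz : PI p z) (hy : PI p y) {f : ℚ} {R1 R2 : ℚ} 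
    (h1 : PI p R1) (h2 : PI p R2) (hf : f = 17*(R1^4-16*R1*R2^3)) : PI p f ∧ ((f:ℚ):ZMod p) = 17*((R1:ZMod p)^4-16*R1*R2^3) := by
  have a1 := h1.pow 4
  have a2 := (PI_ofNat (p := p) 16).mul h1
  have a3 := a2.mul (h2.pow 3)
  refine ⟨by rw [hf]; exact (PI_ofNat 17).mul (a1.sub a3), ?_⟩
  rw [hf, (PI_ofNat (p := p) 17).cmul (a1.sub a3), a1.csub a3, a2.cmul (h2.pow 3), (PI_ofNat (p := p) 16).cmul h1, h1.cpow, h2.cpow]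
  simp

lemma PI_F4 {p : ℕ} [Fact p.Prime] {f : ℚ} {R1 R2 : ℚ} 
    (h1 : PI p R1) (h2 : PI p R2) (hf : f = 17*(R1^2+4*R2^2)) : PI p f ∧ ((f:ℚ):ZMod p) = 17*((R1:ZMod p)^2+4*R2^2) := by
  have a1 := h1.pow 2
  have a2 := (PI_ofNat (p := p) 4).mul (h2.pow 2)
  refine ⟨by rw [hf]; exact (PI_ofNat 17).mul (a1.add a2), ?_⟩
  rw [hf, (PI_ofNat (p := p) 17).cmul (a1.add a2), a1.cadd a2, (PI_ofNat (p := p) 4).cmul (h2.pow 2), h1.cpow, h2.cpow]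
  simp

lemma PI_R2 {p : ℕ} [Fact p.Prime] {z y : ℚ} (hz : PI p z) (hy : PI p y) :
    PI p (5*z+102-y) ∧ (((5*z+102-y:ℚ)):ZMod p) = 5*(z:ZMod p)+102-y := by
  have a1 := (PI_ofNat (p := p) 5).mul hz
  have a2 := a1.add (PI_ofNat (p := p) 102)
  refine ⟨a2.sub hy, ?_⟩
  rw [a2.csub hy, a1.cadd (PI_ofNat 102), (PI_ofNat (p := p) 5).cmul hz]; simp

lemma PI_R1 {p : ℕ} [Fact p.Prime] {z y : ℚ} (hz : PI p z) (hy : PI p y) :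
    PI p (17*(z+9)-(5*z+102-y)) ∧ (((17*(z+9)-(5*z+102-y):ℚ)):ZMod p) = 17*((z:ZMod p)+9)-(5*z+102-y) := by
  have a1 := hz.add (PI_ofNat (p := p) 9)
  have a2 := (PI_ofNat (p := p) 17).mul a1
  have b := PI_R2 hz hy
  refine ⟨a2.sub b.1, ?_⟩
  rw [a2.csub b.1, b.2, (PI_ofNat (p := p) 17).cmul a1, hz.cadd (PI_ofNat 9)]; simp

lemma PI_R2' {p : ℕ} [Fact p.Prime] {z : ℚ} (hz : PI p z) :
    PI p (-(z^2-17*z-1156)) ∧ (((-(z^2-17*z-1156):ℚ)):ZMod p) = -((z:ZMod p)^2-17*z-1156) := by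
  have a1 := (PI_ofNat (p := p) 17).mul hz
  have a2 := (hz.pow 2).sub a1
  have a3 := a2.sub (PI_ofNat (p := p) 1156)
  refine ⟨a3.neg, ?_⟩
  rw [PI.cneg, a2.csub (PI_ofNat 1156), (hz.pow 2).csub a1, (PI_ofNat (p := p) 17).cmul hz, hz.cpow]; simp

lemma PI_R1' {p : ℕ} [Fact p.Prime] {z y : ℚ} (hz : PI p z) (hy : PI p y) :
    PI p (17*(5*z+102+y)-(-(z^2-17*z-1156))) ∧ (((17*(5*z+102+y)-(-(z^2-17*z-1156)):ℚ)):ZMod p) = 17*(5*(z:ZMod p)+102+y)-(-((z:ZMod p)^2-17*z-1156)) := by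
  have a1 := (PI_ofNat (p := p) 5).mul hz
  have a2 := a1.add (PI_ofNat (p := p) 102)
  have a3 := (PI_ofNat (p := p) 17).mul (a2.add hy)
  have b := PI_R2' hz
  refine ⟨a3.sub b.1, ?_⟩
  rw [a3.csub b.1, b.2, (PI_ofNat (p := p) 17).cmul (a2.add hy), a2.cadd hy, a1.cadd (PI_ofNat 102), (PI_ofNat (p := p) 5).cmul hz]; simp

/-- the point `N` corresponds to the parameter `r` -/
def Par (N : E17.Point) (r : ℚ) : Prop := ∃ z y, At N z y ∧ (5*z+102-y)*(r+1) = 17*(z+9) ∧ -(z^2-17*z-1156)*(r+1) = 17*(5*z+102+y)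

lemma Par.ne_zero {N : E17.Point} {r : ℚ} (h : Par N r) : N ≠ 0 := by
  obtain ⟨z, y, h, -⟩ := h; exact h.ne_zero

lemma Par.red6 {p : ℕ} [Fact p.Prime] (hd : EDisc (ZMod p) 17 (-289) 0) {N : E17.Point} {r u : ℚ} (h : Par N r)
    (hu : r^4-16*r = 17*u^2) {Z Y : ZMod p} (hZ : At (redHom hd N) Z Y) :
    IsSquare (17*((17*(Z+9)-(5*Z+102-Y))^4-16*(17*(Z+9)-(5*Z+102-Y))*(5*Z+102-Y)^3)) := by
  obtain ⟨z, y, hN, c1, c2⟩ := h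
  obtain ⟨hz, hy, rfl, rfl⟩ := redHom_at' hd hN hZ
  have b2 := PI_R2 hz hy
  have b1 := PI_R1 hz hy
  have := PI_F6 hz hy b1.1 b2.1 rfl
  rw [b1.2, b2.2] at this
  rw [← this.2]
  refine sq_red (q := 17*u*(5*z+102-y)^2) this.1 ?_
  rw [← c1]; linear_combination 17*(5*z+102-y)^4*hu

lemma Par.red4 {p : ℕ} [Fact p.Prime] (hd : EDisc (ZMod p) 17 (-289) 0) {N : E17.Point} {r u : ℚ} (h : Par N r)
    (hu : r^2+4 = 17*u^2) {Z Y : ZMod p} (hZ : At (redHom hd N) Z Y) :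
    IsSquare (17*((17*(Z+9)-(5*Z+102-Y))^2+4*(5*Z+102-Y)^2)) := by
  obtain ⟨z, y, hN, c1, c2⟩ := h
  obtain ⟨hz, hy, rfl, rfl⟩ := redHom_at' hd hN hZ
  have b2 := PI_R2 hz hy
  have b1 := PI_R1 hz hy
  have := PI_F4 b1.1 b2.1 rfl
  rw [b1.2, b2.2] at this
  rw [← this.2]
  refine sq_red (q := 17*u*(5*z+102-y)) this.1 ?_
  rw [← c1]; linear_combination 17*(5*z+102-y)^2*hu

lemma Par.red4' {p : ℕ} [Fact p.Prime] (hd : EDisc (ZMod p) 17 (-289) 0) {N : E17.Point} {r u : ℚ} (h : Par N r)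
    (hu : r^2+4 = 17*u^2) {Z Y : ZMod p} (hZ : At (redHom hd N) Z Y) :
    IsSquare (17*((17*(5*Z+102+Y)-(-(Z^2-17*Z-1156)))^2+4*(-(Z^2-17*Z-1156))^2)) := by
  obtain ⟨z, y, hN, c1, c2⟩ := h
  obtain ⟨hz, hy, rfl, rfl⟩ := redHom_at' hd hN hZ
  have b2 := PI_R2' hz
  have b1 := PI_R1' hz hy
  have := PI_F4 b1.1 b2.1 rfl
  rw [b1.2, b2.2] at this
  rw [← this.2]
  refine sq_red (q := 17*u*(-(z^2-17*z-1156))) this.1 ?_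
  rw [← c2]; linear_combination 17*(-(z^2-17*z-1156))^2*hu

lemma red_PT {p : ℕ} [Fact p.Prime] (hd : EDisc (ZMod p) 17 (-289) 0) {P T : E17.Point} (hP : At P (-9) (-57)) (hT : At T 0 0) :
    At (redHom hd P) (-9) (-57) ∧ At (redHom hd T) 0 0 := by
  constructor
  · obtain ⟨-, h⟩ := redHom_at hd hP (PI_ofNat (p := p) 9).neg
    exact h.congr (by rw [PI.cneg]; simp) (by rw [PI.cneg]; simp)
  · obtain ⟨-, h⟩ := redHom_at hd hT PI_zero
    exact h.congr (by simp) (by simp)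

lemma TT17 {F : Type} [Field F] [DecidableEq F] {a b c : ℤ} {T : (EC F a b c).Point} {x : F} (hT : At T x 0) : T + T = 0 :=
  hT.add_neg (hT.congr rfl (by simp))

lemma zsmul_mod {A : Type*} [AddCommGroup A] {P : A} {n : ℤ} (h : n • P = 0) (k : ℤ) : k • P = (k % n) • P := by
  conv_lhs => rw [← Int.emod_add_mul_ediv k n, add_zsmul, mul_comm, mul_zsmul, h, zsmul_zero, add_zero]

/-- existence of a prime divisor with prescribed character -/
lemma exists_bad_prime {M : ℤ} (hM : 0 < M) {a : ℤ} (hJ : J(a | M.toNat) = -1) : ∃ p : ℕ, ∃ _ : Fact p.Prime, (M : ZMod p) = 0 ∧ ¬ IsSquare ((a:ℤ):ZMod p) := by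
  obtain ⟨p, hp, h1, h2⟩ := jacobiSym.eq_neg_one_at_prime_divisor_of_eq_neg_one hJ
  haveI : Fact p.Prime := ⟨hp⟩
  refine ⟨p, this, ?_, ZMod.nonsquare_of_jacobiSym_eq_neg_one h2⟩
  rw [ZMod.intCast_zmod_eq_zero_iff_dvd]
  rw [← Int.toNat_of_nonneg hM.le]; exact_mod_cast h1

lemma EDisc17 {p : ℕ} [Fact p.Prime] (h2 : (2:ZMod p) ≠ 0) (h5 : (5:ZMod p) ≠ 0) (h17 : (17:ZMod p) ≠ 0) : EDisc (ZMod p) 17 (-289) 0 := by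
  unfold EDisc
  have : ((16*(-4*17^3*0+17^2*(-289)^2+18*17*(-289)*0-4*(-289)^3-27*0^2):ℤ):ZMod p) = 2^4*17^6*5 := by push_cast; norm_num
  rw [this]
  exact mul_ne_zero (mul_ne_zero (pow_ne_zero _ h2) (pow_ne_zero _ h17)) h5

lemma prime_eq_of_zero {p q : ℕ} [hp : Fact p.Prime] (hq : q.Prime) (h : (q:ZMod p) = 0) : p = q := by
  rw [ZMod.natCast_eq_zero_iff] at h
  exact (Nat.prime_dvd_prime_iff_eq hp.out hq).1 h

set_option linter.unusedSectionVars false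
set_option linter.unusedVariables false
open NumberTheorySymbols

lemma rep17 {P T : E17.Point} (hP : At P (-9) (-57)) (hT : At T 0 0) {r v : ℚ} (h : 17*v^2 = r^4+4*(r-1)^2) (hr : r ≠ -1) :
    ∃ k : ℤ, (Par ((2*k) • P) r ∧ Par ((1-2*k) • P) r) ∨ (Par (T + (2*k) • P) r ∧ Par (T + (1-2*k) • P) r) := by
  have hTT : T + T = 0 := TT17 hT
  obtain ⟨N, N', hs, h1, h2⟩ := pt17 hP h hr
  have h1 : Par N r := h1
  have h2 : Par N' r := h2
  obtain ⟨k, n, hN⟩ := AddSubgroup.mem_closure_pair.1 (mw17 hP hT N)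
  have hN' : N' = P - N := by rw [← hs]; abel
  rcases Int.emod_two_eq_zero_or_one n with hn | hn
  · have hnT : n • T = 0 := by
      obtain ⟨l, rfl⟩ := Int.dvd_of_emod_eq_zero hn
      rw [mul_comm, mul_zsmul, two_zsmul, hTT, zsmul_zero]
    have e1 : N = k • P := by rw [← hN, hnT, add_zero]
    have e2 : N' = (1-k) • P := by rw [hN', e1]; module
    rw [e1] at h1; rw [e2] at h2
    rcases Int.emod_two_eq_zero_or_one k with hk | hk
    · obtain ⟨l, rfl⟩ := Int.dvd_of_emod_eq_zero hk
      exact ⟨l, Or.inl ⟨h1, h2⟩⟩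
    · obtain ⟨l, rfl⟩ : ∃ l, k = 1-2*l := ⟨(1-k)/2, by omega⟩
      exact ⟨l, Or.inl ⟨by convert h2 using 2; ring, h1⟩⟩
  · have hnT : n • T = T := odd_zsmul_two_torsion hTT hn
    have e1 : N = T + k • P := by rw [← hN, hnT, add_comm]
    have e2 : N' = T + (1-k) • P := by
      have : -T = T := neg_eq_of_add_eq_zero_left hTT
      rw [hN', e1]; nth_rewrite 2 [← this]; module
    rw [e1] at h1; rw [e2] at h2
    rcases Int.emod_two_eq_zero_or_one k with hk | hk
    · obtain ⟨l, rfl⟩ := Int.dvd_of_emod_eq_zero hk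
      exact ⟨l, Or.inr ⟨h1, h2⟩⟩
    · obtain ⟨l, rfl⟩ : ∃ l, k = 1-2*l := ⟨(1-k)/2, by omega⟩
      exact ⟨l, Or.inr ⟨by convert h2 using 3; ring, h1⟩⟩

lemma sv101 {P T : (EC (ZMod 101) 17 (-289) 0).Point} (hP : At P (-9) (-57)) (hT : At T 0 0) (k : ℤ) :
    ∃ Z Y : ZMod 101, At (T + k • P) Z Y ∧ ¬ IsSquare (17*((17*(Z+9)-(5*Z+102-Y))^4-16*(17*(Z+9)-(5*Z+102-Y))*(5*Z+102-Y)^3)) := by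
  have a1 := hT.add_eq 40 77 51 hP (by decide +kernel)
  have a2 := a1.add_eq 13 84 60 hP (by decide +kernel)
  have a3 := a2.add_eq 99 13 0 hP (by decide +kernel)
  have a4 := a3.add_eq 99 84 41 hP (by decide +kernel)
  have a5 := a4.add_eq 13 77 50 hP (by decide +kernel)
  have h6 : (6:ℤ) • P = 0 := by
    have : (6:ℤ) • P = (T+P+P+P)+(T+P+P+P)-(T+T) := by module
    rw [this, TT17 a3, TT17 hT, sub_zero]
  rw [zsmul_mod h6 k]
  have : k % 6 = 0 ∨ k % 6 = 1 ∨ k % 6 = 2 ∨ k % 6 = 3 ∨ k % 6 = 4 ∨ k % 6 = 5 := by omega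
  rcases this with h | h | h | h | h | h <;> rw [h]
  · exact ⟨0, 0, by convert hT using 1; module, by decide +kernel⟩
  · exact ⟨77, 51, by convert a1 using 1; module, by decide +kernel⟩
  · exact ⟨84, 60, by convert a2 using 1; module, by decide +kernel⟩
  · exact ⟨13, 0, by convert a3 using 1; module, by decide +kernel⟩
  · exact ⟨84, 41, by convert a4 using 1; module, by decide +kernel⟩
  · exact ⟨77, 50, by convert a5 using 1; module, by decide +kernel⟩

lemma sv127 {P : (EC (ZMod 127) 17 (-289) 0).Point} (hP : At P (-9) (-57)) (j : ℕ) :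
    At ((2^j:ℤ) • P) 118 70 ∨ At ((2^j:ℤ) • P) 18 114 ∨ At ((2^j:ℤ) • P) 18 13 := by
  induction j with
  | zero => left; rw [pow_zero, one_zsmul]; exact hP.congr (by decide +kernel) (by decide +kernel)
  | succ j ih =>
    have e : (2^(j+1):ℤ) • P = (2^j:ℤ) • P + (2^j:ℤ) • P := by rw [← add_zsmul]; congr 1; ring
    rw [e]
    rcases ih with h | h | h
    · right; left; exact h.dbl_eq 12 18 114 (by decide +kernel)
    · right; right; exact h.dbl_eq 43 18 13 (by decide +kernel)
    · right; left; exact h.dbl_eq 84 18 114 (by decide +kernel)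

lemma jac17 {m e M : ℤ} (h17 : ¬ (17:ℤ) ∣ m) (hM : 2*M = m^2+289*e^4) (hM0 : 0 < M) (hM4 : M % 4 = 1) : J((17:ℕ) | M.toNat) = 1 := by
  have hod : Odd M.toNat := Nat.odd_iff.2 (by omega)
  rw [jacobiSym.quadratic_reciprocity_one_mod_four (by norm_num) hod, Int.toNat_of_nonneg hM0.le]
  have hz : (m:ZMod 17) ≠ 0 := by rwa [Ne, ZMod.intCast_zmod_eq_zero_iff_dvd]
  have hM' : (M:ZMod 17) = (3*m)^2 := by
    have : ((2*M:ℤ):ZMod 17) = ((m^2+289*e^4:ℤ):ZMod 17) := by rw [hM]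
    push_cast at this
    have h289 : (289:ZMod 17) = 0 := by decide
    have h17' : (17:ZMod 17) = 0 := by decide
    rw [h289] at this
    linear_combination 9*this - (M:ZMod 17)*h17'
  rw [← jacobiSym.legendreSym.to_jacobiSym, legendreSym.eq_one_iff]
  · exact ⟨3*m, by rw [hM']; ring⟩
  · rw [hM']; exact pow_ne_zero _ (mul_ne_zero (by decide) hz)

lemma Mpos {m e M : ℤ} (he : 0 < e) (hM : 2*M = m^2+289*e^4) : 0 < M := by
  have := pow_pos he 4
  nlinarith [sq_nonneg m]

lemma isqm2159_5 : IsSquare (((-2159:ℤ)):ZMod 5) := by decide +kernel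
lemma isqm2159_3 : IsSquare (((-2159:ℤ)):ZMod 3) := by decide +kernel
lemma isqm2159_17 : IsSquare (((-2159:ℤ)):ZMod 17) := by decide +kernel
lemma isq85_2 : IsSquare (((85:ℤ)):ZMod 2) := by decide +kernel
lemma isq85_5 : IsSquare (((85:ℤ)):ZMod 5) := by decide +kernel
lemma isq85_3 : IsSquare (((85:ℤ)):ZMod 3) := by decide +kernel
lemma isq85_17 : IsSquare (((85:ℤ)):ZMod 17) := by decide +kernel
lemma isq85_19 : IsSquare (((85:ℤ)):ZMod 19) := by decide +kernel

/-- `b = 17 □`, `d = 17 □` -/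
theorem C6 {r u v : ℚ} (hu : r^4-16*r = 17*u^2) (hv : 17*v^2 = r^4+4*(r-1)^2) : r = -1 := by
  by_contra hr
  obtain ⟨P, hP⟩ : ∃ P : E17.Point, At P (-9) (-57) := At.mk E17_disc (by norm_num)
  obtain ⟨T, hT⟩ : ∃ P : E17.Point, At P 0 0 := At.mk E17_disc (by norm_num)
  obtain ⟨k, ⟨h, -⟩ | ⟨h, -⟩⟩ := rep17 hP hT hv hr
  · have hk : 2*k ≠ 0 := by rintro h0; rw [h0] at h; exact h.ne_zero (zero_zsmul _)
    obtain ⟨j, q, hkj, hq⟩ := int_two_pow k (by omega)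
    obtain ⟨m, e, n, M, hR, he, hme, -, hm2, he2, h17, -, hM, hM4⟩ := seq17 hP j
    have hM0 := Mpos he hM
    have hod : Odd M.toNat := Nat.odd_iff.2 (by omega)
    have hJ1 : J(((-1:ℤ)) | M.toNat) = 1 := by
      rw [jacobiSym.at_neg_one hod, ZMod.χ₄_nat_one_mod_four (by omega)]
    have hJ17 := jac17 h17 hM hM0 hM4
    have hJ127 : J((127:ℕ) | M.toNat) = -1 := by
      rw [← jacobiSym.quadratic_reciprocity_one_mod_four (by omega) (by decide), Int.toNat_of_nonneg hM0.le]
      have hd := EDisc17 (p := 127) (by decide) (by decide) (by decide)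
      have hs := sv127 (red_PT hd hP hT).1 j
      rw [← map_zsmul] at hs
      have key : ∃ X Y : ZMod 127, At (redHom hd ((2^j:ℤ) • P)) X Y ∧ (2*58 = X^2+289 ∨ 2*116 = X^2+289) := by
        rcases hs with h | h | h
        · exact ⟨_, _, h, by decide +kernel⟩
        · exact ⟨_, _, h, by decide +kernel⟩
        · exact ⟨_, _, h, by decide +kernel⟩
      obtain ⟨X, Y, hX, hval⟩ := key
      obtain ⟨hx, -, hxX, -⟩ := redHom_at' hd hR hX
      have he0 : (e:ZMod 127) ≠ 0 := by
        intro h0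
        have hee : ((e:ℚ)^2) * (m/(e:ℚ)^2) = m := by
          have : (e:ℚ) ≠ 0 := by exact_mod_cast he.ne'
          field_simp
        have hc := congrArg (fun q : ℚ => (q : ZMod 127)) hee
        beta_reduce at hc
        rw [((PI_int (p := 127) e).pow 2).cmul hx, (PI_int (p := 127) e).cpow] at hc
        have hc' : (m : ZMod 127) = 0 := by
          have : (((m:ℤ):ℚ):ZMod 127) = (m : ZMod 127) := by simp
          rw [← this, ← hc]; simp [h0]
        obtain ⟨a, b, hab⟩ := hme
        have := congrArg (fun z : ℤ => (z : ZMod 127)) hab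
        simp [h0, hc'] at this
      have hXe : X * (e:ZMod 127)^2 = m := by
        have hee : ((e:ℚ)^2) * (m/(e:ℚ)^2) = m := by
          have : (e:ℚ) ≠ 0 := by exact_mod_cast he.ne'
          field_simp
        have hc := congrArg (fun q : ℚ => (q : ZMod 127)) hee
        beta_reduce at hc
        rw [((PI_int (p := 127) e).pow 2).cmul hx, (PI_int (p := 127) e).cpow, hxX] at hc
        have e1 : (((m:ℤ):ℚ):ZMod 127) = (m : ZMod 127) := by simp
        have e2 : (((e:ℤ):ℚ):ZMod 127) = (e : ZMod 127) := by simp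
        rw [e1, e2] at hc
        rw [← hc]; ring
      have hMz : 2*(M:ZMod 127) = (X^2+289)*e^4 := by
        have : ((2*M:ℤ):ZMod 127) = ((m^2+289*e^4:ℤ):ZMod 127) := by rw [hM]
        push_cast at this
        rw [this, ← hXe]; ring
      rw [← jacobiSym.legendreSym.to_jacobiSym, legendreSym.eq_neg_one_iff]
      have h2 : (2:ZMod 127) ≠ 0 := by decide
      have fin : ∀ c : ZMod 127, ¬ IsSquare c → 2*c = X^2+289 → ¬ IsSquare (M:ZMod 127) := by
        intro c hc hcX ⟨w, hw⟩
        rw [← hcX] at hMz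
        have h3 : (M:ZMod 127) = c*e^4 := mul_left_cancel₀ h2 (by rw [hMz]; ring)
        apply hc
        refine ⟨w*((e:ZMod 127)^2)⁻¹, ?_⟩
        rw [h3] at hw
        field_simp
        rw [← sub_eq_zero] at hw ⊢
        linear_combination hw
      rcases hval with h | h
      · exact fin _ (by decide +kernel) h
      · exact fin _ (by decide +kernel) h
    have hJ : J((-2159:ℤ) | M.toNat) = -1 := by
      have : (-2159:ℤ) = (-1)*((17:ℕ)*(127:ℕ)) := by norm_num
      rw [this, jacobiSym.mul_left, jacobiSym.mul_left, hJ1, hJ17, hJ127]; norm_num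
    obtain ⟨p, hp, hMp, hns⟩ := exists_bad_prime hM0 hJ
    have hpe : ∀ {q : ℕ}, q.Prime → (q:ZMod p) = 0 → p = q := fun hq h => prime_eq_of_zero hq h
    have h2 : (2:ZMod p) ≠ 0 := by
      intro h0; have := hpe Nat.prime_two (by exact_mod_cast h0); subst this
      rw [ZMod.intCast_zmod_eq_zero_iff_dvd] at hMp; omega
    have h5 : (5:ZMod p) ≠ 0 := by
      intro h0; have := hpe Nat.prime_five (by exact_mod_cast h0); subst this
      exact hns (isqm2159_5)
    have h3 : (3:ZMod p) ≠ 0 := by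
      intro h0; have := hpe Nat.prime_three (by exact_mod_cast h0); subst this
      exact hns (isqm2159_3)
    have h17' : (17:ZMod p) ≠ 0 := by
      intro h0; have := hpe (q := 17) (by norm_num) (by exact_mod_cast h0); subst this
      exact hns (isqm2159_17)
    have hd := EDisc17 h2 h5 h17'
    have h2R := red_two hd hR hT hme hM hMp
    obtain ⟨-, hTr⟩ := red_PT hd hP hT
    have hNT : redHom hd ((2*k) • P) = redHom hd T := by
      have : (2*k) • P = q • ((2^j:ℤ) • P + (2^j:ℤ) • P) := by rw [hkj]; module
      rw [this, map_zsmul, map_add, h2R, odd_zsmul_two_torsion (TT17 hTr) hq]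
    obtain ⟨w, hw⟩ := h.red6 hd hu (by rw [hNT]; exact hTr)
    apply hns
    have h51 : (51:ZMod p) ≠ 0 := by
      have : (51:ZMod p) = 3*17 := by norm_num
      rw [this]; exact mul_ne_zero h3 h17'
    refine ⟨w/51^2, ?_⟩
    field_simp
    push_cast
    linear_combination hw
  · have hd := EDisc17 (p := 101) (by decide) (by decide) (by decide)
    obtain ⟨hp, ht⟩ := red_PT hd hP hT
    obtain ⟨Z, Y, hZ, hns⟩ := sv101 hp ht (2*k)
    exact hns (h.red6 hd hu (by rw [map_add, map_zsmul]; exact hZ))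

lemma sv59 {P T : (EC (ZMod 59) 17 (-289) 0).Point} (hP : At P (-9) (-57)) (hT : At T 0 0) (k : ℤ) (hk : k % 12 = 10) :
    At (T + k • P) 52 34 := by
  have a1 := hT.add_eq 26 19 37 hP (by decide +kernel)
  have a2 := a1.add_eq 16 52 25 hP (by decide +kernel)
  have a3 := a2.add_eq 41 28 15 hP (by decide +kernel)
  have a4 := a3.add_eq 45 42 4 hP (by decide +kernel)
  have a5 := a4.add_eq 44 57 44 hP (by decide +kernel)
  have a6 := a5.add_eq 6 30 0 hP (by decide +kernel)
  have h6 : (12:ℤ) • P = 0 := by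
    have : (12:ℤ) • P = (T+P+P+P+P+P+P)+(T+P+P+P+P+P+P)-(T+T) := by module
    rw [this, TT17 a6, TT17 hT, sub_zero]
  have : T + k • P = -(T+P+P) := by
    have h1 : T + k • P = -(T+P+P) + (T + T) + (12:ℤ) • P := by
      rw [zsmul_mod h6 k, hk]; module
    rw [h1, TT17 hT, h6, add_zero, add_zero]
  rw [this]; exact a2.neg.congr rfl (by decide +kernel)

lemma sv179 {P T : (EC (ZMod 179) 17 (-289) 0).Point} (hP : At P (-9) (-57)) (hT : At T 0 0) (k : ℤ) 
    (h : k % 12 = 2 ∨ k % 12 = 4 ∨ k % 12 = 6 ∨ k % 12 = 8) :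
    ∃ Z Y : ZMod 179, At (T + k • P) Z Y ∧ ¬ IsSquare (17*((17*(Z+9)-(5*Z+102-Y))^2+4*(5*Z+102-Y)^2)) := by
  have a1 := hT.add_eq 66 52 148 hP (by decide +kernel)
  have a2 := a1.add_eq 109 7 103 hP (by decide +kernel)
  have a3 := a2.add_eq 10 85 12 hP (by decide +kernel)
  have a4 := a3.add_eq 75 162 120 hP (by decide +kernel)
  have a5 := a4.add_eq 45 65 128 hP (by decide +kernel)
  have a6 := a5.add_eq 92 157 0 hP (by decide +kernel)
  have a7 := a6.add_eq 92 65 51 hP (by decide +kernel)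
  have a8 := a7.add_eq 45 162 59 hP (by decide +kernel)
  have h6 : (12:ℤ) • P = 0 := by
    have : (12:ℤ) • P = (T+P+P+P+P+P+P)+(T+P+P+P+P+P+P)-(T+T) := by module
    rw [this, TT17 a6, TT17 hT, sub_zero]
  rw [zsmul_mod h6 k]
  rcases h with h | h | h | h <;> rw [h]
  · exact ⟨7, 103, by convert a2 using 1; module, by decide +kernel⟩
  · exact ⟨162, 120, by convert a4 using 1; module, by decide +kernel⟩
  · exact ⟨157, 0, by convert a6 using 1; module, by decide +kernel⟩
  · exact ⟨162, 59, by convert a8 using 1; module, by decide +kernel⟩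

/-- `a = 17 □`, `b = 17 □` -/
theorem C4 {r u v : ℚ} (hu : r^2+4 = 17*u^2) (hv : 17*v^2 = r^4+4*(r-1)^2) (hr : r ≠ -1) : r = 1/2 := by
  obtain ⟨P, hP⟩ : ∃ P : E17.Point, At P (-9) (-57) := At.mk E17_disc (by norm_num)
  obtain ⟨T, hT⟩ : ∃ P : E17.Point, At P 0 0 := At.mk E17_disc (by norm_num)
  obtain ⟨k, ⟨h, h'⟩ | ⟨h, h'⟩⟩ := rep17 hP hT hv hr
  · exfalso
    have hd := EDisc17 (p := 13) (by decide) (by decide) (by decide)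
    obtain ⟨hp, ht⟩ := red_PT hd hP hT
    have a2 := hp.dbl_eq 4 4 5 (by decide +kernel)
    have h3 : (3:ℤ) • redHom hd P = 0 := by
      have : (3:ℤ) • redHom hd P = (redHom hd P + redHom hd P) + redHom hd P := by module
      rw [this]; exact a2.add_neg (hp.congr (by decide +kernel) (by decide +kernel))
    have : (2*k) % 3 = 0 ∨ (2*k) % 3 = 1 ∨ (2*k) % 3 = 2 := by omega
    rcases this with h0 | h0 | h0
    · have := h'.red4 hd hu (Z := 4) (Y := 8) (by
        rw [map_zsmul, zsmul_mod h3, show (1-2*k) % 3 = 1 by omega, one_zsmul]; exact hp.congr (by decide +kernel) (by decide +kernel))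
      revert this; decide +kernel
    · have := h.red4 hd hu (Z := 4) (Y := 8) (by
        rw [map_zsmul, zsmul_mod h3, h0, one_zsmul]; exact hp.congr (by decide +kernel) (by decide +kernel))
      revert this; decide +kernel
    · have := h.red4' hd hu (Z := 4) (Y := 5) (by
        rw [map_zsmul, zsmul_mod h3, h0, two_zsmul]; exact a2)
      revert this; decide +kernel
  · have hk12 : (2*k) % 12 = 0 := by
      by_contra hne
      have : (2*k) % 12 = 10 ∨ ((2*k) % 12 = 2 ∨ (2*k) % 12 = 4 ∨ (2*k) % 12 = 6 ∨ (2*k) % 12 = 8) := by omega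
      rcases this with h0 | h0
      · have hd := EDisc17 (p := 59) (by decide) (by decide) (by decide)
        obtain ⟨hp, ht⟩ := red_PT hd hP hT
        have := h.red4 hd hu (Z := 52) (Y := 34) (by rw [map_add, map_zsmul]; exact sv59 hp ht _ h0)
        revert this; decide +kernel
      · have hd := EDisc17 (p := 179) (by decide) (by decide) (by decide)
        obtain ⟨hp, ht⟩ := red_PT hd hP hT
        obtain ⟨Z, Y, hZ, hns⟩ := sv179 hp ht _ h0
        exact hns (h.red4 hd hu (by rw [map_add, map_zsmul]; exact hZ))
    rcases eq_or_ne k 0 with rfl | hk0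
    · rw [mul_zero, zero_zsmul, add_zero] at h
      obtain ⟨z, y, hz, c1, -⟩ := h
      obtain ⟨rfl, rfl⟩ := hz.uniq hT
      linarith
    · exfalso
      obtain ⟨j, q, hkj, hq⟩ := int_two_pow k hk0
      have hj : 1 ≤ j := by
        rcases Nat.eq_zero_or_pos j with rfl | h
        · simp at hkj; omega
        · exact h
      obtain ⟨m, e, n, M, hR, he, hme, -, hm2, he2, h17, hs, hM, hM4⟩ := seq17 hP j
      obtain ⟨⟨s, hs⟩, h5me⟩ := hs hj
      have hM0 := Mpos he hM
      have hod : Odd M.toNat := Nat.odd_iff.2 (by omega)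
      have hJ17 := jac17 h17 hM hM0 hM4
      have hJ5 : J((5:ℕ) | M.toNat) = -1 := by
        rw [jacobiSym.quadratic_reciprocity_one_mod_four (by norm_num) hod, Int.toNat_of_nonneg hM0.le]
        rw [← jacobiSym.legendreSym.to_jacobiSym, legendreSym.eq_neg_one_iff]
        have hMz : 2*(M:ZMod 5) = s^4+289*e^4 := by
          have : ((2*M:ℤ):ZMod 5) = ((m^2+289*e^4:ℤ):ZMod 5) := by rw [hM]
          rw [hs] at this; push_cast at this; rw [this]; ring
        have hse : (s:ZMod 5) = 0 ∧ (e:ZMod 5) ≠ 0 ∨ (s:ZMod 5) ≠ 0 ∧ (e:ZMod 5) = 0 := by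
          have hp5 : Prime (5:ℤ) := Nat.prime_iff_prime_int.1 Nat.prime_five
          simp only [Ne, ZMod.intCast_zmod_eq_zero_iff_dvd]
          rcases h5me with h5 | h5
          · left; refine ⟨hp5.dvd_of_dvd_pow (by rw [← hs]; exact h5), fun h => pr_cop hme hp5 h5 h⟩
          · right; refine ⟨fun h => pr_cop hme hp5 ?_ h5, h5⟩
            rw [hs]; exact dvd_pow h two_ne_zero
        generalize (M:ZMod 5) = M' at hMz ⊢
        generalize (s:ZMod 5) = s' at hMz hse
        generalize (e:ZMod 5) = e' at hMz hse
        revert M' s' e'; decide +kernel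
      have hJ : J((85:ℤ) | M.toNat) = -1 := by
        have : (85:ℤ) = ((17:ℕ)*(5:ℕ)) := by norm_num
        rw [this, jacobiSym.mul_left, hJ17, hJ5]; norm_num
      obtain ⟨p, hp, hMp, hns⟩ := exists_bad_prime hM0 hJ
      have hpe : ∀ {q : ℕ}, q.Prime → (q:ZMod p) = 0 → p = q := fun hq h => prime_eq_of_zero hq h
      have h2 : (2:ZMod p) ≠ 0 := by
        intro h0; have := hpe Nat.prime_two (by exact_mod_cast h0); subst this
        exact hns (isq85_2)
      have h5 : (5:ZMod p) ≠ 0 := by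
        intro h0; have := hpe Nat.prime_five (by exact_mod_cast h0); subst this
        exact hns (isq85_5)
      have h3 : (3:ZMod p) ≠ 0 := by
        intro h0; have := hpe Nat.prime_three (by exact_mod_cast h0); subst this
        exact hns (isq85_3)
      have h17' : (17:ZMod p) ≠ 0 := by
        intro h0; have := hpe (q := 17) (by norm_num) (by exact_mod_cast h0); subst this
        exact hns (isq85_17)
      have h19 : (19:ZMod p) ≠ 0 := by
        intro h0; have := hpe (q := 19) (by norm_num) (by exact_mod_cast h0); subst this
        exact hns (isq85_19)
      have hd := EDisc17 h2 h5 h17'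
      have h2R := red_two hd hR hT hme hM hMp
      obtain ⟨hPr, hTr⟩ := red_PT hd hP hT
      have hNT : redHom hd (T + (1-2*k) • P) = redHom hd P := by
        have e1 : T + (1-2*k) • P = T + P - q • ((2^j:ℤ) • P + (2^j:ℤ) • P) := by rw [hkj]; module
        rw [e1, map_sub, map_add, map_zsmul, map_add, h2R, odd_zsmul_two_torsion (TT17 hTr) hq]; abel
      obtain ⟨w, hw⟩ := h'.red4 hd hu (by rw [hNT]; exact hPr)
      apply hns
      have h114 : (114:ZMod p) ≠ 0 := by
        have : (114:ZMod p) = 2*3*19 := by norm_num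
        rw [this]; exact mul_ne_zero (mul_ne_zero h2 h3) h19
      refine ⟨w/114, ?_⟩
      field_simp
      push_cast
      linear_combination hw

set_option linter.unusedSectionVars false
set_option linter.unusedVariables false

/-- cube descent on `y² = x³ + 500` -/
lemma cubeA {x y f : ℤ} (hx0 : x ≠ 0) (hc : IsCoprime x f) (h : y^2 = x^3+500*f^6) :
    ∃ A B : ℤ, 8*y = A^3+15*A*B^2 ∧ 80*f^3 = 3*A^2*B+5*B^3 ∧ 4*x = A^2-5*B^2 := by
  have p5 : Prime (5:ℤ) := Nat.prime_iff_prime_int.1 Nat.prime_five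
  have p2 : Prime (2:ℤ) := Int.prime_two
  have hxo : ¬ (2:ℤ) ∣ x := by
    rintro ⟨t, rfl⟩
    have hfo : f % 2 = 1 := by
      by_contra h0
      exact pr_cop hc p2 ⟨t, rfl⟩ (Int.dvd_of_emod_eq_zero (by omega))
    have hy : (2:ℤ) ∣ y := p2.dvd_of_dvd_pow (n := 2) (by rw [h]; exact ⟨4*t^3+250*f^6, by ring⟩)
    obtain ⟨y, rfl⟩ := hy
    have h1 : y^2 = 2*t^3+125*f^6 := by linarith
    have f2 := int_sq_odd hfo
    have f6 : f^6 % 8 = 1 := by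
      have : f^6 = f^2*f^2*f^2 := by ring
      rw [this, Int.mul_emod, Int.mul_emod (f^2) (f^2), f2]; rfl
    have hyo : y % 2 = 1 := by
      by_contra h0
      obtain ⟨z, rfl⟩ : ∃ z, y = 2*z := ⟨y/2, by omega⟩
      ring_nf at h1; omega
    have y2 := int_sq_odd hyo
    have ht : (2:ℤ) ∣ t := p2.dvd_of_dvd_pow (n := 3) (by omega)
    obtain ⟨t, rfl⟩ := ht
    ring_nf at h1
    ring_nf at y2 f6
    omega
  rcases em ((5:ℤ) ∣ x) with h5 | h5
  · obtain ⟨x, rfl⟩ := h5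
    have hy : (5:ℤ) ∣ y := p5.dvd_of_dvd_pow (n := 2) (by rw [h]; exact ⟨25*x^3+100*f^6, by ring⟩)
    obtain ⟨y, rfl⟩ := hy
    have hy : (5:ℤ) ∣ y := p5.dvd_of_dvd_pow (n := 2) ⟨x^3+4*f^6, by linarith⟩
    obtain ⟨y, rfl⟩ := hy
    have h1 : (2*f^3)^2-5*y^2 = (-x)^3 := by linarith
    obtain ⟨A, B, e1, e2, e3, -⟩ := cube5 (2*f^3) y (-x) (by intro h0; apply hx0; linarith) h1 (by
      apply cop_pr; intro p hp a1 a2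
      rw [dvd_neg] at a2
      have a3 : ¬ p ∣ 2 := fun h0 => hxo (((Prime.dvd_prime_iff_associated hp p2).1 h0).symm.dvd.trans (a2.trans (dvd_mul_left _ _)))
      have a4 : p ∣ y := (hp.dvd_or_dvd a1).resolve_left a3
      have a5 : p ∣ (2*f^3)^2 := by
        have : (2*f^3)^2 = y*(5*y)+x*(-x^2) := by linarith
        rw [this]; exact dvd_add (a4.mul_right _) (a2.mul_right _)
      have a6 := (hp.dvd_or_dvd (hp.dvd_of_dvd_pow a5)).resolve_left a3
      exact pr_cop hc hp (a2.mul_left _) (hp.dvd_of_dvd_pow a6))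
    exact ⟨5*B, A, by linear_combination 25*e2, by linear_combination 5*e1, by linear_combination 5*e3⟩
  · have h1 : y^2-5*(10*f^3)^2 = x^3 := by linarith
    obtain ⟨A, B, e1, e2, e3, -⟩ := cube5 y (10*f^3) x hx0 h1 (by
      apply cop_pr; intro p hp a1 a2
      have a1 : p ∣ 2*2*5*f^3 := by convert a1 using 1; ring
      rcases hp.dvd_or_dvd a1 with a | a
      · rcases hp.dvd_or_dvd a with a | a
        · exact hxo (((Prime.dvd_prime_iff_associated hp p2).1 (hp.dvd_of_dvd_pow (n := 2) (by rwa [pow_two]))).symm.dvd.trans a2)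
        · exact h5 (((Prime.dvd_prime_iff_associated hp p5).1 a).symm.dvd.trans a2)
      · exact pr_cop hc hp a2 (hp.dvd_of_dvd_pow a))
    exact ⟨A, B, by linear_combination e1, by linear_combination e2, by linear_combination -e3⟩

/-- auxiliary: the square trick for `y² + 13500 e⁶ = x³` -/
lemma cubeB_aux {g h : ℤ} (hgh : g = 1 ∧ h = 13500 ∨ g = 3 ∧ h = 500 ∨ g = 5 ∧ h = 108 ∨ g = 15 ∧ h = 4) {x y e : ℤ} (hx0 : x ≠ 0)
    (hc : IsCoprime x e) (h2 : ¬ (2:ℤ) ∣ x) (h3 : ¬ (3:ℤ) ∣ x) (h5 : ¬ (5:ℤ) ∣ x) (heq : g*y^2+h*e^6 = x^3) :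
    ∃ a b : ℚ, a^3-45*a*b^2 = 8*(g^2*y) ∧ 3*a^2*b-15*b^3 = 240*e^3 ∧ a^2+15*b^2 = 4*(g*x) := by
  obtain ⟨c, hc1⟩ : ∃ c : ℤ, c*g = 120 := by
    rcases hgh with ⟨rfl, -⟩ | ⟨rfl, -⟩ | ⟨rfl, -⟩ | ⟨rfl, -⟩
    exacts [⟨120, by norm_num⟩, ⟨40, by norm_num⟩, ⟨24, by norm_num⟩, ⟨8, by norm_num⟩]
  have h30 : ∀ p : ℤ, Prime p → p ∣ x → ¬ p ∣ 2^9*3^9*5^9 := by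
    intro p hp hx ha
    rcases hp.dvd_or_dvd ha with a | a
    · rcases hp.dvd_or_dvd a with a | a
      · exact h2 (((Prime.dvd_prime_iff_associated hp Int.prime_two).1 (hp.dvd_of_dvd_pow a)).symm.dvd.trans hx)
      · exact h3 (((Prime.dvd_prime_iff_associated hp Int.prime_three).1 (hp.dvd_of_dvd_pow a)).symm.dvd.trans hx)
    · exact h5 (((Prime.dvd_prime_iff_associated hp (Nat.prime_iff_prime_int.1 Nat.prime_five)).1 (hp.dvd_of_dvd_pow a)).symm.dvd.trans hx)
  have hg0 : g ≠ 0 := by rintro rfl; omega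
  have hcd : c ∣ 2^9*3^9*5^9 := (Dvd.intro _ hc1).trans (by norm_num)
  have hhd : h ∣ 2^9*3^9*5^9 := by
    rcases hgh with ⟨-, rfl⟩ | ⟨-, rfl⟩ | ⟨-, rfl⟩ | ⟨-, rfl⟩ <;> norm_num
  have hg3 : g^3*h = 13500 := by
    rcases hgh with ⟨rfl, rfl⟩ | ⟨rfl, rfl⟩ | ⟨rfl, rfl⟩ | ⟨rfl, rfl⟩ <;> norm_num
  have hc2 : 15*c^2 = 16*g*h := by
    have : g^2*(15*c^2) = g^2*(16*g*h) := by
      have : g^2*(15*c^2) = 15*(c*g)^2 := by ring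
      rw [this, hc1]; linear_combination -16*hg3
    exact mul_left_cancel₀ (pow_ne_zero 2 hg0) this
  obtain ⟨A, B, e1, e2, e3, -⟩ := cube15 (2*(g*y^2-h*e^6)) (c*y*e^3) (x^2) (pow_ne_zero 2 hx0) (by
      have : (x^2)^3 = (x^3)^2 := by ring
      rw [this, ← heq]; linear_combination y^2*e^6*hc2) (by
      apply cop_pr; intro p hp a1 a2
      have a2 := hp.dvd_of_dvd_pow a2
      rcases hp.dvd_or_dvd a1 with a | a
      · rcases hp.dvd_or_dvd a with a | a
        · exact h30 p hp a2 (a.trans hcd)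
        · have : p ∣ h*e^6 := by
            have : h*e^6 = x*x^2-y*(g*y) := by linarith
            rw [this]; exact dvd_sub (a2.mul_right _) (a.mul_right _)
          rcases hp.dvd_or_dvd this with a | a
          · exact h30 p hp a2 (a.trans hhd)
          · exact pr_cop hc hp a2 (hp.dvd_of_dvd_pow a)
      · exact pr_cop hc hp a2 (hp.dvd_of_dvd_pow a))
  have hxQ : (x:ℚ) ≠ 0 := by exact_mod_cast hx0
  have hgQ : (g:ℚ) ≠ 0 := by exact_mod_cast hg0
  have heqQ : (g:ℚ)*y^2+h*e^6 = x^3 := by exact_mod_cast heq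
  have hg3Q : (g:ℚ)^3*h = 13500 := by exact_mod_cast hg3
  have hc1Q : (c:ℚ)*g = 120 := by exact_mod_cast hc1
  have e1 : (A:ℚ)^3-45*A*B^2 = 8*(g*y^2-h*e^6) := by
    have : A^3-45*A*B^2 = 8*(g*y^2-h*e^6) := by linear_combination -e1
    exact_mod_cast this
  have e2 : (3*A^2*B-15*B^3:ℚ) = 480*y*e^3/g := by
    have : 3*A^2*B-15*B^3 = 4*(c*y*e^3) := by linear_combination -e2
    have : (3*A^2*B-15*B^3:ℚ) = 4*(c*y*e^3) := by exact_mod_cast this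
    rw [this]; field_simp; linear_combination 4*y*e^3*hc1Q
  have e3 : (A:ℚ)^2+15*B^2 = 4*x^2 := by exact_mod_cast e3
  refine ⟨(g^2*y*A+450*e^3*B)/(g*x^2), (30*e^3*A-g^2*y*B)/(g*x^2), ?_, ?_, ?_⟩
  · have k1 : ((g^2*y*A+450*e^3*B)^3-45*(g^2*y*A+450*e^3*B)*(30*e^3*A-g^2*y*B)^2:ℚ) = 8*(g^2*y)*(g*x^2)^3 := by
      have : ((g^2*y*A+450*e^3*B)^3-45*(g^2*y*A+450*e^3*B)*(30*e^3*A-g^2*y*B)^2:ℚ) = 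
        ((g^2*y)^3-45*(g^2*y)*(30*e^3)^2)*((A:ℚ)^3-45*A*B^2) + 15*(3*(g^2*y)^2*(30*e^3)-15*(30*e^3)^3)*(3*A^2*B-15*B^3:ℚ) := by ring
      rw [this, e1, e2]
      have : (8*(g^2*y)*(g*x^2)^3:ℚ) = 8*g^5*y*(x^3)^2 := by ring
      rw [this, ← heqQ]
      field_simp
      rcases hgh with ⟨rfl, rfl⟩ | ⟨rfl, rfl⟩ | ⟨rfl, rfl⟩ | ⟨rfl, rfl⟩ <;> push_cast <;> ring
    field_simp
    linear_combination k1
  · have k1 : (3*(g^2*y*A+450*e^3*B)^2*(30*e^3*A-g^2*y*B)-15*(30*e^3*A-g^2*y*B)^3:ℚ) = 240*e^3*(g*x^2)^3 := by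
      have : (3*(g^2*y*A+450*e^3*B)^2*(30*e^3*A-g^2*y*B)-15*(30*e^3*A-g^2*y*B)^3:ℚ) = 
        (3*(g^2*y)^2*(30*e^3)-15*(30*e^3)^3)*((A:ℚ)^3-45*A*B^2) - ((g^2*y)^3-45*(g^2*y)*(30*e^3)^2)*(3*A^2*B-15*B^3:ℚ) := by ring
      rw [this, e1, e2]
      have : (240*e^3*(g*x^2)^3:ℚ) = 240*g^3*e^3*(x^3)^2 := by ring
      rw [this, ← heqQ]
      field_simp
      rcases hgh with ⟨rfl, rfl⟩ | ⟨rfl, rfl⟩ | ⟨rfl, rfl⟩ | ⟨rfl, rfl⟩ <;> push_cast <;> ring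
    field_simp
    linear_combination k1
  · have k1 : ((g^2*y*A+450*e^3*B)^2+15*(30*e^3*A-g^2*y*B)^2:ℚ) = 4*(g*x)*(g*x^2)^2 := by
      have : ((g^2*y*A+450*e^3*B)^2+15*(30*e^3*A-g^2*y*B)^2:ℚ) = ((g^2*y)^2+13500*e^6)*((A:ℚ)^2+15*B^2) := by ring
      rw [this, e3, ← hg3Q]
      linear_combination 4*g^3*x^2*heqQ
    field_simp
    linear_combination k1

/-- cube descent on `y² = x³ - 13500` at points with odd numerator -/
lemma cubeB {x y e : ℤ} (hx0 : x ≠ 0) (hc : IsCoprime x e) (hxo : x % 2 = 1) (h : y^2+13500*e^6 = x^3) :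
    ∃ a b : ℤ, a^3-45*a*b^2 = 8*y ∧ 3*a^2*b-15*b^3 = 240*e^3 ∧ a^2+15*b^2 = 4*x := by
  have p5 : Prime (5:ℤ) := Nat.prime_iff_prime_int.1 Nat.prime_five
  have p3 : Prime (3:ℤ) := Int.prime_three
  have key : ∃ a b : ℚ, a^3-45*a*b^2 = 8*y ∧ 3*a^2*b-15*b^3 = 240*e^3 ∧ a^2+15*b^2 = 4*x := by
    have d3 : (3:ℤ) ∣ x → ∃ x' y', x = 3*x' ∧ y = 9*y' ∧ ¬ (3:ℤ) ∣ x' := by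
      rintro ⟨x, rfl⟩
      obtain ⟨y, rfl⟩ := p3.dvd_of_dvd_pow (n := 2) (show (3:ℤ) ∣ y^2 from ⟨9*x^3-4500*e^6, by linarith⟩)
      obtain ⟨y, rfl⟩ := p3.dvd_of_dvd_pow (n := 2) (show (3:ℤ) ∣ y^2 from ⟨x^3-500*e^6, by linarith⟩)
      refine ⟨x, y, rfl, by ring, ?_⟩
      intro h0
      have : (3:ℤ) ∣ 500*e^6 := by
        obtain ⟨t, rfl⟩ := h0
        exact ⟨9*t^3-y^2, by linarith⟩
      rcases p3.dvd_or_dvd this with a | a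
      · norm_num at a
      · exact pr_cop hc p3 ⟨x, rfl⟩ (p3.dvd_of_dvd_pow a)
    have d5 : ∀ x y : ℤ, (5:ℤ) ∣ x → IsCoprime x e → ∀ g h : ℤ, g*y^2+h*5^3*e^6 = x^3 → ¬ (5:ℤ) ∣ g → ¬ (5:ℤ) ∣ h → ∃ x' y', x = 5*x' ∧ y = 25*y' ∧ ¬ (5:ℤ) ∣ x' := by
      rintro _ y ⟨x, rfl⟩ hc g h heq hg hh
      obtain ⟨y, rfl⟩ := p5.dvd_of_dvd_pow (n := 2) ((p5.dvd_or_dvd (show (5:ℤ) ∣ g*y^2 from ⟨25*x^3-25*h*e^6, by linarith⟩)).resolve_left hg)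
      obtain ⟨y, rfl⟩ := p5.dvd_of_dvd_pow (n := 2) ((p5.dvd_or_dvd (show (5:ℤ) ∣ g*y^2 from ⟨x^3-h*e^6, by linarith⟩)).resolve_left hg)
      refine ⟨x, y, rfl, by ring, ?_⟩
      intro h0
      have : (5:ℤ) ∣ h*e^6 := by
        obtain ⟨t, rfl⟩ := h0
        exact ⟨25*t^3-g*y^2, by linarith⟩
      rcases p5.dvd_or_dvd this with a | a
      · exact hh a
      · exact pr_cop hc p5 ⟨x, rfl⟩ (p5.dvd_of_dvd_pow a)
    rcases em ((3:ℤ) ∣ x) with h3 | h3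
    · obtain ⟨x, y, rfl, rfl, h3⟩ := d3 h3
      have hc' : IsCoprime x e := IsCoprime.of_mul_left_right hc
      have h' : 3*y^2+500*e^6 = x^3 := by linarith
      rcases em ((5:ℤ) ∣ x) with h5 | h5
      · obtain ⟨x, y, rfl, rfl, h5⟩ := d5 x y h5 hc' 3 4 (by linarith) (by norm_num) (by norm_num)
        obtain ⟨a, b, c1, c2, c3⟩ := cubeB_aux (g := 15) (h := 4) (by simp) (x := x) (y := y) (e := e) (by rintro rfl; simp at hx0) (IsCoprime.of_mul_left_right hc') (by omega) (by omega) h5 (by linarith)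
        exact ⟨a, b, by rw [c1]; push_cast; ring, c2, by rw [c3]; push_cast; ring⟩
      · obtain ⟨a, b, c1, c2, c3⟩ := cubeB_aux (g := 3) (h := 500) (by simp) (x := x) (y := y) (e := e) (by rintro rfl; simp at hx0) hc' (by omega) (by omega) h5 (by linarith)
        exact ⟨a, b, by rw [c1]; push_cast; ring, c2, by rw [c3]; push_cast; ring⟩
    · rcases em ((5:ℤ) ∣ x) with h5 | h5
      · obtain ⟨x, y, rfl, rfl, h5⟩ := d5 x y h5 hc 1 108 (by linarith) (by norm_num) (by norm_num)
        obtain ⟨a, b, c1, c2, c3⟩ := cubeB_aux (g := 5) (h := 108) (by simp) (x := x) (y := y) (e := e) (by rintro rfl; simp at hx0) (IsCoprime.of_mul_left_right hc) (by omega) (by omega) h5 (by linarith)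
        exact ⟨a, b, by rw [c1]; push_cast; ring, c2, by rw [c3]; push_cast; ring⟩
      · obtain ⟨a, b, c1, c2, c3⟩ := cubeB_aux (g := 1) (h := 13500) (by simp) (x := x) (y := y) (e := e) hx0 hc (by omega) (by omega) h5 (by linarith)
        exact ⟨a, b, by rw [c1]; push_cast; ring, c2, by rw [c3]; push_cast; ring⟩
  obtain ⟨a, b, c1, c2, c3⟩ := key
  have ha : a^3-3*x*a = 2*y := by linear_combination c1/4 + (-3*a/4+3*a/2)*c3
  obtain ⟨a', rfl⟩ : ∃ a' : ℤ, a = a' := by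
    have hi : IsIntegral ℤ a := by
      refine ⟨Polynomial.X^3 - Polynomial.C (3*x) * Polynomial.X - Polynomial.C (2*y), ?_, ?_⟩
      · monicity!
      · simp only [Polynomial.eval₂_sub, Polynomial.eval₂_pow, Polynomial.eval₂_mul, Polynomial.eval₂_C, Polynomial.eval₂_X]
        rw [eq_intCast, eq_intCast]
        push_cast; linear_combination ha
    obtain ⟨z, hz⟩ := IsIntegrallyClosed.isIntegral_iff.1 hi
    exact ⟨z, by rw [← hz]; simp⟩
  have hb : (15*b)^2 = ((15*(4*x-a'^2):ℤ):ℚ) := by push_cast; linear_combination 15*c3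
  obtain ⟨n, hn⟩ := rat_sq_int hb
  have hn2 : n^2 = 15*(4*x-a'^2) := by rw [hn] at hb; exact_mod_cast hb
  obtain ⟨n1, rfl⟩ : (3:ℤ) ∣ n := p3.dvd_of_dvd_pow (n := 2) ⟨5*(4*x-a'^2), by linarith⟩
  obtain ⟨n2, rfl⟩ : (5:ℤ) ∣ n1 := p5.dvd_of_dvd_pow (n := 2) ((p5.dvd_or_dvd (show (5:ℤ) ∣ 3*n1^2 from ⟨4*x-a'^2, by linarith⟩)).resolve_left (by norm_num))
  have hbn : b = n2 := by push_cast at hn; linarith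
  subst hbn
  exact ⟨a', n2, by exact_mod_cast c1, by exact_mod_cast c2, by exact_mod_cast c3⟩

set_option linter.unusedSectionVars false
set_option linter.unusedVariables false

/-- the curve `y² = x³ - 13500` -/
abbrev EA := EC ℚ 0 0 (-13500)
/-- the curve `y² = x³ + 500` -/
abbrev EB := EC ℚ 0 0 500
lemma EA_disc : EDisc ℚ 0 0 (-13500) := by unfold EDisc; norm_num
lemma EB_disc : EDisc ℚ 0 0 500 := by unfold EDisc; norm_num

lemma num_dvd' {x : ℚ} {a b : ℤ} (hb : b ≠ 0) (h : x = a/b) : x.num ∣ a := by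
  have h1 : x = Rat.divInt a b := by rw [h, Rat.divInt_eq_div]
  rw [h1]; exact Rat.num_dvd _ hb

/-- tripling through the isogeny -/
lemma triple_u {R : EA.Point} {u v : ℚ} (h10 : v*(3*u^2+5*v^2) = 10) (hu : u ≠ 0) (hx : u^2-5*v^2 ≠ 0)
    (hR : At R (3*(3*u^2+5*v^2)) (9*u*(3*u^2+5*v^2))) :
    ∃ y, At (R+R+R) (((u^3+15*u*v^2)/(u^2-5*v^2))^2+15*(10/(u^2-5*v^2))^2) y := by
  have hD : 3*u^2+5*v^2 ≠ 0 := by positivity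
  have a2 := hR.dbl_eq (3*(3*u^2+5*v^2)/(2*u)) (9*(3*u^2+5*v^2)^2/(4*u^2)-6*(3*u^2+5*v^2)) 
    (3*(3*u^2+5*v^2)/(2*u)*(3*(3*u^2+5*v^2)-(9*(3*u^2+5*v^2)^2/(4*u^2)-6*(3*u^2+5*v^2)))-9*u*(3*u^2+5*v^2))
    ⟨by positivity, by push_cast; field_simp; ring, by push_cast; field_simp; ring, rfl⟩
  have a3 := a2.add_eq (-(3*(3*u^2+5*v^2)/(2*u))+8*u^3/(u^2-5*v^2)) _ _ hR ⟨by
    intro h0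
    have : 9*(3*u^2+5*v^2)*(u^2-5*v^2) = 0 := by
      rw [sub_eq_iff_eq_add, div_eq_iff (by positivity)] at h0; linear_combination -h0
    exact mul_ne_zero (mul_ne_zero (by norm_num) hD) hx this, by
      obtain ⟨E, hE⟩ : ∃ E, E = u^2-5*v^2 := ⟨_, rfl⟩
      have hv : 5*v^2 = u^2-E := by rw [hE]; ring
      rw [← hE] at hx ⊢; rw [hv]; field_simp; ring, rfl, rfl⟩
  refine ⟨_, a3.congr ?_ rfl⟩
  rw [← h10]
  obtain ⟨E, hE⟩ : ∃ E, E = u^2-5*v^2 := ⟨_, rfl⟩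
  rw [← hE] at hx ⊢; push_cast; field_simp
  have hv : v^2 = (u^2-E)/5 := by rw [hE]; ring
  have hv4 : v^4 = ((u^2-E)/5)^2 := by rw [← hv]; ring
  have hv6 : v^6 = ((u^2-E)/5)^3 := by rw [← hv]; ring
  have hv8 : v^8 = ((u^2-E)/5)^4 := by rw [← hv]; ring
  ring_nf
  simp only [hv, hv4, hv6, hv8]
  ring

lemma cube2_irr (v : ℚ) : v^3 ≠ 2 := by
  intro h
  have hi : IsIntegral ℤ v := by
    refine ⟨Polynomial.X^3 - Polynomial.C 2, by monicity!, ?_⟩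
    simp only [Polynomial.eval₂_sub, Polynomial.eval₂_pow, Polynomial.eval₂_C, Polynomial.eval₂_X]
    rw [eq_intCast]; push_cast; linarith
  obtain ⟨z, hz⟩ := IsIntegrallyClosed.isIntegral_iff.1 hi
  simp at hz
  rw [← hz] at h
  have h : z^3 = 2 := by exact_mod_cast h
  have h1 : z < 2 := by nlinarith [sq_nonneg z, sq_nonneg (z+1)]
  have h2 : 1 ≤ z := by
    by_contra h0
    have : z ≤ 0 := by omega
    have : z^3 ≤ 0 := by
      have := sq_nonneg z
      nlinarith
    omega
  obtain rfl : z = 1 := by omega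
  norm_num at h

/-- points with odd numerator are divisible by three, with height control -/
lemma third {Q : EA.Point} {X Y e : ℤ} (he : 0 < e) (hQ : At Q (X/e^2) (Y/e^3)) (hc : IsCoprime X e) (hX : X % 2 = 1) :
    ∃ R z w, At R z w ∧ (Q = R+R+R ∨ Q = -(R+R+R)) ∧ 15*z.num^6 ≤ 60^6*(4*X) := by
  have heQ : (e:ℚ) ≠ 0 := by exact_mod_cast he.ne'
  have heq : Y^2+13500*e^6 = X^3 := by
    have := hQ.eqn
    push_cast at this; field_simp at this
    have h2 : (Y:ℚ)^2+13500*e^6 = X^3 := by linear_combination this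
    exact_mod_cast h2
  obtain ⟨a, b, c1, c2, c3⟩ := cubeB (by rintro rfl; omega) hc hX heq
  have hb : b ≠ 0 := by
    rintro rfl
    have := pow_pos he 3
    ring_nf at c2; omega
  have hbQ : (b:ℚ) ≠ 0 := by exact_mod_cast hb
  have c1Q : (a:ℚ)^3-45*a*b^2 = 8*Y := by exact_mod_cast c1
  have c2Q : 3*(a:ℚ)^2*b-15*b^3 = 240*e^3 := by exact_mod_cast c2
  have c3Q : (a:ℚ)^2+15*b^2 = 4*X := by exact_mod_cast c3
  obtain ⟨S, hS⟩ := At.mk EB_disc (x := 20*e/b) (y := 10*a/b) (by push_cast; field_simp; linear_combination 100/3*c2Q)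
  obtain ⟨m, f, n, hf, hmf, hxm, hyn, hnn, -⟩ := pt_form hS
  have hnn : n^2 = m^3+500*f^6 := by linear_combination hnn
  have hfQ : (f:ℚ) ≠ 0 := by exact_mod_cast hf.ne'
  have hm0 : m ≠ 0 := by
    rintro rfl
    have : (20*e/b:ℚ) = 0 := by rw [hxm]; simp
    have : (20*e/b:ℚ) ≠ 0 := by positivity
    contradiction
  obtain ⟨A, B, d1, d2, d3⟩ := cubeA hm0 hmf hnn
  have hB : B ≠ 0 := by
    rintro rfl
    have := pow_pos hf 3
    ring_nf at d2; omega
  have hBQ : (B:ℚ) ≠ 0 := by exact_mod_cast hB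
  have d1Q : 8*(n:ℚ) = A^3+15*A*B^2 := by exact_mod_cast d1
  have d2Q : 80*(f:ℚ)^3 = 3*A^2*B+5*B^3 := by exact_mod_cast d2
  have d3Q : 4*(m:ℚ) = A^2-5*B^2 := by exact_mod_cast d3
  obtain ⟨u, hu⟩ : ∃ u : ℚ, u = A/(2*f) := ⟨_, rfl⟩
  obtain ⟨v, hv⟩ : ∃ v : ℚ, v = B/(2*f) := ⟨_, rfl⟩
  have hv0 : v ≠ 0 := by rw [hv]; positivity
  have h10 : v*(3*u^2+5*v^2) = 10 := by rw [hu, hv]; field_simp; linear_combination -d2Q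
  have hxE : u^2-5*v^2 = m/f^2 := by rw [hu, hv]; field_simp; linear_combination -d3Q
  have hyE : u^3+15*u*v^2 = n/f^3 := by rw [hu, hv]; field_simp; linear_combination -d1Q
  have hu0 : u ≠ 0 := by
    intro h0; rw [h0] at h10
    exact cube2_irr v (by linarith)
  have hxE0 : u^2-5*v^2 ≠ 0 := by rw [hxE]; have : (m:ℚ) ≠ 0 := by exact_mod_cast hm0
                                  positivity
  obtain ⟨D, hD⟩ : ∃ D, D = 3*u^2+5*v^2 := ⟨_, rfl⟩
  obtain ⟨R, hR⟩ := At.mk EA_disc (x := 3*(3*u^2+5*v^2)) (y := 9*u*(3*u^2+5*v^2)) (by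
    have : (-13500:ℚ) = -135*(v*(3*u^2+5*v^2))^2 := by rw [h10]; norm_num
    push_cast; rw [this]; ring)
  obtain ⟨y3, h3⟩ := triple_u h10 hu0 hxE0 hR
  refine ⟨R, _, _, hR, ?_, ?_⟩
  · refine hQ.eq_or_neg (h3.congr ?_ rfl)
    rw [hyE, hxE, ← hxm, ← hyn]
    field_simp
    linear_combination 100*c3Q
  · have hz : 3*(3*u^2+5*v^2) = ((60*f:ℤ):ℚ)/((B:ℤ):ℚ) := by
      have : 3*u^2+5*v^2 = 10/v := by rw [← h10]; field_simp
      rw [this, hv]; push_cast; field_simp; norm_num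
    have hn := (num_le hB (by positivity) hz).1
    have hfb : f^3 ∣ b := by
      have h1 : n*b = f^3*(10*a) := by
        have : (n:ℚ)*b = f^3*(10*a) := by field_simp at hyn; linear_combination -hyn
        exact_mod_cast this
      have hcop : IsCoprime (f^3) n := by
        apply cop_pr; intro p hp a1 a2
        have a1 := hp.dvd_of_dvd_pow a1
        have : p ∣ m^3 := by
          have : m^3 = n*n-f*(500*f^5) := by linarith
          rw [this]; exact dvd_sub (a2.mul_right _) (a1.mul_right _)
        exact pr_cop hmf hp (hp.dvd_of_dvd_pow this) a1
      exact hcop.dvd_of_dvd_mul_left (Dvd.intro _ h1.symm)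
    have hf3 : f^3 ≤ |b| := Int.le_of_dvd (abs_pos.2 hb) ((dvd_abs _ _).2 hfb)
    have hf6 : (f^3)^2 ≤ b^2 := by
      rw [← sq_abs b]; exact pow_le_pow_left₀ (pow_pos hf 3).le hf3 2
    have hz6 : (3*(3*u^2+5*v^2)).num^6 ≤ (60*f)^6 := by
      rw [← Even.pow_abs (by decide : Even 6) (Rat.num _), ← Even.pow_abs (by decide : Even 6) (60*f)]
      exact pow_le_pow_left₀ (abs_nonneg _) hn 6
    nlinarith [sq_nonneg a]

lemma bnd5 {X e T : ℤ} (he : 0 < e) (hX : 23*e^2 ≤ X) (hT : |T| ≤ X^2/4+1) :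
    |60*X*(X+60*e^2)-27000*e^4-900*T| ≤ 450*X^2 := by
  obtain ⟨g1, g2⟩ := abs_le.1 hT
  have h1 : 1 ≤ e^2 := by nlinarith
  have he4 : 529*e^4 ≤ X^2 := by nlinarith
  have hXe2 : 23*(X*e^2) ≤ X^2 := by nlinarith
  have hXbig : 529 ≤ X^2 := by nlinarith
  have hXebig : 0 ≤ X*e^2 := by nlinarith
  have he40 : 0 ≤ e^4 := by positivity
  have h2 : 60*X*(X+60*e^2)-27000*e^4-900*T = 60*X^2+3600*(X*e^2)-27000*e^4-900*T := by ring
  rw [h2, abs_le]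
  generalize X*e^2 = a at *
  generalize X^2 = b at *
  generalize e^4 = c at *
  omega


/-- translation by `± P` makes the numerator odd -/
lemma trans_odd {P N : EA.Point} (hP : At P 60 450) {X Y e : ℤ} (he : 0 < e) (hN : At N (X/e^2) (Y/e^3)) (hc : IsCoprime X e) 
    (hX : X % 2 = 0) (h60 : X ≠ 60*e^2) (hXe : 23*e^2 ≤ X) :
    ∃ S, (S = P ∨ S = -P) ∧ ∃ x y, At (N+S) x y ∧ x.num % 2 = 1 ∧ x.num ≤ 450*X^2 := by
  have heQ : (e:ℚ) ≠ 0 := by exact_mod_cast he.ne'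
  have heq : Y^2 = X^3-13500*e^6 := by
    have := hN.eqn
    push_cast at this; field_simp at this
    have h2 : (Y:ℚ)^2 = X^3-13500*e^6 := by linear_combination this
    exact_mod_cast h2
  have hYe : (Y*e)^2*23 ≤ (X^2)^2 := by
    have hX0 : 0 ≤ X := by nlinarith [sq_nonneg e]
    have h1 : Y^2 ≤ X^3 := by nlinarith [pow_pos he 6]
    have h2 : (Y*e)^2*23 = Y^2*(23*e^2) := by ring
    rw [h2]
    calc Y^2*(23*e^2) ≤ X^3*X := mul_le_mul h1 hXe (by positivity) (by positivity)
      _ = _ := by ring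
  have hYe' : |Y*e| ≤ X^2/4+1 := by
    have h4 : (4*|Y*e|)^2 ≤ (X^2)^2 := by rw [mul_pow, sq_abs]; nlinarith [sq_nonneg (Y*e)]
    have := abs_le_of_sq_le_sq h4 (sq_nonneg X)
    have := (abs_le.1 (abs_le_of_sq_le_sq h4 (sq_nonneg X) |>.trans' (le_of_eq rfl))).2
    omega
  have heo : e % 2 = 1 := by
    by_contra h0
    exact pr_cop hc Int.prime_two (Int.dvd_of_emod_eq_zero hX) (Int.dvd_of_emod_eq_zero (by omega))
  have e2 := int_sq_odd heo
  have e6 : e^6 % 8 = 1 := by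
    have : e^6 = e^2*e^2*e^2 := by ring
    rw [this, Int.mul_emod, Int.mul_emod (e^2) (e^2), e2]; rfl
  have e3 : e^3 % 2 = 1 := by
    have : e^3 = e^2*e := by ring
    have h1 : e^2 % 2 = 1 := by omega
    rw [this, Int.mul_emod, heo, h1]; rfl
  obtain ⟨X1, hX1⟩ : ∃ X1, X = 2*X1 := ⟨X/2, by omega⟩
  obtain ⟨Y1, hY1⟩ : (2:ℤ) ∣ Y := Int.prime_two.dvd_of_dvd_pow (n := 2) (by rw [heq, hX1]; exact ⟨4*X1^3-6750*e^6, by ring⟩)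
  have h1 : Y1^2 = 2*X1^3-3375*e^6 := by rw [hX1, hY1] at heq; linarith
  have hYo : Y1 % 2 = 1 := by
    by_contra h0
    obtain ⟨z, rfl⟩ : ∃ z, Y1 = 2*z := ⟨Y1/2, by omega⟩
    ring_nf at h1; omega
  have y2 := int_sq_odd hYo
  have hX2 : (2:ℤ) ∣ X1 := Int.prime_two.dvd_of_dvd_pow (n := 3) (by omega)
  obtain ⟨X2, hX2⟩ := hX2
  have hd : X2-15*e^2 ≠ 0 := by intro h0; apply h60; rw [hX1, hX2]; linarith
  have hdQ : (X2-15*e^2:ℚ) ≠ 0 := by exact_mod_cast hd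
  obtain ⟨σ, hσ, hw⟩ : ∃ σ : ℤ, (σ = 1 ∨ σ = -1) ∧ (Y1-225*σ*e^3) % 4 = 2 := by
    have : (Y1-225*e^3) % 4 = 2 ∨ (Y1+225*e^3) % 4 = 2 := by omega
    rcases this with h | h
    · exact ⟨1, by simp, by rw [← h]; ring_nf⟩
    · exact ⟨-1, by simp, by rw [← h]; ring_nf⟩
  obtain ⟨w, hw'⟩ : ∃ w, Y1-225*σ*e^3 = 2*w := ⟨(Y1-225*σ*e^3)/2, by omega⟩
  have hwo : w % 2 = 1 := by omega
  have hσ2 : σ^2 = 1 := by rcases hσ with rfl | rfl <;> norm_num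
  obtain ⟨S, hSP, hS⟩ : ∃ S, (S = P ∨ S = -P) ∧ At S 60 (450*σ) := by
    rcases hσ with rfl | rfl
    · exact ⟨P, by simp, hP.congr rfl (by norm_num)⟩
    · exact ⟨-P, by simp, hP.neg.congr rfl (by norm_num)⟩
  have hXQ : (X:ℚ) = 4*X2 := by rw [hX1, hX2]; push_cast; ring
  have hYQ : (Y:ℚ) = 2*Y1 := by rw [hY1]; push_cast; ring
  have hwQ : (Y1:ℚ)-225*σ*e^3 = 2*w := by exact_mod_cast hw'
  have heqQ : (Y:ℚ)^2 = X^3-13500*e^6 := by exact_mod_cast heq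
  have hσQ : (σ:ℚ)^2 = 1 := by exact_mod_cast hσ2
  obtain ⟨d, hdd⟩ : ∃ d : ℤ, d = X2-15*e^2 := ⟨_, rfl⟩
  have hddQ : (X2:ℚ) = d+15*e^2 := by rw [hdd]; push_cast; ring
  have hd0 : d ≠ 0 := by rw [hdd]; exact hd
  have hd0Q : (d:ℚ) ≠ 0 := by exact_mod_cast hd0
  have hne : (X/e^2:ℚ) ≠ 60 := by
    intro h0; rw [div_eq_iff (by positivity)] at h0; exact h60 (by exact_mod_cast h0)
  have a3 := hN.add_eq ((w:ℚ)/((e:ℚ)*(d:ℚ))) (((w^2-(4*X2+60*e^2)*d^2:ℤ):ℚ)/((e^2*d^2:ℤ):ℚ)) ((w:ℚ)/((e:ℚ)*(d:ℚ))*((X/e^2:ℚ)-(((w^2-(4*X2+60*e^2)*d^2:ℤ):ℚ)/((e^2*d^2:ℤ):ℚ)))-(Y/e^3:ℚ)) hS ⟨hne, by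
    rw [hXQ, hYQ, hddQ]; field_simp; linear_combination -2*d*hwQ, by
    rw [hXQ]; push_cast; field_simp; ring, rfl⟩
  refine ⟨S, hSP, _, _, a3, ?_, ?_⟩
  · have hdv := num_dvd' (x := ((w^2-(4*X2+60*e^2)*d^2:ℤ):ℚ)/((e^2*d^2:ℤ):ℚ)) (by positivity) rfl
    have : (w^2-(4*X2+60*e^2)*d^2) % 2 = 1 := by
      have := int_sq_odd hwo
      have h2 : w^2-(4*X2+60*e^2)*d^2 = w^2 - 2*((2*X2+30*e^2)*d^2) := by ring
      omega
    obtain ⟨t, ht⟩ := hdv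
    rw [ht] at this
    by_contra h0
    have h0 : (((w^2-(4*X2+60*e^2)*d^2:ℤ):ℚ)/((e^2*d^2:ℤ):ℚ)).num % 2 = 0 := by omega
    rw [Int.mul_emod, h0] at this; norm_num at this
  · have hform : ((w^2-(4*X2+60*e^2)*d^2:ℤ):ℚ)/((e^2*d^2:ℤ):ℚ) = ((60*X*(X+60*e^2)-27000*e^4-900*σ*Y*e:ℤ):ℚ)/(((X-60*e^2)^2:ℤ):ℚ) := by
      have hX60 : (X:ℚ)-60*e^2 = 4*d := by rw [hXQ, hddQ]; ring
      push_cast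
      rw [hX60]
      have hw2 : (w:ℚ) = (Y-450*σ*e^3)/4 := by rw [hYQ]; linarith
      have hX2' : (X2:ℚ) = X/4 := by rw [hXQ]; ring
      have hd' : (d:ℚ) = (X-60*e^2)/4 := by rw [hX60]; ring
      field_simp
      rw [hw2, hX2', hd']
      linear_combination heqQ + 202500*e^6*hσQ
    have hpos : 0 < ((w^2-(4*X2+60*e^2)*d^2:ℤ):ℚ)/((e^2*d^2:ℤ):ℚ) := by
      have := a3.eqn
      push_cast at this ⊢
      generalize ((w:ℚ)^2-(4*X2+60*e^2)*d^2)/(e^2*d^2) = z at this ⊢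
      by_contra h0
      have h0 : z ≤ 0 := not_lt.1 h0
      have : z^3 ≤ 0 := Odd.pow_nonpos (by decide) h0
      nlinarith [sq_nonneg (((w:ℚ)/(e*d)*(X/e^2-z)-Y/e^3))]
    have ha0 : (60*X*(X+60*e^2)-27000*e^4-900*σ*Y*e:ℤ) ≠ 0 := by
      intro h0; rw [hform, h0] at hpos; simp at hpos
    have h60' : X-60*e^2 ≠ 0 := sub_ne_zero.2 h60
    have hb := (num_le (pow_ne_zero 2 h60') ha0 hform).1
    refine (le_abs_self _).trans (hb.trans ?_)
    have hX0 : 0 < X := by nlinarith [sq_nonneg e, pow_pos he 2]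
    have hσY : |σ*(Y*e)| ≤ X^2/4+1 := by
      rcases hσ with rfl | rfl
      · rw [one_mul]; exact hYe'
      · rw [neg_one_mul, abs_neg]; exact hYe'
    have := bnd5 he hXe hσY
    rwa [← mul_assoc, ← mul_assoc] at this

/-- list of moduli with bit masks of the quadratic residues -/
def sqMasks : List (ℕ × ℕ) := [(64, 144680414395695635), (63, 288872697407275667), (65, 20863489977805260307), (11, 571), (17, 107287), (19, 199411), (23, 340831), (29, 332473075), (31, 303908791), (37, 96068509339), (41, 1870503675703), (43, 3678700564051)]

lemma sqMasks_ok : ∀ q ∈ sqMasks, ∀ s < q.1, Nat.testBit q.2 (s^2 % q.1) = true := by decide +kernel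
lemma sqMasks_pos : ∀ q ∈ sqMasks, 0 < q.1 := by decide

def sqTest (v : ℕ) : List (ℕ × ℕ) → Bool
  | [] => true
  | q :: l => Nat.testBit q.2 (v % q.1) && sqTest v l

lemma sqTest_of (l : List (ℕ × ℕ)) (s : ℕ) (h : ∀ q ∈ l, 0 < q.1 ∧ ∀ s < q.1, Nat.testBit q.2 (s^2 % q.1) = true) :
    sqTest (s^2) l = true := by
  induction l with
  | nil => rfl
  | cons q l ih =>
    have h1 := h q (by simp)
    have := h1.2 (s % q.1) (Nat.mod_lt _ h1.1)
    rw [← Nat.pow_mod] at this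
    simp only [sqTest, this, Bool.true_and]
    exact ih fun q' hq' => h q' (by simp [hq'])

def allBelow (f : ℕ → Bool) : ℕ → Bool
  | 0 => true
  | n+1 => f n && allBelow f n

lemma allBelow_of {f : ℕ → Bool} {n : ℕ} (h : allBelow f n = true) : ∀ k < n, f k = true := by
  induction n with
  | zero => intro k hk; omega
  | succ n ih =>
    simp only [allBelow, Bool.and_eq_true] at h
    intro k hk
    rcases Nat.lt_succ_iff_lt_or_eq.1 hk with h1 | rfl
    · exact ih h.2 k h1
    · exact h.1

/-- the finite check, for `e` and `X` -/
def chk5 (e X : ℕ) : Bool :=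
  Nat.beq e 0 || Nat.blt (X^3) (13500*e^6) || Nat.beq X (24*e^2) || Nat.beq X (60*e^2) || Nat.beq X (85*e^2) ||
    !(sqTest (X^3-13500*e^6) sqMasks)

lemma chk5_all : allBelow (fun e => allBelow (chk5 e) 1601) 10 = true := by decide +kernel

lemma fin5 (e : ℕ) (he : e < 10) (X : ℕ) (hX : X < 1601) (h : 0 < e ∧ 13500*e^6 ≤ X^3 ∧ (Nat.sqrt (X^3-13500*e^6))^2 = X^3-13500*e^6) :
    X = 24*e^2 ∨ X = 60*e^2 ∨ X = 85*e^2 := by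
  obtain ⟨h1, h2, h3⟩ := h
  have h4 := allBelow_of (allBelow_of chk5_all e he) X hX
  have h5 := sqTest_of sqMasks (Nat.sqrt (X^3-13500*e^6)) (fun q hq => ⟨sqMasks_pos q hq, sqMasks_ok q hq⟩)
  rw [h3] at h5
  have h6 : Nat.blt (X^3) (13500*e^6) = false := by
    rw [Nat.blt, Bool.eq_false_iff]; intro h0; have := Nat.le_of_ble_eq_true h0; omega
  simp only [chk5, h5, h6, Bool.or_eq_true, Nat.beq_eq_true_eq, Bool.not_true] at h4
  simp at h4
  omega

theorem mw5 {P : EA.Point} (hP : At P 60 450) (N : EA.Point) : ∃ k : ℤ, N = k • P := by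
  have h2P := hP.dbl_eq 12 24 (-18) (by norm_num)
  have h3P := h2P.add_eq 13 85 (-775) hP (by norm_num)
  rcases at_or_zero N with rfl | ⟨x, y, hN⟩
  · exact ⟨0, by simp⟩
  obtain ⟨n, hn⟩ : ∃ n : ℕ, n = x.num.natAbs := ⟨_, rfl⟩
  induction n using Nat.strong_induction_on generalizing N x y with
  | _ n ih =>
    obtain ⟨X, e, Y, he, hc, hx, hy, heq, hxn, -⟩ := pt_form hN
    rw [hx, hy] at hN
    have heq : Y^2 = X^3-13500*e^6 := by linear_combination heq
    have heQ : (e:ℚ) ≠ 0 := by exact_mod_cast he.ne'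
    have hX3 : 13500*e^6 ≤ X^3 := by nlinarith [sq_nonneg Y]
    have hX23 : 23*e^2 ≤ X := by
      by_contra h0
      have h0 : X < 23*e^2 := not_le.1 h0
      have h1 : X^3 < (23*e^2)^3 := Odd.strictMono_pow (by decide) h0
      nlinarith [pow_pos he 6]
    have hX0 : 0 < X := by nlinarith [pow_pos he 2]
    have hfin : ∀ {a b : ℚ} {Q : EA.Point}, At Q a b → (X:ℚ) = a*e^2 → (∃ k : ℤ, Q = k • P) → ∃ k : ℤ, N = k • P := by
      intro a b Q hQ hX ⟨k, hk⟩
      have hx' : (X/e^2:ℚ) = a := by rw [hX]; field_simp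
      rcases (hN.congr hx' rfl).eq_or_neg hQ with h | h
      · exact ⟨k, by rw [h, hk]⟩
      · exact ⟨-k, by rw [h, hk]; module⟩
    by_cases hbig : X ≤ 1600
    · have he9 : e < 10 := by nlinarith
      have := fin5 e.toNat (by omega) X.toNat (by omega) (by
        lift X to ℕ using hX0.le
        lift e to ℕ using he.le
        simp only [Int.toNat_natCast]
        have hle : 13500*e^6 ≤ X^3 := by exact_mod_cast hX3
        have hq : Y.natAbs^2 = X^3-13500*e^6 := by
          zify [hle]; rw [sq_abs]; exact heq
        refine ⟨by omega, hle, ?_⟩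
        rw [← hq, pow_two Y.natAbs, Nat.sqrt_eq, pow_two])
      have hXn : (X.toNat:ℚ) = X := by exact_mod_cast Int.toNat_of_nonneg hX0.le
      have hen : (e.toNat:ℚ) = e := by exact_mod_cast Int.toNat_of_nonneg he.le
      rcases this with h | h | h
      · refine hfin h2P ?_ ⟨2, by module⟩
        rw [← hXn, ← hen]; exact_mod_cast h
      · refine hfin hP ?_ ⟨1, by module⟩
        rw [← hXn, ← hen]; exact_mod_cast h
      · refine hfin h3P ?_ ⟨3, by module⟩
        rw [← hXn, ← hen]; exact_mod_cast h
    · have hbig : 1600 < X := not_le.1 hbig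
      have step : ∀ (Q : EA.Point) (x' y' : ℚ), At Q x' y' → x'.num % 2 = 1 → x'.num ≤ 450*X^2 → ∃ k : ℤ, Q = k • P := by
        intro Q x' y' hQ ho hle
        obtain ⟨X', e', Y', he', hc', hx', hy', -, hxn', -⟩ := pt_form hQ
        rw [hxn'] at ho hle
        rw [hx', hy'] at hQ
        obtain ⟨R, z, w, hR, hQR, hz⟩ := third he' hQ hc' ho
        have hlt : |z.num| < X := by
          by_contra h0
          have h0 : X ≤ |z.num| := not_lt.1 h0
          have h1 : X^6 ≤ z.num^6 := by
            rw [← Even.pow_abs (by decide : Even 6) z.num]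
            exact pow_le_pow_left₀ hX0.le h0 6
          have h2 : 15*X^6 ≤ 60^6*(4*(450*X^2)) := by linarith
          have h3 : 1600^4 < X^4 := pow_lt_pow_left₀ hbig (by norm_num) (by norm_num)
          have h4 : 1600^4*X^2 < X^4*X^2 := mul_lt_mul_of_pos_right h3 (by positivity)
          nlinarith [pow_pos hX0 2]
        obtain ⟨k, hk⟩ := ih z.num.natAbs (by rw [hn, hxn]; have := Int.abs_eq_natAbs z.num; omega) R z w hR rfl
        rcases hQR with h | h
        · exact ⟨3*k, by rw [h, hk]; module⟩
        · exact ⟨-(3*k), by rw [h, hk]; module⟩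
      rcases Int.emod_two_eq_zero_or_one X with hXe | hXo
      · by_cases h60 : X = 60*e^2
        · exact hfin hP (by rw [h60]; push_cast; ring) ⟨1, by module⟩
        · obtain ⟨S, hS, x', y', h', ho, hle⟩ := trans_odd hP he hN hc hXe h60 hX23
          obtain ⟨k, hk⟩ := step _ _ _ h' ho hle
          rcases hS with rfl | rfl
          · exact ⟨k-1, by rw [sub_zsmul, ← hk]; module⟩
          · exact ⟨k+1, by rw [add_zsmul, ← hk]; module⟩
      · exact step N x y (by rw [hx, hy]; exact hN) (by rw [hxn]; exact hXo) (by rw [hxn]; nlinarith)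

set_option linter.unusedSectionVars false
set_option linter.unusedVariables false

instance fact53 : Fact (Nat.Prime 53) := ⟨by norm_num⟩
instance fact11 : Fact (Nat.Prime 11) := ⟨by norm_num⟩
instance fact89 : Fact (Nat.Prime 89) := ⟨by norm_num⟩

/-- the local condition for the fifth curve -/
def GdA {F : Type} [Field F] [DecidableEq F] (N : (EC F 0 0 (-13500)).Point) : Prop :=
  (N = 0 ∧ IsSquare (5:F)) ∨ ∃ X Y, At N X Y ∧ IsSquare (5*((54000-X^3)^2+8100*X^4))

lemma GdA_zero {F : Type} [Field F] [DecidableEq F] (h5 : ¬ IsSquare (5:F)) (hg : GdA (0:(EC F 0 0 (-13500)).Point)) : False := by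
  rcases hg with ⟨-, h⟩ | ⟨X, Y, h, -⟩
  · exact h5 h
  · exact h.ne_zero rfl

lemma GdA_at {F : Type} [Field F] [DecidableEq F] {N : (EC F 0 0 (-13500)).Point} {X Y : F} (h : At N X Y)
    (hs : ¬ IsSquare (5*((54000-X^3)^2+8100*X^4))) (hg : GdA N) : False := by
  rcases hg with ⟨h0, -⟩ | ⟨X', Y', h', hs'⟩
  · exact h.ne_zero h0
  · rw [(h.uniq h').1] at hs; exact hs hs'

lemma GdA_at' {F : Type} [Field F] [DecidableEq F] {P N : (EC F 0 0 (-13500)).Point} {X Y : F} (h : At N X Y)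
    (hs : ¬ IsSquare (5*((54000-X^3)^2+8100*X^4))) {n : ℤ} (hn : n • P = 0) (hg : GdA (n • P - N)) : False := by
  rw [hn, zero_sub] at hg
  exact GdA_at h.neg hs hg

lemma GdA_red {p : ℕ} [hp : Fact p.Prime] (hd : EDisc (ZMod p) 0 0 (-13500)) {N : EA.Point} {x y w : ℚ} (h : At N x y)
    (hw : 5*((54000-x^3)^2+8100*x^4) = w^2) : GdA (redHom hd N) := by
  by_cases hx : PI p x
  · obtain ⟨Y, hY⟩ : ∃ Y, At (redHom hd N) (x:ZMod p) Y := ⟨_, (redHom_at hd h hx).2⟩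
    refine Or.inr ⟨_, _, hY, ?_⟩
    have b1 := (PI_ofNat (p := p) 54000).sub (hx.pow 3)
    have b2 := (PI_ofNat (p := p) 8100).mul (hx.pow 4)
    have b3 := (b1.pow 2).add b2
    have h1 := sq_red ((PI_ofNat (p := p) 5).mul b3) hw
    rw [(PI_ofNat (p := p) 5).cmul b3, (b1.pow 2).cadd b2, b1.cpow, (PI_ofNat (p := p) 54000).csub (hx.pow 3), hx.cpow,
      (PI_ofNat (p := p) 8100).cmul (hx.pow 4), hx.cpow] at h1
    simpa using h1
  · refine Or.inl ⟨(redHom_zero' hd h).2 hx, ?_⟩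
    obtain ⟨h0, hi, hi0⟩ := PI_inv_of_not hx
    have hw' : 5*((54000*(x⁻¹)^3-1)^2+8100*(x⁻¹)^2) = (w*(x⁻¹)^3)^2 := by
      have : (w*(x⁻¹)^3)^2 = w^2*(x⁻¹)^6 := by ring
      rw [this, ← hw]; field_simp
    have b0 := (PI_ofNat (p := p) 54000).mul (hi.pow 3)
    have b1 := b0.sub PI_one
    have b2 := (PI_ofNat (p := p) 8100).mul (hi.pow 2)
    have b3 := (b1.pow 2).add b2
    have h1 := sq_red ((PI_ofNat (p := p) 5).mul b3) hw'
    rw [(PI_ofNat (p := p) 5).cmul b3, (b1.pow 2).cadd b2, b1.cpow, b0.csub PI_one, (PI_ofNat (p := p) 54000).cmul (hi.pow 3), hi.cpow,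
      (PI_ofNat (p := p) 8100).cmul (hi.pow 2), hi.cpow, hi0] at h1
    simpa using h1

lemma EA_red_disc {p : ℕ} [hp : Fact p.Prime] (h2 : (2:ZMod p) ≠ 0) (h3 : (3:ZMod p) ≠ 0) (h5 : (5:ZMod p) ≠ 0) :
    EDisc (ZMod p) 0 0 (-13500) := by
  unfold EDisc
  have : ((16 * (-4*0^3*(-13500) + 0^2*0^2 + 18*0*0*(-13500) - 4*0^3 - 27*(-13500)^2) : ℤ) : ZMod p) = -(2^8*3^9*5^6) := by
    push_cast; ring
  rw [this, neg_ne_zero]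
  exact mul_ne_zero (mul_ne_zero (pow_ne_zero _ h2) (pow_ne_zero _ h3)) (pow_ne_zero _ h5)

lemma svA53 {P : (EC (ZMod 53) 0 0 (-13500)).Point} (a1 : At P 7 26) (k : ℤ) (hg : GdA (k • P)) :
    k % 6 = 1 ∨ k % 6 = 5 := by
  have a2 := a1.dbl_eq 12 24 35 (by decide +kernel)
  have a3 := a2.add_eq 13 32 20 a1 (by decide +kernel)
  have a4 := a2.dbl_eq 5 30 41 (by decide +kernel)
  have a6 := a3.dbl_eq 45 0 42 (by decide +kernel)
  have a8 := a4.dbl_eq 20 22 13 (by decide +kernel)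
  have a9 := a8.add_eq 38 37 0 a1 (by decide +kernel)
  have hn : (18:ℤ) • P = 0 := by rw [← TT17 a9]; module
  rw [zsmul_mod hn k] at hg
  by_contra hk
  have : k % 18 = 0 ∨ k % 18 = 2 ∨ k % 18 = 3 ∨ k % 18 = 4 ∨ k % 18 = 6 ∨ k % 18 = 8 ∨ k % 18 = 9 ∨ k % 18 = 10 ∨ k % 18 = 12 ∨ k % 18 = 14 ∨ k % 18 = 15 ∨ k % 18 = 16 := by omega
  rcases this with h | h | h | h | h | h | h | h | h | h | h | h <;> rw [h] at hg
  · exact GdA_zero (F := ZMod 53) (by decide +kernel) (by simpa using hg)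
  · exact GdA_at a2 (by decide +kernel) (by convert hg using 1; module)
  · exact GdA_at a3 (by decide +kernel) (by convert hg using 1; module)
  · exact GdA_at a4 (by decide +kernel) (by convert hg using 1; module)
  · exact GdA_at a6 (by decide +kernel) (by convert hg using 1; module)
  · exact GdA_at a8 (by decide +kernel) (by convert hg using 1; module)
  · exact GdA_at a9 (by decide +kernel) (by convert hg using 1; module)
  · exact GdA_at' a8 (by decide +kernel) (n := 18) hn (by convert hg using 1; module)
  · exact GdA_at' a6 (by decide +kernel) (n := 18) hn (by convert hg using 1; module)
  · exact GdA_at' a4 (by decide +kernel) (n := 18) hn (by convert hg using 1; module)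
  · exact GdA_at' a3 (by decide +kernel) (n := 18) hn (by convert hg using 1; module)
  · exact GdA_at' a2 (by decide +kernel) (n := 18) hn (by convert hg using 1; module)

lemma svA11 {P : (EC (ZMod 11) 0 0 (-13500)).Point} (a1 : At P 5 10) (k : ℤ) (h6 : k % 6 = 1 ∨ k % 6 = 5) (hg : GdA (k • P)) :
    k % 12 = 1 ∨ k % 12 = 11 := by
  have a2 := a1.dbl_eq 1 2 4 (by decide +kernel)
  have a3 := a2.add_eq 2 8 6 a1 (by decide +kernel)
  have a5 := a3.add_eq 4 6 2 a2 (by decide +kernel)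
  have a6 := a5.add_eq 3 9 0 a1 (by decide +kernel)
  have hn : (12:ℤ) • P = 0 := by rw [← TT17 a6]; module
  rw [zsmul_mod hn k] at hg
  by_contra hk
  have : k % 12 = 5 ∨ k % 12 = 7 := by omega
  rcases this with h | h <;> rw [h] at hg
  · exact GdA_at a5 (by decide +kernel) (by convert hg using 1; module)
  · exact GdA_at' a5 (by decide +kernel) (n := 12) hn (by convert hg using 1; module)

lemma svA179 {P : (EC (ZMod 179) 0 0 (-13500)).Point} (a1 : At P 60 92) (k : ℤ) (h6 : k % 12 = 1 ∨ k % 12 = 11) (hg : GdA (k • P)) :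
    k % 36 = 1 ∨ k % 36 = 35 := by
  have a2 := a1.dbl_eq 12 24 161 (by decide +kernel)
  have a4 := a2.dbl_eq 131 108 112 (by decide +kernel)
  have a8 := a4.dbl_eq 169 63 154 (by decide +kernel)
  have a10 := a8.add_eq 9 173 109 a2 (by decide +kernel)
  have a11 := a10.add_eq 35 97 45 a1 (by decide +kernel)
  have a13 := a11.add_eq 45 114 85 a2 (by decide +kernel)
  have a18 := a10.add_eq 24 161 0 a8 (by decide +kernel)
  have hn : (36:ℤ) • P = 0 := by rw [← TT17 a18]; module
  rw [zsmul_mod hn k] at hg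
  by_contra hk
  have : k % 36 = 11 ∨ k % 36 = 13 ∨ k % 36 = 23 ∨ k % 36 = 25 := by omega
  rcases this with h | h | h | h <;> rw [h] at hg
  · exact GdA_at a11 (by decide +kernel) (by convert hg using 1; module)
  · exact GdA_at a13 (by decide +kernel) (by convert hg using 1; module)
  · exact GdA_at' a13 (by decide +kernel) (n := 36) hn (by convert hg using 1; module)
  · exact GdA_at' a11 (by decide +kernel) (n := 36) hn (by convert hg using 1; module)

lemma red60 {p : ℕ} [hp : Fact p.Prime] (hd : EDisc (ZMod p) 0 0 (-13500)) {P : EA.Point} (hP : At P 60 450) :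
    At (redHom hd P) 60 450 := by
  have := (redHom_at hd hP (PI_ofNat 60)).2
  simpa using this

lemma sieve5 {P : EA.Point} (hP : At P 60 450) {k : ℤ} {x y w : ℚ} (h : At (k • P) x y)
    (hw : 5*((54000-x^3)^2+8100*x^4) = w^2) : k % 36 = 1 ∨ k % 36 = 35 := by
  have d1 := EA_red_disc (p := 53) (by decide) (by decide) (by decide)
  have d2 := EA_red_disc (p := 11) (by decide) (by decide) (by decide)
  have d3 := EA_red_disc (p := 179) (by decide) (by decide) (by decide)
  have g1 := GdA_red d1 h hw
  have g2 := GdA_red d2 h hw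
  have g3 := GdA_red d3 h hw
  rw [map_zsmul] at g1 g2 g3
  have k1 := svA53 ((red60 d1 hP).congr (by decide +kernel) (by decide +kernel)) k g1
  have k2 := svA11 ((red60 d2 hP).congr (by decide +kernel) (by decide +kernel)) k k1 g2
  exact svA179 ((red60 d3 hP).congr (by decide +kernel) (by decide +kernel)) k k2 g3

set_option linter.unusedSectionVars false
set_option linter.unusedVariables false

lemma triple_gen {N : EA.Point} {x y : ℚ} (h : At N x y) (hy : y ≠ 0) (hx : x ≠ 0) (h3 : x^3-54000 ≠ 0) :
    ∃ y', At (N+N+N) ((x^9+1296000*x^6+8748000000*x^3-157464000000000)/(9*x^2*(x^3-54000)^2)) y' := by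
  have hE : y^2 = x^3-13500 := by have := h.eqn; push_cast at this; linarith
  have a2 := h.dbl_eq (3*x^2/(2*y)) (9*x^4/(4*y^2)-2*x) (3*x^2/(2*y)*(x-(9*x^4/(4*y^2)-2*x))-y)
    ⟨by positivity, by push_cast; field_simp; ring, by push_cast; field_simp; ring, rfl⟩
  have hdx : 9*x^4/(4*y^2)-2*x - x = -3*x*(x^3-54000)/(4*y^2) := by
    field_simp; linear_combination -12*hE
  have a3 := a2.add_eq (-(3*x^2/(2*y))+8*y^3/(3*x*(x^3-54000))) _ _ h ⟨by
    intro h0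
    rw [← sub_eq_zero, hdx] at h0
    have : -3*x*(x^3-54000)/(4*y^2) ≠ 0 := by
      refine div_ne_zero (mul_ne_zero (mul_ne_zero (by norm_num) hx) h3) (by positivity)
    exact this h0, by
    have e1 : x-(9*x^4/(4*y^2)-2*x) = 3*x*(x^3-54000)/(4*y^2) := by
      have : x-(9*x^4/(4*y^2)-2*x) = -(9*x^4/(4*y^2)-2*x-x) := by ring
      rw [this, hdx]; ring
    rw [hdx, e1]
    field_simp; ring, rfl, rfl⟩
  refine ⟨_, a3.congr ?_ rfl⟩
  have e : (-(3*x^2/(2*y))+8*y^3/(3*x*(x^3-54000)))^2 - ((0:ℤ):ℚ) - (9*x^4/(4*y^2)-2*x) - x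
     = x + 64*(y^2)^3/(9*x^2*(x^3-54000)^2) - 8*x*y^2/(x^3-54000) := by
    push_cast; field_simp; ring
  rw [e, hE]; field_simp; ring

lemma odd_not_dvd_of_dvd {a b : ℤ} (h : a ∣ b) (hb : b % 2 = 1) : a % 2 = 1 := by
  obtain ⟨t, rfl⟩ := h
  by_contra h0
  have : a % 2 = 0 := by omega
  rw [Int.mul_emod, this] at hb; norm_num at hb

/-- from a quotient representation of `x` to the reduced one -/
lemma red_form {m e U V : ℤ} (he : 0 < e) (hc : IsCoprime m e) (hV : V ≠ 0) (h : (m:ℚ)/e^2 = U/V^2) :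
    ∃ c : ℤ, V = e*c ∧ U = m*c^2 := by
  have h1 : m*V^2 = U*e^2 := by
    have he' : (e:ℚ) ≠ 0 := by exact_mod_cast he.ne'
    have hV' : (V:ℚ) ≠ 0 := by exact_mod_cast hV
    field_simp at h
    rw [mul_comm U]; exact_mod_cast h
  have h2 : e^2 ∣ V^2 := (hc.symm.pow_left (m := 2)).dvd_of_dvd_mul_left ⟨U, by rw [h1]; ring⟩
  obtain ⟨c, hc'⟩ := (Int.pow_dvd_pow_iff (by norm_num)).1 h2
  refine ⟨c, hc', ?_⟩
  have : e^2 ≠ 0 := by positivity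
  apply mul_right_cancel₀ this
  rw [← h1, hc']; ring

lemma trip_inv {N : EA.Point} {m e n : ℤ} (h : At N (m/e^2) (n/e^3)) (he : 0 < e) (hc : IsCoprime m e) (hm : m % 2 = 1) (h3 : ¬ (3:ℤ) ∣ m) :
    ∃ m' e' n' : ℤ, At (N+N+N) (m'/e'^2) (n'/e'^3) ∧ 0 < e' ∧ IsCoprime m' e' ∧ m' % 2 = 1 ∧ (3:ℤ) ∣ e' := by
  have heQ : (e:ℚ) ≠ 0 := by exact_mod_cast he.ne'
  have hE : n^2 = m^3-13500*e^6 := by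
    have := h.eqn; push_cast at this; field_simp at this
    have : (n:ℚ)^2 = m^3-13500*e^6 := by linarith
    exact_mod_cast this
  have m3 : m^3 % 2 = 1 := by
    have : m^3 = m^2*m := by ring
    have h2 := int_sq_odd hm
    rw [this, Int.mul_emod, hm, show m^2 % 2 = 1 by omega]; rfl
  have hn : n ≠ 0 := by rintro rfl; omega
  have hm0 : m ≠ 0 := by rintro rfl; omega
  have hd : m^3-54000*e^6 ≠ 0 := by omega
  have hdQ : (m:ℚ)^3-54000*e^6 ≠ 0 := by exact_mod_cast hd
  have hmQ : (m:ℚ) ≠ 0 := by exact_mod_cast hm0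
  have hnQ : (n:ℚ) ≠ 0 := by exact_mod_cast hn
  obtain ⟨y', h'⟩ := triple_gen h (by positivity) (by positivity) (by
    intro h0; apply hdQ; field_simp at h0; linarith)
  obtain ⟨m', e', n', he', hc', hx', hy', -⟩ := pt_form h'
  rw [hx', hy'] at h'
  have hV : 3*m*e*(m^3-54000*e^6) ≠ 0 := by positivity
  obtain ⟨c, hc1, hc2⟩ := red_form (U := m^9+1296000*m^6*e^6+8748000000*m^3*e^12-157464000000000*e^18) (V := 3*m*e*(m^3-54000*e^6)) he' hc' hV (by
    rw [← hx']; push_cast; 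
    have : (m/e^2:ℚ)^3-54000 = (m^3-54000*e^6)/e^6 := by field_simp
    rw [this]; field_simp; norm_num)
  have hU2 : (m^9+1296000*m^6*e^6+8748000000*m^3*e^12-157464000000000*e^18) % 2 = 1 := by
    have : m^9+1296000*m^6*e^6+8748000000*m^3*e^12-157464000000000*e^18 = m^3*m^3*m^3+2*(648000*m^6*e^6+4374000000*m^3*e^12-78732000000000*e^18) := by ring
    rw [this, Int.add_mul_emod_self_left, Int.mul_emod, Int.mul_emod (m^3), m3]; rfl
  have hU3 : ¬ (3:ℤ) ∣ (m^9+1296000*m^6*e^6+8748000000*m^3*e^12-157464000000000*e^18) := by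
    intro h0
    have : (3:ℤ) ∣ m^9 := by
      have h1 : m^9 = (m^9+1296000*m^6*e^6+8748000000*m^3*e^12-157464000000000*e^18) - 3*(432000*m^6*e^6+2916000000*m^3*e^12-52488000000000*e^18) := by ring
      rw [h1]; exact dvd_sub h0 (dvd_mul_right _ _)
    exact h3 (Int.prime_three.dvd_of_dvd_pow this)
  refine ⟨m', e', n', h', he', hc', odd_not_dvd_of_dvd ⟨c^2, hc2⟩ hU2, ?_⟩
  have : (3:ℤ) ∣ e'*c := by rw [← hc1]; exact ⟨m*e*(m^3-54000*e^6), by ring⟩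
  rcases Int.prime_three.dvd_or_dvd this with h0 | h0
  · exact h0
  · exact absurd (hc2 ▸ dvd_mul_of_dvd_right (dvd_pow h0 (by norm_num)) _) hU3

lemma dbl_inv {N : EA.Point} {m e n : ℤ} (h : At N (m/e^2) (n/e^3)) (he : 0 < e) (hc : IsCoprime m e) (hm : m % 2 = 1) (h3 : (3:ℤ) ∣ e) :
    ∃ m' e' n' c : ℤ, At (N+N) (m'/e'^2) (n'/e'^3) ∧ 0 < e' ∧ IsCoprime m' e' ∧ m' % 2 = 1 ∧ (3:ℤ) ∣ e' ∧ (2:ℤ) ∣ e' ∧ ¬ (5:ℤ) ∣ m' ∧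
      2*n*e = e'*c ∧ ∃ j, c.natAbs = 5^j := by
  have heQ : (e:ℚ) ≠ 0 := by exact_mod_cast he.ne'
  have hE : n^2 = m^3-13500*e^6 := by
    have := h.eqn; push_cast at this; field_simp at this
    have : (n:ℚ)^2 = m^3-13500*e^6 := by linarith
    exact_mod_cast this
  have hEQ : (n:ℚ)^2 = m^3-13500*e^6 := by exact_mod_cast hE
  have m3 : m^3 % 2 = 1 := by
    have : m^3 = m^2*m := by ring
    have h2 := int_sq_odd hm
    rw [this, Int.mul_emod, hm, show m^2 % 2 = 1 by omega]; rfl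
  have hn : n ≠ 0 := by rintro rfl; omega
  have hnQ : (n:ℚ) ≠ 0 := by exact_mod_cast hn
  have h3m : ¬ (3:ℤ) ∣ m := fun h0 => pr_cop hc Int.prime_three h0 h3
  have a2 := h.dbl_eq (3*(m:ℚ)^2/(2*n*e)) (((m*(m^3+108000*e^6):ℤ):ℚ)/(((2*n*e):ℤ):ℚ)^2) (3*(m:ℚ)^2/(2*n*e)*((m/e^2:ℚ)-(((m*(m^3+108000*e^6):ℤ):ℚ)/(((2*n*e):ℤ):ℚ)^2))-(n/e^3:ℚ))
    ⟨by positivity, by push_cast; field_simp; ring, by push_cast; field_simp; linear_combination -8*m*hEQ, rfl⟩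
  obtain ⟨m', e', n', he', hc', hx', hy', -⟩ := pt_form a2
  rw [hy', hx'] at a2
  have hV : 2*n*e ≠ 0 := by positivity
  obtain ⟨c, hc1, hc2⟩ := red_form he' hc' hV hx'.symm
  have hU2 : (m*(m^3+108000*e^6)) % 2 = 1 := by
    rw [Int.mul_emod, hm, show (m^3+108000*e^6) % 2 = 1 by omega]; rfl
  have hU3 : ¬ (3:ℤ) ∣ m*(m^3+108000*e^6) := by
    intro h0
    have : (3:ℤ) ∣ m^4 := by
      have h1 : m^4 = m*(m^3+108000*e^6) - 3*(36000*m*e^6) := by ring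
      rw [h1]; exact dvd_sub h0 (dvd_mul_right _ _)
    exact h3m (Int.prime_three.dvd_of_dvd_pow this)
  have hco : c % 2 = 1 := odd_not_dvd_of_dvd ⟨m'*c, by rw [hc2]; ring⟩ hU2
  have hc3 : ¬ (3:ℤ) ∣ c := fun h0 => hU3 (hc2 ▸ dvd_mul_of_dvd_right (dvd_pow h0 (by norm_num)) _)
  have hc0 : c ≠ 0 := by rintro rfl; omega
  refine ⟨m', e', n', c, a2, he', hc', odd_not_dvd_of_dvd ⟨c^2, hc2⟩ hU2, ?_, ?_, ?_, hc1, ?_⟩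
  · have : (3:ℤ) ∣ e'*c := by rw [← hc1]; exact dvd_mul_of_dvd_right h3 _
    rcases Int.prime_three.dvd_or_dvd this with h0 | h0
    · exact h0
    · exact absurd h0 hc3
  · have : (2:ℤ) ∣ e'*c := by rw [← hc1]; exact ⟨n*e, by ring⟩
    rcases Int.prime_two.dvd_or_dvd this with h0 | h0
    · exact h0
    · omega
  · intro h5
    by_cases h5m : (5:ℤ) ∣ m
    · obtain ⟨a, rfl⟩ := h5m
      have h5e : ¬ (5:ℤ) ∣ e := fun h0 => pr_cop hc prime5 (dvd_mul_right _ _) h0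
      obtain ⟨n1, rfl⟩ : (5:ℤ) ∣ n := prime5.dvd_of_dvd_pow (n := 2) (by rw [hE]; exact ⟨25*a^3-2700*e^6, by ring⟩)
      obtain ⟨b, rfl⟩ : (5:ℤ) ∣ n1 := prime5.dvd_of_dvd_pow (n := 2) ⟨a^3-108*e^6, by linarith⟩
      have hb : 5*b^2 = a^3-108*e^6 := by linarith
      have key : (5:ℤ) ∣ a*(a^3+864*e^6) := by
        obtain ⟨g, rfl⟩ := h5
        have h1 : (4*b^2*e^2)*(5*g) = (a*(a^3+864*e^6))*e'^2 := by
          have : (5*g)*(2*(5*(5*b))*e)^2 = (5*a)*((5*a)^3+108000*e^6)*e'^2 := by rw [hc1, hc2]; ring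
          linarith
        have : (5:ℤ) ∣ (a*(a^3+864*e^6))*e'^2 := by rw [← h1]; exact ⟨4*b^2*e^2*g, by ring⟩
        rcases prime5.dvd_or_dvd this with h0 | h0
        · exact h0
        · exact absurd (prime5.dvd_of_dvd_pow h0) (fun h0 => pr_cop hc' prime5 (dvd_mul_right _ _) h0)
      have ha5 : ¬ (5:ℤ) ∣ a := by
        rintro ⟨g, rfl⟩
        have : (5:ℤ) ∣ e^6 := by
          have h1 : e^6 = 5*(b^2-25*g^3) + 109*e^6 - 5*(0) := by linarith
          have h2 : e^6 = 5*(-2*(b^2-25*g^3)) + 5*(-43*e^6) := by linarith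
          rw [h2]; exact dvd_add (dvd_mul_right _ _) (dvd_mul_right _ _)
        exact h5e (prime5.dvd_of_dvd_pow this)
      rcases prime5.dvd_or_dvd key with h0 | h0
      · exact ha5 h0
      · have : (5:ℤ) ∣ e^6 := by
          obtain ⟨g, hg⟩ := h0
          have h2 : e^6 = 5*(-2*(g - b^2)) + 5*(389*e^6) := by linarith
          rw [h2]; exact dvd_add (dvd_mul_right _ _) (dvd_mul_right _ _)
        exact h5e (prime5.dvd_of_dvd_pow this)
    · apply h5m
      have h0 : (5:ℤ) ∣ m*(m^3+108000*e^6) := by rw [hc2]; exact dvd_mul_of_dvd_left h5 _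
      have : (5:ℤ) ∣ m^4 := by
        have h1 : m^4 = m*(m^3+108000*e^6) - 5*(21600*m*e^6) := by ring
        rw [h1]; exact dvd_sub h0 (dvd_mul_right _ _)
      exact prime5.dvd_of_dvd_pow this
  · refine ⟨_, Nat.eq_prime_pow_of_unique_prime_dvd (by omega) ?_⟩
    intro d hd hdc
    have hdz : Prime (d:ℤ) := Nat.prime_iff_prime_int.1 hd
    have hdc : (d:ℤ) ∣ c := Int.natCast_dvd.2 hdc
    have hd2 : d ≠ 2 := by rintro rfl; have : (2:ℤ) ∣ c := hdc; omega
    have hd3 : d ≠ 3 := by rintro rfl; exact hc3 hdc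
    by_contra hd5
    have k1 : (d:ℤ) ∣ 2*n*e := hc1 ▸ dvd_mul_of_dvd_right hdc _
    have k2 : (d:ℤ) ∣ m*(m^3+108000*e^6) := hc2 ▸ dvd_mul_of_dvd_right (dvd_pow hdc (by norm_num)) _
    have hpr : ∀ q : ℕ, q.Prime → (d:ℤ) ∣ (q:ℤ) → d = q := fun q hq h => (Nat.prime_dvd_prime_iff_eq hd hq).1 (Int.natCast_dvd_natCast.1 h)
    have hem : (d:ℤ) ∣ e → False := by
      intro h0
      have : (d:ℤ) ∣ m^4 := by
        have h1 : m^4 = m*(m^3+108000*e^6) - e*(108000*m*e^5) := by ring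
        rw [h1]; exact dvd_sub k2 (dvd_mul_of_dvd_left h0 _)
      exact pr_cop hc hdz (hdz.dvd_of_dvd_pow this) h0
    have hdn : (d:ℤ) ∣ n := by
      rcases hdz.dvd_or_dvd k1 with h0 | h0
      · rcases hdz.dvd_or_dvd h0 with h0 | h0
        · exact absurd (hpr 2 Nat.prime_two h0) hd2
        · exact h0
      · exact (hem h0).elim
    have k3 : (d:ℤ) ∣ 2^2*3^5*5^3*(m*e^6) := by
      have h1 : 2^2*3^5*5^3*(m*e^6) = m*(m^3+108000*e^6) - n*(n*m) := by linear_combination m*hE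
      rw [h1]; exact dvd_sub k2 (dvd_mul_of_dvd_left hdn _)
    have hdm : (d:ℤ) ∣ m := by
      rcases hdz.dvd_or_dvd k3 with h0 | h0
      · rcases hdz.dvd_or_dvd h0 with h0 | h0
        · rcases hdz.dvd_or_dvd h0 with h0 | h0
          · exact absurd (hpr 2 Nat.prime_two (hdz.dvd_of_dvd_pow h0)) hd2
          · exact absurd (hpr 3 Nat.prime_three (hdz.dvd_of_dvd_pow h0)) hd3
        · exact absurd (hpr 5 Nat.prime_five (hdz.dvd_of_dvd_pow h0)) hd5
      · rcases hdz.dvd_or_dvd h0 with h0 | h0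
        · exact h0
        · exact (hem (hdz.dvd_of_dvd_pow h0)).elim
    have k4 : (d:ℤ) ∣ 2^2*3^3*5^3*(e^6) := by
      have h1 : 2^2*3^3*5^3*(e^6) = m*m^2 - n*n := by linear_combination hE
      rw [h1]; exact dvd_sub (dvd_mul_of_dvd_left hdm _) (dvd_mul_of_dvd_left hdn _)
    rcases hdz.dvd_or_dvd k4 with h0 | h0
    · rcases hdz.dvd_or_dvd h0 with h0 | h0
      · rcases hdz.dvd_or_dvd h0 with h0 | h0
        · exact absurd (hpr 2 Nat.prime_two (hdz.dvd_of_dvd_pow h0)) hd2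
        · exact absurd (hpr 3 Nat.prime_three (hdz.dvd_of_dvd_pow h0)) hd3
      · exact absurd (hpr 5 Nat.prime_five (hdz.dvd_of_dvd_pow h0)) hd5
    · exact hem (hdz.dvd_of_dvd_pow h0)

/-- the points `3^(j+2) P` -/
lemma seqA {P : EA.Point} (hP : At P 60 450) (j : ℕ) : ∃ m e n : ℤ, At ((3^(j+2):ℤ) • P) (m/e^2) (n/e^3) ∧ 0 < e ∧
    IsCoprime m e ∧ m % 2 = 1 ∧ (3:ℤ) ∣ e := by
  have h2P := hP.dbl_eq 12 24 (-18) (by norm_num)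
  have h3P := h2P.add_eq 13 85 (-775) hP (by norm_num)
  induction j with
  | zero =>
    have h3 : At (P+P+P) (((85:ℤ):ℚ)/((1:ℤ):ℚ)^2) (((-775:ℤ):ℚ)/((1:ℤ):ℚ)^3) := h3P.congr (by norm_num) (by norm_num)
    obtain ⟨m, e, n, h⟩ := trip_inv h3 (by norm_num) isCoprime_one_right (by norm_num) (by norm_num)
    refine ⟨m, e, n, ?_⟩
    convert h using 2
    norm_num; module
  | succ j ih =>
    obtain ⟨m, e, n, h, he, hc, hm, h3⟩ := ih
    obtain ⟨m', e', n', h'⟩ := trip_inv h he hc hm (fun h0 => pr_cop hc Int.prime_three h0 h3)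
    refine ⟨m', e', n', ?_⟩
    convert h' using 2
    rw [pow_succ (3:ℤ) (j+2)]; module

set_option linter.unusedSectionVars false
set_option linter.unusedVariables false
open NumberTheorySymbols

lemma jac_recip {D : ℤ} (hD : D % 4 = 1) {w : ℕ} (hw : Odd w) : J((w:ℤ) | D.natAbs) = J(D | w) := by
  have hw2 := Nat.odd_iff.1 hw
  rcases le_total 0 D with h | h
  · obtain ⟨n, rfl⟩ := Int.eq_ofNat_of_zero_le h
    rw [Int.natAbs_natCast, ← jacobiSym.quadratic_reciprocity_one_mod_four (by omega) hw]
  · obtain ⟨n, hn⟩ := Int.eq_ofNat_of_zero_le (neg_nonneg.2 h)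
    obtain rfl : D = -n := by rw [← hn]; ring
    rw [Int.natAbs_neg, Int.natAbs_natCast, jacobiSym.neg _ hw]
    have : w % 4 = 1 ∨ w % 4 = 3 := by omega
    rcases this with h1 | h1
    · rw [ZMod.χ₄_nat_one_mod_four h1, one_mul, jacobiSym.quadratic_reciprocity_one_mod_four h1 (Nat.odd_iff.2 (by omega))]
    · rw [ZMod.χ₄_nat_three_mod_four h1, jacobiSym.quadratic_reciprocity_three_mod_four h1 (by omega)]; ring

lemma jac_two {n : ℕ} (h : n % 8 = 1 ∨ n % 8 = 7) : J(2 | n) = 1 := by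
  have ho : Odd n := Nat.odd_iff.2 (by omega)
  rw [jacobiSym.at_two ho, ZMod.χ₈_nat_eq_if_mod_eight]
  rw [if_neg (by omega), if_pos h]

lemma jac_even {D W : ℤ} (hD : D % 8 = 1) (hW : W ≠ 0) (hneg : W < 0 → 0 < D) :
    ∃ w : ℕ, Odd w ∧ w ∣ W.natAbs ∧ J(W | D.natAbs) = J(D | w) ∧ J(W | 89) = J((w:ℤ) | 89) := by
  obtain ⟨a, w, hw, hWw⟩ := Nat.exists_eq_two_pow_mul_odd (n := W.natAbs) (by simpa using hW)
  refine ⟨w, hw, ⟨2^a, by rw [hWw]; ring⟩, ?_, ?_⟩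
  · rw [← jac_recip (by omega) hw]
    have h2 : J(2 | D.natAbs) = 1 := jac_two (by omega)
    have h1 : J(((W.natAbs:ℕ):ℤ) | D.natAbs) = J((w:ℤ) | D.natAbs) := by
      rw [hWw]; push_cast; rw [jacobiSym.mul_left, jacobiSym.pow_left, h2, one_pow, one_mul]
    rw [← h1]
    rcases lt_or_ge W 0 with h0 | h0
    · have hD0 := hneg h0
      have : (W.natAbs:ℤ) = -W := by omega
      rw [this, jacobiSym.neg _ (Nat.odd_iff.2 (by omega)), ZMod.χ₄_nat_one_mod_four (by omega), one_mul]
    · have : (W.natAbs:ℤ) = W := by omega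
      rw [this]
  · have h2 : J(2 | 89) = 1 := jac_two (by norm_num)
    have h1 : J(((W.natAbs:ℕ):ℤ) | 89) = J((w:ℤ) | 89) := by
      rw [hWw]; push_cast; rw [jacobiSym.mul_left, jacobiSym.pow_left, h2, one_pow, one_mul]
    rw [← h1]
    rcases lt_or_ge W 0 with h0 | h0
    · have : (W.natAbs:ℤ) = -W := by omega
      rw [this, jacobiSym.neg _ (by decide), ZMod.χ₄_nat_one_mod_four (by norm_num), one_mul]
    · have : (W.natAbs:ℤ) = W := by omega
      rw [this]

lemma gcd_of_cop {a : ℤ} {n : ℕ} (h : IsCoprime a (n:ℤ)) : Int.gcd a n = 1 := Int.isCoprime_iff_gcd_eq_one.1 h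

lemma jac_sq {a : ℤ} {n : ℕ} (h : IsCoprime a (n:ℤ)) : J(a^2 | n) = 1 := jacobiSym.sq_one' (gcd_of_cop h)

lemma jac_modeq {a b : ℤ} {n : ℕ} (h : (n:ℤ) ∣ a - b) : J(a | n) = J(b | n) :=
  jacobiSym.mod_left' (Int.emod_eq_emod_iff_emod_sub_eq_zero.2 (Int.emod_eq_zero_of_dvd h))

/-- the reciprocity computation -/
lemma jacD {x e y τ : ℤ} (hτ : τ = 1 ∨ τ = -1) (hE : y^2 = x^3-13500*e^6) (he : 0 < e) (hc : IsCoprime x e) (hx : x % 2 = 1)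
    (h3 : (3:ℤ) ∣ e) (h2 : (2:ℤ) ∣ e) (h5 : ¬ (5:ℤ) ∣ x) (hJ : J((37*(90*e^3)-16*τ*y) | 89) = -1) :
    (x^3-54000*e^6) % 8 = 1 ∧ IsCoprime (30*e) (x^3-54000*e^6) ∧
    J((5*(37*(90*e^3)-16*τ*y)*(90*e^3)) | (x^3-54000*e^6).natAbs) = -1 := by
  obtain ⟨D, hD⟩ : ∃ D, D = x^3-54000*e^6 := ⟨_, rfl⟩
  rw [← hD]
  have hDy : D = y^2-40500*e^6 := by rw [hD, hE]; ring
  obtain ⟨e2, he2⟩ := h2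
  have hyo : y % 2 = 1 := by
    have h1 : x^3 % 2 = 1 := by
      have : x^3 = x^2*x := by ring
      have h2 := int_sq_odd hx
      rw [this, Int.mul_emod, hx, show x^2 % 2 = 1 by omega]; rfl
    have h2 : y^2 % 2 = 1 := by omega
    by_contra h0
    have h0 : y % 2 = 0 := by omega
    rw [pow_two, Int.mul_emod, h0] at h2; norm_num at h2
  have hD8 : D % 8 = 1 := by
    have := int_sq_odd hyo
    have h1 : D = y^2 - 8*(324000*e2^6) := by rw [hDy, he2]; ring
    omega
  have cy : IsCoprime y (30*e) := by
    apply cop_pr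
    intro p hp h1 h2
    have hx' : ¬ p ∣ x ∨ ¬ p ∣ e := by
      by_contra h0; push Not at h0; exact pr_cop hc hp h0.1 h0.2
    have hpe : p ∣ e → False := by
      intro h0
      have : p ∣ x^3 := by
        have h1' : x^3 = y*y + e*(13500*e^5) := by linear_combination -hE
        rw [h1']; exact dvd_add (dvd_mul_of_dvd_left h1 _) (dvd_mul_of_dvd_left h0 _)
      exact pr_cop hc hp (hp.dvd_of_dvd_pow this) h0
    rcases hp.dvd_or_dvd h2 with h0 | h0
    · have h30 : p ∣ 2*3*5 := h0
      rcases hp.dvd_or_dvd h30 with h0 | h0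
      · rcases hp.dvd_or_dvd h0 with h0 | h0
        · exact hpe (h0.trans ⟨e2, he2⟩)
        · exact hpe (h0.trans h3)
      · have h5p : (5:ℤ) ∣ p := by
          rcases (hp.irreducible.associated_of_dvd prime5.irreducible h0) with h; exact h.symm.dvd
        have : (5:ℤ) ∣ x^3 := by
          have h1' : x^3 = y*y + 5*(2700*e^6) := by linear_combination -hE
          rw [h1']; exact dvd_add (dvd_mul_of_dvd_left (h5p.trans h1) _) (dvd_mul_right _ _)
        exact h5 (prime5.dvd_of_dvd_pow this)
    · exact hpe h0
  have cD : IsCoprime (30*e) D := by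
    have h1 : IsCoprime (30*e) (y^2) := (cy.symm.pow_right)
    have h2 : D = y^2 + (30*e)*(-1350*e^5) := by rw [hDy]; ring
    rw [h2]; exact IsCoprime.add_mul_left_right h1 _
  refine ⟨hD8, cD, ?_⟩
  obtain ⟨W, hW⟩ : ∃ W, W = 37*(90*e^3)-16*τ*y := ⟨_, rfl⟩
  rw [← hW] at hJ ⊢
  have hW0 : W ≠ 0 := by rintro rfl; rw [jacobiSym.zero_left (by norm_num)] at hJ; norm_num at hJ
  have hneg : W < 0 → 0 < D := by
    intro h0
    have he3 : 0 < e^3 := by positivity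
    have h1 : 3330*e^3 < 16*τ*y := by linarith
    have h2 : (3330*e^3)^2 < (16*τ*y)^2 := pow_lt_pow_left₀ h1 (by positivity) (by norm_num)
    have h3 : (16*τ*y)^2 = 256*y^2 := by rcases hτ with rfl | rfl <;> ring
    rw [h3] at h2
    have h6 : 0 < e^6 := by positivity
    have h7 : (3330*e^3)^2 = 11088900*e^6 := by ring
    rw [hDy]; linarith
  have e1 : 5*W*(90*e^3) = W*2*e*(15*e)^2 := by ring
  have hn8 : D.natAbs % 8 = 1 ∨ D.natAbs % 8 = 7 := by omega
  have c15 : IsCoprime (15*e) (D.natAbs:ℤ) := by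
    have h1 : IsCoprime (15*e) D := IsCoprime.of_isCoprime_of_dvd_left cD ⟨2, by ring⟩
    rcases Int.natAbs_eq D with h | h
    · rwa [← h]
    · have : (D.natAbs:ℤ) = -D := by omega
      rw [this]; exact h1.neg_right
  rw [e1, jacobiSym.mul_left, jacobiSym.mul_left, jacobiSym.mul_left, jac_two hn8, jac_sq c15]
  obtain ⟨w1, ho1, hd1, hj1, -⟩ := jac_even hD8 he.ne' (fun h => absurd h (by omega))
  obtain ⟨w, ho, hd, hj, hj'⟩ := jac_even hD8 hW0 hneg
  have hd1 : (w1:ℤ) ∣ e := Int.natCast_dvd.2 hd1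
  have hd : (w:ℤ) ∣ W := Int.natCast_dvd.2 hd
  have je : J(e | D.natAbs) = 1 := by
    rw [hj1, jac_modeq (b := y^2) (by
      have : D - y^2 = e*(-40500*e^5) := by rw [hDy]; ring
      rw [this]; exact dvd_mul_of_dvd_left hd1 _), jac_sq]
    exact IsCoprime.of_isCoprime_of_dvd_right cy (dvd_mul_of_dvd_right hd1 _)
  have hτ2 : τ^2 = 1 := by rcases hτ with rfl | rfl <;> norm_num
  have hwZ : IsCoprime (90*e^3) (w:ℤ) := by
    have cw2 : IsCoprime (2:ℤ) (w:ℤ) := by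
      have := Nat.odd_iff.1 ho
      exact ⟨-((w/2:ℕ):ℤ), 1, by omega⟩
    have cyZ : IsCoprime y (90*e^3) := by
      have h1 : IsCoprime y ((30*e)^3) := cy.pow_right
      exact IsCoprime.of_isCoprime_of_dvd_right h1 ⟨300, by ring⟩
    have c16 : IsCoprime (w:ℤ) (2^4) := cw2.symm.pow_right
    apply cop_pr
    intro p hp h1 h2
    have k1 : p ∣ 2^4*(τ*y) := by
      have : 2^4*(τ*y) = 37*(90*e^3) - W := by rw [hW]; ring
      rw [this]; exact dvd_sub (dvd_mul_of_dvd_right h1 _) (h2.trans hd)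
    rcases hp.dvd_or_dvd k1 with h0 | h0
    · exact pr_cop c16 hp h2 h0
    · have : p ∣ y := by rcases hτ with rfl | rfl <;> simpa using h0
      exact pr_cop cyZ hp this h1
  have jW : J(W | D.natAbs) = -1 := by
    have c16 : IsCoprime (16:ℤ) (w:ℤ) := by
      have cw2 : IsCoprime (2:ℤ) (w:ℤ) := by
        have := Nat.odd_iff.1 ho
        exact ⟨-((w/2:ℕ):ℤ), 1, by omega⟩
      have : IsCoprime ((2:ℤ)^4) (w:ℤ) := cw2.pow_left
      exact this
    have k1 : J(D | w) = J(16^2*D | w) := by rw [jacobiSym.mul_left, jac_sq c16, one_mul]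
    have k2 : J(16^2*D | w) = J(89*(90*e^3)^2 | w) := jac_modeq (by
      have : 16^2*D - 89*(90*e^3)^2 = W*(-(37*(90*e^3)+16*τ*y)) := by
        rw [hW, hDy]; linear_combination (-256*y^2)*hτ2
      rw [this]; exact dvd_mul_of_dvd_left hd _)
    rw [hj, k1, k2, jacobiSym.mul_left, jac_sq hwZ, mul_one, ← hJ, hj']
    exact jacobiSym.quadratic_reciprocity_one_mod_four (a := 89) (by norm_num) ho
  rw [je, jW]; norm_num

lemma locA {F : Type} [Field F] [DecidableEq F] {P Q : (EC F 0 0 (-13500)).Point} (h2 : (2:F) ≠ 0) (h3 : (3:F) ≠ 0) (h5 : (5:F) ≠ 0)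
    (hP : At P 60 450) {t θ : F} (hQ : At Q t (90*θ)) (ht : t^3 = 54000) (hθ : θ^2 = 5) (hg : GdA (P+Q)) :
    IsSquare (5*(37-16*θ)) := by
  have h30 : (30:F) ≠ 0 := by
    have : (30:F) = 2*3*5 := by norm_num
    rw [this]; exact mul_ne_zero (mul_ne_zero h2 h3) h5
  obtain ⟨τ, rfl⟩ : ∃ τ, t = 30*τ := ⟨t/30, by field_simp⟩
  have hτ : τ^3 = 2 := by
    apply mul_left_cancel₀ (pow_ne_zero 3 h30); linear_combination ht
  have hne : (60:F) ≠ 30*τ := by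
    intro h0
    have : τ = 2 := by apply mul_left_cancel₀ h30; linear_combination -h0
    rw [this] at hτ
    have : (2:F)*3 = 0 := by linear_combination hτ
    exact mul_ne_zero h2 h3 this
  obtain ⟨x, hx⟩ : ∃ x, x = 15*(8+7*τ+6*τ^2-θ*(4+3*τ+2*τ^2)) := ⟨_, rfl⟩
  have a := hP.add_eq ((5-θ)*(4+2*τ+τ^2)/2) x _ hQ ⟨hne, by field_simp; linear_combination (-30*(5-θ))*hτ, by
    rw [hx]; push_cast; field_simp; grind, rfl⟩
  have key : 54000-x^3 = 45*x^2*(4*θ-8) := by rw [hx]; grind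
  have hx0 : x ≠ 0 := by
    intro h0
    rw [h0] at key
    have : (30:F)^3*2 = 0 := by linear_combination key
    exact mul_ne_zero (pow_ne_zero 3 h30) h2 this
  rcases hg with ⟨h0, -⟩ | ⟨X, Y, h', w, hw⟩
  · exact absurd h0 a.ne_zero
  · rw [← (a.uniq h').1, key] at hw
    have h90 : (90:F) ≠ 0 := by
      have : (90:F) = 2*3*3*5 := by norm_num
      rw [this]; exact mul_ne_zero (mul_ne_zero (mul_ne_zero h2 h3) h3) h5
    refine ⟨w/(90*x^2), ?_⟩
    field_simp
    rw [pow_two w, ← hw]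
    linear_combination (-162000*x^4)*hθ

set_option linter.unusedSectionVars false
set_option linter.unusedVariables false
open NumberTheorySymbols

lemma int_three_pow (k : ℤ) (hk : k ≠ 0) : ∃ (j : ℕ) (q : ℤ), k = 3^j*q ∧ q % 3 ≠ 0 := by
  obtain ⟨n, hn⟩ : ∃ n, n = k.natAbs := ⟨_, rfl⟩
  induction n using Nat.strong_induction_on generalizing k with
  | _ n ih =>
    by_cases h : k % 3 = 0
    · obtain ⟨l, rfl⟩ := Int.dvd_of_emod_eq_zero h
      obtain ⟨j, q, h1, h2⟩ := ih l.natAbs (by omega) l (by omega) rfl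
      exact ⟨j+1, q, by rw [h1]; ring, h2⟩
    · exact ⟨0, k, by ring, h⟩

lemma zred {p : ℕ} [hp : Fact p.Prime] {a b c : ℤ} (hd : EDisc (ZMod p) a b c) {N : (EC ℚ a b c).Point} {m e n : ℤ}
    (h : At N ((m:ℚ)/e^2) ((n:ℚ)/e^3)) (he : 0 < e) (hc : IsCoprime m e) {X Y : ZMod p} (h' : At (redHom hd N) X Y) :
    (e:ZMod p) ≠ 0 ∧ X*(e:ZMod p)^2 = m ∧ Y*(e:ZMod p)^3 = n := by
  obtain ⟨hx, hy, hxX, hyY⟩ := redHom_at' hd h h'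
  have heQ : (e:ℚ) ≠ 0 := by exact_mod_cast he.ne'
  have e1 : (((m:ℤ):ℚ):ZMod p) = (m : ZMod p) := by simp
  have e2 : (((e:ℤ):ℚ):ZMod p) = (e : ZMod p) := by simp
  have e3 : (((n:ℤ):ℚ):ZMod p) = (n : ZMod p) := by simp
  have k1 : X*(e:ZMod p)^2 = m := by
    have hee : ((e:ℚ)^2) * (m/(e:ℚ)^2) = m := by field_simp
    have hc := congrArg (fun q : ℚ => (q : ZMod p)) hee
    beta_reduce at hc
    rw [((PI_int (p := p) e).pow 2).cmul hx, (PI_int (p := p) e).cpow, hxX, e1, e2] at hc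
    rw [← hc]; ring
  have k2 : Y*(e:ZMod p)^3 = n := by
    have hee : ((e:ℚ)^3) * (n/(e:ℚ)^3) = n := by field_simp
    have hc := congrArg (fun q : ℚ => (q : ZMod p)) hee
    beta_reduce at hc
    rw [((PI_int (p := p) e).pow 3).cmul hy, (PI_int (p := p) e).cpow, hyY, e3, e2] at hc
    rw [← hc]; ring
  refine ⟨?_, k1, k2⟩
  intro h0
  obtain ⟨a, b, hab⟩ := hc
  have := congrArg (fun z : ℤ => (z : ZMod p)) hab
  simp [h0, ← k1] at this

lemma zred' {p : ℕ} [hp : Fact p.Prime] {a b c : ℤ} (hd : EDisc (ZMod p) a b c) {N : (EC ℚ a b c).Point} {m e n : ℤ}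
    (h : At N ((m:ℚ)/e^2) ((n:ℚ)/e^3)) (he : 0 < e) (hc : IsCoprime m e) (he0 : (e:ZMod p) ≠ 0) :
    ∃ X Y, At (redHom hd N) X Y ∧ X*(e:ZMod p)^2 = m ∧ Y*(e:ZMod p)^3 = n := by
  have e2 : (((e:ℤ):ℚ):ZMod p) = (e : ZMod p) := by simp
  have hx : PI p ((m:ℚ)/e^2) := by
    rw [div_eq_mul_inv]
    refine (PI_int m).mul (((PI_int e).pow 2).inv ?_)
    rw [(PI_int e).cpow, e2]; exact pow_ne_zero _ he0
  have := (redHom_at hd h hx).2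
  exact ⟨_, _, this, (zred hd h he hc this).2⟩

lemma nine_pow (i : ℕ) : ((9:ℤ)*81^i) % 45 = 9 := by
  induction i with
  | zero => norm_num
  | succ i ih => rw [pow_succ]; omega

lemma chain89 {P : (EC (ZMod 89) 0 0 (-13500)).Point} (a1 : At P 60 5) {κ : ℤ} (hκ : κ % 45 = 18 ∨ κ % 45 = 27) :
    (At (κ • P) 53 39 ∧ At (κ • P + κ • P) 52 4) ∨ (At (κ • P) 53 (-39) ∧ At (κ • P + κ • P) 52 (-4)) := by
  have a2 := a1.dbl_eq 12 24 71 (by decide +kernel)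
  have a4 := a2.dbl_eq 41 31 87 (by decide +kernel)
  have a8 := a4.dbl_eq 58 9 32 (by decide +kernel)
  have a9 := a8.add_eq 78 52 85 a1 (by decide +kernel)
  have a18 := a9.dbl_eq 54 53 39 (by decide +kernel)
  have a27 := a18.add_eq 43 53 50 a9 (by decide +kernel)
  have a36 := a18.dbl_eq 43 52 4 (by decide +kernel)
  have h45 : (45:ℤ) • P = 0 := by
    rw [← a18.add_neg (a27.congr rfl (by decide +kernel))]; module
  rw [zsmul_mod h45 κ]
  rcases hκ with h | h <;> rw [h]
  · left
    refine ⟨by convert a18 using 1; module, by convert a36 using 1; module⟩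
  · right
    have e : (27:ℤ) • P = -(18:ℤ) • P := by
      rw [← sub_eq_zero, ← h45]; module
    rw [e]
    refine ⟨by convert a18.neg using 1; module, by convert a36.neg using 1; module⟩

lemma stepA {P : EA.Point} (hP : At P 60 450) (hd : EDisc (ZMod 89) 0 0 (-13500)) {l : ℤ} (hl : l ≠ 0) :
    ∃ (q : ℤ) (N : EA.Point) (m e n : ℤ), q % 3 ≠ 0 ∧ (36*l) • P = q • (N+N) ∧ At N (m/e^2) (n/e^3) ∧ 0 < e ∧
    IsCoprime m e ∧ m % 2 = 1 ∧ (3:ℤ) ∣ e ∧ ((At (redHom hd N) 53 39 ∧ At (redHom hd (N+N)) 52 4) ∨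
      (At (redHom hd N) 53 (-39) ∧ At (redHom hd (N+N)) 52 (-4))) := by
  obtain ⟨j, q, hj, hq⟩ := int_three_pow l hl
  obtain ⟨m, e, n, hN, he, hc, hm, h3⟩ := seqA hP j
  have a1 : At (redHom hd P) 60 5 := (red60 hd hP).congr rfl (by decide +kernel)
  rcases Nat.even_or_odd' j with ⟨i, hi | hi⟩
  · obtain ⟨m', e', n', c, hN', he', hc', hm', h3', -⟩ := dbl_inv hN he hc hm h3
    have hκ : (2*3^(j+2) : ℤ) % 45 = 18 ∨ (2*3^(j+2) : ℤ) % 45 = 27 := by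
      rcases Nat.even_or_odd' i with ⟨s, hs | hs⟩
      · left
        have : (2*3^(j+2):ℤ) = 2*(9*81^s) := by
          rw [hi, hs, show (81:ℤ) = 3^4 by norm_num, ← pow_mul, show (9:ℤ) = 3^2 by norm_num, ← pow_add]; ring_nf
        have := nine_pow s; omega
      · right
        have : (2*3^(j+2):ℤ) = 18*(9*81^s) := by
          rw [hi, hs, show (81:ℤ) = 3^4 by norm_num, ← pow_mul, show (9:ℤ) = 3^2 by norm_num, ← pow_add]; ring_nf
        have := nine_pow s; omega
    have e1 : (3^(j+2):ℤ) • P + (3^(j+2):ℤ) • P = (2*3^(j+2):ℤ) • P := by module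
    refine ⟨q, _, m', e', n', hq, ?_, hN', he', hc', hm', h3', ?_⟩
    · rw [e1, hj]; module
    · rw [e1, map_add, map_zsmul]; exact chain89 a1 hκ
  · have hκ : (3^(j+2) : ℤ) % 45 = 18 ∨ (3^(j+2) : ℤ) % 45 = 27 := by
      rcases Nat.even_or_odd' i with ⟨s, hs | hs⟩
      · right
        have : (3^(j+2):ℤ) = 3*(9*81^s) := by
          rw [hi, hs, show (81:ℤ) = 3^4 by norm_num, ← pow_mul, show (9:ℤ) = 3^2 by norm_num, ← pow_add]; ring_nf
        have := nine_pow s; omega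
      · left
        have : (3^(j+2):ℤ) = 27*(9*81^s) := by
          rw [hi, hs, show (81:ℤ) = 3^4 by norm_num, ← pow_mul, show (9:ℤ) = 3^2 by norm_num, ← pow_add]; ring_nf
        have := nine_pow s; omega
    refine ⟨2*q, _, m, e, n, by omega, ?_, hN, he, hc, hm, h3, ?_⟩
    · rw [hj]; module
    · rw [map_add, map_zsmul]; exact chain89 a1 hκ

lemma sq89 : IsSquare (5:ZMod 89) ∧ IsSquare (-1:ZMod 89) ∧ IsSquare (78:ZMod 89) ∧ IsSquare (-78:ZMod 89) ∧
  ¬ IsSquare (3330-64:ZMod 89) ∧ ¬ IsSquare (3330+64:ZMod 89) ∧ (5:ZMod 89) ≠ 0 := by decide +kernel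

lemma five_pow89 {c : ℤ} {i : ℕ} (h : c.natAbs = 5^i) : IsSquare (c:ZMod 89) ∧ (c:ZMod 89) ≠ 0 := by
  have : c = 5^i ∨ c = -5^i := by
    rcases Int.natAbs_eq c with h' | h' <;> rw [h, Nat.cast_pow, Nat.cast_ofNat] at h'
    · exact Or.inl h'
    · exact Or.inr h'
  obtain ⟨h5, h1, -, -, -, -, h0⟩ := sq89
  rcases this with rfl | rfl
  · push_cast; exact ⟨h5.pow i, pow_ne_zero _ h0⟩
  · push_cast; exact ⟨by rw [neg_eq_neg_one_mul]; exact h1.mul (h5.pow i), neg_ne_zero.2 (pow_ne_zero _ h0)⟩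

lemma J89 {e y e1 n1 c τ : ℤ} {i : ℕ} (hτ : τ = 1 ∨ τ = -1) (hc : c.natAbs = 5^i) (he : 2*n1*e1 = e*c) (he1 : (e1:ZMod 89) ≠ 0)
    (h0 : (e:ZMod 89) ≠ 0)
    (hn : (39*(e1:ZMod 89)^3 = n1 ∧ 4*(e:ZMod 89)^3 = y) ∨ (-39*(e1:ZMod 89)^3 = n1 ∧ -4*(e:ZMod 89)^3 = y)) :
    J((37*(90*e^3)-16*τ*y) | 89) = -1 := by
  obtain ⟨-, -, s1, s2, s3, s4, -⟩ := sq89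
  obtain ⟨hc1, hc0⟩ := five_pow89 hc
  have hez : 2*(n1:ZMod 89)*e1 = e*c := by exact_mod_cast congrArg (fun z : ℤ => (z:ZMod 89)) he
  have hes : IsSquare (e:ZMod 89) := by
    have h4 : IsSquare ((e1:ZMod 89)^4) := ⟨e1^2, by ring⟩
    have : (e:ZMod 89) = (2*n1*e1)/c := by rw [hez]; field_simp
    rw [this]
    refine IsSquare.div ?_ hc1
    rcases hn with ⟨h, -⟩ | ⟨h, -⟩ <;> rw [← h]
    · rw [show 2*(39*(e1:ZMod 89)^3)*e1 = 78*(e1:ZMod 89)^4 by ring]; exact s1.mul h4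
    · rw [show 2*(-39*(e1:ZMod 89)^3)*e1 = -78*(e1:ZMod 89)^4 by ring]; exact s2.mul h4
  obtain ⟨s, hs⟩ := hes
  have hs0 : s ≠ 0 := by rintro rfl; exact h0 (by rw [hs]; ring)
  rw [← jacobiSym.legendreSym.to_jacobiSym, legendreSym.eq_neg_one_iff]
  have key : ∀ v : ZMod 89, ¬ IsSquare v → ((37*(90*e^3)-16*τ*y:ℤ):ZMod 89) = v*(s^3)^2 → ¬ IsSquare ((37*(90*e^3)-16*τ*y:ℤ):ZMod 89) := by
    intro v hv h hh
    rw [h] at hh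
    apply hv
    have := hh.div (⟨s^3, by ring⟩ : IsSquare ((s^3)^2))
    rwa [mul_div_cancel_right₀ _ (pow_ne_zero 2 (pow_ne_zero 3 hs0))] at this
  rcases hτ with rfl | rfl <;> rcases hn with ⟨-, h⟩ | ⟨-, h⟩
  · exact key _ s3 (by push_cast; rw [← h, hs]; ring)
  · exact key _ s4 (by push_cast; rw [← h, hs]; ring)
  · exact key _ s4 (by push_cast; rw [← h, hs]; ring)
  · exact key _ s3 (by push_cast; rw [← h, hs]; ring)

lemma three_tors {F : Type} [Field F] [DecidableEq F] {Q : (EC F 0 0 (-13500)).Point} (h2 : (2:F) ≠ 0) (h3 : (3:F) ≠ 0) (h5 : (5:F) ≠ 0)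
    {t θ : F} (hQ : At Q t (90*θ)) (ht : t^3 = 54000) (hθ : θ^2 = 5) : (3:ℤ) • Q = 0 := by
  have hθ0 : θ ≠ 0 := by rintro rfl; exact h5 (by rw [← hθ]; ring)
  have h90 : (90:F) ≠ 0 := by
    have : (90:F) = 2*3*3*5 := by norm_num
    rw [this]; exact mul_ne_zero (mul_ne_zero (mul_ne_zero h2 h3) h3) h5
  have h180 : 2*(90*θ) ≠ 0 := mul_ne_zero h2 (mul_ne_zero h90 hθ0)
  obtain ⟨l, hl⟩ : ∃ l : F, l*(2*(90*θ)) = 3*t^2 := ⟨3*t^2/(2*(90*θ)), by field_simp⟩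
  have hl2 : l^2 = 3*t := by
    apply mul_right_cancel₀ (pow_ne_zero 2 h180)
    linear_combination (l*(2*(90*θ))+3*t^2)*hl + 9*t*ht-97200*t*hθ
  have a := hQ.dbl_eq l t (-(90*θ)) ⟨h180, by push_cast; linear_combination hl, by push_cast; linear_combination hl2, by ring⟩
  rw [← hQ.add_neg a]; module

theorem C5 {N : EA.Point} {x y w : ℚ} (hN : At N x y) (hw : 5*((54000-x^3)^2+8100*x^4) = w^2) : x = 60 := by
  obtain ⟨P, hP⟩ : ∃ P : EA.Point, At P 60 450 := At.mk EA_disc (by norm_num)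
  suffices H : ∀ k : ℤ, k % 36 = 1 → ∀ y, At (k • P) x y → x = 60 by
    obtain ⟨k, rfl⟩ := mw5 hP N
    rcases sieve5 hP hN hw with h | h
    · exact H k h y hN
    · exact H (-k) (by omega) (-y) (by rw [neg_zsmul]; exact hN.neg)
  intro k hk y hN
  obtain ⟨l, rfl⟩ : ∃ l, k = 1+36*l := ⟨k/36, by omega⟩
  by_cases hl : l = 0
  · subst hl
    exact (hN.uniq (by simpa using hP)).1
  exfalso
  have hd89 := EA_red_disc (p := 89) (by decide) (by decide) (by decide)
  obtain ⟨q, N1, m1, e1, n1, hq, hkq, hN1, he1, hc1, hm1, h31, h89⟩ := stepA hP hd89 hl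
  obtain ⟨m, e, n, c, hN0, he, hc, hm, h3, h2, h5, hec, i, hi⟩ := dbl_inv hN1 he1 hc1 hm1 h31
  have hE : n^2 = m^3-13500*e^6 := by
    have := hN0.eqn
    have heQ : (e:ℚ) ≠ 0 := by exact_mod_cast he.ne'
    push_cast at this
    field_simp at this
    have h' : (n:ℚ)^2 = m^3-13500*e^6 := by linear_combination this
    exact_mod_cast h'
  have hJW : ∀ τ : ℤ, τ = 1 ∨ τ = -1 → J((37*(90*e^3)-16*τ*n) | 89) = -1 := by
    intro τ hτ
    rcases h89 with ⟨g1, g2⟩ | ⟨g1, g2⟩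
    · obtain ⟨z1, -, z2⟩ := zred hd89 hN1 he1 hc1 g1
      obtain ⟨z3, -, z4⟩ := zred hd89 hN0 he hc g2
      exact J89 hτ hi hec z1 z3 (Or.inl ⟨z2, z4⟩)
    · obtain ⟨z1, -, z2⟩ := zred hd89 hN1 he1 hc1 g1
      obtain ⟨z3, -, z4⟩ := zred hd89 hN0 he hc g2
      exact J89 hτ hi hec z1 z3 (Or.inr ⟨z2, z4⟩)
  obtain ⟨τ, hτ, hτq⟩ : ∃ τ : ℤ, (τ = 1 ∨ τ = -1) ∧ (3:ℤ) ∣ q-τ := by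
    have : q % 3 = 1 ∨ q % 3 = 2 := by omega
    rcases this with h | h
    · exact ⟨1, Or.inl rfl, by omega⟩
    · exact ⟨-1, Or.inr rfl, by omega⟩
  obtain ⟨hD8, hDc, hJ⟩ := jacD hτ hE he hc hm h3 h2 h5 (hJW τ hτ)
  obtain ⟨D, hD⟩ : ∃ D, D = m^3-54000*e^6 := ⟨_, rfl⟩
  rw [← hD] at hD8 hDc hJ
  have hJ' : J((5*(37*(90*e^3)-16*τ*n)*(90*e^3)) | ((D.natAbs:ℤ)).toNat) = -1 := by rw [Int.toNat_natCast]; exact hJ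
  obtain ⟨p, hp, hMp, hns⟩ := exists_bad_prime (M := (D.natAbs:ℤ)) (by omega) hJ'
  have hDp : (D:ZMod p) = 0 := by
    rw [ZMod.intCast_zmod_eq_zero_iff_dvd] at hMp ⊢
    exact Int.dvd_natAbs.1 hMp
  have h30e : ((30*e:ℤ):ZMod p) ≠ 0 := by
    intro h0
    obtain ⟨a, b, hab⟩ := hDc
    have := congrArg (fun z : ℤ => (z:ZMod p)) hab
    push_cast at this h0
    rw [h0, hDp] at this
    simp at this
  push_cast at h30e
  have he0 : (e:ZMod p) ≠ 0 := right_ne_zero_of_mul h30e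
  have h30 := left_ne_zero_of_mul h30e
  have h2p : (2:ZMod p) ≠ 0 := by intro h0; apply h30; linear_combination 15*h0
  have h3p : (3:ZMod p) ≠ 0 := by intro h0; apply h30; linear_combination 10*h0
  have h5p : (5:ZMod p) ≠ 0 := by intro h0; apply h30; linear_combination 6*h0
  have h90 : (90:ZMod p) ≠ 0 := by
    have : (90:ZMod p) = 30*3 := by norm_num
    rw [this]; exact mul_ne_zero h30 h3p
  have hd := EA_red_disc h2p h3p h5p
  obtain ⟨t, Y, hQ, htm, hYn⟩ := zred' hd hN0 he hc he0
  obtain ⟨θ, rfl⟩ : ∃ θ, Y = 90*θ := ⟨Y/90, by field_simp⟩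
  rw [hD] at hDp
  push_cast at hDp
  have ht : t^3 = 54000 := by
    rw [← htm] at hDp
    apply mul_right_cancel₀ (pow_ne_zero 6 he0); linear_combination hDp
  have hθ : θ^2 = 5 := by
    have := hQ.eqn
    push_cast at this
    have h90' : (8100:ZMod p) ≠ 0 := by
      have : (8100:ZMod p) = 90^2 := by norm_num
      rw [this]; exact pow_ne_zero _ h90
    apply mul_left_cancel₀ h90'; linear_combination this + ht
  have h3Q := three_tors h2p h3p h5p hQ ht hθ
  have hg := GdA_red hd hN hw
  have hqQ : q • redHom hd (N1+N1) = τ • redHom hd (N1+N1) := by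
    obtain ⟨s, hs⟩ := hτq
    have : q = τ + s*3 := by linarith
    rw [this, add_zsmul, mul_zsmul, h3Q, zsmul_zero, add_zero]
  rw [add_zsmul, one_zsmul, hkq, map_add, map_zsmul, hqQ] at hg
  have hP' := red60 hd hP
  have hfin : IsSquare (5*(37-16*(τ*θ)) : ZMod p) := by
    rcases hτ with rfl | rfl
    · rw [one_zsmul] at hg
      have := locA h2p h3p h5p hP' hQ ht hθ hg
      simpa using this
    · rw [neg_one_zsmul] at hg
      have := locA h2p h3p h5p hP' (hQ.neg.congr rfl (show _ = 90*(-θ) by ring)) ht (by rw [neg_sq]; exact hθ) hg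
      simpa using this
  apply hns
  have hsq : IsSquare ((90*(e:ZMod p)^3)^2) := ⟨90*(e:ZMod p)^3, by ring⟩
  have := hfin.mul hsq
  push_cast
  rw [← hYn]
  rw [show (5*(37*(90*(e:ZMod p)^3)-16*τ*(90*θ*(e:ZMod p)^3))*(90*(e:ZMod p)^3)) = 5*(37-16*(τ*θ))*(90*(e:ZMod p)^3)^2 by ring]
  exact this

set_option linter.unusedSectionVars false
set_option linter.unusedVariables false

lemma ad_fin {m n Y : ℤ} (hm : m ≠ 0) (hn : n ≠ 0) (hc : IsCoprime m n)
    (h : (m^2+4*n^2)*(m^4-16*m*n^3) = Y^2) : m = -4*n := by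
  obtain ⟨s, k, p, q, hsk, hs, hk, hmk, h1, h2⟩ := ad_red hm hn hc h
  have hk0 : k ≠ 0 := by omega
  have hcop : IsCoprime (2*q) k := by
    apply cop_pr
    intro π hπ d1 d2
    have hπ2 : ¬ π ∣ 2 := by
      intro d
      have h2k : (2:ℤ) ∣ k := by
        have := (Int.prime_two.irreducible.dvd_iff.1 d).resolve_left hπ.not_unit
        exact this.dvd.trans d2
      omega
    have dq := (hπ.dvd_or_dvd d1).resolve_left hπ2
    have ds : π ∣ 4*s^6 := by
      have : 4*s^6 = 5*q^2+k^3 := by linarith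
      rw [this]; exact dvd_add (Dvd.dvd.mul_left (dvd_pow dq two_ne_zero) _) (dvd_pow d2 three_ne_zero)
    rcases hπ.dvd_or_dvd ds with d | d
    · rcases hπ.dvd_or_dvd (show π ∣ 2*2 by norm_num; exact d) with d | d <;> exact hπ2 d
    · exact pr_cop hsk hπ (hπ.dvd_of_dvd_pow d) d2
  obtain ⟨A, B, e1, e2, e3, -⟩ := cube5 (2*s^3) q k hk0 (by linarith) hcop
  have hA : A ≠ 0 := by
    rintro rfl
    have : s^3 = 0 := by linarith
    exact hs (pow_eq_zero_iff three_ne_zero |>.1 this)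
  have hAQ : (A:ℚ) ≠ 0 := by exact_mod_cast hA
  have e1Q : 16*(s:ℚ)^3 = A^3+15*A*B^2 := by
    have : 16*s^3 = A^3+15*A*B^2 := by linarith
    exact_mod_cast this
  have e3Q : (A:ℚ)^2-5*B^2 = 4*k := by exact_mod_cast e3
  have h1Q : 4*(s:ℚ)^4+k^2 = 5*p^2 := by exact_mod_cast h1
  obtain ⟨N, hN⟩ := At.mk EA_disc (x := 60*s/A) (y := 450*B/A) (by
    push_cast; field_simp; linear_combination -13500*e1Q)
  have hx3 : 54000-(60*(s:ℚ)/A)^3 = 162000*k/A^2 := by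
    field_simp; linear_combination -13500*e1Q+40500*A*e3Q
  have hx := C5 (w := 5*162000*p/A^2) hN (by
    rw [hx3]; field_simp; linear_combination 26244000000*h1Q)
  have hsA : (s:ℚ) = A := by field_simp at hx; linarith
  rw [← hsA] at hx3
  have hsQ : (s:ℚ) ≠ 0 := by exact_mod_cast hs
  have hks : (k:ℚ) = -s^2 := by field_simp at hx3; linarith
  have hks' : k = -s^2 := by exact_mod_cast hks
  rw [hks'] at hmk
  apply mul_right_cancel₀ (pow_ne_zero 2 hs); linarith

/-- the six arithmetic non-square statements -/
theorem nonsq6 {r : ℚ} (h0 : r ≠ 0) (h1 : r ≠ 1) (h2 : r ≠ -1) (h3 : r ≠ -4) (h4 : r ≠ 1/2) (hA : ¬ IsSquare (r^2+4)) :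
    ¬ IsSquare (r^4+4*(r-1)^2) ∧ ¬ IsSquare (r^4-16*r) ∧ ¬ IsSquare ((r^2+4)*(r^4+4*(r-1)^2)) ∧
    ¬ IsSquare ((r^2+4)*(r^4-16*r)) ∧ ¬ IsSquare ((r^4+4*(r-1)^2)*(r^4-16*r)) ∧
    ¬ IsSquare ((r^2+4)*(r^4+4*(r-1)^2)*(r^4-16*r)) := by
  obtain ⟨m, n, hn, hc, rfl⟩ : ∃ m n : ℤ, n ≠ 0 ∧ IsCoprime m n ∧ r = m/n := by
    refine ⟨r.num, r.den, by exact_mod_cast r.den_ne_zero, ?_, by simpa using (Rat.num_div_den r).symm⟩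
    rw [Int.isCoprime_iff_gcd_eq_one]; exact r.reduced
  have hnQ : (n:ℚ) ≠ 0 := by exact_mod_cast hn
  have hm : m ≠ 0 := by rintro rfl; simp at h0
  have hmn : m ≠ n := by rintro rfl; exact h1 (div_self hnQ)
  have key : ∀ (f : ℚ) (F : ℤ) (j : ℕ), f*((n:ℚ)^j)^2 = F → IsSquare f → ∃ Y : ℤ, F = Y^2 := by
    rintro f F j hF ⟨w, rfl⟩
    have e : (w*(n:ℚ)^j)^2 = F := by rw [← hF]; ring
    obtain ⟨Y, hY⟩ := rat_sq_int e
    rw [hY] at e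
    exact ⟨Y, by exact_mod_cast e.symm⟩
  refine ⟨fun h => ?_, fun h => ?_, fun h => ?_, fun h => ?_, fun h => ?_, fun h => ?_⟩
  · obtain ⟨Y, hY⟩ := key _ (m^4+4*n^2*(m-n)^2) 2 (by push_cast; field_simp) h
    exact b_not_sq m n Y hm hn hc hmn hY
  · obtain ⟨Y, hY⟩ := key _ (m^4-16*m*n^3) 2 (by push_cast; field_simp) h
    exact d_not_sq m n Y hm hn hc hY
  · obtain ⟨Y, hY⟩ := key _ ((m^2+4*n^2)*(m^4+4*n^2*(m-n)^2)) 3 (by push_cast; field_simp) h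
    obtain ⟨α, β, ha, hb⟩ := ab_red hm hn hc hmn hY
    have haQ : (m:ℚ)^2+4*n^2 = 17*α^2 := by exact_mod_cast ha
    have hbQ : (m:ℚ)^4+4*n^2*(m-n)^2 = 17*β^2 := by exact_mod_cast hb
    exact h4 (C4 (u := α/n) (v := β/n^2) (by field_simp; linear_combination haQ) (by field_simp; linear_combination -hbQ) h2)
  · obtain ⟨Y, hY⟩ := key _ ((m^2+4*n^2)*(m^4-16*m*n^3)) 3 (by push_cast; field_simp) h
    have := ad_fin hm hn hc hY
    rw [this] at h3
    apply h3; push_cast; field_simp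
  · obtain ⟨Y, hY⟩ := key _ ((m^4+4*n^2*(m-n)^2)*(m^4-16*m*n^3)) 4 (by push_cast; field_simp) h
    obtain ⟨α, β, ha, hb⟩ := bd_red hm hn hc hmn hY
    have haQ : (m:ℚ)^4-16*m*n^3 = 17*α^2 := by exact_mod_cast ha
    have hbQ : (m:ℚ)^4+4*n^2*(m-n)^2 = 17*β^2 := by exact_mod_cast hb
    exact h2 (C6 (u := α/n^2) (v := β/n^2) (by field_simp; linear_combination haQ) (by field_simp; linear_combination -hbQ))
  · obtain ⟨Y, hY⟩ := key _ ((m^2+4*n^2)*(m^4+4*n^2*(m-n)^2)*(m^4-16*m*n^3)) 5 (by push_cast; field_simp) h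
    refine abd_red hm hn hc hmn (fun α hα => hA ?_) hY
    have hαQ : (m:ℚ)^2+4*n^2 = α^2 := by exact_mod_cast hα
    exact ⟨α/n, by field_simp; linear_combination hαQ⟩

set_option linter.unusedSectionVars false
set_option linter.unusedVariables false

section cyc
variable {K : Type*} [Field K] [CharZero K]

/-- value of the quartic factor attached to the trace `t` -/
def Bval (c t x : K) : K := x^4-t*x^3+1/2*t^2*x^2-1/2*t*x^2+2*c*x^2+1/2*t^2*x-c*t*x+1/2*t*x+x+1/2*c*t^2+1/2*c*t+c^2+c+1

/-- value of the complementary octic factor -/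
def Aval (c t x : K) : K := x^8+t*x^7+1/2*t^2*x^6+1/2*t*x^6+4*c*x^6+1/2*t^2*x^5+3*c*t*x^5-1/2*t*x^5+3/2*c*t^2*x^4+1/2*c*t*x^4+6*c^2*x^4+2*c*x^4-x^4+c*t^2*x^3+1/2*t^2*x^3+3*c^2*t*x^3-1/2*t*x^3+3/2*c^2*t^2*x^2+1/2*c*t^2*x^2-1/2*c^2*t*x^2-1/2*c*t*x^2-t*x^2+4*c^3*x^2+4*c^2*x^2-2*c*x^2-x^2+1/2*c^2*t^2*x+c*t^2*x-1/2*t^2*x+c^3*t*x+1/2*c^2*t*x-2*c*t*x-1/2*t*x-x+1/2*c^3*t^2+1/2*c^2*t^2-1/2*c*t^2-1/2*c^3*t-3/2*c^2*t-1/2*c*t+c^4+2*c^3-c+1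

/-- a 4-cycle of `x ↦ x²+c` with trace `t` -/
structure Cyc (c t x₁ x₂ x₃ x₄ : K) : Prop where
  h₁ : x₂ = x₁^2+c
  h₂ : x₃ = x₂^2+c
  h₃ : x₄ = x₃^2+c
  h₄ : x₁ = x₄^2+c
  tr : x₁+x₂+x₃+x₄ = t
  uv : (x₁+x₃)*(x₂+x₄) = -1

lemma cyc_of_B {c t x : K} (hc : t^3+(4*c+3)*t+4 = 0) (hB : Bval c t x = 0) :
    ∃ x₂ x₃ x₄, Cyc c t x x₂ x₃ x₄ := by
  unfold Bval at hB
  have e3 : (x^2+c)^2+c = t*x^3-1/2*t^2*x^2+1/2*t*x^2-1/2*t^2*x+c*t*x-1/2*t*x-x-1/2*c*t^2-1/2*c*t-1 := by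
    linear_combination hB
  have e4 : ((x^2+c)^2+c)^2+c = -t*x^3+1/2*t^2*x^2-1/2*t*x^2-x^2+1/2*t^2*x-c*t*x+1/2*t*x+1/2*c*t^2+1/2*c*t+t-c+1 := by
    rw [e3]
    linear_combination (t^2*x^2+t^2*x-1/4*t^4-3/4*t^2-2*t)*hB + (-1/4*t^2*x^3-1/2*t*x^3+1/8*t^3*x^2-1/8*t^2*x^2-1/4*t*x^2+1/2*x^2+1/8*t^3*x-1/4*c*t^2*x+1/8*t^2*x-1/2*c*t*x+1/4*t*x+1/2*x+1/8*c*t^3+1/8*c*t^2+1/4*c*t+1/4*t+1/2*c)*hc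
  refine ⟨x^2+c, (x^2+c)^2+c, ((x^2+c)^2+c)^2+c, rfl, rfl, rfl, ?_, ?_, ?_⟩
  · rw [e4]
    linear_combination -(t^2*x^2+t^2*x+2*t*x-1/4*t^4+1/4*t^2+t+1)*hB - (-1/4*t^2*x^3-1/2*t*x^3+1/8*t^3*x^2-1/8*t^2*x^2-3/4*t*x^2-1/2*x^2+1/8*t^3*x-1/4*c*t^2*x+1/8*t^2*x-1/2*c*t*x-1/4*t*x-1/2*x+1/8*c*t^3+1/8*c*t^2-1/4*c*t+1/4*t-1/2*c)*hc
  · rw [e4, e3]; ring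
  · rw [e4, e3]
    linear_combination (-t^2*x^2-t^2*x+1/4*t^4+3/4*t^2)*hB + (1/4*t^2*x^3+1/2*t*x^3-1/8*t^3*x^2+1/8*t^2*x^2+1/4*t*x^2-1/8*t^3*x+1/4*c*t^2*x-1/8*t^2*x+1/2*c*t*x-1/4*t*x-1/8*c*t^3-1/8*c*t^2-1/4*c*t-1/4*t)*hc

lemma quad_of_A {c t x : K} (hc : t^3+(4*c+3)*t+4 = 0) (hA : Aval c t x = 0) :
    ∃ s : K, s^2+t*s+t^2+4*c+3 = 0 := by
  unfold Aval at hA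
  refine ⟨-t*x^7-1/2*t^2*x^6-1/2*t*x^6-1/2*t^2*x^5-3*c*t*x^5+1/2*t*x^5-3/2*c*t^2*x^4-1/2*c*t*x^4+2*x^4-c*t^2*x^3-1/2*t^2*x^3-3*c^2*t*x^3+1/2*t*x^3-3/2*c^2*t^2*x^2-1/2*c*t^2*x^2+1/2*c^2*t*x^2+1/2*c*t*x^2+t*x^2+4*c*x^2+2*x^2-1/2*c^2*t^2*x-c*t^2*x+1/2*t^2*x-c^3*t*x-1/2*c^2*t*x+2*c*t*x+1/2*t*x+2*x-1/2*c^3*t^2-1/2*c^2*t^2+1/2*c*t^2+1/2*c^3*t+3/2*c^2*t+1/2*c*t+2*c^2+4*c-1, ?_⟩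
  linear_combination (t^2*x^6+t^2*x^5-1/4*t^4*x^4+2*c*t^2*x^4-3/4*t^2*x^4+1/4*t^5*x^3-1/2*t^4*x^3+c*t^3*x^3+3/4*t^3*x^3-1/2*t^2*x^3-4*t*x^3-1/8*t^6*x^2+5/8*t^5*x^2-c*t^4*x^2-5/8*t^4*x^2+5/2*c*t^3*x^2+15/8*t^3*x^2+c^2*t^2*x^2-3/2*c*t^2*x^2+9/4*t^2*x^2-2*t*x^2-3/8*t^6*x+1/4*c*t^5*x+3/8*t^5*x-2*c*t^4*x-13/8*t^4*x+c^2*t^3*x+9/4*c*t^3*x+1/8*t^3*x-c^2*t^2*x-3/2*c*t^2*x+1/2*t^2*x-4*c*t*x-2*t*x+1/16*t^8+3/8*c*t^6-1/8*c*t^5+3/8*t^5+1/4*c^2*t^4-3/8*c*t^4-29/16*t^4-1/2*c^2*t^3+9/8*c*t^3-3/8*t^3+1/4*c^2*t^2-5*c*t^2-9/4*t^2+2*c*t-6*t+4)*hA + (-1/16*t^6*x^7+1/4*t^5*x^7-1/4*c*t^4*x^7-3/16*t^4*x^7+c*t^3*x^7+1/2*t^3*x^7-c*t^2*x^7+t^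2*x^7-t*x^7-1/32*t^7*x^6-1/32*t^6*x^6-1/8*c*t^5*x^6+9/32*t^5*x^6-1/8*c*t^4*x^6-15/32*t^4*x^6+c*t^3*x^6+5/4*t^3*x^6-3/2*c*t^2*x^6+1/4*t^2*x^6+c*t*x^6-3/4*t*x^6+2*x^6-1/32*t^7*x^5-3/16*c*t^6*x^5+1/32*t^6*x^5+5/8*c*t^5*x^5+5/32*t^5*x^5-3/4*c^2*t^4*x^5-7/16*c*t^4*x^5-17/32*t^4*x^5+3*c^2*t^3*x^5+2*c*t^3*x^5+7/8*t^3*x^5-3*c^2*t^2*x^5+3/2*c*t^2*x^5-t^2*x^5-2*c*t*x^5-7/4*t*x^5+2*x^5-3/32*c*t^7*x^4-1/32*c*t^6*x^4-3/8*c^2*t^5*x^4+19/32*c*t^5*x^4+1/4*t^5*x^4-1/8*c^2*t^4*x^4-39/32*c*t^4*x^4-3/8*t^4*x^4+2*c^2*t^3*x^4+17/4*c*t^3*x^4+5/8*t^3*x^4-7/2*c^2*t^2*x^4-5/4*c*t^2*x^4+3*c^2*t*x^4-1/4*c*t*x^4-7/4*t*x^4+6*c*x^4+x^4-1/16*c*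t^7*x^3-1/32*t^7*x^3-3/16*c^2*t^6*x^3+1/32*t^6*x^3+1/2*c^2*t^5*x^3+7/16*c*t^5*x^3+1/32*t^5*x^3-3/4*c^3*t^4*x^3-9/16*c^2*t^4*x^3-9/8*c*t^4*x^3-9/32*t^4*x^3+3*c^3*t^3*x^3+7/2*c^2*t^3*x^3+9/4*c*t^3*x^3+3/4*t^3*x^3-3*c^3*t^2*x^3-c^2*t^2*x^3-3/2*c*t^2*x^3-1/4*t^2*x^3-c^2*t*x^3-7/2*c*t*x^3+1/4*t*x^3+4*c*x^3+2*x^3-3/32*c^2*t^7*x^2-1/32*c*t^7*x^2+1/32*c^2*t^6*x^2+1/32*c*t^6*x^2+1/16*t^6*x^2-3/8*c^3*t^5*x^2+7/32*c^2*t^5*x^2+17/32*c*t^5*x^2-1/8*t^5*x^2+1/8*c^3*t^4*x^2-29/32*c^2*t^4*x^2-25/32*c*t^4*x^2-3/16*t^4*x^2+c^3*t^3*x^2+19/4*c^2*t^3*x^2+3/2*c*t^3*x^2-3/8*t^3*x^2-5/2*c^3*t^2*x^2-15/4*c^2*t^2*x^2-5/4*c*t^2*x^2-11/8*t^2*x^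2+3*c^3*t*x^2+11/4*c^2*t*x^2-9/4*c*t*x^2-3/4*t*x^2+6*c^2*x^2+4*c*x^2+x^2-1/32*c^2*t^7*x-1/16*c*t^7*x+1/32*t^7*x-1/16*c^3*t^6*x-1/32*c^2*t^6*x+1/8*c*t^6*x+1/32*t^6*x+1/8*c^3*t^5*x+5/32*c^2*t^5*x+1/16*c*t^5*x-1/32*t^5*x-1/4*c^4*t^4*x-5/16*c^3*t^4*x-7/32*c^2*t^4*x-1/2*c*t^4*x-1/32*t^4*x+c^4*t^3*x+2*c^3*t^3*x+7/8*c^2*t^3*x+9/8*c*t^3*x-3/8*t^3*x-c^4*t^2*x-3/2*c^3*t^2*x-c^2*t^2*x-9/4*c*t^2*x-7/8*t^2*x-3/4*c^2*t*x+1/2*c*t*x-1/4*t*x+2*c^2*x+4*c*x-1/32*c^3*t^7-1/32*c^2*t^7+1/32*c*t^7+1/32*c^3*t^6+3/32*c^2*t^6+1/32*c*t^6-1/8*c^4*t^5-3/32*c^3*t^5+5/32*c^2*t^5-1/32*c*t^5-1/16*t^5+1/8*c^4*t^4+3/32*c^3*t^4-11/32*c^2*t^4-1/32*c*t^4+3/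4*c^3*t^3+7/8*c^2*t^3-7/8*c*t^3+3/16*t^3-1/2*c^4*t^2-5/4*c^3*t^2-7/4*c^2*t^2-3/8*c*t^2-1/8*t^2+c^4*t+9/4*c^3*t+1/2*c^2*t-3/4*c*t+5/4*t+2*c^3+3*c^2)*hc

lemma Phi_fac {c t : K} (hc : t^3+(4*c+3)*t+4 = 0) (x : K) : (Phi4 c).eval x = Aval c t x * Bval c t x := by
  unfold Phi4 Aval Bval
  simp only [Polynomial.eval_add, Polynomial.eval_mul, Polynomial.eval_pow, Polynomial.eval_X, Polynomial.eval_C]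
  linear_combination (-1/4*t*x^8-1/2*t*x^7-c*t*x^6-1/4*t*x^6+1/2*x^6-3/2*c*t*x^5-1/4*t*x^5+1/2*x^5-3/2*c^2*t*x^4-3/4*c*t*x^4-1/4*t*x^4+3/2*c*x^4-3/2*c^2*t*x^3-c*t*x^3+1/4*t*x^3+c*x^3+1/2*x^3-c^3*t*x^2-3/4*c^2*t*x^2-1/4*c*t*x^2+1/4*t*x^2+3/2*c^2*x^2+1/2*c*x^2+1/2*x^2-1/2*c^3*t*x-3/4*c^2*t*x+1/2*c*t*x+1/2*c^2*x+c*x-1/4*c^4*t-1/4*c^3*t+1/4*c^2*t+1/2*c^3+1/2*c^2)*hc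

lemma Cyc.rot {c t x₁ x₂ x₃ x₄ : K} (h : Cyc c t x₁ x₂ x₃ x₄) : Cyc c t x₂ x₃ x₄ x₁ :=
  ⟨h.h₂, h.h₃, h.h₄, h.h₁, by rw [← h.tr]; ring, by rw [← h.uv]; ring⟩

lemma Cyc.ne2 {c : ℚ} {t x₁ x₂ x₃ x₄ : K} (h : Cyc (c:K) t x₁ x₂ x₃ x₄) (hc : c ≠ -5/4) : x₁ ≠ x₃ := by
  rintro rfl
  have h24 : x₂ = x₄ := by rw [h.h₁, h.h₃]
  subst h24
  have h1 := h.h₁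
  have h2 := h.h₂
  have huv := h.uv
  have h0 : (x₁-x₂)*(x₁+x₂+1) = 0 := by linear_combination h2-h1
  rcases mul_eq_zero.1 h0 with h0 | h0
  · have hx : x₁ = x₂ := by linear_combination h0
    subst hx
    have hx : x₁ = ((c-1/4:ℚ):K) := by push_cast; linear_combination h1+1/4*huv
    have hq : (((c-1/4)^2*4:ℚ):K) = ((-1:ℚ):K) := by
      push_cast; push_cast at hx; rw [← hx]; linear_combination huv
    have hq' : (c-1/4)^2*4 = -1 := by exact_mod_cast hq
    nlinarith [sq_nonneg (c-1/4)]
  · apply hc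
    have : (c:K) = ((-5/4:ℚ):K) := by
      push_cast
      have e : x₂ = -x₁-1 := by linear_combination h0
      rw [e] at h1 huv
      linear_combination -h1+1/4*huv
    exact_mod_cast this

lemma Cyc.ne1 {c : ℚ} {t x₁ x₂ x₃ x₄ : K} (h : Cyc (c:K) t x₁ x₂ x₃ x₄) (hc : c ≠ -5/4) : x₁ ≠ x₂ := by
  intro e
  apply h.ne2 hc
  rw [h.h₂, ← e, ← h.h₁, e]

lemma Cyc.disc {c t x₁ x₂ x₃ x₄ : K} (h : Cyc c t x₁ x₂ x₃ x₄) : (x₁+x₃-x₂-x₄)^2 = t^2+4 := by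
  linear_combination (x₁+x₂+x₃+x₄+t)*h.tr-4*h.uv

/-- trace is determined by any point of the cycle -/
lemma Cyc.tr_eq {c t s x₁ x₂ x₃ x₄ y₂ y₃ y₄ : K} (h : Cyc c t x₁ x₂ x₃ x₄) (h' : Cyc c s x₁ y₂ y₃ y₄) : t = s := by
  rw [← h.tr, ← h'.tr, h.h₃, h'.h₃, h.h₂, h'.h₂, h.h₁, h'.h₁]

end cyc

set_option linter.unusedSectionVars false
set_option linter.unusedVariables false

abbrev S12 := Equiv.Perm (Fin 12)

def gA : S12 := ([0, 9, 3, 8, 2, 11, 1, 10] : List (Fin 12)).formPerm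
def gB : S12 := ([0, 8, 2, 10] : List (Fin 12)).formPerm * ([1, 9, 3, 11] : List (Fin 12)).formPerm
def gC : S12 := ([0, 10, 3, 9, 2, 8, 1, 11] : List (Fin 12)).formPerm * ([4, 7, 6, 5] : List (Fin 12)).formPerm

/-- the cycle map on indices -/
def nx : Fin 12 → Fin 12 := ![1,2,3,0,5,6,7,4,9,10,11,8]
/-- block number -/
def bl : Fin 12 → Fin 3 := ![0,0,0,0,1,1,1,1,2,2,2,2]

lemma Hgroup_eq : Hgroup = Subgroup.closure {gA, gB, gC} := rfl

lemma gA_mem : gA ∈ Hgroup := Subgroup.subset_closure (by simp [gA])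
lemma gB_mem : gB ∈ Hgroup := Subgroup.subset_closure (by simp [gB])
lemma gC_mem : gC ∈ Hgroup := Subgroup.subset_closure (by simp [gC])

/-- rotations of the three blocks and the swap of blocks 0 and 2 -/
def r0 : S12 := ⟨![1,2,3,0,4,5,6,7,8,9,10,11], ![3,0,1,2,4,5,6,7,8,9,10,11], by decide, by decide⟩
def r1 : S12 := ⟨![0,1,2,3,5,6,7,4,8,9,10,11], ![0,1,2,3,7,4,5,6,8,9,10,11], by decide, by decide⟩
def r2 : S12 := ⟨![0,1,2,3,4,5,6,7,9,10,11,8], ![0,1,2,3,4,5,6,7,11,8,9,10], by decide, by decide⟩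
def sw : S12 := ⟨![8,9,10,11,4,5,6,7,0,1,2,3], ![8,9,10,11,4,5,6,7,0,1,2,3], by decide, by decide⟩

def word (i j k : Fin 4) (b : Fin 2) : S12 := r0^(i:ℕ) * r1^(j:ℕ) * r2^(k:ℕ) * sw^(b:ℕ)

lemma gA_val : ⇑gA = ![9,10,11,8,4,5,6,7,2,3,0,1] := by decide +kernel
lemma gB_val : ⇑gB = ![8,9,10,11,4,5,6,7,2,3,0,1] := by decide +kernel
lemma gC_val : ⇑gC = ![10,11,8,9,7,4,5,6,1,2,3,0] := by decide +kernel

lemma r0_eq : r0 = gB * gA * gB * gB := by ext i; revert i; decide +kernel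
lemma r1_eq : r1 = gA * gC * gB * gC * gB * gC := by ext i; revert i; decide +kernel
lemma r2_eq : r2 = gA * gB * gB * gB := by ext i; revert i; decide +kernel
lemma sw_eq : sw = gA * gB * gA := by ext i; revert i; decide +kernel

lemma word_mem (i j k : Fin 4) (b : Fin 2) : word i j k b ∈ Hgroup := by
  have a := gA_mem
  have b' := gB_mem
  have c := gC_mem
  have h0 : r0 ∈ Hgroup := by rw [r0_eq]; exact mul_mem (mul_mem (mul_mem b' a) b') b'
  have h1 : r1 ∈ Hgroup := by
    rw [r1_eq]; exact mul_mem (mul_mem (mul_mem (mul_mem (mul_mem a c) b') c) b') c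
  have h2 : r2 ∈ Hgroup := by rw [r2_eq]; exact mul_mem (mul_mem (mul_mem a b') b') b'
  have h3 : sw ∈ Hgroup := by rw [sw_eq]; exact mul_mem (mul_mem a b') a
  exact mul_mem (mul_mem (mul_mem (pow_mem h0 _) (pow_mem h1 _)) (pow_mem h2 _)) (pow_mem h3 _)

lemma word_find : ∀ p q s : Fin 12, bl p = 1 → bl q ≠ 1 → bl s ≠ 1 → bl q ≠ bl s →
    ∃ (i j k : Fin 4) (b : Fin 2), word i j k b p = 4 ∧ word i j k b q = 0 ∧ word i j k b s = 8 := by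
  decide +kernel

lemma word_comm : ∀ (i j k : Fin 4) (b : Fin 2) (x : Fin 12), word i j k b (nx x) = nx (word i j k b x) := by
  decide +kernel

lemma word_pow : ∀ (i j k : Fin 4) (b : Fin 2) (x : Fin 12), (word i j k b ^ 8) x = x := by
  decide +kernel

lemma bl_eq_iff : ∀ x y : Fin 12, bl x = bl y → x = y ∨ x = nx y ∨ x = nx (nx y) ∨ x = nx (nx (nx y)) := by decide +kernel
lemma bl_nx : ∀ x : Fin 12, bl (nx x) = bl x := by decide +kernel

lemma fin12_cases : ∀ x : Fin 12, x = 4 ∨ x = nx 4 ∨ x = nx (nx 4) ∨ x = nx (nx (nx 4)) ∨ x = 0 ∨ x = nx 0 ∨ x = nx (nx 0) ∨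
    x = nx (nx (nx 0)) ∨ x = 8 ∨ x = nx 8 ∨ x = nx (nx 8) ∨ x = nx (nx (nx 8)) := by decide +kernel

lemma fix_eq_one {w : S12} (hn : ∀ x, w (nx x) = nx (w x)) (f1 : w 4 = 4) (f2 : w 0 = 0) (f3 : w 8 = 8) :
    w = 1 := by
  have step : ∀ x, w x = x → w (nx x) = nx x := fun x hx => by rw [hn, hx]
  apply Equiv.ext
  intro x
  rw [Equiv.Perm.one_apply]
  rcases fin12_cases x with h | h | h | h | h | h | h | h | h | h | h | h <;> rw [h]
  · exact f1
  · exact step _ f1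
  · exact step _ (step _ f1)
  · exact step _ (step _ (step _ f1))
  · exact f2
  · exact step _ f2
  · exact step _ (step _ f2)
  · exact step _ (step _ (step _ f2))
  · exact f3
  · exact step _ f3
  · exact step _ (step _ f3)
  · exact step _ (step _ (step _ f3))

lemma bl_sep {σ : S12} (h1 : ∀ x, σ (nx x) = nx (σ x)) (x y : Fin 12) (hxy : bl x ≠ bl y) :
    bl (σ x) ≠ bl (σ y) := by
  intro h
  apply hxy
  rcases bl_eq_iff _ _ h with h | h | h | h
  · rw [σ.injective h]
  · rw [← h1] at h; rw [σ.injective h, bl_nx]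
  · rw [← h1, ← h1] at h; rw [σ.injective h, bl_nx, bl_nx]
  · rw [← h1, ← h1, ← h1] at h; rw [σ.injective h, bl_nx, bl_nx, bl_nx]

lemma bl40 : bl 0 ≠ bl 4 := by decide
lemma bl48 : bl 8 ≠ bl 4 := by decide
lemma bl08 : bl 0 ≠ bl 8 := by decide

lemma mul_eq_one_of {v σ : S12} (hv : ∀ x, v (nx x) = nx (v x)) (h1 : ∀ x, σ (nx x) = nx (σ x))
    (e1 : v (σ 4) = 4) (e2 : v (σ 0) = 0) (e3 : v (σ 8) = 8) : v * σ = 1 := by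
  apply fix_eq_one
  · intro x
    rw [Equiv.Perm.mul_apply, Equiv.Perm.mul_apply, h1, hv]
  · rw [Equiv.Perm.mul_apply, e1]
  · rw [Equiv.Perm.mul_apply, e2]
  · rw [Equiv.Perm.mul_apply, e3]

/-- structure of the permutations commuting with `nx` and preserving the middle block -/
lemma word_of {σ : S12} (h1 : ∀ x, σ (nx x) = nx (σ x)) (h2 : bl (σ 4) = 1) :
    ∃ (i j k : Fin 4) (b : Fin 2), word i j k b * σ = 1 := by
  have n0 : bl (σ 0) ≠ 1 := fun h => bl_sep h1 _ _ bl40 (h.trans h2.symm)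
  have n8 : bl (σ 8) ≠ 1 := fun h => bl_sep h1 _ _ bl48 (h.trans h2.symm)
  obtain ⟨i, j, k, b, e⟩ := word_find (σ 4) (σ 0) (σ 8) h2 n0 n8 (bl_sep h1 _ _ bl08)
  have hv := word_comm i j k b
  refine ⟨i, j, k, b, ?_⟩
  generalize word i j k b = v at e hv
  exact mul_eq_one_of hv h1 e.1 e.2.1 e.2.2

lemma mem_H {σ : S12} (h1 : ∀ x, σ (nx x) = nx (σ x)) (h2 : bl (σ 4) = 1) : σ ∈ Hgroup := by
  obtain ⟨i, j, k, b, h⟩ := word_of h1 h2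
  have : σ = (word i j k b)⁻¹ := (inv_eq_of_mul_eq_one_right h).symm
  rw [this]; exact inv_mem (word_mem i j k b)

lemma H_prop {σ : S12} (h : σ ∈ Hgroup) : (∀ x, σ (nx x) = nx (σ x)) ∧ (∀ x, bl x = 1 → bl (σ x) = 1) ∧ (∀ x, bl (σ x) = 1 → bl x = 1) := by
  rw [Hgroup_eq] at h
  induction h using Subgroup.closure_induction with
  | mem x hx =>
    rcases hx with rfl | rfl | rfl <;> decide +kernel
  | one => simp
  | mul x y _ _ hx hy =>
    refine ⟨fun z => ?_, fun z hz => hx.2.1 _ (hy.2.1 _ hz), fun z hz => hy.2.2 _ (hx.2.2 _ hz)⟩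
    rw [Equiv.Perm.mul_apply, hy.1, hx.1]; rfl
  | inv x _ hx =>
    refine ⟨fun z => ?_, fun z hz => ?_, fun z hz => ?_⟩
    · apply x.injective; rw [hx.1]; simp
    · apply hx.2.2; simpa using hz
    · have := hx.2.1 _ hz; simpa using this

lemma H_pgroup : IsPGroup 2 Hgroup := by
  rintro ⟨σ, hσ⟩
  refine ⟨3, ?_⟩
  apply Subtype.ext
  obtain ⟨h1, h2, -⟩ := H_prop hσ
  obtain ⟨i, j, k, b, h⟩ := word_of h1 (h2 4 (by decide))
  have : σ = (word i j k b)⁻¹ := (inv_eq_of_mul_eq_one_right h).symm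
  have hp : word i j k b ^ 8 = 1 := Equiv.ext (word_pow i j k b)
  show σ^(2^3) = 1
  rw [this, show 2^3 = 8 by norm_num, inv_pow, hp, inv_one]

section conf
open Polynomial
variable {K : Type*} [Field K] [CharZero K]

noncomputable def polyB (c t : K) : K[X] :=
  X ^ 4 +
    C (-t) * X ^ 3 +
    C (1/2*t^2 - 1/2*t + 2*c) * X ^ 2 +
    C (1/2*t^2 - c*t + 1/2*t + 1) * X +
    C (1/2*c*t^2 + 1/2*c*t + c^2 + c + 1)

noncomputable def polyA (c t : K) : K[X] :=
  X ^ 8 +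
    C (t) * X ^ 7 +
    C (1/2*t^2 + 1/2*t + 4*c) * X ^ 6 +
    C (1/2*t^2 + 3*c*t - 1/2*t) * X ^ 5 +
    C (3/2*c*t^2 + 1/2*c*t + 6*c^2 + 2*c - 1) * X ^ 4 +
    C (c*t^2 + 1/2*t^2 + 3*c^2*t - 1/2*t) * X ^ 3 +
    C (3/2*c^2*t^2 + 1/2*c*t^2 - 1/2*c^2*t - 1/2*c*t - t + 4*c^3 + 4*c^2 - 2*c - 1) * X ^ 2 +
    C (1/2*c^2*t^2 + c*t^2 - 1/2*t^2 + c^3*t + 1/2*c^2*t - 2*c*t - 1/2*t - 1) * X +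
    C (1/2*c^3*t^2 + 1/2*c^2*t^2 - 1/2*c*t^2 - 1/2*c^3*t - 3/2*c^2*t - 1/2*c*t + c^4 + 2*c^3 - c + 1)

lemma polyB_eval (c t x : K) : (polyB c t).eval x = Bval c t x := by
  unfold polyB Bval
  simp only [eval_add, eval_mul, eval_pow, eval_X, eval_C]
  ring

lemma polyA_eval (c t x : K) : (polyA c t).eval x = Aval c t x := by
  unfold polyA Aval
  simp only [eval_add, eval_mul, eval_pow, eval_X, eval_C]
  ring

lemma polyB_deg (c t : K) : (polyB c t).natDegree = 4 := by
  unfold polyB; compute_degree!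

lemma polyA_deg (c t : K) : (polyA c t).natDegree = 8 := by
  unfold polyA; compute_degree!

lemma polyB_monic (c t : K) : (polyB c t).Monic := by
  unfold polyB; monicity!

lemma polyA_monic (c t : K) : (polyA c t).Monic := by
  unfold polyA; monicity!

lemma Phi4_deg (c : K) : (Phi4 c).natDegree = 12 := by
  unfold Phi4; compute_degree!

lemma Phi4_monic (c : K) : (Phi4 c).Monic := by
  unfold Phi4; monicity!

lemma Phi4_fac {c t : K} (hc : t^3+(4*c+3)*t+4 = 0) : Phi4 c = polyA c t * polyB c t := by
  apply Polynomial.funext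
  intro x
  rw [eval_mul, polyA_eval, polyB_eval, Phi_fac hc]

lemma Phi4_map [Algebra ℚ K] (c : ℚ) : (Phi4 c).map (algebraMap ℚ K) = Phi4 (c : K) := by
  unfold Phi4
  simp

lemma B_of_cyc {c t x₁ x₂ x₃ x₄ : K} (hc : t^3+(4*c+3)*t+4 = 0) (h : Cyc c t x₁ x₂ x₃ x₄) :
    Bval c t x₁ = 0 := by
  obtain ⟨u, hu⟩ : ∃ u, u = x₁+x₃ := ⟨_, rfl⟩
  obtain ⟨v, hv⟩ : ∃ v, v = x₂+x₄ := ⟨_, rfl⟩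
  have hp : x₁*x₃ = (u^2+2*c-v)/2 := by
    rw [hu, hv]; linear_combination (h.h₁+h.h₃)/2
  have hq : x₂*x₄ = (v^2+2*c-u)/2 := by
    rw [hu, hv]; linear_combination (h.h₂+h.h₄)/2
  have huv : u*v = -1 := by rw [hu, hv]; exact h.uv
  have ht : u+v = t := by rw [hu, hv, ← h.tr]; ring
  have e : (x₁^2-u*x₁+(u^2+2*c-v)/2)*(x₁^2-v*x₁+(v^2+2*c-u)/2) = 0 := by
    rw [← hp, hu]; ring
  clear hp hq hu hv h
  subst ht
  have e1 : u*((v^2+2*c-u)/2)+v*((u^2+2*c-v)/2) = (-(u+v)+2*c*(u+v)-(u+v)^2-2)/2 := by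
    linear_combination (u+v+2)/2*huv
  have e0 : (u^2+2*c-v)/2*((v^2+2*c-u)/2) = 1/2*c*(u+v)^2+1/2*c*(u+v)+c^2+c+1 := by
    linear_combination (u*v-4*c+3*(u+v))/4*huv-1/4*hc
  unfold Bval
  linear_combination e + x₁*e1 - e0

/-- a full configuration of the three 4-cycles -/
structure Conf (c r : ℚ) (y : Fin 12 → K) (t2 t3 : K) : Prop where
  hr0 : r ≠ 0
  hc : r^3+(4*c+3)*r = 4
  hc5 : c ≠ -5/4
  c0 : Cyc (c:K) t2 (y 0) (y 1) (y 2) (y 3)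
  c1 : Cyc (c:K) (-(r:K)) (y 4) (y 5) (y 6) (y 7)
  c2 : Cyc (c:K) t3 (y 8) (y 9) (y 10) (y 11)
  s : t2 + t3 = r
  p : t2 * t3 = (r:K)^2+4*c+3
  n23 : t2 ≠ t3
  n12 : t2 ≠ -(r:K)
  n13 : t3 ≠ -(r:K)

/-- the trace attached to a block -/
def tt (r : ℚ) (t2 t3 : K) : Fin 3 → K := ![t2, -(r:K), t3]

namespace Conf
variable {c r : ℚ} {y : Fin 12 → K} {t2 t3 : K}

lemma cyc_at (h : Conf c r y t2 t3) (j : Fin 12) :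
    Cyc (c:K) (tt r t2 t3 (bl j)) (y j) (y (nx j)) (y (nx (nx j))) (y (nx (nx (nx j)))) := by
  have := h.c0
  have a1 := this.rot
  have a2 := a1.rot
  have a3 := a2.rot
  have := h.c1
  have b1 := this.rot
  have b2 := b1.rot
  have b3 := b2.rot
  have := h.c2
  have c1 := this.rot
  have c2 := c1.rot
  have c3 := c2.rot
  fin_cases j
  exacts [h.c0, a1, a2, a3, h.c1, b1, b2, b3, h.c2, c1, c2, c3]

lemma nx_eq (h : Conf c r y t2 t3) (j : Fin 12) : y (nx j) = y j^2+c := (h.cyc_at j).h₁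

lemma tt_inj (h : Conf c r y t2 t3) : Function.Injective (tt r t2 t3) := by
  have a := h.n23
  have b := h.n12
  have c := h.n13
  intro i j hij
  fin_cases i <;> fin_cases j <;> simp_all [tt]

lemma bl_of (h : Conf c r y t2 t3) {i j : Fin 12} (e : y i = y j) : bl i = bl j := by
  have h1 := h.cyc_at i
  have h2 := h.cyc_at j
  rw [e] at h1
  exact h.tt_inj (h1.tr_eq h2)

lemma inj (h : Conf c r y t2 t3) : Function.Injective y := by
  intro i j e
  have hj := h.cyc_at j
  rcases bl_eq_iff _ _ (h.bl_of e) with k | k | k | k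
  · exact k
  · rw [k] at e; exact absurd e.symm (hj.ne1 h.hc5)
  · rw [k] at e; exact absurd e.symm (hj.ne2 h.hc5)
  · rw [k] at e; exact absurd e (hj.rot.rot.rot.ne1 h.hc5)

lemma hcK (h : Conf c r y t2 t3) : (r:K)^3+(4*c+3)*r = 4 := by
  have := h.hc
  exact_mod_cast congrArg (Rat.cast : ℚ → K) this

lemma cub (h : Conf c r y t2 t3) (k : Fin 3) :
    (tt r t2 t3 k)^3+(4*(c:K)+3)*(tt r t2 t3 k)+4 = 0 := by
  have e := h.hcK
  have e3 : t3 = r - t2 := by rw [← h.s]; ring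
  have hp := h.p
  subst e3
  fin_cases k
  · show t2^3+(4*(c:K)+3)*t2+4 = 0
    linear_combination -(t2+r)*hp-e
  · show (-(r:K))^3+(4*(c:K)+3)*(-(r:K))+4 = 0
    linear_combination -e
  · show (r-t2)^3+(4*(c:K)+3)*(r-t2)+4 = 0
    linear_combination -(r-t2+r)*hp-e

lemma root (h : Conf c r y t2 t3) (i : Fin 12) : (Phi4 (c:K)).eval (y i) = 0 := by
  rw [Phi_fac (h.cub (bl i)), B_of_cyc (h.cub (bl i)) (h.cyc_at i), mul_zero]

lemma all (h : Conf c r y t2 t3) {x : K} (hx : (Phi4 (c:K)).eval x = 0) : ∃ i, y i = x := by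
  classical
  have hne : Phi4 (c:K) ≠ 0 := (Phi4_monic _).ne_zero
  have hsub : Finset.univ.image y ⊆ (Phi4 (c:K)).roots.toFinset := by
    intro z hz
    obtain ⟨i, -, rfl⟩ := Finset.mem_image.1 hz
    rw [Multiset.mem_toFinset, mem_roots hne]
    exact h.root i
  have hcard : (Phi4 (c:K)).roots.toFinset.card ≤ (Finset.univ.image y).card := by
    rw [Finset.card_image_of_injective _ h.inj, Finset.card_univ, Fintype.card_fin, ← Phi4_deg (c:K)]
    exact (Multiset.toFinset_card_le _).trans (card_roots' _)
  have := Finset.eq_of_subset_of_card_le hsub hcard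
  have hm : x ∈ (Phi4 (c:K)).roots.toFinset := by
    rw [Multiset.mem_toFinset, mem_roots hne]; exact hx
  rw [← this] at hm
  obtain ⟨i, -, hi⟩ := Finset.mem_image.1 hm
  exact ⟨i, hi⟩

end Conf

lemma no_cube {r : ℚ} : r^3 ≠ -2 := by
  intro h
  have h0 : r ≠ 0 := by rintro rfl; norm_num at h
  have := congrArg (padicValRat 2) h
  rw [padicValRat.pow, padicValRat.neg] at this
  have e : padicValRat 2 (2:ℚ) = 1 := by
    have := padicValRat.self (p := 2) (by norm_num)
    exact_mod_cast this
  rw [e] at this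
  push_cast at this
  omega

lemma exists_conf {c r : ℚ} (hr0 : r ≠ 0) (hc : r^3+(4*c+3)*r = 4) (hc5 : c ≠ -5/4)
    (hd : ¬ IsSquare (r^4-16*r))
    (hs : (Phi4 (c:K)).Splits) : ∃ (y : Fin 12 → K) (t2 t3 : K), Conf c r y t2 t3 := by
  have hcK : (r:K)^3+(4*c+3)*r = 4 := by
    exact_mod_cast congrArg (Rat.cast : ℚ → K) hc
  have hr0K : (r:K) ≠ 0 := by exact_mod_cast hr0
  have hne : Phi4 (c:K) ≠ 0 := (Phi4_monic _).ne_zero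
  have hcyc : ∀ t : K, t^3+(4*(c:K)+3)*t+4 = 0 → ∃ x₁ x₂ x₃ x₄, Cyc (c:K) t x₁ x₂ x₃ x₄ := by
    intro t ht
    have hsB : (polyB (c:K) t).Splits := hs.of_dvd hne (by rw [Phi4_fac ht]; exact dvd_mul_left _ _)
    obtain ⟨x, hx⟩ := hsB.exists_eval_eq_zero (by
      rw [degree_eq_natDegree (polyB_monic _ _).ne_zero, polyB_deg]; norm_num)
    rw [polyB_eval] at hx
    exact ⟨x, cyc_of_B ht hx⟩
  have h1 : (-(r:K))^3+(4*(c:K)+3)*(-(r:K))+4 = 0 := by linear_combination -hcK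
  have hsA : (polyA (c:K) (-(r:K))).Splits := hs.of_dvd hne (by rw [Phi4_fac h1]; exact dvd_mul_right _ _)
  obtain ⟨x, hx⟩ := hsA.exists_eval_eq_zero (by
      rw [degree_eq_natDegree (polyA_monic _ _).ne_zero, polyA_deg]; norm_num)
  rw [polyA_eval] at hx
  obtain ⟨t2, ht2⟩ := quad_of_A h1 hx
  have q2 : t2^3+(4*(c:K)+3)*t2+4 = 0 := by linear_combination (t2+r)*ht2-hcK
  have q3 : (r-t2)^3+(4*(c:K)+3)*(r-t2)+4 = 0 := by linear_combination (r-t2+r)*ht2-hcK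
  obtain ⟨a0, a1, a2, a3, ha⟩ := hcyc _ q2
  obtain ⟨b0, b1, b2, b3, hb⟩ := hcyc _ h1
  obtain ⟨d0, d1, d2, d3, hd'⟩ := hcyc _ q3
  have d0' : r^4-16*r ≠ 0 := by
    intro h; apply hd; rw [h]; exact ⟨0, by ring⟩
  have cube : r^3 + 2 ≠ 0 := fun h => no_cube (r := r) (by linarith)
  have cubeK : (r:K)^3+2 ≠ 0 := by exact_mod_cast cube
  refine ⟨![a0, a1, a2, a3, b0, b1, b2, b3, d0, d1, d2, d3], t2, r-t2, hr0, hc, hc5, ha, hb, hd', by ring, ?_, ?_, ?_, ?_⟩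
  · linear_combination -ht2
  · intro e
    have e' : (r:K) = 2*t2 := by linear_combination -e
    apply d0'
    have : (r:K)^4-16*r = 0 := by
      linear_combination (-4*r^2)*ht2+4*r*hcK+r^2*(2*t2-r)*e
    exact_mod_cast this
  · intro e
    apply cubeK
    rw [e] at ht2
    linear_combination r/2*ht2-1/2*hcK
  · intro e
    have e' : t2 = 2*r := by linear_combination -e
    apply cubeK
    rw [e'] at ht2
    linear_combination r/2*ht2-1/2*hcK

end conf

section gal
open Polynomial

/-! ### sign characters -/

section sgn
variable {L : Type*} [Field L]

def fa (z : Fin 12 → L) : L := z 4 + z 6 - z 5 - z 7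
def fb (z : Fin 12 → L) : L := (z 0 + z 2 - z 1 - z 3) * (z 8 + z 10 - z 9 - z 11)
def fg (z : Fin 12 → L) : L := z 0 + z 1 + z 2 + z 3 - (z 8 + z 9 + z 10 + z 11)

lemma fa_A (z : Fin 12 → L) : fa (z ∘ gA) = fa z := by
  rw [gA_val]; show z 4 + z 6 - z 5 - z 7 = _; unfold fa; ring
lemma fa_B (z : Fin 12 → L) : fa (z ∘ gB) = fa z := by
  rw [gB_val]; show z 4 + z 6 - z 5 - z 7 = _; unfold fa; ring
lemma fa_C (z : Fin 12 → L) : fa (z ∘ gC) = -fa z := by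
  rw [gC_val]; show z 7 + z 5 - z 4 - z 6 = _; unfold fa; ring
lemma fb_A (z : Fin 12 → L) : fb (z ∘ gA) = -fb z := by
  rw [gA_val]; show (z 9 + z 11 - z 10 - z 8) * (z 2 + z 0 - z 3 - z 1) = _; unfold fb; ring
lemma fb_B (z : Fin 12 → L) : fb (z ∘ gB) = fb z := by
  rw [gB_val]; show (z 8 + z 10 - z 9 - z 11) * (z 2 + z 0 - z 3 - z 1) = _; unfold fb; ring
lemma fb_C (z : Fin 12 → L) : fb (z ∘ gC) = -fb z := by
  rw [gC_val]; show (z 10 + z 8 - z 11 - z 9) * (z 1 + z 3 - z 2 - z 0) = _; unfold fb; ring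
lemma fg_A (z : Fin 12 → L) : fg (z ∘ gA) = -fg z := by
  rw [gA_val]; show z 9 + z 10 + z 11 + z 8 - (z 2 + z 3 + z 0 + z 1) = _; unfold fg; ring
lemma fg_B (z : Fin 12 → L) : fg (z ∘ gB) = -fg z := by
  rw [gB_val]; show z 8 + z 9 + z 10 + z 11 - (z 2 + z 3 + z 0 + z 1) = _; unfold fg; ring
lemma fg_C (z : Fin 12 → L) : fg (z ∘ gC) = -fg z := by
  rw [gC_val]; show z 10 + z 11 + z 8 + z 9 - (z 1 + z 2 + z 3 + z 0) = _; unfold fg; ring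

/-- `δ` transforms under `g` by the character with kernel `M` -/
def Sg (M : Subgroup Hgroup) (δ : (Fin 12 → L) → L) (g : Hgroup) : Prop :=
  (g ∈ M → ∀ z, δ (z ∘ (g : S12)) = δ z) ∧ (g ∉ M → ∀ z, δ (z ∘ (g : S12)) = -δ z)

lemma Sg_all {M : Subgroup Hgroup} (hM : M.index = 2) {δ : (Fin 12 → L) → L}
    (hA : Sg M δ ⟨gA, gA_mem⟩) (hB : Sg M δ ⟨gB, gB_mem⟩) (hC : Sg M δ ⟨gC, gC_mem⟩) (g : Hgroup) :
    Sg M δ g := by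
  obtain ⟨g, hg⟩ := g
  have hg' : g ∈ Subgroup.closure {gA, gB, gC} := hg
  induction hg' using Subgroup.closure_induction with
  | mem x hx =>
    rcases hx with rfl | rfl | rfl
    exacts [hA, hB, hC]
  | one =>
    refine ⟨fun _ z => rfl, fun h => absurd M.one_mem h⟩
  | mul x y hx hy ihx ihy =>
    have ix := ihx hx
    have iy := ihy hy
    have key : (⟨x * y, hg⟩ : Hgroup) ∈ M ↔ ((⟨x, hx⟩ : Hgroup) ∈ M ↔ (⟨y, hy⟩ : Hgroup) ∈ M) :=
      Subgroup.mul_mem_iff_of_index_two hM (a := ⟨x, hx⟩) (b := ⟨y, hy⟩)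
    have hcomp : ∀ z : Fin 12 → L, z ∘ ((x * y : S12)) = (z ∘ x) ∘ y := fun z => rfl
    unfold Sg at ix iy ⊢
    simp only [hcomp]
    simp only at ix iy
    rw [key]
    by_cases h1 : (⟨x, hx⟩ : Hgroup) ∈ M <;> by_cases h2 : (⟨y, hy⟩ : Hgroup) ∈ M
    · refine ⟨fun _ z => ?_, fun h => absurd (iff_of_true h1 h2) h⟩
      rw [iy.1 h2, ix.1 h1]
    · refine ⟨fun h => absurd (h.1 h1) h2, fun _ z => ?_⟩
      rw [iy.2 h2, ix.1 h1]
    · refine ⟨fun h => absurd (h.2 h2) h1, fun _ z => ?_⟩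
      rw [iy.1 h2, ix.2 h1]
    · refine ⟨fun _ z => ?_, fun h => absurd (iff_of_false h1 h2) h⟩
      rw [iy.2 h2, ix.2 h1, neg_neg]
  | inv x hx ih =>
    have ix := ih hx
    have key : (⟨x⁻¹, hg⟩ : Hgroup) ∈ M ↔ (⟨x, hx⟩ : Hgroup) ∈ M :=
      M.inv_mem_iff (x := (⟨x, hx⟩ : Hgroup))
    have hcomp : ∀ z : Fin 12 → L, (z ∘ ((x⁻¹ : S12))) ∘ x = z := by
      intro z; funext i; simp
    unfold Sg at ix ⊢
    simp only at ix ⊢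
    rw [key]
    refine ⟨fun h z => ?_, fun h z => ?_⟩
    · have := ix.1 h (z ∘ (x⁻¹ : S12)); rw [hcomp] at this; exact this.symm
    · have := ix.2 h (z ∘ (x⁻¹ : S12)); rw [hcomp] at this; rw [this, neg_neg]

end sgn

lemma exists_index_two {G : Type*} [Group G] [Finite G] (hG : IsPGroup 2 G) (K : Subgroup G) (hK : K ≠ ⊤) :
    ∃ M : Subgroup G, M.index = 2 ∧ K ≤ M := by
  haveI : Fact (Nat.Prime 2) := ⟨Nat.prime_two⟩
  obtain ⟨n, hn⟩ := IsPGroup.iff_card.1 hG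
  obtain ⟨m, hm⟩ := IsPGroup.iff_card.1 (hG.to_subgroup K)
  have hlt : m < n := by
    by_contra hle
    apply hK
    apply Subgroup.eq_top_of_le_card
    rw [hn, hm]
    exact Nat.pow_le_pow_right (by norm_num) (not_lt.1 hle)
  obtain ⟨M, hM, hKM⟩ := Sylow.exists_subgroup_card_pow_prime_le 2 (m := n-1) (G := G)
    (by rw [hn]; exact pow_dvd_pow _ (Nat.sub_le _ _)) K hm (by omega)
  refine ⟨M, ?_, hKM⟩
  have := M.card_mul_index
  rw [hM, hn] at this
  have e : 2^n = 2^(n-1)*2 := by rw [← pow_succ]; congr 1; omega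
  rw [e] at this
  exact Nat.eq_of_mul_eq_mul_left (by positivity) this

lemma gens_top {M : Subgroup Hgroup} (hA : (⟨gA, gA_mem⟩ : Hgroup) ∈ M) (hB : (⟨gB, gB_mem⟩ : Hgroup) ∈ M)
    (hC : (⟨gC, gC_mem⟩ : Hgroup) ∈ M) : M = ⊤ := by
  rw [eq_top_iff]
  rintro ⟨g, hg⟩ -
  have hg' : g ∈ Subgroup.closure {gA, gB, gC} := hg
  have : Hgroup ≤ M.map Hgroup.subtype := by
    refine (Subgroup.closure_le (K := M.map Hgroup.subtype) (k := {gA, gB, gC})).2 ?_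
    rintro x (rfl | rfl | rfl)
    exacts [⟨_, hA, rfl⟩, ⟨_, hB, rfl⟩, ⟨_, hC, rfl⟩]
  obtain ⟨h, hh, e⟩ := this hg
  have : h = ⟨g, hg⟩ := Subtype.ext e
  rwa [← this]

section main
variable {L : Type*} [Field L] [CharZero L] [Algebra ℚ L]

lemma fixed_sq [FiniteDimensional ℚ L] [IsGalois ℚ L] {x : L} {D : ℚ} (hx : ∀ σ : L ≃ₐ[ℚ] L, σ x = x)
    (h : x^2 = (D : L)) : IsSquare D := by
  obtain ⟨q, rfl⟩ := (IsGalois.mem_range_algebraMap_iff_fixed x).2 hx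
  refine ⟨q, ?_⟩
  rw [eq_ratCast] at h
  have : q^2 = D := by exact_mod_cast h
  rw [← this]; ring

lemma Cyc.map {c : ℚ} {t : ℚ} {x₁ x₂ x₃ x₄ : L} (h : Cyc (c:L) (t:L) x₁ x₂ x₃ x₄) (σ : L ≃ₐ[ℚ] L) :
    Cyc (c:L) (t:L) (σ x₁) (σ x₂) (σ x₃) (σ x₄) := by
  refine ⟨?_, ?_, ?_, ?_, ?_, ?_⟩
  · have := congrArg σ h.h₁; simpa using this
  · have := congrArg σ h.h₂; simpa using this
  · have := congrArg σ h.h₃; simpa using this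
  · have := congrArg σ h.h₄; simpa using this
  · have := congrArg σ h.tr; simpa using this
  · have := congrArg σ h.uv; simpa using this

variable {c r : ℚ} {y : Fin 12 → L} {t2 t3 : L}

lemma Conf.conj (h : Conf c r y t2 t3) (σ : L ≃ₐ[ℚ] L) (i : Fin 12) : ∃ j, y j = σ (y i) := by
  apply h.all
  have h0 := h.root i
  rw [← Phi4_map, eval_map_algebraMap] at h0 ⊢
  have e := Polynomial.aeval_algHom_apply σ (y i) (Phi4 c)
  rw [h0, map_zero] at e
  exact e

lemma Conf.hom (h : Conf c r y t2 t3) :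
    ∃ P : (L ≃ₐ[ℚ] L) →* Hgroup, ∀ σ i, y ((P σ : S12) i) = σ (y i) := by
  choose f hf using h.conj
  have fone : ∀ i, f 1 i = i := fun i => h.inj (by rw [hf]; rfl)
  have fmul : ∀ σ τ i, f (σ * τ) i = f σ (f τ i) := fun σ τ i => h.inj (by rw [hf, hf, hf]; rfl)
  let P : (L ≃ₐ[ℚ] L) →* S12 :=
    { toFun := fun σ => ⟨f σ, f σ⁻¹, fun i => by rw [← fmul, inv_mul_cancel, fone],
        fun i => by rw [← fmul, mul_inv_cancel, fone]⟩
      map_one' := Equiv.ext fone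
      map_mul' := fun σ τ => Equiv.ext (fmul σ τ) }
  have hP : ∀ σ i, y (P σ i) = σ (y i) := hf
  have hmem : ∀ σ, P σ ∈ Hgroup := by
    intro σ
    apply mem_H
    · intro x
      apply h.inj
      rw [hP, h.nx_eq, h.nx_eq, hP]
      simp
    · apply h.tt_inj
      have e1 := h.cyc_at (P σ 4)
      have e2 : Cyc (c:L) ((-r:ℚ):L) (y 4) (y 5) (y 6) (y 7) := by push_cast; exact h.c1
      have e3 := e2.map σ
      rw [hP] at e1
      have := e1.tr_eq e3
      rw [this]
      push_cast; rfl
  exact ⟨P.codRestrict Hgroup hmem, fun σ i => hP σ i⟩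

lemma Conf.fa_sq (h : Conf c r y t2 t3) : (fa y)^2 = ((r^2+4 : ℚ) : L) := by
  have := h.c1.disc
  unfold fa; push_cast; linear_combination this

lemma Conf.rp (h : Conf c r y t2 t3) : (r:L) * (t2*t3) = 4 := by
  linear_combination r*h.p+h.hcK

lemma Conf.fb_sq (h : Conf c r y t2 t3) : (r/2*fb y)^2 = ((r^4+4*(r-1)^2 : ℚ) : L) := by
  have d0 := h.c0.disc
  have d2 := h.c2.disc
  have hp := h.rp
  have hs := h.s
  have : (r/2*fb y)^2 = (r:L)^2/4*((t2^2+4)*(t3^2+4)) := by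
    rw [← d0, ← d2]; unfold fb; ring
  rw [this]
  push_cast
  linear_combination (1/4*(r*(t2*t3)+4)-2*r)*hp+r^2*(t2+t3+r)*hs

lemma Conf.fg_sq (h : Conf c r y t2 t3) : (r*fg y)^2 = ((r^4-16*r : ℚ) : L) := by
  have hp := h.rp
  have hs := h.s
  have : fg y = t2 - t3 := by rw [← h.c0.tr, ← h.c2.tr]; unfold fg; ring
  rw [this]
  push_cast
  linear_combination -4*r*hp+r^2*(t2+t3+r)*hs


/-- surjectivity of the permutation representation -/
lemma Conf.surj [FiniteDimensional ℚ L] [IsGalois ℚ L] (h : Conf c r y t2 t3) (P : (L ≃ₐ[ℚ] L) →* Hgroup)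
    (hP : ∀ σ i, y ((P σ : S12) i) = σ (y i))
    (hA : ¬ IsSquare (r^2+4)) (hns : ¬IsSquare (r^4+4*(r-1)^2) ∧ ¬IsSquare (r^4-16*r) ∧
      ¬IsSquare ((r^2+4)*(r^4+4*(r-1)^2)) ∧ ¬IsSquare ((r^2+4)*(r^4-16*r)) ∧
      ¬IsSquare ((r^4+4*(r-1)^2)*(r^4-16*r)) ∧ ¬IsSquare ((r^2+4)*(r^4+4*(r-1)^2)*(r^4-16*r))) :
    Function.Surjective P := by
  rw [← MonoidHom.range_eq_top]
  by_contra hne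
  obtain ⟨M, hM, hle⟩ := exists_index_two H_pgroup _ hne
  have hcomp : ∀ σ : L ≃ₐ[ℚ] L, y ∘ (P σ : S12) = fun i => σ (y i) := fun σ => funext (hP σ)
  have key : ∀ (δ : (Fin 12 → L) → L) (D : ℚ), Sg M δ ⟨gA, gA_mem⟩ → Sg M δ ⟨gB, gB_mem⟩ →
      Sg M δ ⟨gC, gC_mem⟩ → (∀ σ : L ≃ₐ[ℚ] L, σ (δ y) = δ (fun i => σ (y i))) →
      (δ y)^2 = (D:L) → IsSquare D := by
    intro δ D h1 h2 h3 h4 h5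
    refine fixed_sq (x := δ y) (fun σ => ?_) h5
    rw [h4, ← hcomp]
    exact (Sg_all hM h1 h2 h3 (P σ)).1 (hle ⟨σ, rfl⟩) y
  have qa := h.fa_sq
  have qb := h.fb_sq
  have qg := h.fg_sq
  have ma : ∀ σ : L ≃ₐ[ℚ] L, σ (fa y) = fa (fun i => σ (y i)) := by intro σ; simp [fa]
  have mb : ∀ σ : L ≃ₐ[ℚ] L, σ (fb y) = fb (fun i => σ (y i)) := by intro σ; simp [fb]
  have mg : ∀ σ : L ≃ₐ[ℚ] L, σ (fg y) = fg (fun i => σ (y i)) := by intro σ; simp [fg]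
  have m2 : ∀ σ : L ≃ₐ[ℚ] L, σ ((r:L)/2) = r/2 := by
    intro σ; rw [map_div₀, map_ratCast, map_ofNat]
  have m1 : ∀ σ : L ≃ₐ[ℚ] L, σ (r:L) = r := by intro σ; simp
  have hgoal : ∀ g hg, ∀ δ : (Fin 12 → L) → L, (⟨g, hg⟩ : Hgroup) ∈ M → (∀ z, δ (z ∘ g) = δ z) →
      Sg M δ ⟨g, hg⟩ := fun g hg δ hm hz => ⟨fun _ => hz, fun h => absurd hm h⟩
  have hgoal' : ∀ g hg, ∀ δ : (Fin 12 → L) → L, (⟨g, hg⟩ : Hgroup) ∉ M → (∀ z, δ (z ∘ g) = -δ z) →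
      Sg M δ ⟨g, hg⟩ := fun g hg δ hm hz => ⟨fun h => absurd h hm, fun _ => hz⟩
  obtain ⟨n1, n2, n3, n4, n5, n6⟩ := hns
  by_cases uA : (⟨gA, gA_mem⟩ : Hgroup) ∈ M <;> by_cases uB : (⟨gB, gB_mem⟩ : Hgroup) ∈ M <;>
    by_cases uC : (⟨gC, gC_mem⟩ : Hgroup) ∈ M
  · rw [gens_top uA uB uC, Subgroup.index_top] at hM
    norm_num at hM
  · -- alpha
    refine hA (key fa _ (hgoal _ _ _ uA fa_A) (hgoal _ _ _ uB fa_B) (hgoal' _ _ _ uC fa_C) ma qa)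
  · refine n5 (key (fun z => (r/2*fb z) * (r*fg z)) _ (hgoal _ _ _ uA fun z => ?_)
      (hgoal' _ _ _ uB fun z => ?_) (hgoal _ _ _ uC fun z => ?_) (fun σ => ?_) ?_)
    · simp only [fb_A, fg_A]; ring
    · simp only [fb_B, fg_B]; ring
    · simp only [fb_C, fg_C]; ring
    · simp only [map_mul, m1, m2, mb, mg]
    · rw [mul_pow, qb, qg]; push_cast; ring
  · refine n6 (key (fun z => fa z * (r/2*fb z) * (r*fg z)) _ (hgoal _ _ _ uA fun z => ?_)
      (hgoal' _ _ _ uB fun z => ?_) (hgoal' _ _ _ uC fun z => ?_) (fun σ => ?_) ?_)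
    · simp only [fa_A, fb_A, fg_A]; ring
    · simp only [fa_B, fb_B, fg_B]; ring
    · simp only [fa_C, fb_C, fg_C]; ring
    · simp only [map_mul, m1, m2, ma, mb, mg]
    · rw [mul_pow, mul_pow, qa, qb, qg]; push_cast; ring
  · refine n3 (key (fun z => fa z * (r/2*fb z)) _ (hgoal' _ _ _ uA fun z => ?_)
      (hgoal _ _ _ uB fun z => ?_) (hgoal _ _ _ uC fun z => ?_) (fun σ => ?_) ?_)
    · simp only [fa_A, fb_A]; ring
    · simp only [fa_B, fb_B]
    · simp only [fa_C, fb_C]; ring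
    · simp only [map_mul, m2, ma, mb]
    · rw [mul_pow, qa, qb]; push_cast; ring
  · refine n1 (key (fun z => (r/2*fb z)) _ (hgoal' _ _ _ uA fun z => ?_)
      (hgoal _ _ _ uB fun z => ?_) (hgoal' _ _ _ uC fun z => ?_) (fun σ => ?_) ?_)
    · simp only [fb_A]; ring
    · simp only [fb_B]
    · simp only [fb_C]; ring
    · simp only [map_mul, m2, mb]
    · exact qb
  · refine n4 (key (fun z => fa z * (r*fg z)) _ (hgoal' _ _ _ uA fun z => ?_)
      (hgoal' _ _ _ uB fun z => ?_) (hgoal _ _ _ uC fun z => ?_) (fun σ => ?_) ?_)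
    · simp only [fa_A, fg_A]; ring
    · simp only [fa_B, fg_B]; ring
    · simp only [fa_C, fg_C]; ring
    · simp only [map_mul, m1, ma, mg]
    · rw [mul_pow, qa, qg]; push_cast; ring
  · refine n2 (key (fun z => (r*fg z)) _ (hgoal' _ _ _ uA fun z => ?_)
      (hgoal' _ _ _ uB fun z => ?_) (hgoal' _ _ _ uC fun z => ?_) (fun σ => ?_) ?_)
    · simp only [fg_A]; ring
    · simp only [fg_B]; ring
    · simp only [fg_C]; ring
    · simp only [map_mul, m1, mg]
    · exact qg

end main
end gal

section fin
open Polynomial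

lemma irr_of_conj {L : Type*} [Field L] [Algebra ℚ L] {q : ℚ[X]} (hq : q.Monic) {x : L}
    (hx : aeval x q = 0) (S : Finset L) (hS : ∀ s ∈ S, ∃ σ : L ≃ₐ[ℚ] L, σ x = s)
    (hcard : q.natDegree ≤ S.card) : Irreducible q := by
  classical
  have hxint : IsIntegral ℚ x := ⟨q, hq, hx⟩
  have hdvd : minpoly ℚ x ∣ q := minpoly.dvd ℚ x hx
  have hne : (minpoly ℚ x).map (algebraMap ℚ L) ≠ 0 :=
    ((minpoly.monic hxint).map _).ne_zero
  have hsub : S ⊆ ((minpoly ℚ x).map (algebraMap ℚ L)).roots.toFinset := by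
    intro s hs
    obtain ⟨σ, rfl⟩ := hS s hs
    rw [Multiset.mem_toFinset, mem_roots hne, IsRoot.def, eval_map_algebraMap]
    have e := Polynomial.aeval_algHom_apply σ x (minpoly ℚ x)
    rw [minpoly.aeval, map_zero] at e
    exact e
  have hle : q.natDegree ≤ (minpoly ℚ x).natDegree := by
    refine hcard.trans ((Finset.card_le_card hsub).trans ((Multiset.toFinset_card_le _).trans ?_))
    refine (card_roots' _).trans ?_
    rw [natDegree_map]
  have := eq_of_monic_of_dvd_of_natDegree_le (minpoly.monic hxint) hq hdvd hle
  rw [this]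
  exact minpoly.irreducible hxint

lemma polyB_map {K : Type*} [Field K] [CharZero K] [Algebra ℚ K] (c t : ℚ) :
    (polyB c t).map (algebraMap ℚ K) = polyB (c : K) (t : K) := by
  unfold polyB
  simp

lemma polyA_map {K : Type*} [Field K] [CharZero K] [Algebra ℚ K] (c t : ℚ) :
    (polyA c t).map (algebraMap ℚ K) = polyA (c : K) (t : K) := by
  unfold polyA
  simp

lemma orb4 : ∀ x : Fin 12, bl x = 1 → ∃ (i j k : Fin 4) (b : Fin 2), word i j k b 4 = x := by decide +kernel
lemma orb0 : ∀ x : Fin 12, bl x ≠ 1 → ∃ (i j k : Fin 4) (b : Fin 2), word i j k b 0 = x := by decide +kernel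

lemma r_excl {c r : ℚ} (hr0 : r ≠ 0) (he : r^3+(4*c+3)*r = 4)
    (hc : c ∉ ({-5, -5/2, -155/72, -2, -5/4, 0, 19/16} : Set ℚ)) :
    r ≠ 1 ∧ r ≠ -1 ∧ r ≠ -4 ∧ r ≠ 1/2 := by
  simp only [Set.mem_insert_iff, Set.mem_singleton_iff, not_or] at hc
  obtain ⟨h1, -, -, h4, h5, h6, h7⟩ := hc
  refine ⟨?_, ?_, ?_, ?_⟩
  · rintro rfl; apply h6; linarith
  · rintro rfl; apply h4; linarith
  · rintro rfl; apply h1; linarith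
  · rintro rfl; apply h7; linarith

lemma not_sq {c r : ℚ} (hr0 : r ≠ 0) (he : r^3+(4*c+3)*r = 4)
    (hrho : ¬ ∃ r : ℚ, r ≠ 0 ∧ r ≠ 1 ∧ r ≠ -1 ∧
      c = (1 + 4 * r ^ 3 - r ^ 6) / (4 * r ^ 2 * (r ^ 2 - 1))) : ¬ IsSquare (r^2+4) := by
  rintro ⟨w, hw⟩
  apply hrho
  obtain ⟨s, hs⟩ : ∃ s, s = (r+w)/2 := ⟨_, rfl⟩
  have e : s^2 - r*s - 1 = 0 := by rw [hs]; linear_combination -hw/4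
  have s0 : s ≠ 0 := by rintro rfl; norm_num at e
  have s1 : s ≠ 1 := by
    intro h; rw [h] at e; apply hr0; linarith
  have s2 : s ≠ -1 := by
    intro h; rw [h] at e; apply hr0; linarith
  have s3 : s^2-1 ≠ 0 := by
    intro h; apply mul_ne_zero hr0 s0; linarith
  refine ⟨s, s0, s1, s2, ?_⟩
  rw [eq_div_iff (by positivity)]
  have hr : r = (s^2-1)/s := by field_simp; linarith
  rw [hr] at he
  field_simp at he
  linear_combination he

theorem core {L : Type*} [Field L] [CharZero L] [Algebra ℚ L] [FiniteDimensional ℚ L] [IsGalois ℚ L] (c : ℚ)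
    (hspl : (Phi4 (c : L)).Splits)
    (hext : ∀ σ τ : L ≃ₐ[ℚ] L, (∀ x, aeval x (Phi4 c) = 0 → σ x = τ x) → σ = τ)
    (hc : c ∉ ({-5, -5/2, -155/72, -2, -5/4, 0, 19/16} : Set ℚ))
    (heta : ∃ r : ℚ, r ≠ 0 ∧ c = (4 - 3 * r - r ^ 3) / (4 * r))
    (hrho : ¬ ∃ r : ℚ, r ≠ 0 ∧ r ≠ 1 ∧ r ≠ -1 ∧
      c = (1 + 4 * r ^ 3 - r ^ 6) / (4 * r ^ 2 * (r ^ 2 - 1))) :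
    (∃ A B : ℚ[X], Irreducible A ∧ Irreducible B ∧
      A.natDegree = 8 ∧ B.natDegree = 4 ∧ Phi4 c = A * B) ∧
    Nonempty ((L ≃ₐ[ℚ] L) ≃* Hgroup) := by
  classical
  obtain ⟨r, hr0, hcr⟩ := heta
  have he : r^3+(4*c+3)*r = 4 := by rw [hcr]; field_simp; ring
  obtain ⟨k1, k2, k3, k4⟩ := r_excl hr0 he hc
  have hA := not_sq hr0 he hrho
  have hns := nonsq6 hr0 k1 k2 k3 k4 hA
  have hc5 : c ≠ -5/4 := by
    intro h; apply hc; simp [h]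
  obtain ⟨y, t2, t3, h⟩ := exists_conf (K := L) hr0 he hc5 hns.2.1 hspl
  obtain ⟨P, hP⟩ := h.hom
  have hsurj := h.surj P hP hA hns
  have hcub : (-r)^3+(4*c+3)*(-r)+4 = 0 := by linear_combination -he
  have horb : ∀ (g : S12), g ∈ Hgroup → ∀ i, ∃ σ : L ≃ₐ[ℚ] L, σ (y i) = y (g i) := by
    intro g hg i
    obtain ⟨σ, hσ⟩ := hsurj ⟨g, hg⟩
    refine ⟨σ, ?_⟩
    rw [← hP, hσ]
  have hrootA : aeval (y 0) (polyA c (-r)) = 0 := by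
    rw [← eval_map_algebraMap, polyA_map, polyA_eval]
    have h0 := h.root 0
    have hcub' := h.cub 1
    change (-(r : L))^3+_*(-(r : L))+4 = 0 at hcub'
    rw [Phi_fac hcub'] at h0
    push_cast
    rcases mul_eq_zero.1 h0 with h0 | h0
    · exact h0
    · obtain ⟨x₂, x₃, x₄, hh⟩ := cyc_of_B hcub' h0
      exact absurd (h.c0.tr_eq hh) h.n12
  have hrootB : aeval (y 4) (polyB c (-r)) = 0 := by
    rw [← eval_map_algebraMap, polyB_map, polyB_eval]
    push_cast
    exact B_of_cyc (h.cub 1) h.c1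
  refine ⟨⟨polyA c (-r), polyB c (-r), ?_, ?_, polyA_deg _ _, polyB_deg _ _, Phi4_fac hcub⟩, ?_⟩
  · refine irr_of_conj (polyA_monic _ _) hrootA ((Finset.univ.filter fun i => bl i ≠ 1).image y) ?_ ?_
    · intro s hs
      obtain ⟨i, hi, rfl⟩ := Finset.mem_image.1 hs
      obtain ⟨a, b, d, e, hw⟩ := orb0 i (Finset.mem_filter.1 hi).2
      have := horb _ (word_mem a b d e) 0
      rwa [hw] at this
    · rw [Finset.card_image_of_injective _ h.inj, polyA_deg]; decide
  · refine irr_of_conj (polyB_monic _ _) hrootB ((Finset.univ.filter fun i => bl i = 1).image y) ?_ ?_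
    · intro s hs
      obtain ⟨i, hi, rfl⟩ := Finset.mem_image.1 hs
      obtain ⟨a, b, d, e, hw⟩ := orb4 i (Finset.mem_filter.1 hi).2
      have := horb _ (word_mem a b d e) 4
      rwa [hw] at this
    · rw [Finset.card_image_of_injective _ h.inj, polyB_deg]; decide
  · have hinj : Function.Injective P := by
      intro σ τ hst
      refine hext _ _ (fun x hx2 => ?_)
      rw [← eval_map_algebraMap, Phi4_map] at hx2
      obtain ⟨i, rfl⟩ := h.all hx2
      rw [← hP, ← hP, hst]
    exact ⟨MulEquiv.ofBijective P ⟨hinj, hsurj⟩⟩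

/-- the canonical algebra structure on a splitting field -/
noncomputable abbrev algSF {F : Type*} [Field F] (p : F[X]) : Algebra F p.SplittingField := inferInstance

theorem main_aux (c : ℚ)
    (hc : c ∉ ({-5, -5/2, -155/72, -2, -5/4, 0, 19/16} : Set ℚ))
    (heta : ∃ r : ℚ, r ≠ 0 ∧ c = (4 - 3 * r - r ^ 3) / (4 * r))
    (hrho : ¬ ∃ r : ℚ, r ≠ 0 ∧ r ≠ 1 ∧ r ≠ -1 ∧
      c = (1 + 4 * r ^ 3 - r ^ 6) / (4 * r ^ 2 * (r ^ 2 - 1))) :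
    (∃ A B : ℚ[X], Irreducible A ∧ Irreducible B ∧
      A.natDegree = 8 ∧ B.natDegree = 4 ∧ Phi4 c = A * B) ∧
    Nonempty ((Phi4 c).Gal ≃* Hgroup) := by
  letI alg : Algebra ℚ (Phi4 c).SplittingField := algSF (Phi4 c)
  haveI : Normal ℚ (Phi4 c).SplittingField :=
    @Normal.of_isSplittingField ℚ _ _ _ (algSF (Phi4 c)) (Phi4 c) (IsSplittingField.splittingField (Phi4 c))
  haveI : FiniteDimensional ℚ (Phi4 c).SplittingField := 
    @IsSplittingField.finiteDimensional ℚ _ _ _ (algSF (Phi4 c)) (Phi4 c) (IsSplittingField.splittingField (Phi4 c))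
  haveI : IsGalois ℚ (Phi4 c).SplittingField := IsGalois.mk
  refine core (L := (Phi4 c).SplittingField) c ?_ ?_ hc heta hrho
  · rw [← Phi4_map]; exact SplittingField.splits _
  · intro σ τ hst
    refine Polynomial.Gal.ext (p := Phi4 c) (fun x hx => ?_)
    rw [mem_rootSet] at hx
    exact hst x hx.2

end fin

theorem phi4_galois_eta_not_rho (c : ℚ)
    (hc : c ∉ ({-5, -5/2, -155/72, -2, -5/4, 0, 19/16} : Set ℚ))
    (heta : ∃ r : ℚ, r ≠ 0 ∧ c = (4 - 3 * r - r ^ 3) / (4 * r))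
    (hrho : ¬ ∃ r : ℚ, r ≠ 0 ∧ r ≠ 1 ∧ r ≠ -1 ∧
      c = (1 + 4 * r ^ 3 - r ^ 6) / (4 * r ^ 2 * (r ^ 2 - 1))) :
    (∃ A B : ℚ[X], Irreducible A ∧ Irreducible B ∧
      A.natDegree = 8 ∧ B.natDegree = 4 ∧ Phi4 c = A * B) ∧
    Nonempty ((Phi4 c).Gal ≃* Hgroup) := by
  exact main_aux c hc heta hrho
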